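/- Let $G$ be a polycyclic-by-finite group. Then the following are equivalent: (1) $G$ is not polycyclic; (2) there exists a non-finitely generated projective $\mathbb{Z}G$-module that is not free; (3) there exists a nonzero projective $\mathbb{Z}G$-module $P$ such that $P$ has no nonzero finitely generated direct summands. -/

import Mathlib

open TensorProduct

/-- A group is polycyclic if it has a subnormal series with cyclic factors. -/
def IsPolycyclic (G : Type*) [Group G] : Prop :=
  ∃ (n : ℕ) (s : Fin (n + 1) → Subgroup G),
    s 0 = ⊥ ∧ s (Fin.last n) = ⊤ ∧
    ∀ i : Fin n, s i.castSucc ≤ s i.succ ∧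
      ∃ _ : ((s i.castSucc).subgroupOf (s i.succ)).Normal,
        IsCyclic ((s i.succ) ⧸ (s i.castSucc).subgroupOf (s i.succ))

/-- A group is polycyclic-by-finite if it has a normal polycyclic subgroup of
finite index. -/
def IsPolycyclicByFinite (G : Type*) [Group G] : Prop :=
  ∃ N : Subgroup G, N.Normal ∧ N.FiniteIndex ∧ IsPolycyclic N

/-- The subgroups reachable from the trivial one by finitely many normal extensions with
cyclic factors. -/
inductive Subgroup.IsPoly {G : Type} [Group G] : Subgroup G → Prop
  | bot : Subgroup.IsPoly ⊥
  | step {H K : Subgroup G} (t : G) (hHK : H ≤ K) (ht : t ∈ K)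
      (hn : ∀ k ∈ K, ∀ h ∈ H, k * h * k⁻¹ ∈ H)
      (hc : ∀ k ∈ K, ∃ n : ℤ, k * t ^ n ∈ H) (hH : Subgroup.IsPoly H) : Subgroup.IsPoly K

namespace Subgroup.IsPoly

variable {G G' : Type} [Group G] [Group G']

theorem of_hom {H K : Subgroup G} (hHK : H ≤ K) {C : Type} [Group C] [IsCyclic C]
    (φ : K →* C) (hφ : ∀ x, φ x = 1 ↔ (x : G) ∈ H) (hH : H.IsPoly) : K.IsPoly := by
  have : IsCyclic φ.range := inferInstance
  obtain ⟨⟨_, t, rfl⟩, hg⟩ := IsCyclic.exists_generator (α := φ.range)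
  refine step (t : G) hHK t.2 (fun k hk h hh => ?_) (fun k hk => ?_) hH
  · have := (hφ (⟨k, hk⟩ * ⟨h, hHK hh⟩ * ⟨k, hk⟩⁻¹)).1 (by
      rw [map_mul, map_mul, (hφ ⟨h, hHK hh⟩).2 hh, map_inv]; simp)
    simpa using this
  · obtain ⟨n, hn⟩ := Subgroup.mem_zpowers_iff.1 (hg ⟨φ ⟨k, hk⟩, ⟨k, hk⟩, rfl⟩)
    have hn' : φ t ^ n = φ ⟨k, hk⟩ := by simpa using congrArg Subtype.val hn
    refine ⟨-n, ?_⟩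
    have := (hφ (⟨k, hk⟩ * t ^ (-n))).1 (by rw [map_mul, map_zpow, ← hn']; simp)
    simpa using this

theorem exists_hom {H K : Subgroup G} {t : G} (ht : t ∈ K)
      (hn : ∀ k ∈ K, ∀ h ∈ H, k * h * k⁻¹ ∈ H)
      (hc : ∀ k ∈ K, ∃ n : ℤ, k * t ^ n ∈ H) :
      ∃ _ : (H.subgroupOf K).Normal, IsCyclic (K ⧸ H.subgroupOf K) := by
  have hN : (H.subgroupOf K).Normal :=
    ⟨fun n h g => by simpa [Subgroup.mem_subgroupOf] using hn g g.2 n h⟩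
  refine ⟨hN, ⟨⟨QuotientGroup.mk ⟨t, ht⟩, fun x => ?_⟩⟩⟩
  obtain ⟨x, rfl⟩ := QuotientGroup.mk_surjective x
  obtain ⟨n, hn⟩ := hc x x.2
  refine ⟨-n, ?_⟩
  simp only []
  rw [← QuotientGroup.mk_zpow, eq_comm, QuotientGroup.eq_iff_div_mem]
  simpa [Subgroup.mem_subgroupOf, div_eq_mul_inv] using hn

theorem map (f : G →* G') {H : Subgroup G} (hH : H.IsPoly) : (H.map f).IsPoly := by
  induction hH with
  | bot => simpa using bot
  | @step H K t hHK ht hn hc hH ih =>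
    refine step (f t) (Subgroup.map_mono hHK) (Subgroup.mem_map_of_mem f ht) ?_ ?_ ih
    · rintro _ ⟨k, hk, rfl⟩ _ ⟨h, hh, rfl⟩
      exact ⟨_, hn k hk h hh, by simp⟩
    · rintro _ ⟨k, hk, rfl⟩
      obtain ⟨n, hn⟩ := hc k hk
      exact ⟨n, _, hn, by simp⟩

theorem comap (f : G →* G') (hf : f.ker.IsPoly) {H : Subgroup G'} (hH : H.IsPoly) :
    (H.comap f).IsPoly := by
  induction hH with
  | bot => exact hf
  | @step H K t hHK ht hn hc hH ih =>
    obtain ⟨hN, hC⟩ := exists_hom ht hn hc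
    refine of_hom (H := H.comap f) (Subgroup.comap_mono hHK)
      ((QuotientGroup.mk' (H.subgroupOf K)).comp (f.subgroupComap K)) (fun x => ?_) ih
    rw [MonoidHom.comp_apply, QuotientGroup.mk'_apply, QuotientGroup.eq_one_iff]
    rfl

theorem comap_of_injective (f : G →* G') (hf : Function.Injective f) {H : Subgroup G'}
    (hH : H.IsPoly) : (H.comap f).IsPoly :=
  comap f (by rw [(MonoidHom.ker_eq_bot_iff f).2 hf]; exact bot) hH

theorem top_of_self {H : Subgroup G} (hH : H.IsPoly) : (⊤ : Subgroup H).IsPoly := by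
  simpa using comap_of_injective H.subtype H.subtype_injective hH

theorem of_top {H : Subgroup G} (hH : (⊤ : Subgroup H).IsPoly) : H.IsPoly := by
  have := map H.subtype hH
  rwa [← MonoidHom.range_eq_map, Subgroup.range_subtype] at this

theorem mono {H K : Subgroup G} (hHK : H ≤ K) (hK : K.IsPoly) : H.IsPoly := by
  have := of_top (comap_of_injective (Subgroup.inclusion hHK)
    (Subgroup.inclusion_injective hHK) (top_of_self hK))
  simpa using this

theorem fg {H : Subgroup G} (hH : H.IsPoly) : H.FG := by
  induction hH with
  | bot => exact ⟨∅, by simp⟩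
  | @step H K t hHK ht hn hc hH ih =>
    have : K = H ⊔ Subgroup.zpowers t := by
      refine le_antisymm (fun k hk => ?_) (sup_le hHK (by simpa using ht))
      obtain ⟨n, hn⟩ := hc k hk
      have h1 := Subgroup.mul_mem_sup hn (Subgroup.zpow_mem_zpowers t (-n))
      simpa using h1
    rw [this]
    exact ih.sup ⟨{t}, by simp [Subgroup.zpowers_eq_closure]⟩

theorem isSolvable {H : Subgroup G} (hH : H.IsPoly) : Group.IsSolvable H := by
  induction hH with
  | bot => infer_instance
  | @step H K t hHK ht hn hc hH ih =>
    obtain ⟨hN, hC⟩ := exists_hom ht hn hc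
    have : Group.IsSolvable (K ⧸ H.subgroupOf K) := by
      let _ := IsCyclic.commGroup (α := K ⧸ H.subgroupOf K)
      exact Group.isSolvable_of_comm mul_comm
    refine Group.isSolvable_of_ker_le_range (Subgroup.inclusion hHK)
      (QuotientGroup.mk' (H.subgroupOf K)) ?_
    rw [QuotientGroup.ker_mk']
    intro x hx
    exact ⟨⟨x, hx⟩, rfl⟩

open scoped commutatorElement in
theorem of_commutator_le {H : Subgroup G} (hH : H.IsPoly) (K : Subgroup G)
    (hHK : H ≤ K) (hc : ⁅K, K⁆ ≤ H) (hfin : K.FG) : K.IsPoly := by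
  classical
  obtain ⟨s, hs⟩ := hfin
  suffices h : ∀ u : Finset G, u ⊆ s → (H ⊔ Subgroup.closure (u : Set G)).IsPoly by
    have := h s subset_rfl
    rwa [hs, sup_eq_right.2 hHK] at this
  intro u
  induction u using Finset.induction_on with
  | empty => intro _; simpa using hH
  | insert t u htu ih =>
    intro hus
    have hus' : u ⊆ s := fun x hx => hus (Finset.mem_insert_of_mem hx)
    have htK : t ∈ K := by
      rw [← hs]; exact Subgroup.subset_closure (hus (Finset.mem_insert_self _ _))
    set L := H ⊔ Subgroup.closure (u : Set G) with hL
    have hLK : L ≤ K := sup_le hHK (by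
      rw [← hs]; exact Subgroup.closure_mono (by exact_mod_cast hus'))
    have hLn : ∀ k ∈ K, ∀ l ∈ L, k * l * k⁻¹ ∈ L := fun k hk l hl => by
      have h1 : ⁅k, l⁆ ∈ L :=
        (le_sup_left : H ≤ L) (hc (Subgroup.commutator_mem_commutator hk (hLK hl)))
      simpa [commutatorElement_def] using L.mul_mem h1 hl
    have hM : H ⊔ Subgroup.closure ((insert t u : Finset G) : Set G)
        = L ⊔ Subgroup.zpowers t := by
      rw [Finset.coe_insert, Set.insert_eq, Subgroup.closure_union,
        ← Subgroup.zpowers_eq_closure, hL, sup_assoc, sup_comm (Subgroup.zpowers t)]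
    rw [hM]
    have hLs : L ⊔ Subgroup.zpowers t ≤ K := sup_le hLK (by simpa using htK)
    refine step t le_sup_left (Subgroup.mem_sup_right (Subgroup.mem_zpowers t))
      (fun k hk => hLn k (hLs hk)) (fun k hk => ?_) (ih hus')
    let M : Subgroup G :=
      { carrier := {k | k ∈ K ∧ ∃ n : ℤ, k * t ^ n ∈ L}
        one_mem' := ⟨K.one_mem, 0, by simp⟩
        mul_mem' := by
          rintro a b ⟨ha, m, hm⟩ ⟨hb, n, hn⟩
          refine ⟨K.mul_mem ha hb, n + m, ?_⟩
          have h1 := hLn a ha _ hn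
          have := L.mul_mem h1 hm
          rw [zpow_add]
          simpa [mul_assoc] using this
        inv_mem' := by
          rintro a ⟨ha, m, hm⟩
          refine ⟨K.inv_mem ha, -m, ?_⟩
          have h1 := hLn _ (K.inv_mem ha) _ (L.inv_mem hm)
          have h2 := hLn _ (K.zpow_mem htK m) _ (hLn _ ha _ h1)
          simp only [mul_inv_rev, zpow_neg, inv_inv, mul_assoc, mul_inv_cancel_left,
            mul_inv_cancel, mul_one] at h2 h1 ⊢
          simpa [mul_assoc] using h1 }
    have : L ⊔ Subgroup.zpowers t ≤ M := by
      refine sup_le (fun l hl => ⟨hLK hl, 0, by simpa using hl⟩) ?_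
      rw [Subgroup.zpowers_le]
      exact ⟨htK, -1, by simp⟩
    exact (this hk).2

theorem of_finite_solvable [Finite G] [Group.IsSolvable G] : (⊤ : Subgroup G).IsPoly := by
  obtain ⟨n, hn⟩ := Group.isSolvable_def G |>.1 inferInstance
  suffices h : ∀ k, k ≤ n → (derivedSeries G (n - k)).IsPoly by
    simpa using h n le_rfl
  intro k
  induction k with
  | zero => intro _; simpa [hn] using bot
  | succ k ih =>
    intro hk
    have h1 : n - k = (n - (k + 1)) + 1 := by omega
    have h2 := ih (by omega)
    rw [h1, derivedSeries_succ] at h2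
    exact of_commutator_le h2 _ (Subgroup.commutator_le_left _ _) le_rfl
      ((Group.fg_iff_subgroup_fg _).1 inferInstance)

end Subgroup.IsPoly

theorem isPolycyclic_iff {G : Type} [Group G] :
    IsPolycyclic G ↔ (⊤ : Subgroup G).IsPoly := by
  constructor
  · rintro ⟨n, s, h0, hn, hs⟩
    rw [← hn]
    suffices h : ∀ i : Fin (n + 1), (s i).IsPoly from h _
    intro i
    induction i using Fin.induction with
    | zero => rw [h0]; exact .bot
    | succ i ih =>
      obtain ⟨h1, h2, h3⟩ := hs i
      exact .of_hom h1 (QuotientGroup.mk' ((s i.castSucc).subgroupOf (s i.succ)))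
        (fun x => by
          rw [QuotientGroup.mk'_apply, QuotientGroup.eq_one_iff]; rfl) ih
  · intro h
    change ∃ (n : ℕ) (s : Fin (n + 1) → Subgroup G), s 0 = ⊥ ∧ s (Fin.last n) = ⊤ ∧ _
    generalize (⊤ : Subgroup G) = H at h ⊢
    induction h with
    | bot => exact ⟨0, fun _ => ⊥, rfl, rfl, fun i => i.elim0⟩
    | @step H K t hHK ht hn hc hH ih =>
      obtain ⟨n, s, h0, hl, hs⟩ := ih
      refine ⟨n + 1, Fin.snoc s K, ?_, Fin.snoc_last _ _, fun i => ?_⟩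
      · rw [← Fin.castSucc_zero, Fin.snoc_castSucc, h0]
      · induction i using Fin.lastCases with
        | last =>
          rw [Fin.snoc_castSucc, Fin.succ_last, Fin.snoc_last, hl]
          exact ⟨hHK, Subgroup.IsPoly.exists_hom ht hn hc⟩
        | cast i =>
          rw [Fin.succ_castSucc, Fin.snoc_castSucc, Fin.snoc_castSucc]
          exact hs i

theorem Subgroup.IsPoly.of_polycyclicByFinite {G : Type} [Group G] [Group.IsSolvable G]
    (h : IsPolycyclicByFinite G) : (⊤ : Subgroup G).IsPoly := by
  obtain ⟨N, hN, hf, hp⟩ := h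
  have h1 : (QuotientGroup.mk' N).ker.IsPoly := by
    rw [QuotientGroup.ker_mk']
    exact .of_top (isPolycyclic_iff.1 hp)
  exact .comap _ h1 .of_finite_solvable

section Perfect

variable {G : Type} [Group G]

open scoped commutatorElement

theorem Subgroup.commutator_eq_bot_of_metabelian {K A : Subgroup G} [K.Normal] [A.Normal]
    (hA : ⁅A, A⁆ = ⊥) (hK : ⁅⁅K, K⁆, ⁅K, K⁆⁆ = ⊥) (h : K ≤ ⁅K, K⁆ ⊔ A) : ⁅K, K⁆ = ⊥ := by
  set D := ⁅K, K⁆ with hD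
  have hDn : D.Normal := inferInstance
  have key : ∀ X : Subgroup G, ⁅D, X⁆ = ⊥ → ⁅A, X⁆ = ⊥ → ⁅K, X⁆ = ⊥ := by
    intro X h1 h2
    rw [Subgroup.commutator_eq_bot_iff_le_centralizer] at *
    exact h.trans (sup_le h1 h2)
  have h1 : ⁅K, ⁅A, K⁆⁆ = ⊥ := by
    have hsub : ⁅A, K⁆ ≤ D ⊓ A := by
      refine le_inf ?_ (Subgroup.commutator_le_left _ _)
      rw [Subgroup.commutator_le]
      intro a ha k hk
      obtain ⟨d, hd, b, hb, rfl⟩ := Subgroup.mem_sup_of_normal_left.1 (h hk)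
      have e : b * a = a * b := by
        have := (Subgroup.commutator_eq_bot_iff_le_centralizer.1 hA) ha
        exact (Subgroup.mem_centralizer_iff.1 this b hb)
      have : ⁅a, d * b⁆ = ⁅a, d⁆ := by
        simp only [commutatorElement_def, mul_inv_rev]
        have : a * (d * b) * a⁻¹ * (b⁻¹ * d⁻¹) = a * d * (b * a⁻¹ * b⁻¹) * d⁻¹ := by group
        rw [this, show b * a⁻¹ * b⁻¹ = a⁻¹ by
          rw [mul_inv_eq_iff_eq_mul, eq_inv_mul_iff_mul_eq, ← mul_assoc, ← e]; group]
      rw [this]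
      exact (Subgroup.commutator_le_right A D) (Subgroup.commutator_mem_commutator ha hd)
    refine key _ ?_ ?_
    · exact le_bot_iff.1 (hK ▸ Subgroup.commutator_mono le_rfl (hsub.trans inf_le_left))
    · exact le_bot_iff.1 (hA ▸ Subgroup.commutator_mono le_rfl (hsub.trans inf_le_right))
  have h2 : ⁅⁅K, K⁆, A⁆ = ⊥ := by
    refine Subgroup.commutator_commutator_eq_bot_of_rotate ?_ ?_
    · rw [Subgroup.commutator_comm K A, Subgroup.commutator_comm]; exact h1
    · rw [Subgroup.commutator_comm]; exact h1
  have h3 : ⁅K, A⁆ = ⊥ := key _ h2 hA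
  have h4 : ⁅K, D⁆ = ⊥ := key _ hK (by rw [Subgroup.commutator_comm]; exact h2)
  refine key _ ?_ ?_
  · rw [Subgroup.commutator_comm]; exact h4
  · rw [Subgroup.commutator_comm]; exact h3

theorem Subgroup.commutator_le_of_le_sup {K A E : Subgroup G} [K.Normal] [A.Normal] [E.Normal]
    (hA : ⁅A, A⁆ ≤ E) (hK : ⁅⁅K, K⁆, ⁅K, K⁆⁆ ≤ E) (h : K ≤ ⁅K, K⁆ ⊔ A) : ⁅K, K⁆ ≤ E := by
  have hs := QuotientGroup.mk'_surjective E
  have hiff : ∀ X : Subgroup G, X ≤ E ↔ X.map (QuotientGroup.mk' E) = ⊥ := fun X => by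
    rw [Subgroup.map_eq_bot_iff, QuotientGroup.ker_mk']
  have := Subgroup.Normal.map (inferInstance : K.Normal) _ hs
  have := Subgroup.Normal.map (inferInstance : A.Normal) _ hs
  rw [hiff, Subgroup.map_commutator] at hA ⊢
  rw [hiff, Subgroup.map_commutator, Subgroup.map_commutator] at hK
  refine Subgroup.commutator_eq_bot_of_metabelian hA hK ?_
  simpa only [Subgroup.map_sup, Subgroup.map_commutator] using
    Subgroup.map_mono (f := QuotientGroup.mk' E) h

theorem exists_derivedSeries_le_succ (N : Subgroup G) [N.Normal] [N.FiniteIndex]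
    [Group.IsSolvable N] : ∃ m, derivedSeries G m ≤ derivedSeries G (m + 1) := by
  obtain ⟨n, hn⟩ := Group.isSolvable_def N |>.1 inferInstance
  let L : ℕ → Subgroup G := fun j => (derivedSeries N j).map N.subtype
  have hLn : ∀ j, (L j).Normal := fun j => inferInstance
  have hLs : ∀ j, ⁅L j, L j⁆ = L (j + 1) := fun j => by
    rw [← Subgroup.map_commutator, ← derivedSeries_succ]
  suffices h : ∀ j, ∃ m, derivedSeries G m ≤ derivedSeries G (m + 1) ⊔ L j by
    obtain ⟨m, hm⟩ := h n
    exact ⟨m, by simpa [L, hn] using hm⟩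
  intro j
  induction j with
  | zero =>
    have hL0 : L 0 = N := by
      simp only [L, derivedSeries_zero, ← MonoidHom.range_eq_map, Subgroup.range_subtype]
    let f : ℕ →o (Subgroup (G ⧸ N))ᵒᵈ :=
      ⟨fun m => OrderDual.toDual (derivedSeries (G ⧸ N) m), fun a b hab =>
        derivedSeries_antitone _ hab⟩
    obtain ⟨m, hm⟩ := WellFoundedGT.monotone_chain_condition f
    refine ⟨m, ?_⟩
    have h1 : derivedSeries (G ⧸ N) m = derivedSeries (G ⧸ N) (m + 1) := hm (m + 1) (by omega)
    have hs := QuotientGroup.mk'_surjective N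
    rw [← map_derivedSeries_eq hs, ← map_derivedSeries_eq hs] at h1
    have := Subgroup.map_le_iff_le_comap.1 h1.le
    rwa [Subgroup.comap_map_eq, QuotientGroup.ker_mk', ← hL0] at this
  | succ j ih =>
    obtain ⟨m, hm⟩ := ih
    refine ⟨m + 1, ?_⟩
    have h1 := Subgroup.commutator_le_of_le_sup (K := derivedSeries G m) (A := L j)
      (E := derivedSeries G (m + 2) ⊔ L (j + 1)) (by rw [hLs]; exact le_sup_right)
      (by rw [← derivedSeries_succ, ← derivedSeries_succ]; exact le_sup_left)
      (by rwa [← derivedSeries_succ])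
    rwa [← derivedSeries_succ] at h1

theorem IsPolycyclicByFinite.fg_of_subgroup (h : IsPolycyclicByFinite G) (H : Subgroup G) :
    Group.FG H := by
  obtain ⟨N, hN, hf, hp⟩ := h
  have h1 : (N ⊓ H).IsPoly := (Subgroup.IsPoly.of_top (isPolycyclic_iff.1 hp)).mono inf_le_left
  have h2 := h1.fg
  have h3 : (N.subgroupOf H).FiniteIndex := inferInstance
  have h4 : Group.FG (N.subgroupOf H) := by
    have e : (N ⊓ H).subgroupOf H = N.subgroupOf H := by simp
    rw [← e]
    have := (Group.fg_iff_subgroup_fg _).2 h2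
    exact Group.fg_of_surjective (f := (Subgroup.subgroupOfEquivOfLe
      (inf_le_right : N ⊓ H ≤ H)).symm.toMonoidHom) (MulEquiv.surjective _)
  have h5 : (⊤ : Subgroup H).FG := by
    classical
    have hfin : Finite (H ⧸ N.subgroupOf H) := inferInstance
    obtain ⟨s, hs⟩ := (Group.fg_iff_subgroup_fg _).1 h4
    let r : (H ⧸ N.subgroupOf H) → H := Quotient.out
    have hfr := Set.finite_range r
    refine ⟨s ∪ hfr.toFinset, ?_⟩
    rw [eq_top_iff]
    intro x _
    have h6 : (r x)⁻¹ * x ∈ N.subgroupOf H := QuotientGroup.eq.1 (Quotient.out_eq' (s₁ := QuotientGroup.leftRel _) _)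
    have h6' : (r x)⁻¹ * x ∈ Subgroup.closure (s : Set H) := by simpa only [hs] using h6
    have h7 : r x * ((r x)⁻¹ * x) ∈ Subgroup.closure ((s ∪ hfr.toFinset : Finset H) : Set H) := by
      refine Subgroup.mul_mem _ (Subgroup.subset_closure ?_) (Subgroup.closure_mono ?_ h6')
      · simp
      · simp
    simpa using h7
  exact Group.fg_def.2 h5

theorem IsPolycyclicByFinite.exists_isPerfect (h : IsPolycyclicByFinite G)
    (hG : ¬ IsPolycyclic G) :
    ∃ H : Subgroup G, H ≠ ⊥ ∧ Group.IsPerfect H ∧ Group.FG H := by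
  have hs : ¬ Group.IsSolvable G := fun hs =>
    hG (isPolycyclic_iff.2 (.of_polycyclicByFinite h))
  have h' := h
  obtain ⟨N, hN, hf, hp⟩ := h'
  have : Group.IsSolvable N := by
    have := (Subgroup.IsPoly.of_top (isPolycyclic_iff.1 hp)).isSolvable
    exact this
  obtain ⟨m, hm⟩ := exists_derivedSeries_le_succ N
  refine ⟨derivedSeries G m, fun hb => hs ((Group.isSolvable_def _).2 ⟨m, hb⟩), ?_,
    h.fg_of_subgroup _⟩
  rw [Subgroup.isPerfect_iff]
  exact le_antisymm (Subgroup.commutator_le_left _ _) hm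

end Perfect

section Augmentation

open scoped commutatorElement

variable {H : Type} [Group H]

/-- The augmentation of an integral group ring. -/
noncomputable def augmentation (H : Type) [Group H] : MonoidAlgebra ℤ H →+* ℤ :=
  (MonoidAlgebra.lift ℤ ℤ H 1).toRingHom

@[simp]
theorem augmentation_single (h : H) (n : ℤ) : augmentation H (.single h n) = n := by
  simp [augmentation]

theorem of_sub_one_mem_of_mem_closure (I : Submodule (MonoidAlgebra ℤ H)ᵐᵒᵖ (MonoidAlgebra ℤ H))
    (s : Set H) (hs : ∀ h ∈ s, MonoidAlgebra.of ℤ H h - 1 ∈ I) {x : H}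
    (hx : x ∈ Subgroup.closure s) : MonoidAlgebra.of ℤ H x - 1 ∈ I := by
  induction hx using Subgroup.closure_induction with
  | mem x hx => exact hs x hx
  | one => simp [MonoidAlgebra.one_def]
  | mul x y _ _ hx hy =>
    have := I.add_mem (I.smul_mem (MulOpposite.op (MonoidAlgebra.of ℤ H y)) hx) hy
    simpa [sub_mul] using this
  | inv x _ hx =>
    have := I.neg_mem (I.smul_mem (MulOpposite.op (MonoidAlgebra.of ℤ H x⁻¹)) hx)
    simpa [sub_mul, MonoidAlgebra.one_def] using this

theorem exists_relation_of_isPerfect [Group.FG H] [Group.IsPerfect H] [Nontrivial H] :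
    ∃ (ι : Type) (_ : Fintype ι) (a : ι → MonoidAlgebra ℤ H)
      (y : ι → ι → ι → MonoidAlgebra ℤ H),
      (∀ i, augmentation H (a i) = 0) ∧ (∃ i, a i ≠ 0) ∧
      ∀ m, a m = ∑ i, ∑ j, a i * a j * y i j m := by
  obtain ⟨s, hs⟩ := Group.fg_def.1 (inferInstance : Group.FG H)
  let a : s → MonoidAlgebra ℤ H := fun h => MonoidAlgebra.of ℤ H h - 1
  let D := Submodule.span (MonoidAlgebra ℤ H)ᵐᵒᵖ (Set.range a)
  let J := Submodule.span (MonoidAlgebra ℤ H)ᵐᵒᵖ (Set.range fun p : s × s => a p.1 * a p.2)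
  have hD : ∀ h, MonoidAlgebra.of ℤ H h - 1 ∈ D := fun h =>
    of_sub_one_mem_of_mem_closure D s (fun h hh => Submodule.subset_span ⟨⟨h, hh⟩, rfl⟩)
      (by rw [hs]; trivial)
  have hD' : ∀ (c : MonoidAlgebra ℤ H) (h : H), c * (MonoidAlgebra.of ℤ H h - 1) ∈ D := by
    intro c h
    induction c using MonoidAlgebra.induction_on with
    | of k =>
      have := D.sub_mem (hD (k * h)) (hD k)
      rw [map_mul] at this
      convert this using 1
      noncomm_ring
    | add x y hx hy => rw [add_mul]; exact D.add_mem hx hy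
    | smul r x hx => rw [smul_mul_assoc]; exact D.smul_of_tower_mem r hx
  have hJ : ∀ i, ∀ d ∈ D, a i * d ∈ J := by
    intro i d hd
    induction hd using Submodule.span_induction with
    | mem d hd => obtain ⟨j, rfl⟩ := hd; exact Submodule.subset_span ⟨(i, j), rfl⟩
    | zero => simp
    | add x y _ _ hx hy => rw [mul_add]; exact J.add_mem hx hy
    | smul r x _ hx =>
      have := J.smul_mem r hx
      rwa [MulOpposite.smul_eq_mul_unop, mul_assoc] at this
  have hJ' : ∀ d ∈ D, ∀ h, d * (MonoidAlgebra.of ℤ H h - 1) ∈ J := by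
    intro d hd h
    obtain ⟨c, rfl⟩ := (Submodule.mem_span_range_iff_exists_fun _).1 hd
    rw [Finset.sum_mul]
    refine J.sum_mem fun i _ => ?_
    rw [MulOpposite.smul_eq_mul_unop, mul_assoc]
    exact hJ _ _ (hD' _ _)
  have hall : ∀ h, MonoidAlgebra.of ℤ H h - 1 ∈ J := by
    intro h
    have hh : h ∈ commutator H := Group.IsPerfect.mem_commutator
    rw [commutator_eq_closure] at hh
    refine of_sub_one_mem_of_mem_closure J _ ?_ hh
    rintro _ ⟨x, y, rfl⟩
    have := J.smul_mem (MulOpposite.op (MonoidAlgebra.of ℤ H (x⁻¹ * y⁻¹)))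
      (J.sub_mem (hJ' _ (hD x) y) (hJ' _ (hD y) x))
    rw [MulOpposite.smul_eq_mul_unop, MulOpposite.unop_op] at this
    have e1 : MonoidAlgebra.of ℤ H ⁅x, y⁆ - 1 =
      (MonoidAlgebra.of ℤ H x * MonoidAlgebra.of ℤ H y -
       MonoidAlgebra.of ℤ H y * MonoidAlgebra.of ℤ H x) *
        MonoidAlgebra.of ℤ H (x⁻¹ * y⁻¹) := by
      rw [sub_mul, ← map_mul, ← map_mul, ← map_mul, ← map_mul, commutatorElement_def,
        show y * x * (x⁻¹ * y⁻¹) = 1 by group, map_one, mul_assoc (x * y)]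
    rw [e1]
    convert this using 2
    noncomm_ring
  have hc : ∀ m : s, ∃ c : s × s → (MonoidAlgebra ℤ H)ᵐᵒᵖ,
      ∑ p, c p • (a p.1 * a p.2) = a m := fun m =>
    (Submodule.mem_span_range_iff_exists_fun _).1 (hall m)
  choose c hc using hc
  refine ⟨s, inferInstance, a, fun i j m => (c m (i, j)).unop, fun i => by simp [a], ?_, ?_⟩
  · by_contra! hcon
    obtain ⟨h, hh⟩ := exists_ne (1 : H)
    have h1 : D = ⊥ := by
      rw [Submodule.span_eq_bot]
      rintro _ ⟨i, rfl⟩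
      exact hcon i
    have h2 := hD h
    rw [h1, Submodule.mem_bot, sub_eq_zero, ← map_one (MonoidAlgebra.of ℤ H)] at h2
    exact hh (MonoidAlgebra.of_injective h2)
  · intro m
    rw [← hc m, Fintype.sum_prod_type]
    rfl

end Augmentation

section Telescope

variable {R F : Type} [Ring R] [AddCommGroup F] [Module R F]

/-- The partial telescopes attached to linear maps `f` and `g`. -/
noncomputable def telescope (f g : F →ₗ[R] F) : ℕ → (F →ₗ[R] (ℕ →₀ F))
  | 0 => Finsupp.lsingle 1
  | k + 1 => telescope f g k ∘ₗ g + Finsupp.lsingle (k + 2) ∘ₗ (LinearMap.id - f ∘ₗ g)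

/-- The idempotent endomorphism whose image is the direct limit of the sequence `f, f, …`. -/
noncomputable def telescopeProj (f g : F →ₗ[R] F) : (ℕ →₀ F) →ₗ[R] (ℕ →₀ F) :=
  Finsupp.lsum ℕ fun k => telescope f g k ∘ₗ f

theorem telescopeProj_single (f g : F →ₗ[R] F) (k : ℕ) (x : F) :
    telescopeProj f g (Finsupp.single k x) = telescope f g k (f x) := by
  simp [telescopeProj]

theorem telescope_succ (f g : F →ₗ[R] F) (h : ∀ x, g (f (f x)) = f x) (k : ℕ) (x : F) :
    telescope f g (k + 1) (f (f x)) = telescope f g k (f x) := by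
  simp [telescope, h]

theorem telescopeProj_idem (f g : F →ₗ[R] F) (h : ∀ x, g (f (f x)) = f x) (v : ℕ →₀ F) :
    telescopeProj f g (telescopeProj f g v) = telescopeProj f g v := by
  set s := telescopeProj f g
  have hs : ∀ k x, s (Finsupp.single (k + 1) (f x)) = s (Finsupp.single k x) := fun k x => by
    rw [telescopeProj_single, telescopeProj_single, telescope_succ f g h]
  have ht : ∀ k x, s (telescope f g k x) = s (Finsupp.single (k + 1) x) := by
    intro k
    induction k with
    | zero => intro x; rfl
    | succ k ih =>
      intro x
      simp only [telescope, LinearMap.add_apply, LinearMap.comp_apply, map_add, ih,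
        LinearMap.sub_apply, LinearMap.id_apply, Finsupp.lsingle_apply, map_sub]
      rw [hs]
      abel
  induction v using Finsupp.induction_linear with
  | zero => simp
  | add v w hv hw => simp only [map_add, hv, hw]
  | single k x => rw [telescopeProj_single, ht, hs, telescopeProj_single]

end Telescope

section

variable {R : Type} [Ring R] {ι : Type} [Fintype ι] (a : ι → R) (y : ι → ι → ι → R)

/-- The shift `e_l ↦ ∑ i, a i • e_{i :: l}` on the free module over all words. -/
noncomputable def wordShift : (List ι →₀ R) →ₗ[R] (List ι →₀ R) :=
  Finsupp.linearCombination R fun l => ∑ i, Finsupp.single (i :: l) (a i)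

/-- A one-sided inverse of the shift on words. -/
noncomputable def wordUnshift : (List ι →₀ R) →ₗ[R] (List ι →₀ R) :=
  Finsupp.linearCombination R fun l => match l with
    | j :: i :: l => ∑ m, Finsupp.single (m :: l) (y i j m)
    | _ => 0

theorem wordUnshift_wordShift (h : ∀ m, a m = ∑ i, ∑ j, a i * a j * y i j m)
    (x : List ι →₀ R) : wordUnshift y (wordShift a (wordShift a x)) = wordShift a x := by
  classical
  induction x using Finsupp.induction_linear with
  | zero => simp
  | add v w hv hw => simp only [map_add, hv, hw]
  | single l r =>
    have h1 : ∀ l r, wordShift a (Finsupp.single l r) =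
        ∑ i, Finsupp.single (i :: l) (r * a i) := fun l r => by
      simp [wordShift, Finset.smul_sum]
    have h2 : ∀ i j l r, wordUnshift y (Finsupp.single (j :: i :: l) r) =
        ∑ m, Finsupp.single (m :: l) (r * y i j m) := fun i j l r => by
      simp [wordUnshift, Finset.smul_sum]
    have h3 : ∀ m, Finsupp.single (m :: l) (r * a m) =
        ∑ i, ∑ j, Finsupp.single (m :: l) (r * a i * a j * y i j m) := fun m => by
      rw [h m]
      simp only [Finset.mul_sum, Finsupp.single_finsetSum, mul_assoc]
    simp only [h1, h2, map_sum]
    rw [Finset.sum_congr rfl fun m _ => h3 m, Finset.sum_comm]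
    rw [Finset.sum_comm]
    conv_rhs => rw [Finset.sum_comm]
    exact Finset.sum_congr rfl fun i _ => Finset.sum_comm

theorem exists_projective_of_relation (ε : R →+* ℤ) (ha : ∀ i, ε (a i) = 0)
    (hne : ∃ i, a i ≠ 0) (h : ∀ m, a m = ∑ i, ∑ j, a i * a j * y i j m) :
    ∃ (P : Type) (_ : AddCommGroup P) (_ : Module R P), Nontrivial P ∧ Module.Projective R P ∧
      ∀ (φ : P →ₗ[R] R) (p : P), ε (φ p) = 0 := by
  set f := wordShift a with hf
  have hg : ∀ x, wordUnshift y (f (f x)) = f x := wordUnshift_wordShift a y h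
  set s := telescopeProj f (wordUnshift y) with hs
  have hsi : ∀ v, s (s v) = s v := telescopeProj_idem f _ hg
  refine ⟨LinearMap.range s, inferInstance, inferInstance, ?_, ?_, ?_⟩
  · obtain ⟨i, hi⟩ := hne
    refine ⟨⟨⟨s (Finsupp.single 0 (Finsupp.single [] 1)), ⟨_, rfl⟩⟩, 0, fun h0 => hi ?_⟩⟩
    have h1 := congrArg (fun z : LinearMap.range s => z.1 1 [i]) h0
    classical
    simpa [hs, telescopeProj_single, telescope, hf, wordShift, Finsupp.single_apply,
      Finsupp.finsetSum_apply] using h1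
  · refine Module.Projective.of_split (LinearMap.range s).subtype s.rangeRestrict ?_
    ext ⟨_, v, rfl⟩ : 2
    simp [hsi]
  · rintro φ ⟨_, v, rfl⟩
    let ψ : (ℕ →₀ (List ι →₀ R)) →ₗ[R] R := φ ∘ₗ s.rangeRestrict
    change ε (ψ v) = 0
    induction v using Finsupp.induction_linear with
    | zero => simp
    | add v w hv hw => rw [map_add, map_add, hv, hw, add_zero]
    | single k x =>
      have e1 : ψ (Finsupp.single k x) = ψ (Finsupp.single (k + 1) (f x)) := by
        simp only [ψ, LinearMap.comp_apply]
        congr 1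
        ext1
        simp only [LinearMap.codRestrict_apply, LinearMap.rangeRestrict]
        rw [hs, telescopeProj_single, telescopeProj_single, telescope_succ f _ hg]
      rw [e1]
      clear e1
      induction x using Finsupp.induction_linear with
      | zero => simp
      | add v w hv' hw' => rw [map_add, Finsupp.single_add, map_add, map_add, hv', hw', add_zero]
      | single l r =>
        have : f (Finsupp.single l r) = ∑ i, (r * a i) • Finsupp.single (i :: l) 1 := by
          simp [hf, wordShift, Finset.smul_sum]
        rw [this, Finsupp.single_finsetSum, map_sum, map_sum]
        refine Finset.sum_eq_zero fun i _ => ?_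
        rw [← Finsupp.smul_single, map_smul, smul_eq_mul, map_mul, map_mul, ha]
        simp

end

section Induced

variable {F : Type} [Group F] {A : Type*} [Ring A]

open scoped Classical in
/-- The matrices of the representation induced from `σ : H →* A`. -/
noncomputable def inducedMatrix (H : Subgroup F) [Fintype (F ⧸ H)] [DecidableEq (F ⧸ H)] (σ : H →* A) :
    F →* Matrix (F ⧸ H) (F ⧸ H) A :=
  { toFun := fun g => Matrix.of fun s t =>
      if h : s.out⁻¹ * g * t.out ∈ H then σ ⟨_, h⟩ else 0
    map_one' := by
      ext s t
      rw [Matrix.of_apply, Matrix.one_apply]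
      have key : s.out⁻¹ * 1 * t.out ∈ H ↔ s = t := by
        rw [mul_one, ← QuotientGroup.eq]
        simp
      by_cases hst : s = t
      · subst hst
        rw [dif_pos (key.2 rfl), if_pos rfl, ← map_one σ]
        congr 1
        ext
        simp
      · rw [dif_neg (fun h => hst (key.1 h)), if_neg hst]
    map_mul' := fun g g' => by
      ext s u
      rw [Matrix.mul_apply, Matrix.of_apply]
      let t₀ : F ⧸ H := QuotientGroup.mk (g' * u.out)
      have ht : ∀ t : F ⧸ H, t.out⁻¹ * g' * u.out ∈ H ↔ t = t₀ := fun t => by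
        rw [mul_assoc, ← QuotientGroup.eq]
        simp [t₀]
      rw [Finset.sum_eq_single t₀]
      · simp only [Matrix.of_apply]
        have h0 := (ht t₀).2 rfl
        rw [dif_pos h0]
        have e : s.out⁻¹ * (g * g') * u.out =
            (s.out⁻¹ * g * t₀.out) * (t₀.out⁻¹ * g' * u.out) := by group
        by_cases h1 : s.out⁻¹ * g * t₀.out ∈ H
        · have h2 : s.out⁻¹ * (g * g') * u.out ∈ H := by rw [e]; exact H.mul_mem h1 h0
          rw [dif_pos h1, dif_pos h2, ← map_mul]
          congr 1
          ext
          exact e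
        · rw [dif_neg h1, zero_mul, dif_neg]
          rw [e]
          exact fun h => h1 ((H.mul_mem_cancel_right h0).1 h)
      · intro t _ hne
        simp only [Matrix.of_apply]
        rw [dif_neg (fun h => hne ((ht t).1 h)), mul_zero]
      · intro h
        exact absurd (Finset.mem_univ _) h }

open scoped Classical in
theorem inducedMatrix_apply (H : Subgroup F) [Fintype (F ⧸ H)] [DecidableEq (F ⧸ H)] (σ : H →* A) (g : F) (s t : F ⧸ H) :
    inducedMatrix H σ g s t = if h : s.out⁻¹ * g * t.out ∈ H then σ ⟨_, h⟩ else 0 := rfl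

theorem lift_inducedMatrix_apply (H : Subgroup F) [Fintype (F ⧸ H)]
    [DecidableEq (F ⧸ H)] [Fintype H]
    (σ : H →* A) (x : MonoidAlgebra ℤ F) (s t : F ⧸ H) :
    MonoidAlgebra.liftNC (Int.castAddHom (Matrix (F ⧸ H) (F ⧸ H) A)) (inducedMatrix H σ) x s t =
      ∑ h : H, x.coeff (s.out * h * t.out⁻¹) • σ h := by
  classical
  induction x using MonoidAlgebra.induction_linear with
  | zero => simp
  | add x y hx hy => simp [hx, hy, add_smul, Finset.sum_add_distrib]
  | single g r =>
    have e : ∀ h : H, g = s.out * h * t.out⁻¹ ↔ s.out⁻¹ * g * t.out = h := fun h => by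
      constructor
      · rintro rfl; group
      · intro h; rw [← h]; group
    rw [MonoidAlgebra.liftNC_single, Int.coe_castAddHom, ← zsmul_eq_mul, Matrix.smul_apply,
      inducedMatrix_apply]
    simp only [MonoidAlgebra.coeff_single, Finsupp.single_apply, e]
    split_ifs with h
    · rw [Finset.sum_eq_single ⟨_, h⟩]
      · simp
      · intro b _ hb
        rw [if_neg (fun h' => hb (Subtype.ext h'.symm)), zero_smul]
      · simp
    · rw [Finset.sum_eq_zero, smul_zero]
      intro b _
      rw [if_neg (fun h' => h (by rw [h']; exact b.2)), zero_smul]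

end Induced

section IdempotentTrace

theorem Matrix.trace_mem_range_intCast {A : Type*} [CommRing A]
    (hA : ∀ u : A, u * u = u → u ∈ (Int.castRingHom A).range)
    {n : Type*} [Fintype n] [DecidableEq n] (T : Matrix n n A) (hT : T * T = T) :
    T.trace ∈ (Int.castRingHom A).range := by
  let D : (B : Type _) → [CommRing B] → [Algebra A B] → B → B := fun B _ _ t =>
    (1 + (t - 1) • T.map (algebraMap A B)).det
  have hmul : ∀ (B : Type _) [CommRing B] [Algebra A B] (t s : B),
      D B t * D B s = D B (t * s) := by
    intro B _ _ t s
    have hT' : T.map (algebraMap A B) * T.map (algebraMap A B) = T.map (algebraMap A B) := by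
      rw [← Matrix.map_mul, hT]
    simp only [D]
    rw [← Matrix.det_mul]
    congr 1
    simp only [add_mul, mul_add, one_mul, mul_one, smul_mul_assoc, mul_smul_comm, hT']
    module
  have hmap : ∀ (B B' : Type _) [CommRing B] [Algebra A B] [CommRing B'] [Algebra A B']
      (φ : B →ₐ[A] B') (t : B), φ (D B t) = D B' (φ t) := by
    intro B B' _ _ _ _ φ t
    simp only [D]
    rw [AlgHom.map_det]
    congr 1
    ext i j
    by_cases hij : i = j <;> simp [hij]
  let f := D (Polynomial A) Polynomial.X
  have hf : ∀ i, f.coeff i * f.coeff i = f.coeff i := by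
    intro i
    let y : Polynomial (Polynomial A) := Polynomial.X
    let x : Polynomial (Polynomial A) := Polynomial.C Polynomial.X
    have e1 : Polynomial.aeval x f * Polynomial.aeval y f = Polynomial.aeval (y * x) f := by
      rw [hmap, hmap, hmap, hmul]
      simp [mul_comm]
    have ex : Polynomial.aeval x f = Polynomial.C f := by
      rw [Polynomial.aeval_def, Polynomial.eval₂_eq_sum_range]
      conv_rhs => rw [f.as_sum_range_C_mul_X_pow]
      simp [x, map_sum, Polynomial.algebraMap_apply]
    have ey : Polynomial.aeval y f = f.map Polynomial.C := by
      rw [Polynomial.aeval_def, Polynomial.map]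
      rfl
    have exy : Polynomial.aeval (y * x) f =
        ∑ i ∈ Finset.range (f.natDegree + 1), Polynomial.C (Polynomial.C (f.coeff i) * Polynomial.X ^ i) * Polynomial.X ^ i := by
      rw [Polynomial.aeval_def, Polynomial.eval₂_eq_sum_range]
      refine Finset.sum_congr rfl fun i _ => ?_
      simp [x, y, Polynomial.algebraMap_apply]
      ring
    rw [ex, ey, exy] at e1
    by_cases hi : i ≤ f.natDegree
    · have e2 := congrArg (fun q => (q.coeff i).coeff i) e1
      simp only [Polynomial.coeff_map, Polynomial.coeff_C_mul, Polynomial.finsetSum_coeff] at e2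
      rw [Finset.sum_eq_single i] at e2
      · simpa [Polynomial.coeff_X_pow] using e2
      · intro b _ hb
        simp [Polynomial.coeff_X_pow, hb.symm]
      · intro hn
        exact absurd (Finset.mem_range.2 (by omega)) hn
    · rw [Polynomial.coeff_eq_zero_of_natDegree_lt (by omega), mul_zero]
  have hl : f ∈ Polynomial.lifts (Int.castRingHom A) := by
    rw [Polynomial.lifts_iff_coeff_lifts]
    exact fun i => hA _ (hf i)
  obtain ⟨q, hq⟩ := (Polynomial.mem_lifts _).1 hl
  have h1 : Polynomial.aeval (Polynomial.X + 1 : Polynomial A) f =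
      (1 + (Polynomial.X : Polynomial A) • T.map Polynomial.C).det := by
    rw [hmap]
    simp [D, Polynomial.algebraMap_eq]
  rw [Matrix.det_one_add_X_smul] at h1
  have h2 := congrArg (fun p => p.coeff 1) h1
  refine ⟨(q.comp (Polynomial.X + 1)).coeff 1, ?_⟩
  rw [← Polynomial.coeff_map, Polynomial.map_comp, hq]
  simpa [Polynomial.aeval_def, Polynomial.comp, Polynomial.coeff_mul_X_pow',
    Polynomial.algebraMap_eq, Polynomial.coeff_one] using h2

theorem MonoidAlgebra.isIdempotentElem_mem_range {C : Type} [CommGroup C] [Finite C]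
    (u : MonoidAlgebra ℤ C) (hu : u * u = u) :
    u ∈ (Int.castRingHom (MonoidAlgebra ℤ C)).range := by
  let ψ : ℕ → (MonoidAlgebra ℤ C →+* MonoidAlgebra ℤ C) := fun n =>
    MonoidAlgebra.mapDomainRingHom ℤ (powMonoidHom n)
  have hψs : ∀ n c r, ψ n (MonoidAlgebra.single c r) = MonoidAlgebra.single (c ^ n) r :=
    fun n c r => by simp [ψ]
  have hidem : ∀ w : MonoidAlgebra ℤ C, w * w = w → ∀ n, n ≠ 0 → w ^ n = w := fun w hw n hn =>
    IsIdempotentElem.pow_eq hw hn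
  have hp : ∀ p : ℕ, p.Prime → ∀ w, w * w = w → ψ p w = w := by
    intro p hp w hw
    have h1 : ∀ x : MonoidAlgebra ℤ C, (p : MonoidAlgebra ℤ C) ∣ x ^ p - ψ p x := by
      intro x
      induction x using MonoidAlgebra.induction_linear with
      | zero => simp [hp.ne_zero]
      | add x y hx hy =>
        obtain ⟨r, hr⟩ := exists_add_pow_prime_eq hp x y
        rw [hr, map_add]
        have := dvd_add (dvd_add hx hy) (dvd_mul_right (p : MonoidAlgebra ℤ C) (x * y * r))
        convert this using 1
        ring
      | single c r =>
        rw [hψs, MonoidAlgebra.single_pow]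
        rw [← MonoidAlgebra.single_sub]
        have : (p : ℤ) ∣ r ^ p - r := by
          have := Fact.mk hp
          rw [← ZMod.intCast_zmod_eq_zero_iff_dvd]
          simp
        obtain ⟨z, hz⟩ := this
        refine ⟨MonoidAlgebra.single (c ^ p) z, ?_⟩
        rw [hz, MonoidAlgebra.natCast_def, MonoidAlgebra.single_mul_single, one_mul]
    have h2 : (p : MonoidAlgebra ℤ C) ∣ w - ψ p w := by
      have := h1 w
      rwa [hidem w hw p hp.ne_zero] at this
    have h3 : ∀ k, (p : MonoidAlgebra ℤ C) ^ (k + 1) ∣ w - ψ p w := fun k => by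
      have := dvd_sub_pow_of_dvd_sub h2 k
      rwa [hidem w hw _ (pow_ne_zero _ hp.ne_zero), ← map_pow,
        hidem w hw _ (pow_ne_zero _ hp.ne_zero)] at this
    refine (sub_eq_zero.1 (MonoidAlgebra.ext (Finsupp.ext fun c => ?_))).symm
    have h4 : ∀ k, (((p ^ (k + 1) : ℕ) : ℤ)) ∣ (w - ψ p w).coeff c := fun k => by
      obtain ⟨z, hz⟩ := h3 k
      refine ⟨z.coeff c, ?_⟩
      rw [hz, ← Nat.cast_pow, ← nsmul_eq_mul, MonoidAlgebra.coeff_smul, Finsupp.smul_apply,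
        nsmul_eq_mul]
    refine Int.eq_zero_of_abs_lt_dvd (h4 ((w - ψ p w).coeff c).natAbs) ?_
    rw [Int.abs_eq_natAbs, Nat.cast_lt]
    exact (Nat.lt_succ_self _).trans (Nat.lt_pow_self hp.one_lt)
  have hall : ∀ n : ℕ, n ≠ 0 → ∀ w, w * w = w → ψ n w = w := by
    intro n
    induction n using induction_on_primes with
    | zero => simp
    | one => 
      intro _ w _
      have : ψ 1 = RingHom.id _ := by
        refine MonoidAlgebra.ringHom_ext ?_ ?_ <;> simp [hψs]
      simp [this]
    | prime_mul p n hpp ih =>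
      intro h0 w hw
      have : ψ (p * n) = (ψ p).comp (ψ n) := by
        refine MonoidAlgebra.ringHom_ext ?_ ?_ <;> simp [hψs, ← pow_mul, mul_comm]
      rw [this, RingHom.comp_apply, ih (by rintro rfl; simp at h0) w hw, hp p hpp w hw]
  have := hall (Nat.card C) Nat.card_pos.ne' u hu
  refine ⟨augmentation C u, ?_⟩
  rw [← this]
  have e : (Int.castRingHom _).comp ((augmentation C).comp (ψ (Nat.card C))) = ψ (Nat.card C) := by
    refine MonoidAlgebra.ringHom_ext (fun r => ?_) (fun c => ?_)
    · rw [RingHom.comp_apply, RingHom.comp_apply, hψs, augmentation_single, one_pow, eq_intCast,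
        MonoidAlgebra.intCast_def]
      rfl
    · rw [RingHom.comp_apply, RingHom.comp_apply, hψs, augmentation_single, pow_card_eq_one',
        map_one, MonoidAlgebra.one_def]
  exact congrArg (fun f => f u) e

end IdempotentTrace

section FiniteIdempotent

variable {F : Type} [Group F]

theorem trace_comp_lift_inducedMatrix {A : Type*} [CommRing A] (H : Subgroup F) [Fintype (F ⧸ H)]
    [DecidableEq (F ⧸ H)] [Fintype H] (σ : H →* A) {n : Type*} [Fintype n] [DecidableEq n]
    (e : Matrix n n (MonoidAlgebra ℤ F)) :
    (Matrix.comp n n (F ⧸ H) (F ⧸ H) A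
      (e.map (MonoidAlgebra.liftNC (Int.castAddHom _) (inducedMatrix H σ)))).trace =
      ∑ s : F ⧸ H, ∑ h : H, e.trace.coeff (s.out * h * s.out⁻¹) • σ h := by
  rw [Matrix.trace, Fintype.sum_prod_type, Finset.sum_comm]
  refine Finset.sum_congr rfl fun s _ => ?_
  simp only [Matrix.diag_apply, Matrix.comp_apply, Matrix.map_apply, lift_inducedMatrix_apply]
  rw [Finset.sum_comm]
  refine Finset.sum_congr rfl fun h _ => ?_
  rw [← Finset.sum_smul]
  congr 1
  simp [Matrix.trace, MonoidAlgebra.coeff_sum, Finsupp.finsetSum_apply]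

/-- The ring homomorphism attached to the induced representation. -/
noncomputable def inducedHom {A : Type*} [Ring A] (H : Subgroup F) [Fintype (F ⧸ H)]
    [DecidableEq (F ⧸ H)] (σ : H →* A) :
    MonoidAlgebra ℤ F →+* Matrix (F ⧸ H) (F ⧸ H) A :=
  MonoidAlgebra.liftNCRingHom (Int.castRingHom _) (inducedMatrix H σ)
    (fun _ _ => Int.cast_commute _ _)

theorem isIdempotentElem_comp_lift_inducedMatrix {A : Type*} [CommRing A] (H : Subgroup F)
    [Fintype (F ⧸ H)] [DecidableEq (F ⧸ H)] (σ : H →* A) {n : Type*} [Fintype n]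
    [DecidableEq n] (e : Matrix n n (MonoidAlgebra ℤ F)) (he : e * e = e) :
    Matrix.comp n n (F ⧸ H) (F ⧸ H) A
      (e.map (MonoidAlgebra.liftNC (Int.castAddHom _) (inducedMatrix H σ))) *
    Matrix.comp n n (F ⧸ H) (F ⧸ H) A
      (e.map (MonoidAlgebra.liftNC (Int.castAddHom _) (inducedMatrix H σ))) =
    Matrix.comp n n (F ⧸ H) (F ⧸ H) A
      (e.map (MonoidAlgebra.liftNC (Int.castAddHom _) (inducedMatrix H σ))) := by
  rw [← Matrix.compRingEquiv_apply, ← map_mul]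
  congr 1
  have := (Matrix.map_mul : (e * e).map (inducedHom H σ) = _)
  rw [he] at this
  exact this.symm

theorem sum_coeff_conj_eq_zero [Fintype F] {n : Type*} [Fintype n] [DecidableEq n]
    (e : Matrix n n (MonoidAlgebra ℤ F)) (he : e * e = e) (g : F) (hg : g ≠ 1) :
    ∑ x : F, e.trace.coeff (x * g * x⁻¹) = 0 := by
  classical
  let C := Subgroup.zpowers g
  let _ : CommGroup C := { (inferInstance : Group C) with
    mul_comm := fun a b => Subtype.ext (by
      obtain ⟨⟨_, i, rfl⟩, ⟨_, j, rfl⟩⟩ := a, b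
      exact (Commute.refl g).zpow_zpow i j) }
  have h1 := Matrix.trace_mem_range_intCast MonoidAlgebra.isIdempotentElem_mem_range _
    (isIdempotentElem_comp_lift_inducedMatrix C (MonoidAlgebra.of ℤ C) e he)
  rw [trace_comp_lift_inducedMatrix] at h1
  obtain ⟨z, hz⟩ := h1
  have h2 := congrArg (fun w => w.coeff ⟨g, Subgroup.mem_zpowers g⟩) hz
  have hg' : (1 : C) ≠ ⟨g, Subgroup.mem_zpowers g⟩ := fun h => hg (congrArg Subtype.val h).symm
  simp only [eq_intCast, MonoidAlgebra.intCast_def, MonoidAlgebra.coeff_sum,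
    Finsupp.finsetSum_apply, MonoidAlgebra.coeff_smul, Finsupp.smul_apply, MonoidAlgebra.of_apply,
    MonoidAlgebra.coeff_single, Finsupp.single_apply, if_neg hg', smul_eq_mul, mul_ite, mul_one,
    mul_zero, Finset.sum_ite_eq', Finset.mem_univ, if_true] at h2
  have h3 : ∀ x : F, ∃ h : C, (QuotientGroup.mk x : F ⧸ C).out = x * h := fun x =>
    QuotientGroup.mk_out_eq_mul C x
  have h4 : ∀ x : F, e.trace.coeff (x * g * x⁻¹) =
      e.trace.coeff ((QuotientGroup.mk x : F ⧸ C).out * g * (QuotientGroup.mk x : F ⧸ C).out⁻¹) := by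
    intro x
    obtain ⟨h, hh⟩ := h3 x
    have : (h : F) * g = g * h :=
      congrArg Subtype.val (mul_comm h (⟨g, Subgroup.mem_zpowers g⟩ : C))
    rw [hh]
    congr 1
    rw [mul_assoc x (h : F) g, this]
    group
  rw [Finset.sum_congr rfl fun x _ => h4 x]
  have h5 : ∀ p : (F ⧸ C) × C, (QuotientGroup.mk (p.1.out * p.2) : F ⧸ C) = p.1 := fun p => by
    rw [QuotientGroup.mk_mul_of_mem _ p.2.2, QuotientGroup.out_eq']
  have hb : Function.Bijective (fun p : (F ⧸ C) × C => p.1.out * (p.2 : F)) := by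
    refine ⟨fun p q hpq => ?_, fun x => ?_⟩
    · have h := congrArg (QuotientGroup.mk : F → F ⧸ C) hpq
      simp only [h5] at h
      refine Prod.ext h (Subtype.ext ?_)
      simp only [h] at hpq
      exact mul_left_cancel hpq
    · obtain ⟨h, hh⟩ := h3 x
      exact ⟨(QuotientGroup.mk x, h⁻¹), by simp [hh]⟩
  rw [← Function.Bijective.sum_comp hb, Fintype.sum_prod_type]
  have h6 : ∀ s : F ⧸ C, ∀ h : C, (QuotientGroup.mk (s.out * h) : F ⧸ C) = s :=
    fun s h => h5 (s, h)
  simp only [h6, Finset.sum_const, ← Finset.smul_sum]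
  rw [← h2, smul_zero]

theorem eq_zero_of_idempotent_of_augmentation [Finite F] {n : Type*} [Fintype n] [DecidableEq n]
    (e : Matrix n n (MonoidAlgebra ℤ F)) (he : e * e = e)
    (h0 : ∀ i j, augmentation F (e i j) = 0) : e = 0 := by
  classical
  have := Fintype.ofFinite F
  have haug : ∀ x : MonoidAlgebra ℤ F, augmentation F x = ∑ g, x.coeff g := fun x => by
    induction x using MonoidAlgebra.induction_linear with
    | zero => simp
    | add x y hx hy => simp [hx, hy, Finset.sum_add_distrib]
    | single g r => simp [Finsupp.single_apply]
  have h1 : ∑ g, e.trace.coeff g = 0 := by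
    rw [← haug, Matrix.trace, map_sum]
    exact Finset.sum_eq_zero fun i _ => h0 i i
  have h2 : ∑ g : F, ∑ x : F, e.trace.coeff (x * g * x⁻¹) = 0 := by
    rw [Finset.sum_comm]
    refine Finset.sum_eq_zero fun x _ => ?_
    rw [← h1]
    exact Equiv.sum_comp (MulAut.conj x).toEquiv _
  rw [Finset.sum_eq_single 1 (fun g _ hg => sum_coeff_conj_eq_zero e he g hg) (by simp)] at h2
  simp only [mul_one, mul_inv_cancel, Finset.sum_const, smul_eq_zero] at h2
  have h3 : e.trace.coeff 1 = 0 := h2.resolve_left (by simp)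
  have h4 := isIdempotentElem_comp_lift_inducedMatrix (⊥ : Subgroup F) (1 : _ →* ℚ) e he
  have h5 := trace_comp_lift_inducedMatrix (⊥ : Subgroup F) (1 : _ →* ℚ) e
  set T := Matrix.comp n n (F ⧸ (⊥ : Subgroup F)) (F ⧸ (⊥ : Subgroup F)) ℚ
    (e.map (MonoidAlgebra.liftNC (Int.castAddHom _) (inducedMatrix ⊥ 1))) with hTdef
  have h6 : T.trace = 0 := by
    rw [h5]
    refine Finset.sum_eq_zero fun s _ => Finset.sum_eq_zero fun h _ => ?_
    have : (h : F) = 1 := Subgroup.mem_bot.1 h.2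
    simp [this, h3]
  have h7 : T = 0 := by
    have : IsIdempotentElem (Matrix.toLin' T) := by
      rw [IsIdempotentElem, Module.End.mul_eq_comp, ← Matrix.toLin'_mul, h4]
    have := LinearMap.IsIdempotentElem.eq_zero_of_trace_eq_zero this (by rw [Matrix.trace_toLin'_eq, h6])
    exact (Matrix.toLin').map_eq_zero_iff.1 this
  ext i j g
  have h8 := congrFun (congrFun h7 (i, QuotientGroup.mk g)) (j, QuotientGroup.mk 1)
  rw [hTdef, Matrix.comp_apply, Matrix.map_apply, lift_inducedMatrix_apply] at h8
  have h9 : ∀ x : F, (QuotientGroup.mk x : F ⧸ (⊥ : Subgroup F)).out = x := fun x => by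
    obtain ⟨h, hh⟩ := QuotientGroup.mk_out_eq_mul (⊥ : Subgroup F) x
    rw [hh, Subgroup.mem_bot.1 h.2, mul_one]
  rw [Fintype.sum_eq_single 1 (fun h hh => absurd (Subsingleton.elim _ _) hh), h9, h9] at h8
  simpa using h8

end FiniteIdempotent

section ResiduallyFinite

theorem Group.ResiduallyFinite.of_injective {G G' : Type} [Group G] [Group G']
    (f : G →* G') (hf : Function.Injective f) [Group.ResiduallyFinite G'] :
    Group.ResiduallyFinite G := by
  rw [Group.residuallyFinite_iff_exists_finiteIndex]
  intro g hg
  obtain ⟨H, h, hH⟩ := Group.residuallyFinite_iff_exists_finiteIndex.1 ‹_› (f g)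
    (by rwa [Ne, map_eq_one_iff f hf])
  refine ⟨H.comap f, ⟨?_⟩, hH⟩
  rw [Subgroup.index_comap]
  exact fun h0 => h.index_ne_zero (Subgroup.index_eq_zero_of_relIndex_eq_zero h0)

theorem Group.FG.finite_monoidHom {N P : Type} [Group N] [Group.FG N] [Group P] [Finite P] :
    Finite (N →* P) := by
  obtain ⟨S, hS⟩ := Group.fg_def.1 ‹Group.FG N›
  refine Finite.of_injective (fun f : N →* P => fun s : S => f s) fun f g h => ?_
  refine MonoidHom.eq_of_eqOn_dense hS fun s hs => congrFun h ⟨s, hs⟩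

theorem exists_characteristic_finiteIndex {N : Type} [Group N] [Group.FG N]
    [Group.ResiduallyFinite N] (x : N) (hx : x ≠ 1) :
    ∃ K : Subgroup N, K.Characteristic ∧ K.FiniteIndex ∧ x ∉ K := by
  obtain ⟨K₀, hK₀, hxK⟩ := Group.residuallyFinite_iff_exists_finiteIndex.1 ‹_› x hx
  have : Finite (N ⧸ K₀) := inferInstance
  let P := Equiv.Perm (N ⧸ K₀)
  have : Finite (N →* P) := Group.FG.finite_monoidHom
  refine ⟨⨅ f : N →* P, f.ker, ?_, ?_, ?_⟩
  · rw [Subgroup.characteristic_iff_le_comap]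
    intro φ y hy
    rw [Subgroup.mem_comap, Subgroup.mem_iInf]
    intro f
    exact (Subgroup.mem_iInf.1 hy) (f.comp φ.toMonoidHom)
  · exact Subgroup.finiteIndex_iInf fun f => Subgroup.finiteIndex_ker f
  · intro h
    have h1 := (Subgroup.mem_iInf.1 h) (MulAction.toPermHom N (N ⧸ K₀))
    rw [← Subgroup.normalCore_eq_ker] at h1
    exact hxK (K₀.normalCore_le h1)

theorem Group.ResiduallyFinite.of_cyclic_quotient {Γ : Type} [Group Γ] (N : Subgroup Γ) [N.Normal]
    [Group.FG N] [Group.ResiduallyFinite N] (t : Γ) (ht : ∀ k : Γ, ∃ n : ℤ, k * t ^ n ∈ N) :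
    Group.ResiduallyFinite Γ := by
  rw [Group.residuallyFinite_iff_exists_finiteIndex]
  intro x hx
  by_cases hfin : ∃ m : ℤ, m ≠ 0 ∧ t ^ m ∈ N
  · obtain ⟨m, hm, hmN⟩ := hfin
    have hNf : N.FiniteIndex := by
      have : Finite (Γ ⧸ N) := by
        refine Finite.of_surjective (fun i : Fin m.natAbs => (QuotientGroup.mk (t ^ (i : ℤ)) : Γ ⧸ N))
          fun q => ?_
        obtain ⟨k, rfl⟩ := QuotientGroup.mk_surjective q
        obtain ⟨n, hn⟩ := ht k
        have hlt := Int.emod_lt (-n) hm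
        have hge := Int.emod_nonneg (-n) hm
        refine ⟨⟨((-n) % m).toNat, by omega⟩, ?_⟩
        simp only [Int.toNat_of_nonneg hge]
        have h1 : (QuotientGroup.mk k : Γ ⧸ N) = (QuotientGroup.mk t) ^ (-n) := by
          rw [zpow_neg, eq_inv_iff_mul_eq_one, ← QuotientGroup.mk_zpow, ← QuotientGroup.mk_mul,
            QuotientGroup.eq_one_iff]
          exact hn
        have h2 : (QuotientGroup.mk t : Γ ⧸ N) ^ m = 1 := by
          rw [← QuotientGroup.mk_zpow, QuotientGroup.eq_one_iff]
          exact hmN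
        rw [h1, QuotientGroup.mk_zpow]
        conv_rhs => rw [← Int.emod_add_mul_ediv (-n) m, zpow_add, zpow_mul, h2, one_zpow, mul_one]
      exact Subgroup.finiteIndex_of_finite_quotient
    by_cases hxN : x ∈ N
    · obtain ⟨K, hK, hxK⟩ := Group.residuallyFinite_iff_exists_finiteIndex.1 ‹_› (⟨x, hxN⟩ : N)
        (fun h => hx (congrArg Subtype.val h))
      refine ⟨K.map N.subtype, ⟨?_⟩, ?_⟩
      · rw [Subgroup.index_map_subtype]
        exact mul_ne_zero hK.index_ne_zero hNf.index_ne_zero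
      · rintro ⟨y, hy, rfl⟩
        exact hxK hy
    · exact ⟨N, hNf, hxN⟩
  · push Not at hfin
    suffices h : ∃ K : Subgroup Γ, K ≤ N ∧ K.Normal ∧ (K.subgroupOf N).FiniteIndex ∧
        ∃ m : ℤ, m ≠ 0 ∧ ∀ k ∈ K, ∀ i : ℤ, x ≠ k * t ^ (m * i) by
      obtain ⟨K, hKN, hKn, hKf, m, hm, hmx⟩ := h
      refine ⟨K ⊔ Subgroup.zpowers (t ^ m), ?_, ?_⟩
      · have : Finite (Γ ⧸ (K ⊔ Subgroup.zpowers (t ^ m))) := by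
          refine Finite.of_surjective (fun p : (N ⧸ K.subgroupOf N) × Fin m.natAbs =>
            (QuotientGroup.mk (t ^ (p.2 : ℤ) * (p.1.out : Γ)) : Γ ⧸ (K ⊔ Subgroup.zpowers (t ^ m))))
            fun q => ?_
          obtain ⟨k, rfl⟩ := QuotientGroup.mk_surjective q
          obtain ⟨n, hn⟩ := ht k
          have hlt := Int.emod_lt (-n) hm
          have hge := Int.emod_nonneg (-n) hm
          have hr : (((-n) % m).toNat : ℤ) = (-n) % m := Int.toNat_of_nonneg hge
          have hν : t ^ (-((-n) % m)) * (k * t ^ n) * t ^ ((-n) % m) ∈ N := by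
            have := ‹N.Normal›.conj_mem _ hn (t ^ (-((-n) % m)))
            rwa [← zpow_neg, neg_neg] at this
          obtain ⟨⟨c, hc⟩, hc'⟩ := QuotientGroup.mk_out_eq_mul (K.subgroupOf N) ⟨_, hν⟩
          refine ⟨(QuotientGroup.mk ⟨_, hν⟩, ⟨((-n) % m).toNat, by omega⟩), ?_⟩
          rw [QuotientGroup.eq]
          simp only [hr, hc']
          have hcK : (c : Γ) ∈ K := hc
          have e : (t ^ (-n % m) * (t ^ (-(-n % m)) * (k * t ^ n) * t ^ (-n % m) * (c : Γ)))⁻¹ * k =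
              (c : Γ)⁻¹ * (t ^ m) ^ (-n / m) := by
            have : (t ^ m) ^ (-n / m) = t ^ (-(-n % m)) * t ^ (-n) := by
              rw [← zpow_mul, ← zpow_add]
              congr 1
              have := Int.emod_add_mul_ediv (-n) m
              linarith
            rw [this]
            group
          exact e ▸ Subgroup.mul_mem _ (Subgroup.inv_mem _ (Subgroup.mem_sup_left hcK))
            (Subgroup.mem_sup_right ⟨_, rfl⟩)
        exact Subgroup.finiteIndex_of_finite_quotient
      · intro h
        rw [← SetLike.mem_coe, Subgroup.normal_mul] at h
        obtain ⟨k, hk, _, ⟨i, rfl⟩, h⟩ := h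
        refine hmx k hk i ?_
        rw [zpow_mul]
        exact h.symm
    by_cases hxN : x ∈ N
    · obtain ⟨K, hKc, hK, hxK⟩ := exists_characteristic_finiteIndex (⟨x, hxN⟩ : N)
        (fun h => hx (congrArg Subtype.val h))
      refine ⟨K.map N.subtype, Subgroup.map_subtype_le _, inferInstance, ?_, 1, one_ne_zero, ?_⟩
      · rw [Subgroup.subgroupOf, Subgroup.comap_map_eq_self_of_injective N.subtype_injective]
        exact hK
      · rintro _ ⟨k, hk, rfl⟩ i h
        have h1 : t ^ (1 * i) ∈ N := by
          have : t ^ (1 * i) = (N.subtype k)⁻¹ * x := by rw [h]; group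
          rw [this]
          exact N.mul_mem (N.inv_mem k.2) hxN
        have h2 : i = 0 := by
          by_contra hi
          exact hfin (1 * i) (by simpa using hi) h1
        subst h2
        simp only [mul_zero, zpow_zero, mul_one] at h
        apply hxK
        have : (⟨x, hxN⟩ : N) = k := Subtype.ext h
        rwa [this]
    · obtain ⟨n, hn⟩ := ht x
      have hn0 : n ≠ 0 := by
        rintro rfl
        simp at hn
        exact hxN hn
      refine ⟨N, le_rfl, inferInstance, ?_, 2 * n, by simpa using hn0, ?_⟩
      · rw [Subgroup.subgroupOf_self]
        infer_instance
      intro k hk i h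
      have h1 : t ^ (2 * n * i + n) ∈ N := by
        have : t ^ (2 * n * i + n) = k⁻¹ * (x * t ^ n) := by rw [h, zpow_add]; group
        rw [this]
        exact N.mul_mem (N.inv_mem hk) hn
      refine hfin _ ?_ h1
      have : 2 * n * i + n = n * (2 * i + 1) := by ring
      rw [this]
      exact mul_ne_zero hn0 (by omega)

end ResiduallyFinite

section PartA

theorem Subgroup.IsPoly.residuallyFinite {G : Type} [Group G] {H : Subgroup G} (hH : H.IsPoly) :
    Group.ResiduallyFinite H := by
  induction hH with
  | bot => infer_instance
  | @step H K t hHK ht hn hc hH ih =>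
    have e : H.subgroupOf K ≃* H := Subgroup.subgroupOfEquivOfLe hHK
    have : Group.FG H := (Group.fg_iff_subgroup_fg H).2 hH.fg
    have : Group.FG (H.subgroupOf K) := Group.fg_of_surjective (f := e.symm.toMonoidHom)
      e.symm.surjective
    have : Group.ResiduallyFinite (H.subgroupOf K) :=
      Group.ResiduallyFinite.of_injective e.toMonoidHom e.injective
    have : (H.subgroupOf K).Normal := ⟨fun h hh k => hn k k.2 h hh⟩
    refine Group.ResiduallyFinite.of_cyclic_quotient (H.subgroupOf K) ⟨t, ht⟩ fun k => ?_
    obtain ⟨n, h⟩ := hc k k.2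
    exact ⟨n, h⟩

theorem IsPolycyclicByFinite.residuallyFinite {G : Type} [Group G] (hG : IsPolycyclicByFinite G) :
    Group.ResiduallyFinite G := by
  obtain ⟨N, hN, hf, hp⟩ := hG
  have : Group.ResiduallyFinite N :=
    (Subgroup.IsPoly.of_top (isPolycyclic_iff.1 hp)).residuallyFinite
  rw [Group.residuallyFinite_iff_exists_finiteIndex]
  intro x hx
  by_cases hxN : x ∈ N
  · obtain ⟨K, hK, hxK⟩ := Group.residuallyFinite_iff_exists_finiteIndex.1 ‹_› (⟨x, hxN⟩ : N)
      (fun h => hx (congrArg Subtype.val h))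
    refine ⟨K.map N.subtype, ⟨?_⟩, ?_⟩
    · rw [Subgroup.index_map_subtype]
      exact mul_ne_zero hK.index_ne_zero hf.index_ne_zero
    · rintro ⟨y, hy, rfl⟩
      exact hxK hy
  · exact ⟨N, hf, hxN⟩

theorem augmentation_mapDomainRingHom {G G' : Type} [Group G] [Group G'] (f : G →* G')
    (x : MonoidAlgebra ℤ G) :
    augmentation G' (MonoidAlgebra.mapDomainRingHom ℤ f x) = augmentation G x := by
  induction x using MonoidAlgebra.induction_linear with
  | zero => simp
  | add x y hx hy => rw [map_add, map_add, map_add, hx, hy]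
  | single g r => simp

theorem eq_zero_of_idempotent_of_augmentation' {G : Type} [Group G] [Group.ResiduallyFinite G]
    {n : Type*} [Fintype n] [DecidableEq n]
    (e : Matrix n n (MonoidAlgebra ℤ G)) (he : e * e = e)
    (h0 : ∀ i j, augmentation G (e i j) = 0) : e = 0 := by
  classical
  ext i j g
  by_contra hg
  have hK : ∀ h : G, ∃ K : FiniteIndexNormalSubgroup G, g⁻¹ * h ∈ K → g = h := fun h => by
    by_cases hgh : g = h
    · exact ⟨.ofSubgroup ⊤, fun _ => hgh⟩
    · obtain ⟨K, hK⟩ := Group.exists_finiteIndexNormalSubgroup_notMem (g⁻¹ * h)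
        (fun h' => hgh (by rwa [inv_mul_eq_one] at h'))
      exact ⟨K, fun h' => absurd h' hK⟩
  choose K hK using hK
  let L : Subgroup G := ⨅ h : (e i j).coeff.support, (K h).toSubgroup
  have hLn : L.Normal := Subgroup.normal_iInf_normal fun h => inferInstance
  have hLf : L.FiniteIndex := Subgroup.finiteIndex_iInf fun h => inferInstance
  have hL : ∀ h ∈ (e i j).coeff.support, g⁻¹ * h ∈ L → g = h := fun h hh hh' =>
    hK h ((Subgroup.mem_iInf.1 hh') ⟨h, hh⟩)
  have h1 := eq_zero_of_idempotent_of_augmentation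
    (e.map (MonoidAlgebra.mapDomainRingHom ℤ (QuotientGroup.mk' L)))
    (by rw [← Matrix.map_mul, he]) (fun i j => by
      rw [Matrix.map_apply, augmentation_mapDomainRingHom, h0])
  have h2 := congrArg (fun x => x.coeff (QuotientGroup.mk' L g)) (congrFun (congrFun h1 i) j)
  apply hg
  have key : ∀ x : MonoidAlgebra ℤ G, (MonoidAlgebra.mapDomainRingHom ℤ (QuotientGroup.mk' L) x).coeff
      (QuotientGroup.mk' L g) = ∑ h ∈ x.coeff.support, if g⁻¹ * h ∈ L then x.coeff h else 0 := by
    intro x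
    rw [MonoidAlgebra.mapDomainRingHom_apply, MonoidAlgebra.coeff_mapDomain, Finsupp.mapDomain,
      Finsupp.sum_apply, Finsupp.sum]
    refine Finset.sum_congr rfl fun h _ => ?_
    rw [Finsupp.single_apply]
    have : (QuotientGroup.mk' L) h = (QuotientGroup.mk' L) g ↔ g⁻¹ * h ∈ L := by
      rw [eq_comm]
      exact QuotientGroup.eq
    simp only [this]
  simp only [Matrix.map_apply] at h2
  rw [key, Finset.sum_eq_single g] at h2
  · simpa using h2
  · intro b hb hbg
    rw [if_neg fun h => hbg (hL b hb h).symm]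
  · intro h
    simpa using h

theorem exists_projective_without_summands {G : Type} [Group G] (hG : IsPolycyclicByFinite G)
    (hn : ¬ IsPolycyclic G) :
    ∃ (P : Type) (_ : AddCommGroup P) (_ : Module (MonoidAlgebra ℤ G) P),
      Nontrivial P ∧ Module.Projective (MonoidAlgebra ℤ G) P ∧
      ∀ Q Q' : Submodule (MonoidAlgebra ℤ G) P, IsCompl Q Q' →
        Module.Finite (MonoidAlgebra ℤ G) Q → Q = ⊥ := by
  obtain ⟨H, hH, hp, hfg⟩ := hG.exists_isPerfect hn
  have : Nontrivial H := (Subgroup.nontrivial_iff_ne_bot H).2 hH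
  obtain ⟨ι, _, a, y, ha, hne, h⟩ := exists_relation_of_isPerfect (H := H)
  let j := MonoidAlgebra.mapDomainRingHom ℤ H.subtype
  have hj : Function.Injective j := MonoidAlgebra.mapDomain_injective H.subtype_injective
  obtain ⟨P, _, _, hnt, hproj, hε⟩ := exists_projective_of_relation (R := MonoidAlgebra ℤ G)
    (fun i => j (a i)) (fun p q r => j (y p q r)) (augmentation G)
    (fun i => by rw [augmentation_mapDomainRingHom, ha])
    (by obtain ⟨i, hi⟩ := hne; exact ⟨i, by rwa [Ne, map_eq_zero_iff j hj]⟩)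
    (fun m => by rw [h m]; simp only [map_sum, map_mul])
  refine ⟨P, _, _, hnt, hproj, fun Q Q' hQ hQf => ?_⟩
  have := hG.residuallyFinite
  have hQp : Module.Projective (MonoidAlgebra ℤ G) Q := by
    refine Module.Projective.of_split Q.subtype (Q.projectionOnto Q' hQ) ?_
    ext x
    exact congrArg Subtype.val (Submodule.projectionOnto_apply_left hQ x)
  obtain ⟨n, π, hπ⟩ := Module.Finite.exists_fin' (MonoidAlgebra ℤ G) Q
  obtain ⟨s, hs⟩ := Module.projective_lifting_property π LinearMap.id hπ
  let e : Matrix (Fin n) (Fin n) (MonoidAlgebra ℤ G) := fun i => s (π (Pi.single i 1))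
  have hv : ∀ v : Fin n → MonoidAlgebra ℤ G, s (π v) = ∑ i, v i • e i := fun v => by
    conv_lhs => rw [pi_eq_sum_univ' v]
    simp [map_sum, e]
  have he : e * e = e := by
    funext i k
    have h1 := hv (e i)
    have h2 : s (π (e i)) = e i := by
      have : ∀ q, π (s q) = q := fun q => LinearMap.congr_fun hs q
      simp only [e, this]
    rw [h2] at h1
    rw [Matrix.mul_apply]
    conv_rhs => rw [h1]
    simp
  have he0 : e = 0 := by
    refine eq_zero_of_idempotent_of_augmentation' e he fun i k => ?_
    have := hε ((LinearMap.proj k ∘ₗ s) ∘ₗ Q.projectionOnto Q' hQ) (π (Pi.single i 1))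
    rw [LinearMap.comp_apply, Submodule.projectionOnto_apply_left] at this
    exact this
  rw [Submodule.eq_bot_iff]
  intro q hq
  obtain ⟨v, hv'⟩ := hπ ⟨q, hq⟩
  have h1 := hv v
  have h2 : π (s (π v)) = π v := LinearMap.congr_fun hs (π v)
  have h3 : (⟨q, hq⟩ : Q) = 0 := by
    rw [← hv', ← h2, h1, he0]
    exact (congrArg π (Finset.sum_eq_zero fun i _ => smul_zero _)).trans (map_zero _)
  exact congrArg Subtype.val h3

end PartA

section Bass

variable {R : Type*} [Ring R] {P : Type*} [AddCommGroup P] [Module R P]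

/-- Every finitely generated submodule is killed by functionals whose images generate `R`. -/
def Module.IsUniformlyBig (R P : Type*) [Ring R] [AddCommGroup P] [Module R P] : Prop :=
  ∀ X : Submodule R P, X.FG → ∀ I : Submodule R R,
    (∀ θ : P →ₗ[R] R, X ≤ LinearMap.ker θ → LinearMap.range θ ≤ I) → I = ⊤

namespace Module.IsUniformlyBig

theorem exists_surjective [IsNoetherianRing R] (hP : Module.IsUniformlyBig R P)
    (X : Submodule R P) (hX : X.FG) :
    ∃ θ : P →ₗ[R] R, X ≤ LinearMap.ker θ ∧ Function.Surjective θ := by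
  let S : Set (Submodule R R) := {I | ∃ θ : P →ₗ[R] R, X ≤ LinearMap.ker θ ∧ LinearMap.range θ = I}
  obtain ⟨I, ⟨θ, hθX, rfl⟩, hmax⟩ := set_has_maximal_iff_noetherian.2 ‹IsNoetherianRing R› S
    ⟨_, 0, by simp, rfl⟩
  refine ⟨θ, hθX, LinearMap.range_eq_top.1 ?_⟩
  obtain ⟨Y, hYfg, hY⟩ : ∃ Y : Submodule R P, Y.FG ∧ Y.map θ = LinearMap.range θ := by
    obtain ⟨s, hs⟩ := IsNoetherian.noetherian (LinearMap.range θ)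
    choose f hf using fun x : s => (hs ▸ Submodule.subset_span x.2 : (x : R) ∈ LinearMap.range θ)
    refine ⟨Submodule.span R (Set.range f), Submodule.fg_span (Set.finite_range f), ?_⟩
    rw [Submodule.map_span, ← Set.range_comp, ← hs]
    congr 1
    ext x
    constructor
    · rintro ⟨y, rfl⟩
      simp [hf]
    · intro hx
      exact ⟨⟨x, hx⟩, hf _⟩
  refine hP (X ⊔ Y) (hX.sup hYfg) _ fun θ' hθ' => ?_
  have hle : LinearMap.range θ ≤ LinearMap.range (θ + θ') := by
    rw [← hY]
    rintro _ ⟨y, hy, rfl⟩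
    exact ⟨y, by simp [LinearMap.mem_ker.1 (hθ' (Submodule.mem_sup_right hy))]⟩
  have heq : LinearMap.range (θ + θ') = LinearMap.range θ := by
    by_contra hne
    refine hmax _ ⟨θ + θ', ?_, rfl⟩ (lt_of_le_of_ne hle (Ne.symm hne))
    intro x hx
    simp [LinearMap.mem_ker.1 (hθX hx), LinearMap.mem_ker.1 (hθ' (Submodule.mem_sup_left hx))]
  rintro _ ⟨p, rfl⟩
  have h1 : (θ + θ') p ∈ LinearMap.range θ := heq ▸ ⟨p, rfl⟩
  have := Submodule.sub_mem _ h1 (LinearMap.mem_range_self θ p)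
  simpa using this

theorem exists_surjective_fin [IsNoetherianRing R] (hP : Module.IsUniformlyBig R P)
    (X : Submodule R P) (hX : X.FG) (n : ℕ) :
    ∃ (θ : P →ₗ[R] (Fin n → R)) (p : (Fin n → R) →ₗ[R] P),
      X ≤ LinearMap.ker θ ∧ θ ∘ₗ p = LinearMap.id := by
  suffices h : ∃ θ : P →ₗ[R] (Fin n → R), X ≤ LinearMap.ker θ ∧ Function.Surjective θ by
    obtain ⟨θ, h1, h2⟩ := h
    obtain ⟨p, hp⟩ := Module.projective_lifting_property θ LinearMap.id h2
    exact ⟨θ, p, h1, hp⟩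
  induction n with
  | zero => exact ⟨0, by simp, fun x => ⟨0, Subsingleton.elim _ _⟩⟩
  | succ n ih =>
    obtain ⟨θ, h1, h2⟩ := ih
    obtain ⟨p, hp⟩ := Module.projective_lifting_property θ LinearMap.id h2
    have hp' : ∀ v, θ (p v) = v := fun v => LinearMap.congr_fun hp v
    have hfg : (LinearMap.range p).FG := by
      rw [LinearMap.range_eq_map]
      exact Module.Finite.fg_top.map p
    obtain ⟨η, hη1, hη2⟩ := hP.exists_surjective (X ⊔ LinearMap.range p) (hX.sup hfg)
    refine ⟨LinearMap.pi (Fin.cons η fun i => LinearMap.proj i ∘ₗ θ), fun x hx => ?_, fun v => ?_⟩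
    · rw [LinearMap.mem_ker]
      ext i
      refine Fin.cases ?_ (fun i => ?_) i
      · exact LinearMap.mem_ker.1 (hη1 (Submodule.mem_sup_left hx))
      · simp [LinearMap.mem_ker.1 (h1 hx)]
    · obtain ⟨q, hq⟩ := hη2 (v 0)
      have hz : ∀ w, η (p w) = 0 := fun w =>
        LinearMap.mem_ker.1 (hη1 (Submodule.mem_sup_right ⟨w, rfl⟩))
      refine ⟨p (Fin.tail v - θ q) + q, ?_⟩
      ext i
      refine Fin.cases ?_ (fun i => ?_) i
      · simp [hz, hq]
      · simp [hp', Fin.tail]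

/-- A finitely generated part of a projective module splits off after adding a free module. -/
theorem _root_.Module.Projective.exists_stable_split [Module.Projective R P] (y : P) :
    ∃ (n m : ℕ) (α₁ : (Fin n → R) →ₗ[R] P) (α₂ : (Fin n → R) →ₗ[R] (Fin m → R))
      (β₁ : P →ₗ[R] (Fin n → R)) (β₂ : (Fin m → R) →ₗ[R] (Fin n → R)) (v : Fin n → R),
      β₁ ∘ₗ α₁ + β₂ ∘ₗ α₂ = LinearMap.id ∧ α₁ v = y ∧ α₂ v = 0 := by
  classical
  obtain ⟨s, hs⟩ := (Module.projective_def (R := R) (P := P)).1 inferInstance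
  let π : (P →₀ R) →ₗ[R] P := Finsupp.linearCombination R id
  have hπ : ∀ x, π (s x) = x := hs
  let ρ : (P →₀ R) →ₗ[R] (P →₀ R) := LinearMap.id - s ∘ₗ π
  have hρ : ∀ x, ρ x = x - s (π x) := fun x => rfl
  let S := (s y).support
  let T := S.biUnion fun i => (ρ (Finsupp.single i 1)).support
  let inc : (U : Finset P) → (U →₀ R) →ₗ[R] (P →₀ R) := fun U => Finsupp.lmapDomain R R Subtype.val
  let res : (U : Finset P) → (P →₀ R) →ₗ[R] (U →₀ R) := fun U =>
    Finsupp.lcomapDomain Subtype.val Subtype.val_injective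
  have hri : ∀ U w, res U (inc U w) = w := fun U w =>
    Finsupp.comapDomain_mapDomain _ Subtype.val_injective w
  have hir : ∀ (U : Finset P) (w : P →₀ R), w.support ⊆ U → inc U (res U w) = w := by
    intro U w hw
    refine Finsupp.mapDomain_comapDomain _ Subtype.val_injective w ?_
    intro x hx
    exact ⟨⟨x, hw hx⟩, rfl⟩
  have hT : ∀ w, (ρ (inc S w)).support ⊆ T := by
    intro w
    induction w using Finsupp.induction_linear with
    | zero => simp
    | add f g hf hg =>
      rw [map_add, map_add]
      exact Finsupp.support_add.trans (Finset.union_subset hf hg)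
    | single i r =>
      have : inc S (Finsupp.single i r) = r • Finsupp.single (i : P) 1 := by simp [inc]
      rw [this, map_smul]
      exact Finsupp.support_smul.trans
        (Finset.subset_biUnion_of_mem (fun i => (ρ (Finsupp.single i 1)).support) i.2)
  let eS : (Fin S.card → R) ≃ₗ[R] (S →₀ R) :=
    (LinearEquiv.funCongrLeft R R S.equivFin).trans (Finsupp.linearEquivFunOnFinite R R S).symm
  let eT : (Fin T.card → R) ≃ₗ[R] (T →₀ R) :=
    (LinearEquiv.funCongrLeft R R T.equivFin).trans (Finsupp.linearEquivFunOnFinite R R T).symm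
  refine ⟨S.card, T.card, π ∘ₗ inc S ∘ₗ eS, eT.symm ∘ₗ res T ∘ₗ ρ ∘ₗ inc S ∘ₗ eS,
    eS.symm ∘ₗ res S ∘ₗ s, eS.symm ∘ₗ res S ∘ₗ ρ ∘ₗ inc T ∘ₗ eT, eS.symm (res S (s y)), ?_, ?_, ?_⟩
  · refine LinearMap.ext fun v => ?_
    simp only [LinearMap.add_apply, LinearMap.comp_apply, LinearEquiv.coe_coe,
      LinearEquiv.apply_symm_apply, LinearMap.id_apply]
    rw [hir T _ (hT _), ← map_add, ← map_add, LinearEquiv.symm_apply_eq]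
    have : s (π (inc S (eS v))) + ρ (ρ (inc S (eS v))) = inc S (eS v) := by
      simp only [hρ, map_sub, hπ]
      abel
    rw [this, hri]
  · simp only [LinearMap.comp_apply, LinearEquiv.coe_coe, LinearEquiv.apply_symm_apply]
    rw [hir S _ (Finset.Subset.refl _), hπ]
  · simp only [LinearMap.comp_apply, LinearEquiv.coe_coe, LinearEquiv.apply_symm_apply]
    rw [hir S _ (Finset.Subset.refl _), hρ, hπ, sub_self, map_zero, map_zero]

theorem exists_free_summand [IsNoetherianRing R] [Module.Projective R P]
    (hP : Module.IsUniformlyBig R P) (y : P) :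
    ∃ (n : ℕ) (α : (Fin n → R) →ₗ[R] P) (β : P →ₗ[R] (Fin n → R)),
      β ∘ₗ α = LinearMap.id ∧ y ∈ LinearMap.range α := by
  obtain ⟨n, m, α₁, α₂, β₁, β₂, v, h1, h2, h3⟩ := Module.Projective.exists_stable_split (R := R) y
  obtain ⟨θ, p, hθ, hp⟩ := hP.exists_surjective_fin (LinearMap.range α₁)
    (by rw [LinearMap.range_eq_map]; exact Module.Finite.fg_top.map _) m
  refine ⟨n, α₁ + p ∘ₗ α₂, β₁ ∘ₗ (LinearMap.id - p ∘ₗ θ) + β₂ ∘ₗ θ, ?_, v, by simp [h2, h3]⟩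
  refine LinearMap.ext fun w => ?_
  have e1 : θ (α₁ w) = 0 := LinearMap.mem_ker.1 (hθ ⟨w, rfl⟩)
  have e2 : θ (p (α₂ w)) = α₂ w := LinearMap.congr_fun hp _
  have e3 := LinearMap.congr_fun h1 w
  simp only [LinearMap.add_apply, LinearMap.comp_apply, LinearMap.sub_apply, LinearMap.id_apply,
    map_add, e1, e2, map_zero, map_sub] at e3 ⊢
  conv_rhs => rw [← e3]
  abel

theorem of_isCompl (hP : Module.IsUniformlyBig R P) {A Q : Submodule R P} (h : IsCompl A Q)
    (hA : A.FG) : Module.IsUniformlyBig R Q := by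
  intro X hX I hI
  refine hP (A ⊔ X.map Q.subtype) (hA.sup (hX.map _)) I fun θ hθ => ?_
  have h1 := hI (θ ∘ₗ Q.subtype) (fun x hx => by
    exact LinearMap.mem_ker.1 (hθ (Submodule.mem_sup_right ⟨x, hx, rfl⟩)))
  rintro _ ⟨p, rfl⟩
  obtain ⟨a, ha, q, hq, rfl⟩ := Submodule.mem_sup.1 (h.sup_eq_top ▸ Submodule.mem_top : p ∈ A ⊔ Q)
  rw [map_add, LinearMap.mem_ker.1 (hθ (Submodule.mem_sup_left ha)), zero_add]
  exact h1 ⟨⟨q, hq⟩, rfl⟩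

theorem exists_extend [IsNoetherianRing R] [Nontrivial R] [Module.Projective R P]
    (hP : Module.IsUniformlyBig R P) (S : Set P) (hSf : S.Finite)
    (hS : LinearIndepOn R id S) (Q : Submodule R P) (hQ : IsCompl (Submodule.span R S) Q) (y : P) :
    ∃ S' : Set P, S'.Finite ∧ S ⊆ S' ∧ LinearIndepOn R id S' ∧ y ∈ Submodule.span R S' ∧
      ∃ Q' : Submodule R P, IsCompl (Submodule.span R S') Q' := by
  have hb := hP.of_isCompl hQ (Submodule.fg_span hSf)
  have hproj : Module.Projective R Q := by
    refine Module.Projective.of_split Q.subtype (Q.projectionOnto _ hQ.symm) ?_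
    ext x
    exact congrArg Subtype.val (Submodule.projectionOnto_apply_left hQ.symm x)
  obtain ⟨n, α, β, h1, v, hv⟩ := hb.exists_free_summand (Q.projectionOnto _ hQ.symm y)
  have hβα : ∀ w, β (α w) = w := fun w => LinearMap.congr_fun h1 w
  have hinj : Function.Injective (Q.subtype ∘ₗ α) :=
    Q.injective_subtype.comp (Function.LeftInverse.injective hβα)
  let b : Fin n → P := fun i => α (Pi.single i 1)
  have hbli : LinearIndependent R b := by
    have := (Pi.basisFun R (Fin n)).linearIndependent.map' (Q.subtype ∘ₗ α)
      (LinearMap.ker_eq_bot.2 hinj)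
    convert this using 1
    ext i
    simp [b]
  have hspan : Submodule.span R (Set.range b) = (LinearMap.range α).map Q.subtype := by
    rw [← LinearMap.range_comp, LinearMap.range_eq_map, ← (Pi.basisFun R (Fin n)).span_eq,
      Submodule.map_span, ← Set.range_comp]
    congr 2
    ext i
    simp [b]
  refine ⟨S ∪ Set.range b, hSf.union (Set.finite_range b), Set.subset_union_left, ?_, ?_,
    (LinearMap.ker β).map Q.subtype, ?_⟩
  · refine LinearIndepOn.union hS (by simpa using hbli.linearIndepOn_id) ?_
    simp only [id, Set.image_id']
    rw [hspan]
    exact hQ.disjoint.mono_right (Submodule.map_subtype_le _ _)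
  · rw [Submodule.span_union, hspan]
    obtain ⟨a, ha, q, hq, rfl⟩ :=
      Submodule.mem_sup.1 (hQ.sup_eq_top ▸ Submodule.mem_top : y ∈ Submodule.span R S ⊔ Q)
    refine Submodule.add_mem_sup ha ⟨α v, ⟨v, rfl⟩, ?_⟩
    rw [hv, map_add, Submodule.projectionOnto_apply_right hQ.symm ⟨a, ha⟩, zero_add]
    exact congrArg Subtype.val (Submodule.projectionOnto_apply_left hQ.symm ⟨q, hq⟩)
  · rw [Submodule.span_union, hspan]
    constructor
    · rw [Submodule.disjoint_def]
      rintro x hx ⟨k, hk, rfl⟩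
      obtain ⟨a, ha, _, ⟨_, ⟨w, rfl⟩, rfl⟩, h⟩ := Submodule.mem_sup.1 hx
      have ha0 : a = 0 := by
        refine Submodule.disjoint_def.1 hQ.disjoint a ha ?_
        rw [eq_sub_of_add_eq h]
        exact (k - α w).2
      rw [ha0, zero_add] at h
      have h' : α w = k := Subtype.ext h
      have hk' : β k = 0 := hk
      rw [← h', hβα] at hk'
      rw [← h', hk', map_zero, map_zero]
    · rw [codisjoint_iff, eq_top_iff, ← hQ.sup_eq_top, sup_assoc]
      refine sup_le_sup_left (fun q hq => ?_) _
      refine Submodule.mem_sup.2 ⟨_, ⟨α (β ⟨q, hq⟩), ⟨_, rfl⟩, rfl⟩, _,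
        ⟨⟨q, hq⟩ - α (β ⟨q, hq⟩), ?_, rfl⟩, ?_⟩
      · exact LinearMap.mem_ker.2 (by rw [map_sub, hβα, sub_self])
      · rw [← map_add, add_sub_cancel]
        rfl

theorem free [IsNoetherianRing R] [Nontrivial R] [Module.Projective R P]
    (hP : Module.IsUniformlyBig R P) (hc : ∃ y : ℕ → P, Submodule.span R (Set.range y) = ⊤) :
    Module.Free R P := by
  obtain ⟨y, hy⟩ := hc
  let A := {S : Set P // S.Finite ∧ LinearIndepOn R id S ∧
    ∃ Q : Submodule R P, IsCompl (Submodule.span R S) Q}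
  have step : ∀ (S : A) (z : P), ∃ S' : A, S.1 ⊆ S'.1 ∧ z ∈ Submodule.span R S'.1 := by
    rintro ⟨S, h1, h2, Q, h3⟩ z
    obtain ⟨S', a, b, c, d, e⟩ := hP.exists_extend S h1 h2 Q h3 z
    exact ⟨⟨S', a, c, e⟩, b, d⟩
  choose f hf1 hf2 using step
  let s : ℕ → A := fun n => Nat.rec ⟨∅, Set.finite_empty, by simp, ⊤, by
    simpa using isCompl_bot_top⟩ (fun k S => f S (y k)) n
  have hmono : Monotone fun n => (s n).1 := monotone_nat_of_le_succ fun n => hf1 (s n) (y n)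
  have hli : LinearIndepOn R id (⋃ n, (s n).1) :=
    linearIndepOn_iUnion_of_directed hmono.directed_le fun n => (s n).2.2.1
  refine Module.Free.of_basis (Module.Basis.mk hli.linearIndependent ?_)
  rw [← hy, Submodule.span_le]
  rintro _ ⟨n, rfl⟩
  have := hf2 (s n) (y n)
  refine Submodule.span_mono ?_ this
  intro x hx
  exact ⟨⟨x, Set.mem_iUnion.2 ⟨n + 1, hx⟩⟩, rfl⟩

end Module.IsUniformlyBig

end Bass

section Kaplansky

/-- A module generated by countably many elements. -/
def Module.IsCountablyGenerated (R P : Type*) [Ring R] [AddCommGroup P] [Module R P] : Prop :=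
  ∃ S : Set P, S.Countable ∧ Submodule.span R S = ⊤

theorem Set.Countable.exists_closure {X : Type*} (D : X → Finset X) (x : X) :
    ∃ C : Set X, C.Countable ∧ x ∈ C ∧ ∀ y ∈ C, ↑(D y) ⊆ C := by
  let S : ℕ → Set X := fun n => Nat.rec {x} (fun _ T => ⋃ a ∈ T, (D a : Set X)) n
  have hS : ∀ n, (S n).Countable := fun n => by
    induction n with
    | zero => exact Set.countable_singleton x
    | succ n ih => exact ih.biUnion fun a _ => (D a).countable_toSet
  refine ⟨⋃ n, S n, Set.countable_iUnion hS, Set.mem_iUnion.2 ⟨0, rfl⟩, fun y hy => ?_⟩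
  obtain ⟨n, hn⟩ := Set.mem_iUnion.1 hy
  exact (Set.subset_biUnion_of_mem (u := fun a => (D a : Set X)) hn).trans
    (Set.subset_iUnion S (n + 1))

theorem iSupIndep_of_disjoint_lt {R P X : Type*} [Ring R] [AddCommGroup P] [Module R P]
    [LinearOrder X] (L A : X → Submodule R P) (hLA : ∀ x y, y < x → L y ≤ A x)
    (hd : ∀ x, Disjoint (A x) (L x)) : iSupIndep L := by
  classical
  rw [iSupIndep_iff_finsetSum_eq_zero_imp_eq_zero]
  intro s
  induction s using Finset.induction_on_max with
  | empty => simp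
  | insert a s hs ih =>
    intro v hv h
    have ha : a ∉ s := fun h => lt_irrefl _ (hs a h)
    rw [Finset.sum_insert ha] at h
    have h1 : v a = 0 := by
      refine Submodule.disjoint_def.1 (hd a) _ ?_ (hv a (Finset.mem_insert_self _ _))
      rw [eq_neg_of_add_eq_zero_left h]
      exact Submodule.neg_mem _ (Submodule.sum_mem _ fun i hi =>
        hLA a i (hs i hi) (hv i (Finset.mem_insert_of_mem hi)))
    rw [h1, zero_add] at h
    intro i hi
    rcases Finset.mem_insert.1 hi with rfl | hi
    · exact h1
    · exact ih v (fun i hi => hv i (Finset.mem_insert_of_mem hi)) h i hi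

/-- Kaplansky: a projective module is a direct sum of countably generated submodules. -/
theorem Module.Projective.exists_isInternal {R P : Type*} [Ring R] [AddCommGroup P] [Module R P]
    [Module.Projective R P] :
    ∃ L : P → Submodule R P, (∀ x, Module.IsCountablyGenerated R (L x)) ∧
      iSupIndep L ∧ iSup L = ⊤ := by
  classical
  obtain ⟨s, hs⟩ := (Module.projective_def (R := R) (P := P)).1 inferInstance
  let π : (P →₀ R) →ₗ[R] P := Finsupp.linearCombination R id
  have hπ : ∀ x, π (s x) = x := hs
  clear_value π
  let D : P → Finset P := fun x => (s (π (Finsupp.single x 1))).support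
  choose C hCc hxC hC using fun x => Set.Countable.exists_closure D x
  obtain ⟨_, _⟩ := exists_wellFoundedLT P
  let lt : P → Set P := fun x => ⋃ y, ⋃ _ : y < x, C y
  let le : P → Set P := fun x => lt x ∪ C x
  let F : Set P → Submodule R (P →₀ R) := fun S => Finsupp.supported R R S
  let A : Set P → Submodule R P := fun S => (F S).comap s
  have hclosed : ∀ S : Set P, (∀ y ∈ S, ↑(D y) ⊆ S) → ∀ w ∈ F S, s (π w) ∈ F S := by
    intro S hS w hw
    have : w ∈ Submodule.span R ((fun i => Finsupp.single i (1 : R)) '' S) := by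
      rwa [← Finsupp.supported_eq_span_single]
    induction this using Submodule.span_induction with
    | mem x hx =>
      obtain ⟨y, hy, rfl⟩ := hx
      exact (Finsupp.mem_supported R _).2 (hS y hy)
    | zero => simp
    | add x y hx hy h1 h2 =>
      rw [← Finsupp.supported_eq_span_single] at hx hy
      rw [map_add, map_add]
      exact Submodule.add_mem _ (h1 hx) (h2 hy)
    | smul r x hx h1 =>
      rw [← Finsupp.supported_eq_span_single] at hx
      rw [map_smul, map_smul]
      exact Submodule.smul_mem _ _ (h1 hx)
  have hltc : ∀ x, ∀ y ∈ lt x, ↑(D y) ⊆ lt x := by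
    intro x y hy
    obtain ⟨z, hzx, hyz⟩ := Set.mem_iUnion₂.1 hy
    exact (hC z y hyz).trans (Set.subset_iUnion₂ (s := fun y (_ : y < x) => C y) z hzx)
  have hlec : ∀ x, ∀ y ∈ le x, ↑(D y) ⊆ le x := by
    rintro x y (hy | hy)
    · exact (hltc x y hy).trans Set.subset_union_left
    · exact (hC x y hy).trans Set.subset_union_right
  let T : P → Set P := fun x => C x \ lt x
  let q : (x : P) → (P →₀ R) →ₗ[R] (P →₀ R) := fun x =>
    (Finsupp.supported R R (T x)).subtype ∘ₗ Finsupp.restrictDom R R (T x)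
  have hqm : ∀ x w, q x w ∈ F (T x) := fun x w => (Finsupp.restrictDom R R (T x) w).2
  have hq0 : ∀ x w, w ∈ F (lt x) → q x w = 0 := by
    intro x w hw
    ext i
    simp only [q, LinearMap.comp_apply, Submodule.subtype_apply, Finsupp.restrictDom_apply,
      Finsupp.filter_apply, Finsupp.coe_zero, Pi.zero_apply, ite_eq_right_iff]
    intro hi
    by_contra hne
    exact hi.2 (hw (Finsupp.mem_support_iff.2 hne))
  have hqd : ∀ x w, w ∈ F (le x) → w - q x w ∈ F (lt x) := by
    intro x w hw
    refine (Finsupp.mem_supported R _).2 fun i hi => ?_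
    have hi' : (w - q x w) i ≠ 0 := Finsupp.mem_support_iff.1 hi
    simp only [q, LinearMap.comp_apply, Submodule.subtype_apply, Finsupp.restrictDom_apply,
      Finsupp.filter_apply, Finsupp.coe_sub, Pi.sub_apply] at hi'
    split_ifs at hi' with h
    · simp at hi'
    · have hwi : w i ≠ 0 := by simpa using hi'
      rcases hw (Finsupp.mem_support_iff.2 hwi) with h2 | h2
      · exact h2
      · by_contra h3
        exact h ⟨h2, h3⟩
  let L : P → Submodule R P := fun x => (F (T x)).map (π ∘ₗ q x ∘ₗ s ∘ₗ π)
  have hLle : ∀ x, L x ≤ A (le x) := by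
    rintro x _ ⟨w, hw, rfl⟩
    refine hclosed _ (hlec x) _ ?_
    exact Finsupp.supported_mono (Set.sdiff_subset.trans Set.subset_union_right) (hqm x _)
  have hAmono : ∀ S S', S ⊆ S' → A S ≤ A S' := fun S S' h =>
    Submodule.comap_mono (Finsupp.supported_mono h)
  have hlelt : ∀ x y, y < x → le y ⊆ lt x := by
    rintro x y hyx z (hz | hz)
    · obtain ⟨u, hu, hz⟩ := Set.mem_iUnion₂.1 hz
      exact Set.mem_iUnion₂.2 ⟨u, hu.trans hyx, hz⟩
    · exact Set.mem_iUnion₂.2 ⟨y, hyx, hz⟩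
  have hidem : ∀ x w, q x (s (π (q x (s (π w))))) = q x (s (π w)) ∨ w ∉ F (T x) := by
    intro x w
    by_cases hw : w ∈ F (T x)
    · left
      have h1 : s (π w) ∈ F (le x) := hclosed _ (hlec x) _
        (Finsupp.supported_mono (Set.sdiff_subset.trans Set.subset_union_right) hw)
      have h2 := hq0 x _ (hclosed _ (hltc x) _ (hqd x _ h1))
      rw [map_sub, map_sub, map_sub, hπ, sub_eq_zero] at h2
      exact h2.symm
    · exact Or.inr hw
  refine ⟨L, fun x => ?_, ?_, ?_⟩
  · have : L x = Submodule.span R ((fun i => (π ∘ₗ q x ∘ₗ s ∘ₗ π) (Finsupp.single i 1)) '' T x) := by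
      simp only [L, F]
      rw [Finsupp.supported_eq_span_single, Submodule.map_span, Set.image_image]
    rw [this]
    have hc := ((hCc x).mono (Set.sdiff_subset (t := lt x))).image
      (fun i => (π ∘ₗ q x ∘ₗ s ∘ₗ π) (Finsupp.single i 1))
    exact ⟨_, hc.preimage Subtype.val_injective, Submodule.span_span_coe_preimage⟩
  · refine iSupIndep_of_disjoint_lt L (fun x => A (lt x))
      (fun x y h => (hLle y).trans (hAmono _ _ (hlelt x y h))) fun x => ?_
    rw [Submodule.disjoint_def]
    rintro _ h ⟨w, hw, rfl⟩
    have h1 := hq0 x _ h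
    simp only [LinearMap.comp_apply] at h1 ⊢
    rw [(hidem x w).resolve_right (not_not.2 hw)] at h1
    rw [h1, map_zero]
  · have hle : ∀ x, A (le x) ≤ iSup L := by
      intro x
      induction x using WellFoundedLT.induction with
      | _ x ih =>
      have hlt : A (lt x) ≤ iSup L := by
        intro p hp
        by_cases hne : (s p).support.Nonempty
        · have h3 : ∀ i ∈ (s p).support, ∃ y, y < x ∧ i ∈ C y := fun i hi => by
            obtain ⟨y, hy, h⟩ := Set.mem_iUnion₂.1 (hp hi)
            exact ⟨y, hy, h⟩
          choose! f hf1 hf2 using h3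
          obtain ⟨i, hi, hmax⟩ := Finset.exists_max_image _ f hne
          refine ih (f i) (hf1 i hi) ?_
          refine (Finsupp.mem_supported R _).2 fun j hj => ?_
          rcases (hmax j hj).eq_or_lt with h | h
          · exact Or.inr (h ▸ hf2 j hj)
          · exact Or.inl (Set.mem_iUnion₂.2 ⟨f j, h, hf2 j hj⟩)
        · have : s p = 0 := by simpa using hne
          rw [← hπ p, this, map_zero]
          exact Submodule.zero_mem _
      intro p hp
      have h1 : p - π (q x (s (π (q x (s p))))) ∈ A (lt x) := by
        have h2 := hqd x _ hp
        have h3 := hclosed _ (hltc x) _ h2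
        rw [map_sub, map_sub, hπ] at h3
        have h4 := hq0 x _ h3
        rw [map_sub, sub_eq_zero] at h4
        rw [← h4]
        change s (p - _) ∈ F (lt x)
        rwa [map_sub]
      have h2 : π (q x (s (π (q x (s p))))) ∈ L x := ⟨q x (s p), hqm x _, rfl⟩
      have := Submodule.add_mem _ (hlt h1) (le_iSup L x h2)
      simpa using this
    rw [eq_top_iff]
    intro p _
    by_cases hne : (s p).support.Nonempty
    · obtain ⟨i, hi, hmax⟩ := Finset.exists_max_image _ id hne
      refine hle i ?_
      refine (Finsupp.mem_supported R _).2 fun j hj => ?_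
      rcases (hmax j hj).eq_or_lt with h | h
      · have h : j = i := h
        exact Or.inr (h ▸ hxC j)
      · exact Or.inl (Set.mem_iUnion₂.2 ⟨j, h, hxC j⟩)
    · have : s p = 0 := by simpa using hne
      rw [← hπ p, this, map_zero]
      exact Submodule.zero_mem _

end Kaplansky

section Kaplansky

open DirectSum

theorem DirectSum.not_finite_of_nontrivial {R ι : Type*} [Ring R] [Infinite ι] (A : ι → Type*)
    [∀ i, AddCommGroup (A i)] [∀ i, Module R (A i)] [∀ i, Nontrivial (A i)] :
    ¬ Module.Finite R (⨁ i, A i) := by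
  classical
  intro h
  obtain ⟨S, hS⟩ := h.fg_top
  obtain ⟨i, hi⟩ := Infinite.exists_notMem_finset (S.biUnion fun x => DFinsupp.support x)
  have h1 : (⊤ : Submodule R (⨁ i, A i)) ≤ LinearMap.ker (DirectSum.component R ι A i) := by
    rw [← hS, Submodule.span_le]
    intro x hx
    by_contra hne
    exact hi (Finset.mem_biUnion.2 ⟨x, hx, DFinsupp.mem_support_iff.2 hne⟩)
  obtain ⟨a, ha⟩ := exists_ne (0 : A i)
  have h2 := h1 (x := DirectSum.lof R ι A i a) trivial
  rw [LinearMap.mem_ker, DirectSum.component.lof_self] at h2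
  exact ha h2

theorem Module.IsCountablyGenerated.directSum {R ι : Type*} [Ring R] [Countable ι] (A : ι → Type*)
    [∀ i, AddCommGroup (A i)] [∀ i, Module R (A i)]
    (h : ∀ i, Module.IsCountablyGenerated R (A i)) : Module.IsCountablyGenerated R (⨁ i, A i) := by
  classical
  choose S hS hT using h
  refine ⟨⋃ i, DirectSum.lof R ι A i '' S i, Set.countable_iUnion fun i => (hS i).image _, ?_⟩
  rw [eq_top_iff]
  intro x _
  induction x using DirectSum.induction_on with
  | zero => exact Submodule.zero_mem _
  | of i a =>
    have h1 : a ∈ Submodule.span R (S i) := hT i ▸ trivial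
    have h2 := Submodule.mem_map_of_mem (f := DirectSum.lof R ι A i) h1
    rw [Submodule.map_span] at h2
    exact Submodule.span_mono (Set.subset_iUnion_of_subset i subset_rfl) h2
  | add x y hx hy => exact Submodule.add_mem _ (hx trivial) (hy trivial)

theorem Module.IsCountablyGenerated.of_surjective {R P Q : Type*} [Ring R] [AddCommGroup P]
    [Module R P] [AddCommGroup Q] [Module R Q] (f : P →ₗ[R] Q) (hf : Function.Surjective f)
    (h : Module.IsCountablyGenerated R P) : Module.IsCountablyGenerated R Q := by
  obtain ⟨S, hS, hT⟩ := h
  refine ⟨f '' S, hS.image _, ?_⟩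
  rw [← Submodule.map_span, hT, Submodule.map_top, LinearMap.range_eq_top.2 hf]

universe u v

/-- If countably generated projectives that are not finitely generated are free, then so are
all projectives that are not finitely generated. -/
theorem Module.Projective.free_of_forall_countablyGenerated {R : Type u} [Ring R] {P : Type v}
    [AddCommGroup P] [Module R P]
    (hT : ∀ (Q : Type v) [AddCommGroup Q] [Module R Q], Module.Projective R Q →
      Module.IsCountablyGenerated R Q → ¬ Module.Finite R Q → Module.Free R Q)
    [Module.Projective R P] (hP : ¬ Module.Finite R P) : Module.Free R P := by
  classical
  obtain ⟨L, hLc, hLi, hLt⟩ := Module.Projective.exists_isInternal (R := R) (P := P)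
  let J := {x : P // L x ≠ ⊥}
  have hIntegral : DirectSum.IsInternal fun j : J => L j := by
    refine DirectSum.isInternal_submodule_of_iSupIndep_of_iSup_eq_top
      (hLi.comp Subtype.val_injective) ?_
    rw [← hLt]
    refine le_antisymm (iSup_le fun j => le_iSup L j) (iSup_le fun x => ?_)
    by_cases hx : L x = ⊥
    · rw [hx]; exact bot_le
    · exact le_iSup (fun j : J => L j) ⟨x, hx⟩
  let E : (⨁ j : J, L j) ≃ₗ[R] P := LinearEquiv.ofBijective (DirectSum.coeLinearMap _) hIntegral
  have hpr : ∀ j : J, Module.Projective R (L j) := fun j => by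
    refine Module.Projective.of_split
      (E.toLinearMap ∘ₗ DirectSum.lof R J (fun j => L j) j)
      (DirectSum.component R J (fun j => L j) j ∘ₗ E.symm.toLinearMap) ?_
    ext x
    simp [DirectSum.component.lof_self]
  have hnt : ∀ j : J, Nontrivial (L j) := fun j => Submodule.nontrivial_iff_ne_bot.2 j.2
  rcases finite_or_infinite J with hJ | hJ
  · refine hT P inferInstance ?_ hP
    exact (Module.IsCountablyGenerated.directSum _ fun j : J => hLc j).of_surjective
      E.toLinearMap E.surjective
  · obtain ⟨e⟩ : Nonempty (J ≃ Σ _ : J, ℕ) := by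
      rw [← Cardinal.eq]
      simp [Cardinal.mk_sigma]
    have hfree : ∀ j : J, Module.Free R (⨁ n : ℕ, L (e.symm ⟨j, n⟩)) := fun j => by
      refine hT _ (inferInstanceAs (Module.Projective R (Π₀ n : ℕ, L (e.symm ⟨j, n⟩))))
        (Module.IsCountablyGenerated.directSum _ fun n => hLc _)
        (DirectSum.not_finite_of_nontrivial _)
    have : Module.Free R (⨁ (j : J) (n : ℕ), L (e.symm ⟨j, n⟩)) :=
      Module.Free.directSum R _
    have E2 := DirectSum.lequivCongrLeft R (M := fun j : J => L j) e
    have E3 := DirectSum.sigmaLcurryEquiv R (ι := J) (α := fun _ => ℕ)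
      (δ := fun j n => L (e.symm ⟨j, n⟩))
    exact Module.Free.of_equiv ((E.symm.trans E2).trans E3).symm

end Kaplansky

section RowFinite

variable {R : Type*} [Ring R]

/-- A row-finite idempotent matrix, given by its rows. -/
def IsRowIdempotent (e : ℕ → ℕ →₀ R) : Prop :=
  ∀ i, Finsupp.linearCombination R e (e i) = e i

/-- All but finitely many columns of `e` have their entries in `I`. -/
def IsSmallMod (e : ℕ → ℕ →₀ R) (I : Ideal R) : Prop :=
  ∃ N, ∀ i, ∀ j ≥ N, e i j ∈ I

/-- The image of a row-finite matrix under a ring homomorphism. -/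
noncomputable def rowMap {S : Type*} [Ring S] (φ : R →+* S) (e : ℕ → ℕ →₀ R) : ℕ → ℕ →₀ S :=
  fun i => (e i).mapRange φ φ.map_zero

@[simp] theorem rowMap_apply {S : Type*} [Ring S] (φ : R →+* S) (e : ℕ → ℕ →₀ R) (i j : ℕ) :
    rowMap φ e i j = φ (e i j) := rfl

theorem IsRowIdempotent.sum_eq {e : ℕ → ℕ →₀ R} (he : IsRowIdempotent e) (i j : ℕ) {S : Finset ℕ}
    (hS : (e i).support ⊆ S) : ∑ l ∈ S, e i l * e l j = e i j := by
  conv_rhs => rw [← he i, Finsupp.linearCombination_apply, Finsupp.sum_of_support_subset _ hS _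
    (by simp), Finsupp.finsetSum_apply]
  simp

theorem isRowIdempotent_of_sum_eq {e : ℕ → ℕ →₀ R}
    (he : ∀ i j, ∑ l ∈ (e i).support, e i l * e l j = e i j) : IsRowIdempotent e := by
  intro i
  ext j
  rw [← he i j, Finsupp.linearCombination_apply, Finsupp.sum, Finsupp.finsetSum_apply]
  simp

theorem IsRowIdempotent.map {S : Type*} [Ring S] (φ : R →+* S) {e : ℕ → ℕ →₀ R}
    (he : IsRowIdempotent e) : IsRowIdempotent (rowMap φ e) := by
  refine isRowIdempotent_of_sum_eq fun i j => ?_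
  have h : ((rowMap φ e) i).support ⊆ (e i).support := Finsupp.support_mapRange
  rw [Finset.sum_subset h fun l _ hl => by rw [Finsupp.notMem_support_iff.1 hl, zero_mul]]
  simp only [rowMap_apply, ← map_mul, ← map_sum]
  rw [he.sum_eq i j subset_rfl]

theorem isSmallMod_rowMap {S : Type*} [Ring S] (φ : R →+* S) (e : ℕ → ℕ →₀ R) (I : Ideal S) :
    IsSmallMod (rowMap φ e) I ↔ IsSmallMod e (I.comap φ) := Iff.rfl

theorem IsSmallMod.mono {e : ℕ → ℕ →₀ R} {I J : Ideal R} (h : IsSmallMod e I) (hIJ : I ≤ J) :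
    IsSmallMod e J := by
  obtain ⟨N, hN⟩ := h
  exact ⟨N, fun i j hj => hIJ (hN i j hj)⟩

/-- Far enough to the right, the entries of `e` are computed without using the first columns. -/
theorem IsRowIdempotent.exists_sum_eq {e : ℕ → ℕ →₀ R} (he : IsRowIdempotent e) (N : ℕ) :
    ∃ N', ∀ i, ∀ j ≥ N', ∑ l ∈ (e i).support with N ≤ l, e i l * e l j = e i j := by
  classical
  let T := (Finset.range N).biUnion fun l => (e l).support
  refine ⟨T.sup id + 1, fun i j hj => ?_⟩
  rw [← he.sum_eq i j subset_rfl, Finset.sum_filter]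
  refine Finset.sum_congr rfl fun l _ => ?_
  split_ifs with hl
  · rfl
  · have : j ∉ (e l).support := fun hjl => by
      have : j ≤ T.sup id := Finset.le_sup (f := id)
        (Finset.mem_biUnion.2 ⟨l, Finset.mem_range.2 (by omega), hjl⟩)
      omega
    rw [Finsupp.notMem_support_iff.1 this, mul_zero]

theorem IsSmallMod.of_iInf {e : ℕ → ℕ →₀ R} (he : IsRowIdempotent e) {I : Ideal R}
    (h : IsSmallMod e I) (F : ℕ → Ideal R) (h0 : F 0 = ⊤)
    (hF : ∀ n, ∀ a ∈ I, ∀ b ∈ F n, a * b ∈ F (n + 1)) : IsSmallMod e (⨅ n, F n) := by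
  obtain ⟨N, hN⟩ := h
  obtain ⟨N', hN'⟩ := he.exists_sum_eq N
  refine ⟨N', fun i j hj => (Submodule.mem_iInf _).2 fun n => ?_⟩
  induction n generalizing i with
  | zero => rw [h0]; trivial
  | succ n ih =>
    rw [← hN' i j hj]
    refine Ideal.sum_mem _ fun l hl => hF n _ (hN i l (Finset.mem_filter.1 hl).2) _ (ih l)

variable {P : Type*} [AddCommGroup P] [Module R P]

theorem Module.IsCountablyGenerated.exists_nat (h : Module.IsCountablyGenerated R P) :
    ∃ y : ℕ → P, Submodule.span R (Set.range y) = ⊤ := by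
  obtain ⟨S, hS, hT⟩ := h
  obtain ⟨y, hy⟩ := (hS.insert 0).exists_eq_range (Set.insert_nonempty _ _)
  refine ⟨y, ?_⟩
  rw [← hy, Submodule.span_insert_zero, hT]

/-- A countably generated projective module is either finitely generated, or uniformly big, or
its idempotent is small modulo a proper ideal without being small. -/
theorem Module.Projective.free_of_rowIdempotent [IsNoetherianRing R] [Nontrivial R]
    (hR : ∀ e : ℕ → ℕ →₀ R, IsRowIdempotent e → ¬ IsSmallMod e ⊥ →
      ∀ M : Ideal R, M.IsTwoSided → IsSmallMod e M → M = ⊤)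
    [Module.Projective R P] (hP : Module.IsCountablyGenerated R P) (hf : ¬ Module.Finite R P) :
    Module.Free R P := by
  classical
  obtain ⟨y, hy⟩ := hP.exists_nat
  refine Module.IsUniformlyBig.free ?_ ⟨y, hy⟩
  let π : (ℕ →₀ R) →ₗ[R] P := Finsupp.linearCombination R y
  have hπ : Function.Surjective π := by
    rw [← LinearMap.range_eq_top, Finsupp.range_linearCombination, hy]
  obtain ⟨s, hs⟩ := Module.projective_lifting_property π LinearMap.id hπ
  replace hs : ∀ x, π (s x) = x := fun x => LinearMap.congr_fun hs x
  clear_value π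
  let e : ℕ → ℕ →₀ R := fun i => s (π (Finsupp.single i 1))
  have he' : Finsupp.linearCombination R e = s ∘ₗ π := by
    ext i
    simp [e]
  have he : IsRowIdempotent e := fun i => by
    rw [he']
    simp [e, hs]
  have hsm : ¬ IsSmallMod e ⊥ := by
    rintro ⟨N, hN⟩
    have : Module.Finite R (Finsupp.supported R R (Set.Iio N)) :=
      Module.Finite.equiv (Finsupp.supportedEquivFinsupp (M := R) (R := R) (Set.Iio N)).symm
    refine hf (Module.Finite.of_surjective
      (π ∘ₗ (Finsupp.supported R R (Set.Iio N)).subtype) fun x => ?_)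
    refine ⟨⟨s x, ?_⟩, hs x⟩
    obtain ⟨z, rfl⟩ := hπ x
    rw [← LinearMap.comp_apply, ← he', Finsupp.linearCombination_apply]
    refine Submodule.sum_mem _ fun l _ => Submodule.smul_mem _ _ ?_
    refine (Finsupp.mem_supported _ _).2 fun j hj => ?_
    by_contra hjN
    exact (Finsupp.mem_support_iff.1 hj) (hN l j (not_lt.1 hjN))
  intro X hX I hI
  obtain ⟨S, rfl⟩ := hX
  let N := (S.biUnion fun x => (s x).support).sup id + 1
  have hN : ∀ x ∈ Submodule.span R (S : Set P), ∀ j ≥ N, s x j = 0 := by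
    intro x hx j hj
    have : Submodule.span R (S : Set P) ≤ LinearMap.ker (Finsupp.lapply j ∘ₗ s) := by
      rw [Submodule.span_le]
      intro x hx
      rw [SetLike.mem_coe, LinearMap.mem_ker, LinearMap.comp_apply, Finsupp.lapply_apply]
      by_contra hne
      have : j ≤ N - 1 := Finset.le_sup (f := id)
        (Finset.mem_biUnion.2 ⟨x, hx, Finsupp.mem_support_iff.2 hne⟩)
      omega
    exact this hx
  let M : Ideal R :=
    { carrier := {x | ∀ r, x * r ∈ I}
      add_mem' := fun ha hb r => by rw [add_mul]; exact I.add_mem (ha r) (hb r)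
      zero_mem' := fun r => by simp
      smul_mem' := fun c x hx r => by
        rw [smul_eq_mul, mul_assoc]; exact I.smul_mem c (hx r) }
  have hM2 : M.IsTwoSided := ⟨fun {a} b ha r => by rw [mul_assoc]; exact ha _⟩
  have hMt := hR e he hsm M hM2 ⟨N, fun i j hj r => by
    refine hI ((LinearMap.toSpanSingleton R R r) ∘ₗ Finsupp.lapply j ∘ₗ s) (fun x hx => ?_)
      ⟨π (Finsupp.single i 1), rfl⟩
    simp [hN x hx j hj]⟩
  rw [Ideal.eq_top_iff_one]
  have : (1 : R) ∈ M := hMt ▸ trivial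
  simpa using this 1

end RowFinite

section StableSubmodules

theorem WellFoundedGT.exists_forall_ge_eq {α : Type*} [PartialOrder α] [WellFoundedGT α]
    (a : ℕ → ℕ → α) (h1 : ∀ n, Monotone fun j => a j n) (h2 : ∀ j, Monotone (a j)) :
    ∃ J, ∀ j ≥ J, ∀ n, a j n = a J n := by
  obtain ⟨J, hJ⟩ := WellFoundedGT.monotone_chain_condition
    (⟨fun n => a n n, fun n m h => (h1 n h).trans (h2 m h)⟩ : ℕ →o α)
  choose K hK using fun n => WellFoundedGT.monotone_chain_condition
    (⟨fun j => a j n, h1 n⟩ : ℕ →o α)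
  let L := max J ((Finset.range J).sup K)
  have key : ∀ j ≥ J, ∀ n ≥ J, a j n = a J J := fun j hj n hn => by
    refine le_antisymm ?_ ((h1 J hj).trans (h2 j hn))
    refine ((h1 n (le_max_left j n)).trans (h2 _ (le_max_right j n))).trans ?_
    exact (hJ _ (hj.trans (le_max_left _ _))).ge
  refine ⟨L, fun j hj n => ?_⟩
  by_cases hn : J ≤ n
  · rw [key j ((le_max_left _ _).trans hj) n hn, key L (le_max_left _ _) n hn]
  · have h3 : K n ≤ L := (Finset.le_sup (Finset.mem_range.2 (not_le.1 hn))).trans (le_max_right _ _)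
    exact (hK n _ (h3.trans hj)).symm.trans (hK n _ h3)

variable {D V G : Type*} [CommRing D] [AddCommGroup V] [Module D V] [Group G]

/-- A submodule stable under a subgroup. -/
def IsStableUnder (ρ : G →* Module.End D V) (H : Subgroup G) (W : Submodule D V) : Prop :=
  ∀ h ∈ H, ∀ w ∈ W, ρ h w ∈ W

/-- The stable submodule generated by a set. -/
def stableSpan (ρ : G →* Module.End D V) (H : Subgroup G) (S : Set V) : Submodule D V :=
  Submodule.span D {v | ∃ h ∈ H, ∃ s ∈ S, ρ h s = v}

/-- Stable submodules of `W`. -/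
abbrev StableSubmodule (ρ : G →* Module.End D V) (H : Subgroup G) (W : Submodule D V) : Type _ :=
  {M : Submodule D V // M ≤ W ∧ IsStableUnder ρ H M}

variable (ρ : G →* Module.End D V) {H K : Subgroup G}

theorem stableSpan_isStableUnder (S : Set V) : IsStableUnder ρ H (stableSpan ρ H S) := by
  intro h hh w hw
  have key : stableSpan ρ H S ≤ (stableSpan ρ H S).comap (ρ h) := by
    conv_lhs => rw [stableSpan]
    rw [Submodule.span_le]
    rintro _ ⟨k, hk, s, hs, rfl⟩
    refine Submodule.subset_span ⟨h * k, H.mul_mem hh hk, s, hs, ?_⟩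
    rw [map_mul]; rfl
  exact key hw

theorem subset_stableSpan (S : Set V) : S ⊆ stableSpan ρ H S := fun s hs =>
  Submodule.subset_span ⟨1, H.one_mem, s, hs, by simp⟩

theorem stableSpan_le {S : Set V} {W : Submodule D V} (hW : IsStableUnder ρ H W) (hS : S ⊆ W) :
    stableSpan ρ H S ≤ W := by
  rw [stableSpan, Submodule.span_le]
  rintro _ ⟨h, hh, s, hs, rfl⟩
  exact hW h hh s (hS hs)

theorem IsStableUnder.mono {W : Submodule D V} (hW : IsStableUnder ρ K W) (h : H ≤ K) :
    IsStableUnder ρ H W := fun g hg => hW g (h hg)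

theorem IsStableUnder.sup {W W' : Submodule D V} (hW : IsStableUnder ρ H W)
    (hW' : IsStableUnder ρ H W') : IsStableUnder ρ H (W ⊔ W') := by
  intro h hh w hw
  obtain ⟨a, ha, b, hb, rfl⟩ := Submodule.mem_sup.1 hw
  rw [map_add]
  exact Submodule.add_mem_sup (hW h hh a ha) (hW' h hh b hb)

theorem IsStableUnder.inf {W W' : Submodule D V} (hW : IsStableUnder ρ H W)
    (hW' : IsStableUnder ρ H W') : IsStableUnder ρ H (W ⊓ W') := fun h hh w hw =>
  ⟨hW h hh w hw.1, hW' h hh w hw.2⟩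

theorem IsStableUnder.iSup {ι : Sort*} {W : ι → Submodule D V}
    (hW : ∀ i, IsStableUnder ρ H (W i)) : IsStableUnder ρ H (⨆ i, W i) := by
  intro h hh w hw
  refine (iSup_le fun i => ?_ : (⨆ i, W i) ≤ (⨆ i, W i).comap (ρ h)) hw
  exact fun v hv => (le_iSup W i) (hW i h hh v hv)

theorem IsStableUnder.map {W : Submodule D V} (hW : IsStableUnder ρ H W) (t : G)
    (ht : ∀ h ∈ H, t⁻¹ * h * t ∈ H) : IsStableUnder ρ H (W.map (ρ t)) := by
  rintro h hh _ ⟨w, hw, rfl⟩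
  refine ⟨ρ (t⁻¹ * h * t) w, hW _ (ht h hh) w hw, ?_⟩
  rw [← Module.End.mul_apply, ← Module.End.mul_apply, ← map_mul, ← map_mul]
  group

theorem IsStableUnder.comap {W : Submodule D V} (hW : IsStableUnder ρ H W) (t : G)
    (ht : ∀ h ∈ H, t * h * t⁻¹ ∈ H) : IsStableUnder ρ H (W.comap (ρ t)) := by
  intro h hh w hw
  rw [Submodule.mem_comap] at hw ⊢
  have := hW _ (ht h hh) _ hw
  rw [← Module.End.mul_apply, ← map_mul] at this ⊢
  simpa [mul_assoc] using this

/-- The sum of the translates of `W` by `x ^ i` for `a ≤ i < b`. -/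
def zpowSum (x : G) (W : Submodule D V) (a b : ℤ) : Submodule D V :=
  ⨆ i : Set.Ico a b, W.map (ρ (x ^ (i : ℤ)))

theorem zpowSum_mono (x : G) (W : Submodule D V) {a b a' b' : ℤ} (ha : a' ≤ a) (hb : b ≤ b') :
    zpowSum ρ x W a b ≤ zpowSum ρ x W a' b' :=
  iSup_le fun i => le_iSup (fun i : Set.Ico a' b' => W.map (ρ (x ^ (i : ℤ))))
    ⟨i, ha.trans i.2.1, i.2.2.trans_le hb⟩

theorem map_le_zpowSum (x : G) (W : Submodule D V) {a b i : ℤ} (ha : a ≤ i) (hb : i < b) :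
    W.map (ρ (x ^ i)) ≤ zpowSum ρ x W a b :=
  le_iSup (fun i : Set.Ico a b => W.map (ρ (x ^ (i : ℤ)))) ⟨i, ha, hb⟩

theorem zpowSum_succ (x : G) (W : Submodule D V) {a b : ℤ} (h : a ≤ b) :
    zpowSum ρ x W a (b + 1) = zpowSum ρ x W a b ⊔ W.map (ρ (x ^ b)) := by
  refine le_antisymm (iSup_le fun i => ?_) (sup_le (zpowSum_mono ρ x W le_rfl (by omega))
    (map_le_zpowSum ρ x W h (by omega)))
  rcases (Int.lt_add_one_iff.1 i.2.2).eq_or_lt with hi | hi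
  · rw [hi]; exact le_sup_right
  · exact (map_le_zpowSum ρ x W i.2.1 hi).trans le_sup_left

theorem zpowSum_pred (x : G) (W : Submodule D V) {a b : ℤ} (h : a ≤ b) :
    zpowSum ρ x W (a - 1) b = zpowSum ρ x W a b ⊔ W.map (ρ (x ^ (a - 1))) := by
  refine le_antisymm (iSup_le fun i => ?_) (sup_le (zpowSum_mono ρ x W (by omega) le_rfl)
    (map_le_zpowSum ρ x W le_rfl (by omega)))
  have h1 := i.2.1
  rcases h1.eq_or_lt with hi | hi
  · rw [← hi]; exact le_sup_right
  · exact (map_le_zpowSum ρ x W (by omega) i.2.2).trans le_sup_left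

theorem map_zpowSum (x : G) (W : Submodule D V) (a b k : ℤ) :
    (zpowSum ρ x W a b).map (ρ (x ^ k)) ≤ zpowSum ρ x W (a + k) (b + k) := by
  rw [zpowSum, Submodule.map_iSup]
  refine iSup_le fun i => ?_
  rw [← Submodule.map_comp]
  have : ρ (x ^ k) ∘ₗ ρ (x ^ (i : ℤ)) = ρ (x ^ ((i : ℤ) + k)) := by
    rw [add_comm, zpow_add, map_mul]; rfl
  rw [this]
  exact map_le_zpowSum ρ x W (by have := i.2.1; omega) (by have := i.2.2; omega)

/-- The steps of the filtration of a module by sums of translates of `W` by powers of `x`. -/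
def zpowFiltration (x : G) (W : Submodule D V) (k : ℕ) : Submodule D V :=
  zpowSum ρ x W (-(k / 2 : ℕ)) ((k + 1) / 2 : ℕ)

/-- The exponents added at each step of `zpowFiltration`. -/
def filtrationExponent (k : ℕ) : ℤ := if Even k then (k / 2 : ℕ) else -((k + 1) / 2 : ℕ)

theorem zpowFiltration_succ (x : G) (W : Submodule D V) (k : ℕ) :
    zpowFiltration ρ x W (k + 1) =
      zpowFiltration ρ x W k ⊔ W.map (ρ (x ^ filtrationExponent k)) := by
  rcases Nat.even_or_odd' k with ⟨n, rfl | rfl⟩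
  · have : ((2 * n / 2 : ℕ) : ℤ) = ((2 * n + 1) / 2 : ℕ) := by omega
    rw [zpowFiltration, zpowFiltration, filtrationExponent, if_pos (by simp), this,
      ← zpowSum_succ ρ x W (by omega)]
    congr 1; omega
  · rw [zpowFiltration, zpowFiltration, filtrationExponent, if_neg (by simp [parity_simps])]
    have : (-((2 * n + 1 + 1) / 2 : ℕ) : ℤ) = -((2 * n + 1) / 2 : ℕ) - 1 := by omega
    rw [this, ← zpowSum_pred ρ x W (by omega)]
    congr 1; omega

theorem zpowFiltration_zero (x : G) (W : Submodule D V) : zpowFiltration ρ x W 0 = ⊥ := by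
  rw [zpowFiltration, zpowSum, eq_bot_iff]
  refine iSup_le fun i => ?_
  have h1 := i.2.1
  have h2 := i.2.2
  simp at h1 h2
  omega

theorem zpowFiltration_mono (x : G) (W : Submodule D V) : Monotone (zpowFiltration ρ x W) :=
  monotone_nat_of_le_succ fun k => by rw [zpowFiltration_succ]; exact le_sup_left

/-- The part of `W` that the `k`th translate pushes into earlier ones, modulo `M`. -/
def filtrationKer (x : G) (W M : Submodule D V) (k : ℕ) : Submodule D V :=
  W ⊓ (M ⊔ zpowFiltration ρ x W k).comap (ρ (x ^ filtrationExponent k))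

theorem filtrationKer_mono (x : G) (W : Submodule D V) (k : ℕ) :
    Monotone fun M => filtrationKer ρ x W M k := fun _ _ h =>
  inf_le_inf_left _ (Submodule.comap_mono (sup_le_sup_right h _))

theorem filtrationKer_le_add_two (x : G) (W M : Submodule D V)
    (hM : ∀ k : ℤ, ∀ m ∈ M, ρ (x ^ k) m ∈ M) (k : ℕ) :
    filtrationKer ρ x W M k ≤ filtrationKer ρ x W M (k + 2) := by
  have key : ∀ (a b a' b' c d i : ℤ), c + i = d → a' ≤ a + i → b + i ≤ b' →
      W ⊓ (M ⊔ zpowSum ρ x W a b).comap (ρ (x ^ c)) ≤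
        W ⊓ (M ⊔ zpowSum ρ x W a' b').comap (ρ (x ^ d)) := by
    intro a b a' b' c d i hcd ha hb w hw
    refine ⟨hw.1, ?_⟩
    have h1 : ρ (x ^ c) w ∈ M ⊔ zpowSum ρ x W a b := hw.2
    change ρ (x ^ d) w ∈ M ⊔ zpowSum ρ x W a' b'
    rw [← hcd, add_comm, zpow_add, map_mul, Module.End.mul_apply]
    obtain ⟨m, hm, z, hz, hmz⟩ := Submodule.mem_sup.1 h1
    rw [← hmz, map_add]
    exact Submodule.add_mem_sup (hM i m hm)
      (zpowSum_mono ρ x W ha hb (map_zpowSum ρ x W a b i ⟨z, hz, rfl⟩))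
  rcases Nat.even_or_odd' k with ⟨n, rfl | rfl⟩
  · rw [filtrationKer, filtrationKer, filtrationExponent, filtrationExponent, if_pos (by simp),
      if_pos (by simp [parity_simps])]
    exact key _ _ _ _ _ _ 1 (by omega) (by omega) (by omega)
  · rw [filtrationKer, filtrationKer, filtrationExponent, filtrationExponent,
      if_neg (by simp [parity_simps]), if_neg (by simp [parity_simps])]
    exact key _ _ _ _ _ _ (-1) (by omega) (by omega) (by omega)

theorem iSup_zpowFiltration (x : G) (W : Submodule D V) (i : ℤ) :
    W.map (ρ (x ^ i)) ≤ ⨆ k, zpowFiltration ρ x W k := by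
  refine le_trans ?_ (le_iSup _ (2 * (i.natAbs + 1)))
  exact map_le_zpowSum ρ x W (by omega) (by omega)

end StableSubmodules

section StableNoetherian

variable {D V : Type*} {G : Type} [CommRing D] [AddCommGroup V] [Module D V] [Group G]
  (ρ : G →* Module.End D V) {H K : Subgroup G}

theorem zpowFiltration_isStableUnder {x : G} (hx : ∀ k : ℤ, ∀ h ∈ H, x ^ k * h * x ^ (-k) ∈ H)
    {W : Submodule D V} (hW : IsStableUnder ρ H W) (k : ℕ) :
    IsStableUnder ρ H (zpowFiltration ρ x W k) :=
  IsStableUnder.iSup ρ fun i => hW.map ρ _ fun h hh => by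
    have := hx (-i) h hh
    rwa [zpow_neg, neg_neg] at this

theorem filtrationKer_isStableUnder {x : G} (hx : ∀ k : ℤ, ∀ h ∈ H, x ^ k * h * x ^ (-k) ∈ H)
    {W M : Submodule D V} (hW : IsStableUnder ρ H W) (hM : IsStableUnder ρ H M) (k : ℕ) :
    IsStableUnder ρ H (filtrationKer ρ x W M k) :=
  hW.inf ρ ((hM.sup ρ (zpowFiltration_isStableUnder ρ hx hW k)).comap ρ _ fun h hh => by
    have := hx (filtrationExponent k) h hh
    rwa [zpow_neg] at this)

theorem eq_of_filtrationKer_eq {x : G} {W M M' : Submodule D V} (hMM : M ≤ M')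
    (h : ∀ k, filtrationKer ρ x W M k = filtrationKer ρ x W M' k)
    (hM' : M' ≤ ⨆ k, zpowFiltration ρ x W k) : M = M' := by
  refine le_antisymm hMM fun m hm => ?_
  obtain ⟨k, hk⟩ := (Submodule.mem_iSup_of_directed _
    (zpowFiltration_mono ρ x W).directed_le).1 (hM' hm)
  induction k generalizing m with
  | zero =>
    rw [zpowFiltration_zero, Submodule.mem_bot] at hk
    exact hk ▸ M.zero_mem
  | succ k ih =>
    rw [zpowFiltration_succ] at hk
    obtain ⟨f, hf, _, ⟨w, hw, rfl⟩, hfw⟩ := Submodule.mem_sup.1 hk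
    have h1 : w ∈ filtrationKer ρ x W M' k := by
      refine ⟨hw, ?_⟩
      change ρ (x ^ filtrationExponent k) w ∈ M' ⊔ zpowFiltration ρ x W k
      have : ρ (x ^ filtrationExponent k) w = m + -f := by rw [← hfw]; abel
      rw [this]
      exact Submodule.add_mem_sup hm (neg_mem hf)
    rw [← h] at h1
    obtain ⟨m1, hm1, f1, hf1, hmf⟩ := Submodule.mem_sup.1
      (show ρ (x ^ filtrationExponent k) w ∈ M ⊔ zpowFiltration ρ x W k from h1.2)
    have h2 := ih (m - m1) (sub_mem hm (hMM hm1)) (by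
      rw [← hfw, ← hmf]
      convert add_mem hf hf1 using 1
      abel)
    simpa using add_mem h2 hm1

theorem stableSpan_le_iSup_zpowFiltration {t : G}
    (hn : ∀ k ∈ K, ∀ h ∈ H, k * h * k⁻¹ ∈ H) (ht : t ∈ K)
    (hc : ∀ k ∈ K, ∃ n : ℤ, k * t ^ n ∈ H) (S : Set V) :
    stableSpan ρ K S ≤ ⨆ k, zpowFiltration ρ t (stableSpan ρ H S) k := by
  rw [stableSpan, Submodule.span_le]
  rintro _ ⟨k, hk, s, hs, rfl⟩
  obtain ⟨n, hn'⟩ := hc k hk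
  refine iSup_zpowFiltration ρ t _ (-n) ⟨ρ (t ^ n * k) s, ?_, ?_⟩
  · refine Submodule.subset_span ⟨_, ?_, s, hs, rfl⟩
    have := hn _ (K.zpow_mem ht n) _ hn'
    simpa [mul_assoc] using this
  · rw [← Module.End.mul_apply, ← map_mul]
    group

theorem zpow_conj_mem {t : G} (hn : ∀ k ∈ K, ∀ h ∈ H, k * h * k⁻¹ ∈ H) (ht : t ∈ K) (k : ℤ)
    (h : G) (hh : h ∈ H) : t ^ k * h * t ^ (-k) ∈ H := by
  rw [zpow_neg]
  exact hn _ (K.zpow_mem ht k) h hh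

/-- Stabilisation of the kernels of the filtration along ascending chains. -/
theorem exists_filtrationKer_stabilize {x : G}
    (hx : ∀ k : ℤ, ∀ h ∈ H, x ^ k * h * x ^ (-k) ∈ H) {W : Submodule D V}
    (hW : IsStableUnder ρ H W) [WellFoundedGT (StableSubmodule ρ H W)]
    (M : ℕ →o Submodule D V) (hM : ∀ n, IsStableUnder ρ H (M n))
    (hMx : ∀ n, ∀ k : ℤ, ∀ m ∈ M n, ρ (x ^ k) m ∈ M n) :
    ∃ J, ∀ j ≥ J, ∀ k, filtrationKer ρ x W (M j) k = filtrationKer ρ x W (M J) k := by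
  have key : ∀ r : ℕ, ∃ J, ∀ j ≥ J, ∀ k, filtrationKer ρ x W (M j) (2 * k + r) =
      filtrationKer ρ x W (M J) (2 * k + r) := fun r => by
    obtain ⟨J, hJ⟩ := WellFoundedGT.exists_forall_ge_eq
      (fun j k => (⟨filtrationKer ρ x W (M j) (2 * k + r), inf_le_left,
        filtrationKer_isStableUnder ρ hx hW (hM j) _⟩ : StableSubmodule ρ H W))
      (fun n i j hij => filtrationKer_mono ρ x W _ (M.monotone hij))
      (fun j => monotone_nat_of_le_succ fun k => by
        have := filtrationKer_le_add_two ρ x W (M j) (hMx j) (2 * k + r)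
        rwa [show 2 * k + r + 2 = 2 * (k + 1) + r by ring] at this)
    exact ⟨J, fun j hj k => congrArg Subtype.val (hJ j hj k)⟩
  obtain ⟨J0, h0⟩ := key 0
  obtain ⟨J1, h1⟩ := key 1
  refine ⟨max J0 J1, fun j hj k => ?_⟩
  rcases Nat.even_or_odd' k with ⟨n, rfl | rfl⟩
  · exact (h0 j (le_of_max_le_left hj) n).trans (h0 _ (le_max_left _ _) n).symm
  · exact (h1 j (le_of_max_le_right hj) n).trans (h1 _ (le_max_right _ _) n).symm

/-- **Hall's theorem**: finitely generated modules over polycyclic groups are noetherian. -/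
theorem Subgroup.IsPoly.wellFoundedGT_stableSubmodule [IsNoetherianRing D] (hH : H.IsPoly)
    (S : Set V) (hS : S.Finite) : WellFoundedGT (StableSubmodule ρ H (stableSpan ρ H S)) := by
  induction hH with
  | bot =>
    have h1 : stableSpan ρ ⊥ S = Submodule.span D S := by
      rw [stableSpan]
      congr 1
      ext v
      simp
    have h2 : IsNoetherian D (Submodule.span D S) :=
      isNoetherian_of_fg_of_noetherian _ (Submodule.fg_span hS)
    have h3 := isNoetherian_iff'.1 h2
    rw [h1]
    refine StrictMono.wellFoundedGT (β := Submodule D (Submodule.span D S))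
      (f := fun M => M.1.comap (Submodule.subtype _)) ?_
    refine Monotone.strictMono_of_injective (fun a b h => Submodule.comap_mono h) ?_
    intro a b hab
    have := congrArg (Submodule.map (Submodule.subtype _)) hab
    simp only [Submodule.map_comap_subtype] at this
    rw [inf_eq_right.2 a.2.1, inf_eq_right.2 b.2.1] at this
    exact Subtype.ext this
  | step t hHK ht hn hc hH ih =>
    rename_i H K
    rw [wellFoundedGT_iff_monotone_chain_condition]
    intro M
    obtain ⟨J, hJ⟩ := exists_filtrationKer_stabilize ρ (zpow_conj_mem hn ht)
      (stableSpan_isStableUnder ρ S) ⟨fun n => (M n).1, fun i j h => M.monotone h⟩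
      (fun n => (M n).2.2.mono ρ hHK) (fun n k => (M n).2.2 _ (K.zpow_mem ht k))
    refine ⟨J, fun j hj => Subtype.ext (eq_of_filtrationKer_eq ρ (M.monotone hj)
      (fun k => (hJ j hj k).symm)
      ((M j).2.1.trans (stableSpan_le_iSup_zpowFiltration ρ hn ht hc S)))⟩

/-- Group rings of polycyclic groups are noetherian. -/
theorem Subgroup.IsPoly.isNoetherianRing [IsNoetherianRing D] (hG : (⊤ : Subgroup G).IsPoly) :
    IsNoetherianRing (MonoidAlgebra D G) := by
  let ρ : G →* Module.End D (MonoidAlgebra D G) :=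
    (Algebra.lmul D (MonoidAlgebra D G) : _ →* _).comp (MonoidAlgebra.of D G)
  have h := hG.wellFoundedGT_stableSubmodule ρ {1} (Set.finite_singleton _)
  have htop : stableSpan ρ ⊤ {(1 : MonoidAlgebra D G)} = ⊤ := by
    rw [eq_top_iff]
    intro x _
    induction x using MonoidAlgebra.induction_linear with
    | zero => exact Submodule.zero_mem _
    | add f g hf hg => exact Submodule.add_mem _ (hf trivial) (hg trivial)
    | single g r =>
      have : MonoidAlgebra.single g r = r • MonoidAlgebra.single g (1 : D) := by simp
      rw [this]
      refine Submodule.smul_mem _ _ (Submodule.subset_span ⟨g, trivial, 1, rfl, ?_⟩)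
      simp [ρ]
  rw [htop] at h
  refine isNoetherianRing_iff.2 (isNoetherian_iff'.2 ?_)
  refine StrictMono.wellFoundedGT (β := StableSubmodule ρ ⊤ ⊤)
    (f := fun M => ⟨M.restrictScalars D, le_top, fun g _ w hw => M.smul_mem _ hw⟩) ?_
  intro a b hab
  exact hab

end StableNoetherian

section GenericFreeness

variable {D V : Type*} {G : Type} [CommRing D] [AddCommGroup V] [Module D V] [Group G]

/-- Linear independence modulo a submodule. -/
def LinearIndepMod (U : Submodule D V) (C : Set V) : Prop :=
  ∀ l ∈ Finsupp.supported D D C, Finsupp.linearCombination D (id : V → V) l ∈ U → l = 0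

/-- After inverting `f`, the module `W / (W ∩ U)` is free on a subset of `W`. -/
def IsFreeModAfter (f : D) (U W : Submodule D V) (C : Set V) : Prop :=
  C ⊆ W ∧ LinearIndepMod U C ∧ ∀ w ∈ W, ∃ n : ℕ, f ^ n • w ∈ Submodule.span D C ⊔ U

theorem linearCombination_id_mem_span {C : Set V} {l : V →₀ D} (hl : l ∈ Finsupp.supported D D C) :
    Finsupp.linearCombination D (id : V → V) l ∈ Submodule.span D C := by
  rw [← Set.image_id C, Finsupp.span_image_eq_map_linearCombination]
  exact ⟨l, hl, rfl⟩

theorem mem_span_sup_mono {U : Submodule D V} {B C : Set V} (h : B ⊆ C) {v : V}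
    (hv : v ∈ Submodule.span D B ⊔ U) : v ∈ Submodule.span D C ⊔ U := by
  have : Submodule.span D B ⊔ U ≤ Submodule.span D C ⊔ U :=
    sup_le_sup_right (Submodule.span_mono h) _
  exact this hv

theorem LinearIndepMod.union {U F : Submodule D V} {B C : Set V} (hUF : U ≤ F) (hBF : B ⊆ F)
    (hB : LinearIndepMod U B) (hC : LinearIndepMod F C) : LinearIndepMod U (B ∪ C) := by
  classical
  intro l hl hlU
  have hl2 : l.filter (· ∉ B) ∈ Finsupp.supported D D C := by
    rw [Finsupp.mem_supported] at hl ⊢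
    intro v hv
    simp only [Finsupp.support_filter, Finset.coe_filter, Set.mem_ofPred_eq] at hv
    exact (hl hv.1).resolve_left hv.2
  have hl1 : l.filter (· ∈ B) ∈ Finsupp.supported D D B := by
    rw [Finsupp.mem_supported]
    intro v hv
    simp only [Finsupp.support_filter, Finset.coe_filter, Set.mem_ofPred_eq] at hv
    exact hv.2
  have hs := Finsupp.filter_add_filter_not l (· ∈ B)
  have h2 : l.filter (· ∉ B) = 0 := by
    refine hC _ hl2 ?_
    have h3 : Finsupp.linearCombination D (id : V → V) (l.filter (· ∉ B)) =
        Finsupp.linearCombination D id l - Finsupp.linearCombination D id (l.filter (· ∈ B)) := by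
      rw [eq_sub_iff_add_eq', ← map_add, hs]
    rw [h3]
    have hBF' : Submodule.span D B ≤ F := Submodule.span_le.2 hBF
    exact F.sub_mem (hUF hlU) (hBF' (linearCombination_id_mem_span hl1))
  rw [h2, add_zero] at hs
  exact hB l (hs ▸ hl1) hlU

theorem LinearIndepMod.iUnion {U : Submodule D V} {B : ℕ → Set V} (hB : Monotone B)
    (h : ∀ n, LinearIndepMod U (B n)) : LinearIndepMod U (⋃ n, B n) := by
  intro l hl hlU
  rw [Finsupp.mem_supported] at hl
  obtain ⟨n, hn⟩ := hB.directed_le.exists_mem_subset_of_finset_subset_biUnion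
    (s := l.support) (by simpa using hl)
  exact h n l ((Finsupp.mem_supported _ _).2 hn) hlU

theorem IsFreeModAfter.of_dvd {f g : D} {U W : Submodule D V} {C : Set V}
    (h : IsFreeModAfter f U W C) (hfg : f ∣ g) : IsFreeModAfter g U W C := by
  obtain ⟨h1, h2, h3⟩ := h
  refine ⟨h1, h2, fun w hw => ?_⟩
  obtain ⟨n, hn⟩ := h3 w hw
  obtain ⟨c, rfl⟩ := hfg
  refine ⟨n, ?_⟩
  rw [mul_pow, mul_comm, mul_smul]
  exact Submodule.smul_mem _ _ hn

theorem IsFreeModAfter.union {f : D} {U F W : Submodule D V} {B C : Set V} (hUF : U ≤ F)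
    (hFW : F ≤ W) (hB : IsFreeModAfter f U F B) (hC : IsFreeModAfter f F W C) :
    IsFreeModAfter f U W (B ∪ C) := by
  refine ⟨Set.union_subset (hB.1.trans hFW) hC.1, hB.2.1.union hUF hB.1 hC.2.1, fun w hw => ?_⟩
  obtain ⟨n, hn⟩ := hC.2.2 w hw
  obtain ⟨c, hc, v, hv, hcv⟩ := Submodule.mem_sup.1 hn
  obtain ⟨m, hm⟩ := hB.2.2 v hv
  refine ⟨m + n, ?_⟩
  rw [pow_add, mul_smul, ← hcv, smul_add]
  refine add_mem (Submodule.mem_sup_left (Submodule.smul_mem _ _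
    (Submodule.span_mono Set.subset_union_right hc))) ?_
  exact mem_span_sup_mono Set.subset_union_left hm

/-- Transport along a linear map inducing an isomorphism of subquotients. -/
theorem IsFreeModAfter.image {f : D} {U W F : Submodule D V} {C : Set V} (φ : V →ₗ[D] V)
    (h : IsFreeModAfter f U W C) (hU : U = W ⊓ F.comap φ) :
    IsFreeModAfter f F (F ⊔ W.map φ) (φ '' C) := by
  refine ⟨?_, fun l hl hlF => ?_, fun w hw => ?_⟩
  · rintro _ ⟨c, hc, rfl⟩
    exact Submodule.mem_sup_right ⟨c, h.1 hc, rfl⟩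
  · obtain ⟨l', hl', rfl⟩ : ∃ l' ∈ Finsupp.supported D D C, Finsupp.lmapDomain D D φ l' = l := by
      rw [← Finsupp.lmapDomain_supported] at hl
      exact hl
    rw [h.2.1 l' hl', map_zero]
    have h1 : Finsupp.linearCombination D (id : V → V) (Finsupp.lmapDomain D D φ l') =
        φ (Finsupp.linearCombination D id l') := by
      rw [Finsupp.lmapDomain_apply, Finsupp.linearCombination_mapDomain,
        Finsupp.apply_linearCombination]
      rfl
    rw [h1] at hlF
    rw [hU]
    exact ⟨(Submodule.span_le.2 h.1) (linearCombination_id_mem_span hl'), hlF⟩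
  · obtain ⟨u, hu, _, ⟨v, hv, rfl⟩, rfl⟩ := Submodule.mem_sup.1 hw
    obtain ⟨n, hn⟩ := h.2.2 v hv
    refine ⟨n, ?_⟩
    obtain ⟨c, hc, z, hz, hcz⟩ := Submodule.mem_sup.1 hn
    rw [smul_add, ← map_smul, ← hcz, map_add]
    refine add_mem (Submodule.mem_sup_right (Submodule.smul_mem _ _ hu)) (add_mem ?_ ?_)
    · rw [← Submodule.map_span]
      exact Submodule.mem_sup_left ⟨c, hc, rfl⟩
    · rw [hU] at hz
      exact Submodule.mem_sup_right hz.2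

theorem exists_isFreeModAfter_of_fg [IsDomain D] (U : Submodule D V) (S : Set V) (hS : S.Finite) :
    ∃ f : D, f ≠ 0 ∧ ∃ C, IsFreeModAfter f U (Submodule.span D S) C := by
  classical
  induction S, hS using Set.Finite.induction_on with
  | empty =>
    refine ⟨1, one_ne_zero, ∅, Set.empty_subset _, fun l hl _ => ?_, fun w hw => ⟨0, ?_⟩⟩
    · simpa using hl
    · rw [Submodule.span_empty, Submodule.mem_bot] at hw
      simp [hw]
  | insert _ _ ih =>
    rename_i s S _ _
    obtain ⟨f, hf, C, hC⟩ := ih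
    by_cases hs : ∃ a : D, a ≠ 0 ∧ a • s ∈ Submodule.span D C ⊔ U
    · obtain ⟨a, ha, has⟩ := hs
      obtain ⟨h1, h2, h3⟩ := hC
      refine ⟨f * a, mul_ne_zero hf ha, C,
        h1.trans (Submodule.span_mono (Set.subset_insert _ _)), h2, fun w hw => ?_⟩
      obtain ⟨b, z, hz, rfl⟩ := Submodule.mem_span_insert.1 hw
      obtain ⟨n, hn⟩ := h3 z hz
      refine ⟨n + 1, ?_⟩
      rw [smul_add]
      refine add_mem ?_ ?_
      · rw [smul_smul, show (f * a) ^ (n + 1) * b = (f ^ (n + 1) * a ^ n * b) * a by ring, mul_smul]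
        exact Submodule.smul_mem _ _ has
      · rw [show (f * a) ^ (n + 1) = (f * a ^ (n + 1)) * f ^ n by ring, mul_smul]
        exact Submodule.smul_mem _ _ hn
    · push Not at hs
      refine ⟨f, hf, C ∪ {s}, ?_, ?_, fun w hw => ?_⟩
      · refine Set.union_subset (hC.1.trans (Submodule.span_mono (Set.subset_insert _ _))) ?_
        rintro _ rfl
        exact Submodule.subset_span (Set.mem_insert _ _)
      · refine hC.2.1.union (F := Submodule.span D C ⊔ U) le_sup_right
          (Submodule.subset_span.trans (fun x hx => Submodule.mem_sup_left hx)) fun l hl hlF => ?_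
        obtain ⟨a, rfl⟩ : ∃ a, l = Finsupp.single s a := by
          refine ⟨l s, (Finsupp.support_subset_singleton.1 ?_)⟩
          have := (Finsupp.mem_supported _ _).1 hl
          exact_mod_cast this
        by_cases ha : a = 0
        · simp [ha]
        · exact absurd (by simpa using hlF) (hs a ha)
      · obtain ⟨b, z, hz, rfl⟩ := Submodule.mem_span_insert.1 hw
        obtain ⟨n, hn⟩ := hC.2.2 z hz
        refine ⟨n, ?_⟩
        rw [smul_add]
        refine add_mem ?_ ?_
        · exact Submodule.mem_sup_left (Submodule.smul_mem _ _ (Submodule.smul_mem _ _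
            (Submodule.subset_span (Or.inr rfl))))
        · exact mem_span_sup_mono Set.subset_union_left hn

variable (ρ : G →* Module.End D V) {H K : Subgroup G}

theorem finite_range_filtrationKer {x : G} (hx : ∀ k : ℤ, ∀ h ∈ H, x ^ k * h * x ^ (-k) ∈ H)
    {W : Submodule D V} (hW : IsStableUnder ρ H W) [WellFoundedGT (StableSubmodule ρ H W)]
    (M : Submodule D V) (hM : IsStableUnder ρ H M) (hMx : ∀ k : ℤ, ∀ m ∈ M, ρ (x ^ k) m ∈ M) :
    (Set.range (filtrationKer ρ x W M)).Finite := by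
  have key : ∀ r : ℕ, (Set.range fun k => filtrationKer ρ x W M (2 * k + r)).Finite := fun r => by
    obtain ⟨J, hJ⟩ := WellFoundedGT.monotone_chain_condition
      (⟨fun k => (⟨filtrationKer ρ x W M (2 * k + r), inf_le_left,
        filtrationKer_isStableUnder ρ hx hW hM _⟩ : StableSubmodule ρ H W),
        monotone_nat_of_le_succ fun k => by
          have := filtrationKer_le_add_two ρ x W M hMx (2 * k + r)
          rwa [show 2 * k + r + 2 = 2 * (k + 1) + r by ring] at this⟩ :
        ℕ →o StableSubmodule ρ H W)
    refine ((Set.finite_Iic J).image fun k => filtrationKer ρ x W M (2 * k + r)).subset ?_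
    rintro _ ⟨k, rfl⟩
    rcases le_total k J with h | h
    · exact ⟨k, h, rfl⟩
    · exact ⟨J, Set.mem_Iic.2 le_rfl, congrArg Subtype.val (hJ k h)⟩
  refine ((key 0).union (key 1)).subset ?_
  rintro _ ⟨k, rfl⟩
  rcases Nat.even_or_odd' k with ⟨n, rfl | rfl⟩
  · exact Or.inl ⟨n, rfl⟩
  · exact Or.inr ⟨n, rfl⟩

/-- **Generic freeness** for finitely generated modules over polycyclic groups acting linearly
over a noetherian domain. -/
theorem Subgroup.IsPoly.exists_isFreeModAfter [IsDomain D] [IsNoetherianRing D] (hH : H.IsPoly)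
    (S : Set V) (hS : S.Finite) (U : Submodule D V) (hU : IsStableUnder ρ H U) :
    ∃ f : D, f ≠ 0 ∧ ∃ C, IsFreeModAfter f U (stableSpan ρ H S) C := by
  classical
  induction hH generalizing U with
  | bot =>
    have h1 : stableSpan ρ ⊥ S = Submodule.span D S := by
      rw [stableSpan]
      congr 1
      ext v
      simp
    rw [h1]
    exact exists_isFreeModAfter_of_fg U S hS
  | step t hHK ht hn hc hH ih =>
    rename_i H K
    have := hH.wellFoundedGT_stableSubmodule ρ S hS
    have hfin := finite_range_filtrationKer ρ (zpow_conj_mem hn ht) (stableSpan_isStableUnder ρ S)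
      U (hU.mono ρ hHK) fun k => hU _ (K.zpow_mem ht k)
    have hx := zpow_conj_mem hn ht
    have hW0 := stableSpan_isStableUnder ρ (H := H) S
    choose! f hf C hC using fun k => ih (filtrationKer ρ t (stableSpan ρ H S) U k)
      (filtrationKer_isStableUnder ρ hx hW0 (hU.mono ρ hHK) k)
    obtain ⟨T, hT⟩ : ∃ T : Finset ℕ, ∀ k, ∃ j ∈ T, filtrationKer ρ t (stableSpan ρ H S) U k =
        filtrationKer ρ t (stableSpan ρ H S) U j := by
      have := hfin.fintype
      refine ⟨Finset.univ.image (Set.rangeSplitting (filtrationKer ρ t (stableSpan ρ H S) U)), fun k => ⟨_,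
        Finset.mem_image_of_mem _ (Finset.mem_univ ⟨_, k, rfl⟩), ?_⟩⟩
      exact (Set.apply_rangeSplitting (filtrationKer ρ t (stableSpan ρ H S) U) ⟨_, k, rfl⟩).symm
    let g := ∏ j ∈ T, f j
    have hg : g ≠ 0 := Finset.prod_ne_zero_iff.2 fun j _ => hf j
    have h1 : ∀ k, ∃ C, IsFreeModAfter g (filtrationKer ρ t (stableSpan ρ H S) U k)
        (stableSpan ρ H S) C := fun k => by
      obtain ⟨j, hj, hkj⟩ := hT k
      exact ⟨C j, hkj ▸ (hC j).of_dvd (Finset.dvd_prod_of_mem f hj)⟩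
    choose B hB using h1
    let F := zpowFiltration ρ t (stableSpan ρ H S)
    let E : ℕ → Set V := fun k => ⋃ i ∈ Finset.range k, ρ (t ^ filtrationExponent i) '' B i
    have hE : ∀ k, IsFreeModAfter g U (U ⊔ F k) (E k) := fun k => by
      induction k with
      | zero =>
        refine ⟨by simp [E], fun l hl _ => by simpa [E] using hl, fun w hw => ⟨0, ?_⟩⟩
        simpa [F, zpowFiltration_zero, E] using hw
      | succ k ihk =>
        have h2 := (hB k).image (F := U ⊔ F k) (ρ (t ^ filtrationExponent k)) rfl
        have h3 : E (k + 1) = E k ∪ ρ (t ^ filtrationExponent k) '' B k := by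
          simp only [E, Finset.mem_range]
          rw [Set.biUnion_lt_succ]
        have h4 : U ⊔ F (k + 1) = (U ⊔ F k) ⊔
            (stableSpan ρ H S).map (ρ (t ^ filtrationExponent k)) := by
          rw [sup_assoc]
          exact congrArg _ (zpowFiltration_succ ρ t _ k)
        rw [h3, h4]
        exact ihk.union le_sup_left le_sup_left h2
    have hWK := stableSpan_isStableUnder ρ (H := K) S
    have hW0K : stableSpan ρ H S ≤ stableSpan ρ K S :=
      stableSpan_le ρ (hWK.mono ρ hHK) (subset_stableSpan ρ S)
    refine ⟨g, hg, ⋃ k, E k, ?_, ?_, fun w hw => ?_⟩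
    · refine Set.iUnion_subset fun k => Set.iUnion₂_subset fun i _ => ?_
      rintro _ ⟨b, hb, rfl⟩
      exact hWK _ (K.zpow_mem ht _) _ (hW0K ((hB i).1 hb))
    · refine LinearIndepMod.iUnion (fun i j hij => ?_) fun k => (hE k).2.1
      exact Set.biUnion_subset_biUnion_left fun x hx =>
        Finset.mem_coe.2 (Finset.range_mono hij hx)
    · obtain ⟨k, hk⟩ := (Submodule.mem_iSup_of_directed _
        (zpowFiltration_mono ρ t _).directed_le).1
        (stableSpan_le_iSup_zpowFiltration ρ hn ht hc S hw)
      obtain ⟨n, hn⟩ := (hE k).2.2 w (Submodule.mem_sup_right hk)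
      exact ⟨n, mem_span_sup_mono (Set.subset_iUnion _ k) hn⟩

end GenericFreeness

section MaximalIdeals

theorem MonoidAlgebra.mul_mem_of_left {H : Type*} [Group H] (N : AddSubgroup (MonoidAlgebra ℤ H))
    (hN : ∀ h : H, ∀ x ∈ N, MonoidAlgebra.of ℤ H h * x ∈ N) (r : MonoidAlgebra ℤ H) :
    ∀ x ∈ N, r * x ∈ N := by
  intro x hx
  induction r using MonoidAlgebra.induction_linear with
  | zero => rw [zero_mul]; exact N.zero_mem
  | add f g hf hg => rw [add_mul]; exact N.add_mem hf hg
  | single h n =>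
    have : MonoidAlgebra.single h n = n • MonoidAlgebra.of ℤ H h := by simp
    rw [this, smul_mul_assoc]
    exact N.zsmul_mem (hN h x hx) n

open Classical in
/-- Restriction of an element of the group ring to a right coset of a subgroup. -/
noncomputable def cosetPart {H : Type*} [Group H] (C : Subgroup H) (t : H) :
    MonoidAlgebra ℤ H →+ MonoidAlgebra ℤ H :=
  (MonoidAlgebra.coeffAddEquiv.symm.toAddMonoidHom.comp
    (Finsupp.filterAddHom (fun h => h * t⁻¹ ∈ C))).comp MonoidAlgebra.coeffAddEquiv.toAddMonoidHom

theorem coeff_cosetPart {H : Type*} [Group H] (C : Subgroup H) (t : H) (x : MonoidAlgebra ℤ H)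
    (h : H) [Decidable (h * t⁻¹ ∈ C)] :
    (cosetPart C t x).coeff h = if h * t⁻¹ ∈ C then x.coeff h else 0 := by
  classical
  change (Finsupp.filter _ x.coeff) h = _
  rw [Finsupp.filter_apply]
  congr

theorem cosetPart_single {H : Type*} [Group H] (C : Subgroup H) (t h : H) (n : ℤ)
    [Decidable (h * t⁻¹ ∈ C)] :
    cosetPart C t (MonoidAlgebra.single h n) =
      if h * t⁻¹ ∈ C then MonoidAlgebra.single h n else 0 := by
  classical
  apply MonoidAlgebra.coeff_injective
  ext k
  rw [coeff_cosetPart, MonoidAlgebra.coeff_single, Finsupp.single_apply]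
  by_cases hk : h = k
  · subst hk
    by_cases hC : h * t⁻¹ ∈ C <;> simp [hC]
  · split_ifs <;> simp [hk]

theorem cosetPart_mul_of_left {H : Type*} [Group H] (C : Subgroup H) (t : H) {c : H} (hc : c ∈ C)
    (x : MonoidAlgebra ℤ H) :
    cosetPart C t (MonoidAlgebra.of ℤ H c * x) = MonoidAlgebra.of ℤ H c * cosetPart C t x := by
  classical
  induction x using MonoidAlgebra.induction_linear with
  | zero => simp
  | add f g hf hg => rw [mul_add, map_add, map_add, mul_add, hf, hg]
  | single h n =>
    rw [MonoidAlgebra.of_apply, MonoidAlgebra.single_mul_single, cosetPart_single, cosetPart_single,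
      mul_assoc, C.mul_mem_cancel_left hc]
    split_ifs
    · rw [MonoidAlgebra.single_mul_single]
    · simp

theorem cosetPart_mul_of_right {H : Type*} [Group H] (C : Subgroup H) (t b : H)
    (hb : t * b * t⁻¹ ∈ C) (x : MonoidAlgebra ℤ H) :
    cosetPart C t (x * MonoidAlgebra.of ℤ H b) = cosetPart C t x * MonoidAlgebra.of ℤ H b := by
  classical
  induction x using MonoidAlgebra.induction_linear with
  | zero => simp
  | add f g hf hg => rw [add_mul, map_add, map_add, add_mul, hf, hg]
  | single h n =>
    have : h * b * t⁻¹ = h * t⁻¹ * (t * b * t⁻¹) := by group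
    rw [MonoidAlgebra.of_apply, MonoidAlgebra.single_mul_single, cosetPart_single, cosetPart_single,
      this, C.mul_mem_cancel_right hb]
    split_ifs
    · rw [MonoidAlgebra.single_mul_single]
    · simp

theorem cosetPart_ne_zero_iff {H : Type*} [Group H] (C : Subgroup H) (t : H)
    (x : MonoidAlgebra ℤ H) :
    cosetPart C t x ≠ 0 ↔ ∃ h ∈ x.coeff.support, h * t⁻¹ ∈ C := by
  classical
  rw [ne_eq, ← not_iff_not, not_not]
  push Not
  constructor
  · intro h0 h hh hC
    have := coeff_cosetPart C t x h
    rw [h0, if_pos hC] at this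
    exact (Finsupp.mem_support_iff.mp hh) this.symm
  · intro h0
    apply MonoidAlgebra.coeff_injective
    ext h
    rw [coeff_cosetPart]
    split_ifs with hC
    · by_contra hne
      exact h0 h (Finsupp.mem_support_iff.mpr hne) hC
    · rfl

end MaximalIdeals

section MaximalIdeals

theorem cosetPart_cosetPart {H : Type*} [Group H] (C : Subgroup H) (s t : H)
    (x : MonoidAlgebra ℤ H) (hst : s * t⁻¹ ∉ C) : cosetPart C s (cosetPart C t x) = 0 := by
  classical
  by_contra hne
  obtain ⟨h, hh, hs⟩ := (cosetPart_ne_zero_iff C s _).mp hne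
  rw [Finsupp.mem_support_iff, coeff_cosetPart] at hh
  have ht : h * t⁻¹ ∈ C := by
    by_contra hc
    exact hh (if_neg hc)
  apply hst
  have : s * t⁻¹ = (h * s⁻¹)⁻¹ * (h * t⁻¹) := by group
  rw [this]
  exact C.mul_mem (C.inv_mem hs) ht

theorem cosetPart_self {H : Type*} [Group H] (C : Subgroup H) (t : H)
    (x : MonoidAlgebra ℤ H) (hx : ∀ h ∈ x.coeff.support, h * t⁻¹ ∈ C) : cosetPart C t x = x := by
  classical
  apply MonoidAlgebra.coeff_injective
  ext h
  rw [coeff_cosetPart]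
  split_ifs with hC
  · rfl
  · by_contra hne
    exact hC (hx h (Finsupp.mem_support_iff.mpr (Ne.symm hne)))

theorem cosetPart_congr {H : Type*} [Group H] (C : Subgroup H) {s t : H} (hst : s * t⁻¹ ∈ C)
    (x : MonoidAlgebra ℤ H) : cosetPart C s x = cosetPart C t x := by
  classical
  apply MonoidAlgebra.coeff_injective
  ext h
  rw [coeff_cosetPart, coeff_cosetPart]
  have : h * t⁻¹ ∈ C ↔ h * s⁻¹ ∈ C := by
    have : h * t⁻¹ = h * s⁻¹ * (s * t⁻¹) := by group
    rw [this, C.mul_mem_cancel_right hst]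
  simp only [this]

variable {H : Type} [Group H] {B : Type} [CommGroup B] (ι : B →* H) (α : H →* MulAut B)

theorem cosetPart_mul_of_sub_mem (hα : ∀ h b, ι (α h b) = h * ι b * h⁻¹)
    (P : Ideal (MonoidAlgebra ℤ B)) (C : Subgroup H)
    (hC : ∀ h, h ∈ C ↔ ∀ b, MonoidAlgebra.of ℤ B (α h b) - MonoidAlgebra.of ℤ B b ∈ P)
    (hιC : ∀ b, ι b ∈ C) (Q : AddSubgroup (MonoidAlgebra ℤ H))
    (hP : ∀ p ∈ P, ∀ x, MonoidAlgebra.mapDomainRingHom ℤ ι p * x ∈ Q) (t : H) (b : B)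
    (x : MonoidAlgebra ℤ H) :
    cosetPart C t (x * MonoidAlgebra.of ℤ H (ι b)) -
      MonoidAlgebra.of ℤ H (ι (α t b)) * cosetPart C t x ∈ Q := by
  classical
  rw [cosetPart_mul_of_right C t (ι b) (by rw [← hα]; exact hιC _)]
  induction x using MonoidAlgebra.induction_linear with
  | zero => simp
  | add f g hf hg =>
    rw [map_add, mul_add, add_mul, add_sub_add_comm]
    exact Q.add_mem hf hg
  | single h n =>
    rw [cosetPart_single]
    split_ifs with hh
    · have h1 : MonoidAlgebra.single h n * MonoidAlgebra.of ℤ H (ι b) -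
          MonoidAlgebra.of ℤ H (ι (α t b)) * MonoidAlgebra.single h n =
          MonoidAlgebra.mapDomainRingHom ℤ ι
            (MonoidAlgebra.of ℤ B (α (h * t⁻¹) (α t b)) - MonoidAlgebra.of ℤ B (α t b)) *
              MonoidAlgebra.single h n := by
        rw [map_sub, sub_mul]
        congr 1
        · have h2 : α (h * t⁻¹) (α t b) = α h b := by
            rw [← MulAut.mul_apply, ← map_mul, inv_mul_cancel_right]
          rw [h2]
          simp [hα]
        · simp
      rw [h1]
      exact hP _ ((hC _).mp hh _) _
    · simp

theorem cosetPart_mem (hα : ∀ h b, ι (α h b) = h * ι b * h⁻¹)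
    (P : Ideal (MonoidAlgebra ℤ B)) (C : Subgroup H)
    (hC : ∀ h, h ∈ C ↔ ∀ b, MonoidAlgebra.of ℤ B (α h b) - MonoidAlgebra.of ℤ B b ∈ P)
    (hιC : ∀ b, ι b ∈ C) (Q : AddSubgroup (MonoidAlgebra ℤ H))
    (hP : ∀ p ∈ P, ∀ x, MonoidAlgebra.mapDomainRingHom ℤ ι p * x ∈ Q)
    (hl : ∀ s, ∀ x ∈ Q, MonoidAlgebra.mapDomainRingHom ℤ ι s * x ∈ Q)
    (hr : ∀ x ∈ Q, ∀ r, x * r ∈ Q)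
    (htf : ∀ s ∉ P, ∀ x, MonoidAlgebra.mapDomainRingHom ℤ ι s * x ∈ Q → x ∈ Q)
    (t : H) (x : MonoidAlgebra ℤ H) (hx : x ∈ Q) : cosetPart C t x ∈ Q := by
  classical
  let cosets : MonoidAlgebra ℤ H → Finset (Quotient (QuotientGroup.rightRel C)) := fun x =>
    x.coeff.support.image (Quotient.mk _)
  have hcos : ∀ x s, Quotient.mk _ s ∈ cosets x ↔ cosetPart C s x ≠ 0 := by
    intro x s
    rw [cosetPart_ne_zero_iff, Finset.mem_image]
    refine exists_congr fun h => and_congr_right fun _ => ?_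
    rw [Quotient.eq, QuotientGroup.rightRel_apply, ← C.inv_mem_iff]
    simp
  induction hn : (cosets x).card using Nat.strong_induction_on generalizing x with
  | _ n ih =>
  by_cases hall : ∀ h ∈ x.coeff.support, h * t⁻¹ ∈ C
  · rwa [cosetPart_self C t x hall]
  push Not at hall
  obtain ⟨u, hu, hut⟩ := hall
  have hs : t * u⁻¹ ∉ C := by
    rwa [← C.inv_mem_iff, mul_inv_rev, inv_inv]
  obtain ⟨b, hb⟩ : ∃ b, MonoidAlgebra.of ℤ B (α (t * u⁻¹) b) - MonoidAlgebra.of ℤ B b ∉ P := by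
    by_contra hcon
    push Not at hcon
    exact hs ((hC _).mpr hcon)
  let b₁ := α u⁻¹ b
  have hb₁ : α u b₁ = b := by
    rw [← MulAut.mul_apply, ← map_mul, mul_inv_cancel]; simp
  have hb₂ : α t b₁ = α (t * u⁻¹) b := by
    rw [map_mul, MulAut.mul_apply]
  have hmapof : ∀ b, MonoidAlgebra.mapDomainRingHom ℤ ι (MonoidAlgebra.of ℤ B b) =
      MonoidAlgebra.of ℤ H (ι b) := fun b => by simp
  let y := x * MonoidAlgebra.of ℤ H (ι b₁) - MonoidAlgebra.of ℤ H (ι b) * x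
  have hkey : ∀ s, cosetPart C s y - (MonoidAlgebra.of ℤ H (ι (α s b₁)) -
      MonoidAlgebra.of ℤ H (ι b)) * cosetPart C s x ∈ Q := by
    intro s
    have h1 := cosetPart_mul_of_sub_mem ι α hα P C hC hιC Q hP s b₁ x
    have h2 : cosetPart C s y - (MonoidAlgebra.of ℤ H (ι (α s b₁)) -
      MonoidAlgebra.of ℤ H (ι b)) * cosetPart C s x =
        cosetPart C s (x * MonoidAlgebra.of ℤ H (ι b₁)) -
      MonoidAlgebra.of ℤ H (ι (α s b₁)) * cosetPart C s x := by
      rw [map_sub, cosetPart_mul_of_left C s (hιC b), sub_mul]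
      abel
    rwa [h2]
  have hy : y ∈ Q := by
    refine Q.sub_mem (hr x hx _) ?_
    rw [← hmapof]
    exact hl _ _ hx
  have hyu : cosetPart C u y ∈ Q := by
    simpa [hb₁] using hkey u
  let z := y - cosetPart C u y
  have hz : z ∈ Q := Q.sub_mem hy hyu
  have hsub : cosets z ⊂ cosets x := by
    rw [Finset.ssubset_iff_of_subset]
    · refine ⟨Quotient.mk _ u, Finset.mem_image_of_mem _ hu, ?_⟩
      rw [hcos, not_not, map_sub, sub_eq_zero]
      symm
      apply cosetPart_self
      intro h hh
      rw [Finsupp.mem_support_iff, coeff_cosetPart] at hh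
      by_contra hc
      exact hh (if_neg hc)
    · intro q
      induction q using Quotient.inductionOn with
      | _ s =>
      rw [hcos, hcos]
      intro h1 h2
      apply h1
      have h3 : cosetPart C s y = 0 := by
        have h4 : s * ι b₁ * s⁻¹ ∈ C := by rw [← hα]; exact hιC _
        rw [map_sub, cosetPart_mul_of_left C s (hιC b), cosetPart_mul_of_right C s _ h4, h2]
        simp
      rw [map_sub, h3, zero_sub, neg_eq_zero]
      by_cases hsu : s * u⁻¹ ∈ C
      · rw [← cosetPart_congr C hsu y, h3, map_zero]
      · exact cosetPart_cosetPart C s u y hsu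
  have h5 := ih _ (hn ▸ Finset.card_lt_card hsub) z hz rfl
  have h6 : cosetPart C t z = cosetPart C t y := by
    rw [map_sub, cosetPart_cosetPart C t u y hs, sub_zero]
  rw [h6] at h5
  have h7 := Q.sub_mem h5 (hkey t)
  rw [sub_sub_cancel, hb₂, ← hmapof, ← hmapof, ← map_sub] at h7
  exact htf _ hb _ h7

end MaximalIdeals

section JacobsonInt

theorem Int.isJacobsonRing : IsJacobsonRing ℤ := by
  rw [isJacobsonRing_iff_sInf_maximal]
  intro I hI
  by_cases h0 : I = ⊥
  · subst h0
    refine ⟨{J | J.IsMaximal}, fun J hJ => Or.inl hJ, ?_⟩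
    symm
    rw [eq_bot_iff]
    intro n hn
    rw [Ideal.mem_sInf] at hn
    by_contra hne
    obtain ⟨p, hp, hpp⟩ := Nat.exists_infinite_primes (n.natAbs + 1)
    have hmax : (Ideal.span {(p : ℤ)}).IsMaximal :=
      PrincipalIdealRing.isMaximal_of_irreducible (Nat.prime_iff_prime_int.mp hpp).irreducible
    have h1 := hn hmax
    rw [Ideal.mem_span_singleton] at h1
    have h2 := Int.natAbs_dvd_natAbs.mpr h1
    have h3 := Nat.le_of_dvd (Int.natAbs_pos.mpr hne) h2
    rw [Int.natAbs_natCast] at h3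
    omega
  · exact ⟨{I}, fun J hJ => Or.inl ((Set.mem_singleton_iff.mp hJ) ▸ hI.isMaximal h0), by simp⟩

theorem isJacobsonRing_of_finiteType_int (D : Type*) [CommRing D] [Algebra.FiniteType ℤ D] :
    IsJacobsonRing D := by
  have := Int.isJacobsonRing
  obtain ⟨n, f, hf⟩ := Algebra.FiniteType.iff_quotient_mvPolynomial''.mp
    (inferInstance : Algebra.FiniteType ℤ D)
  exact isJacobsonRing_of_surjective ⟨f.toRingHom, hf⟩

theorem Field.finite_of_finiteType_int (K : Type*) [Field K] [Algebra.FiniteType ℤ K] :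
    Finite K := by
  have := Int.isJacobsonRing
  have hfin : Module.Finite ℤ K := finite_of_finite_type_of_isJacobsonRing ℤ K
  have hIntegral : Algebra.IsIntegral ℤ K := inferInstance
  have hninj : ¬ Function.Injective (algebraMap ℤ K) := fun hinj =>
    Int.not_isField (isField_of_isIntegral_of_isField hinj (Field.toIsField K))
  rw [injective_iff_map_eq_zero] at hninj
  push Not at hninj
  obtain ⟨n, hn, hn0⟩ := hninj
  refine Module.finite_of_fg_torsion K ?_
  intro x
  refine ⟨⟨n, mem_nonZeroDivisors_of_ne_zero hn0⟩, ?_⟩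
  change n • x = 0
  rw [zsmul_eq_mul, ← eq_intCast (algebraMap ℤ K) n, hn, zero_mul]

end JacobsonInt

section MaximalIdeals

variable {D V : Type*} {C : Type} [CommRing D] [AddCommGroup V] [Module D V] [Group C]
  (ρ : C →* Module.End D V)

theorem Subgroup.IsPoly.exists_maximal_notMem_smul [IsDomain D] [IsNoetherianRing D]
    [IsJacobsonRing D] (hC : (⊤ : Subgroup C).IsPoly) (v : V) (hv : v ≠ 0)
    (htf : ∀ (d : D) (x : V), d ≠ 0 → d • x = 0 → x = 0) :
    ∃ 𝔪 : Ideal D, 𝔪.IsMaximal ∧ v ∉ 𝔪 • stableSpan ρ ⊤ {v} := by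
  classical
  obtain ⟨f, hf, Cs, hCW, hlin, hloc⟩ := hC.exists_isFreeModAfter ρ {v} (Set.finite_singleton v) ⊥
    (fun g _ x hx => by
      rw [Submodule.mem_bot] at hx
      rw [hx, map_zero]
      exact Submodule.zero_mem _)
  set W := stableSpan ρ ⊤ {v}
  obtain ⟨𝔪, hm, hfm⟩ : ∃ 𝔪 : Ideal D, 𝔪.IsMaximal ∧ f ∉ 𝔪 := by
    by_contra hcon
    push Not at hcon
    have h1 := IsJacobsonRing.out (inferInstance : IsJacobsonRing D)
      (I := (⊥ : Ideal D)) (Ideal.isPrime_bot.isRadical)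
    apply hf
    rw [← Ideal.mem_bot, ← h1, Ideal.jacobson, Ideal.mem_sInf]
    intro J hJ
    exact hcon J hJ.2
  refine ⟨𝔪, hm, fun hvm => ?_⟩
  have hstab : IsStableUnder ρ ⊤ (𝔪 • W) := by
    intro g hg x hx
    induction hx using Submodule.smul_induction_on' with
    | smul r hr n hn =>
      rw [map_smul]
      exact Submodule.smul_mem_smul hr (stableSpan_isStableUnder (ρ := ρ) {v} g hg n hn)
    | add x hx y hy ihx ihy =>
      rw [map_add]
      exact Submodule.add_mem _ ihx ihy
  have hW : W ≤ 𝔪 • W := stableSpan_le ρ hstab (Set.singleton_subset_iff.mpr hvm)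
  have hvW : v ∈ W := subset_stableSpan (ρ := ρ) {v} rfl
  obtain ⟨n, hn⟩ := hloc v hvW
  rw [sup_bot_eq] at hn
  have hne : Cs.Nonempty := by
    by_contra hemp
    rw [Set.not_nonempty_iff_eq_empty] at hemp
    rw [hemp, Submodule.span_empty, Submodule.mem_bot] at hn
    exact hv (htf _ _ (pow_ne_zero n hf) hn)
  obtain ⟨c, hc⟩ := hne
  have hpow : ∀ w ∈ 𝔪 • W, ∃ n, f ^ n • w ∈ 𝔪 • Submodule.span D Cs := by
    intro w hw
    induction hw using Submodule.smul_induction_on' with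
    | smul r hr w hw =>
      obtain ⟨n, hn⟩ := hloc w hw
      rw [sup_bot_eq] at hn
      exact ⟨n, by rw [smul_comm]; exact Submodule.smul_mem_smul hr hn⟩
    | add x hx y hy ihx ihy =>
      obtain ⟨n, hn⟩ := ihx
      obtain ⟨k, hk⟩ := ihy
      refine ⟨n + k, ?_⟩
      rw [smul_add]
      refine Submodule.add_mem _ ?_ ?_
      · rw [add_comm, pow_add, mul_smul]
        exact Submodule.smul_mem _ _ hn
      · rw [pow_add, mul_smul]
        exact Submodule.smul_mem _ _ hk
  obtain ⟨k, hk⟩ := hpow c (hW (hCW hc))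
  rw [← Set.image_id Cs, Submodule.mem_ideal_smul_span_iff_exists_sum'] at hk
  obtain ⟨a, ha, hsum⟩ := hk
  have hl := hlin (Finsupp.single c (f ^ k) - a.mapDomain Subtype.val) (by
    refine Submodule.sub_mem _ (Finsupp.single_mem_supported D _ hc) ?_
    rw [Finsupp.mem_supported]
    intro x hx
    obtain ⟨y, -, rfl⟩ := Finset.mem_image.mp (Finsupp.mapDomain_support hx)
    exact y.2) (by
    rw [Submodule.mem_bot, map_sub, sub_eq_zero, Finsupp.linearCombination_single,
      Finsupp.linearCombination_mapDomain, Finsupp.linearCombination_apply, id, ← hsum]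
    rfl)
  have h2 := DFunLike.congr_fun hl c
  rw [Finsupp.sub_apply, Finsupp.single_eq_same, Finsupp.zero_apply, sub_eq_zero] at h2
  have h3 : (a.mapDomain Subtype.val) c = a ⟨c, hc⟩ :=
    Finsupp.mapDomain_apply Subtype.val_injective a ⟨c, hc⟩
  rw [h3] at h2
  exact hfm (hm.isPrime.mem_of_pow_mem k (h2 ▸ ha _))

end MaximalIdeals

section MaximalIdeals

theorem Ideal.exists_notMem_mul_mem_of_mem_minimalPrimes {S : Type*} [CommRing S] {I 𝔭 : Ideal S}
    (hI : I.IsRadical) (hp : 𝔭 ∈ I.minimalPrimes) {x : S} (hx : x ∈ 𝔭) :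
    ∃ d ∉ 𝔭, d * x ∈ I := by
  have := hp.1.1
  have h1 := IsLocalization.AtPrime.radical_map_of_mem_minimalPrimes
    (A := Localization.AtPrime 𝔭) 𝔭 I hp
  have h2 : algebraMap S (Localization.AtPrime 𝔭) x ∈
      (I.map (algebraMap S (Localization.AtPrime 𝔭))).radical := by
    rw [h1]
    exact Ideal.mem_map_of_mem _ hx
  obtain ⟨n, hn⟩ := h2
  rw [← map_pow, IsLocalization.mem_map_algebraMap_iff 𝔭.primeCompl] at hn
  obtain ⟨⟨⟨a, ha⟩, ⟨s, hs⟩⟩, h3⟩ := hn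
  rw [← map_mul, IsLocalization.eq_iff_exists 𝔭.primeCompl] at h3
  obtain ⟨⟨c, hc⟩, h4⟩ := h3
  simp only at h4
  have hcs : c * s ∉ 𝔭 := fun h => (hp.1.1.mem_or_mem h).elim hc hs
  refine ⟨c * s, hcs, hI ⟨n + 1, ?_⟩⟩
  have : (c * s * x) ^ (n + 1) = (c * s) ^ n * x * (c * (x ^ n * s)) := by ring
  rw [this, h4]
  exact I.mul_mem_left _ (I.mul_mem_left _ ha)

variable {H : Type} [Group H] {B : Type} [CommGroup B] (ι : B →* H) (α : H →* MulAut B)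

theorem mapDomainRingHom_mulAut (hα : ∀ h b, ι (α h b) = h * ι b * h⁻¹) (h : H)
    (s : MonoidAlgebra ℤ B) :
    MonoidAlgebra.mapDomainRingHom ℤ ι
      (MonoidAlgebra.mapDomainRingHom ℤ (α h : B →* B) s) =
      MonoidAlgebra.of ℤ H h * MonoidAlgebra.mapDomainRingHom ℤ ι s * MonoidAlgebra.of ℤ H h⁻¹ := by
  induction s using MonoidAlgebra.induction_linear with
  | zero => simp
  | add f g hf hg => rw [map_add, map_add, map_add, mul_add, add_mul, hf, hg]
  | single b n => simp [hα]

theorem of_mul_mapDomainRingHom (hα : ∀ h b, ι (α h b) = h * ι b * h⁻¹) (h : H)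
    (s : MonoidAlgebra ℤ B) :
    MonoidAlgebra.of ℤ H h * MonoidAlgebra.mapDomainRingHom ℤ ι s =
    MonoidAlgebra.mapDomainRingHom ℤ ι
      (MonoidAlgebra.mapDomainRingHom ℤ (α h : B →* B) s) * MonoidAlgebra.of ℤ H h := by
  rw [mapDomainRingHom_mulAut ι α hα, mul_assoc, ← map_mul, inv_mul_cancel, map_one, mul_one]

theorem isRadical_comap_of_maximal [Group.FG B] (hα : ∀ h b, ι (α h b) = h * ι b * h⁻¹)
    (M : Ideal (MonoidAlgebra ℤ H)) [M.IsTwoSided] (hM : M ≠ ⊤)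
    (hmax : ∀ N : Ideal (MonoidAlgebra ℤ H), N.IsTwoSided → M ≤ N → N ≠ ⊤ → N ≤ M) :
    (M.comap (MonoidAlgebra.mapDomainRingHom ℤ ι)).IsRadical := by
  have hnoeth : IsNoetherianRing (MonoidAlgebra ℤ B) := by
    have : Algebra.FiniteType ℤ (MonoidAlgebra ℤ B) := MonoidAlgebra.finiteType_of_fg
    exact Algebra.FiniteType.isNoetherianRing ℤ _
  set 𝔞 := M.comap (MonoidAlgebra.mapDomainRingHom ℤ ι) with h𝔞
  have hinv : ∀ h, ∀ s ∈ 𝔞, MonoidAlgebra.mapDomainRingHom ℤ (α h : B →* B) s ∈ 𝔞 := by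
    intro h s hs
    rw [h𝔞, Ideal.mem_comap, mapDomainRingHom_mulAut ι α hα]
    exact M.mul_mem_right _ (M.mul_mem_left _ hs)
  have hinvr : ∀ h, ∀ s ∈ 𝔞.radical,
      MonoidAlgebra.mapDomainRingHom ℤ (α h : B →* B) s ∈ 𝔞.radical := by
    rintro h s ⟨n, hn⟩
    exact ⟨n, by rw [← map_pow]; exact hinv h _ hn⟩
  let N₀ : AddSubgroup (MonoidAlgebra ℤ H) :=
    { carrier := {x | ∀ s ∈ 𝔞.radical, MonoidAlgebra.mapDomainRingHom ℤ ι s * x ∈ M}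
      add_mem' := fun hx hy s hs => by rw [mul_add]; exact M.add_mem (hx s hs) (hy s hs)
      zero_mem' := fun s _ => by rw [mul_zero]; exact M.zero_mem
      neg_mem' := fun hx s hs => by rw [mul_neg]; exact M.neg_mem (hx s hs) }
  have hN₀ : ∀ r, ∀ x ∈ N₀, r * x ∈ N₀ := fun r => by
    refine MonoidAlgebra.mul_mem_of_left N₀ (fun h x hx s hs => ?_) r
    have h1 : MonoidAlgebra.mapDomainRingHom ℤ ι s * (MonoidAlgebra.of ℤ H h * x) =
        MonoidAlgebra.of ℤ H h * (MonoidAlgebra.mapDomainRingHom ℤ ι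
          (MonoidAlgebra.mapDomainRingHom ℤ (α h⁻¹ : B →* B) s) * x) := by
      rw [mapDomainRingHom_mulAut ι α hα, ← mul_assoc, ← mul_assoc, ← mul_assoc, ← mul_assoc,
        ← map_mul, mul_inv_cancel, map_one, one_mul, inv_inv]
    rw [h1]
    exact M.mul_mem_left _ (hx _ (hinvr _ _ hs))
  let N : Ideal (MonoidAlgebra ℤ H) :=
    { N₀ with smul_mem' := fun r x hx => hN₀ r x hx }
  have hN2 : N.IsTwoSided := ⟨fun {x} r hx s hs => by
    rw [← mul_assoc]
    exact M.mul_mem_right _ (hx s hs)⟩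
  have hMN : M ≤ N := fun x hx s _ => M.mul_mem_left _ hx
  by_cases hNt : N = ⊤
  · intro s hs
    have h1 : (1 : MonoidAlgebra ℤ H) ∈ N := hNt ▸ Submodule.mem_top
    have h2 := h1 s hs
    rwa [mul_one] at h2
  · have hNM := hmax N hN2 hMN hNt
    exfalso
    obtain ⟨n, hn⟩ := 𝔞.exists_radical_pow_le_of_fg (IsNoetherian.noetherian _)
    have hdesc : ∀ k, 𝔞.radical ^ (k + 1) ≤ 𝔞 → 𝔞.radical ^ k ≤ 𝔞 := by
      intro k hk s hs
      apply hNM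
      intro r hr
      rw [← map_mul]
      have : r * s ∈ 𝔞.radical ^ (k + 1) := by
        rw [pow_succ']
        exact Ideal.mul_mem_mul hr hs
      exact hk this
    have hall : ∀ k, 𝔞.radical ^ k ≤ 𝔞 → 𝔞.radical ^ 0 ≤ 𝔞 := by
      intro k
      induction k with
      | zero => exact id
      | succ k ih => exact fun hk => ih (hdesc k hk)
    have h1 := hall n hn
    rw [pow_zero, Ideal.one_eq_top, top_le_iff, Ideal.eq_top_iff_one, h𝔞, Ideal.mem_comap,
      map_one] at h1
    exact hM ((Ideal.eq_top_iff_one M).mpr h1)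

end MaximalIdeals

section MaximalIdeals

theorem Algebra.FiniteType.int_of_surjective {S T : Type*} [CommRing S] [CommRing T]
    [Algebra.FiniteType ℤ S] (f : S →+* T) (hf : Function.Surjective f) :
    Algebra.FiniteType ℤ T :=
  Algebra.FiniteType.of_surjective f.toIntAlgHom hf

theorem MonoidAlgebra.finiteType_int {B : Type*} [CommGroup B] [Group.FG B] :
    @Algebra.FiniteType ℤ (MonoidAlgebra ℤ B) _ _ (Ring.toIntAlgebra _) := by
  have h : Algebra.FiniteType ℤ (MonoidAlgebra ℤ B) := MonoidAlgebra.finiteType_of_fg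
  have h2 : (MonoidAlgebra.algebra : Algebra ℤ (MonoidAlgebra ℤ B)) = Ring.toIntAlgebra _ :=
    Subsingleton.elim _ _
  rw [← h2]
  exact h

theorem Subgroup.IsPoly.exists_maximal_notMem_smul_span {S V : Type*} {C : Type} [CommRing S]
    [Algebra.FiniteType ℤ S] [AddCommGroup V] [Module S V] [Group C] (ρ : C →* Module.End S V)
    (hC : (⊤ : Subgroup C).IsPoly) (𝔭 : Ideal S) [𝔭.IsPrime] (v : V) (hv : v ≠ 0)
    (hp : ∀ s ∈ 𝔭, ∀ x : V, s • x = 0) (htf : ∀ s ∉ 𝔭, ∀ x : V, s • x = 0 → x = 0) :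
    ∃ 𝔪 : Ideal S, 𝔪.IsMaximal ∧ v ∉ 𝔪 • Submodule.span S (Set.range fun c => ρ c v) := by
  have ht : Module.IsTorsionBySet S V (𝔭 : Set S) := fun x s => hp s s.2 x
  let : Module (S ⧸ 𝔭) V := ht.module
  have hsm : ∀ (s : S) (x : V), (Ideal.Quotient.mk 𝔭 s) • x = s • x := fun s x => ht.mk_smul s x
  let ρ' : C →* Module.End (S ⧸ 𝔭) V :=
    { toFun := fun c =>
        { toFun := ρ c
          map_add' := (ρ c).map_add
          map_smul' := fun s x => by
            obtain ⟨s, rfl⟩ := Ideal.Quotient.mk_surjective s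
            rw [hsm, map_smul, RingHom.id_apply, hsm] }
      map_one' := by ext x; simp
      map_mul' := fun c c' => by ext x; simp }
  have : @Algebra.FiniteType ℤ (S ⧸ 𝔭) _ _ (Ring.toIntAlgebra _) :=
    .int_of_surjective (Ideal.Quotient.mk 𝔭) Ideal.Quotient.mk_surjective
  have : IsNoetherianRing (S ⧸ 𝔭) := Algebra.FiniteType.isNoetherianRing ℤ _
  have : IsJacobsonRing (S ⧸ 𝔭) := isJacobsonRing_of_finiteType_int _
  obtain ⟨𝔫, hn, hvn⟩ := hC.exists_maximal_notMem_smul ρ' v hv (fun d x hd hx => by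
    obtain ⟨s, rfl⟩ := Ideal.Quotient.mk_surjective d
    rw [hsm] at hx
    exact htf s (fun h => hd (Ideal.Quotient.eq_zero_iff_mem.mpr h)) x hx)
  refine ⟨𝔫.comap (Ideal.Quotient.mk 𝔭),
    Ideal.comap_isMaximal_of_surjective _ Ideal.Quotient.mk_surjective, fun h => hvn ?_⟩
  have hspan : ∀ y ∈ Submodule.span S (Set.range fun c => ρ c v), y ∈ stableSpan ρ' ⊤ {v} := by
    intro y hy
    induction hy using Submodule.span_induction with
    | mem y hy =>
      obtain ⟨c, rfl⟩ := hy
      exact Submodule.subset_span ⟨c, trivial, v, rfl, rfl⟩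
    | zero => exact Submodule.zero_mem _
    | add x y _ _ hx hy => exact Submodule.add_mem _ hx hy
    | smul s x _ hx =>
      rw [← hsm]
      exact Submodule.smul_mem _ _ hx
  refine Submodule.smul_induction_on (p := fun y => y ∈ 𝔫 • stableSpan ρ' ⊤ {v}) h
    (fun r hr y hy => ?_) (fun x y hx hy => Submodule.add_mem _ hx hy)
  rw [← hsm]
  exact Submodule.smul_mem_smul hr (hspan y hy)

variable {H : Type} [Group H] {B : Type} [CommGroup B] (ι : B →* H) (α : H →* MulAut B)

theorem exists_pow_sub_one_add_ne_one [Group.FG B] (hι : Function.Injective ι)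
    (hα : ∀ h b, ι (α h b) = h * ι b * h⁻¹) (hH : (⊤ : Subgroup H).IsPoly)
    (M : Ideal (MonoidAlgebra ℤ H)) [M.IsTwoSided] (hM : M ≠ ⊤)
    (hmax : ∀ N : Ideal (MonoidAlgebra ℤ H), N.IsTwoSided → M ≤ N → N ≠ ⊤ → N ≤ M) :
    ∃ m : ℕ, 0 < m ∧ ∀ μ ∈ M, ∀ d ∈ AddSubgroup.closure {z | ∃ (b : B) (x : MonoidAlgebra ℤ H),
      (MonoidAlgebra.of ℤ H (ι b) ^ m - 1) * x = z}, μ + d ≠ 1 := by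
  classical
  have hft := MonoidAlgebra.finiteType_int (B := B)
  set φ := MonoidAlgebra.mapDomainRingHom ℤ ι with hφ
  have hrad := isRadical_comap_of_maximal ι α hα M hM hmax
  rw [← hφ] at hrad
  set 𝔞 := M.comap φ with h𝔞
  have h𝔞t : 𝔞 ≠ ⊤ := by
    rw [Ne, Ideal.eq_top_iff_one, h𝔞, Ideal.mem_comap, map_one, ← Ideal.eq_top_iff_one]
    exact hM
  obtain ⟨J, hJ, h𝔞J⟩ := Ideal.exists_le_maximal 𝔞 h𝔞t
  obtain ⟨𝔭, hp, -⟩ := Ideal.exists_minimalPrimes_le h𝔞J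
  have hpp : 𝔭.IsPrime := hp.1.1
  have h𝔞p : 𝔞 ≤ 𝔭 := hp.1.2
  let : Module (MonoidAlgebra ℤ B) (MonoidAlgebra ℤ H) := Module.compHom _ φ
  have hsmul : ∀ (s : MonoidAlgebra ℤ B) (x : MonoidAlgebra ℤ H), s • x = φ s * x := fun _ _ => rfl
  let Q : Submodule (MonoidAlgebra ℤ B) (MonoidAlgebra ℤ H) :=
    { carrier := {x | ∃ d ∉ 𝔭, φ d * x ∈ M}
      add_mem' := by
        rintro x y ⟨d, hd, hx⟩ ⟨d', hd', hy⟩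
        refine ⟨d * d', fun h => (hpp.mem_or_mem h).elim hd hd', ?_⟩
        rw [mul_add]
        refine M.add_mem ?_ ?_
        · rw [mul_comm, map_mul, mul_assoc]
          exact M.mul_mem_left _ hx
        · rw [map_mul, mul_assoc]
          exact M.mul_mem_left _ hy
      zero_mem' := ⟨1, fun h => hpp.ne_top ((Ideal.eq_top_iff_one _).mpr h), by simp⟩
      smul_mem' := by
        rintro s x ⟨d, hd, hx⟩
        refine ⟨d, hd, ?_⟩
        rw [hsmul, ← mul_assoc, ← map_mul, mul_comm, map_mul, mul_assoc]
        exact M.mul_mem_left _ hx }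
  have hMQ : ∀ x ∈ M, x ∈ Q := fun x hx =>
    ⟨1, fun h => hpp.ne_top ((Ideal.eq_top_iff_one _).mpr h), by simpa using hx⟩
  have h1Q : (1 : MonoidAlgebra ℤ H) ∉ Q := by
    rintro ⟨d, hd, h⟩
    rw [mul_one] at h
    exact hd (h𝔞p h)
  have hPQ : ∀ p ∈ 𝔭, ∀ x, φ p * x ∈ Q := by
    intro p hpm x
    obtain ⟨d, hd, hdp⟩ := Ideal.exists_notMem_mul_mem_of_mem_minimalPrimes hrad hp hpm
    refine ⟨d, hd, ?_⟩
    rw [← mul_assoc, ← map_mul]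
    exact M.mul_mem_right _ hdp
  have hrQ : ∀ x ∈ Q, ∀ r, x * r ∈ Q := by
    rintro x ⟨d, hd, hx⟩ r
    exact ⟨d, hd, by rw [← mul_assoc]; exact M.mul_mem_right _ hx⟩
  have htfQ : ∀ s ∉ 𝔭, ∀ x, φ s * x ∈ Q → x ∈ Q := by
    rintro s hs x ⟨d, hd, hx⟩
    exact ⟨d * s, fun h => (hpp.mem_or_mem h).elim hd hs, by rwa [map_mul, mul_assoc]⟩
  let act : H → MonoidAlgebra ℤ B →+* MonoidAlgebra ℤ B := fun h =>
    MonoidAlgebra.mapDomainRingHom ℤ (α h : B →* B)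
  have hact : ∀ h, (∀ b, MonoidAlgebra.of ℤ B (α h b) - MonoidAlgebra.of ℤ B b ∈ 𝔭) →
      ∀ s, act h s - s ∈ 𝔭 := by
    intro h hb s
    induction s using MonoidAlgebra.induction_linear with
    | zero => simp
    | add f g hf hg =>
      rw [map_add, add_sub_add_comm]
      exact 𝔭.add_mem hf hg
    | single b n =>
      have : act h (MonoidAlgebra.single b n) - MonoidAlgebra.single b n =
          MonoidAlgebra.single 1 n *
            (MonoidAlgebra.of ℤ B (α h b) - MonoidAlgebra.of ℤ B b) := by
        simp [act, mul_sub]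
      rw [this]
      exact 𝔭.mul_mem_left _ (hb b)
  have hactof : ∀ h b, act h (MonoidAlgebra.of ℤ B b) = MonoidAlgebra.of ℤ B (α h b) := by
    intro h b; simp [act]
  let C : Subgroup H :=
    { carrier := {h | ∀ b, MonoidAlgebra.of ℤ B (α h b) - MonoidAlgebra.of ℤ B b ∈ 𝔭}
      one_mem' := fun b => by simp
      mul_mem' := fun {h k} hh hk b => by
        have h1 := 𝔭.add_mem (hh (α k b)) (hk b)
        rwa [sub_add_sub_cancel, ← MulAut.mul_apply, ← map_mul] at h1
      inv_mem' := fun {h} hh b => by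
        have h1 := 𝔭.neg_mem (hh (α h⁻¹ b))
        rwa [neg_sub, ← MulAut.mul_apply, ← map_mul, mul_inv_cancel, map_one,
          MulAut.one_apply] at h1 }
  have hιC : ∀ b, ι b ∈ C := by
    intro b b'
    have : α (ι b) b' = b' := hι (by rw [hα, ← map_mul, ← map_inv, ← map_mul]; simp)
    rw [this, sub_self]
    exact 𝔭.zero_mem
  have hcQ : ∀ c ∈ C, ∀ x ∈ Q, MonoidAlgebra.of ℤ H c * x ∈ Q := by
    rintro c hc x ⟨d, hd, hx⟩
    refine ⟨act c d, fun h => hd ?_, ?_⟩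
    · have h1 := 𝔭.sub_mem h (hact c hc d)
      rwa [sub_sub_cancel] at h1
    · rw [← mul_assoc, ← of_mul_mapDomainRingHom ι α hα, mul_assoc]
      exact M.mul_mem_left _ hx
  let V := MonoidAlgebra ℤ H ⧸ Q
  let ρ : C →* Module.End (MonoidAlgebra ℤ B) V :=
    { toFun := fun c =>
        { toFun := QuotientAddGroup.map Q.toAddSubgroup Q.toAddSubgroup
            (AddMonoidHom.mulLeft (MonoidAlgebra.of ℤ H (c : H))) (fun x hx => hcQ c c.2 x hx)
          map_add' := map_add _
          map_smul' := fun s x => by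
            obtain ⟨x, rfl⟩ := Submodule.Quotient.mk_surjective _ x
            change Submodule.Quotient.mk (MonoidAlgebra.of ℤ H (c : H) * (φ s * x)) =
              Submodule.Quotient.mk (φ s * (MonoidAlgebra.of ℤ H (c : H) * x))
            rw [Submodule.Quotient.eq, ← mul_assoc, of_mul_mapDomainRingHom ι α hα, mul_assoc,
              ← sub_mul, ← map_sub]
            exact hPQ _ (hact c c.2 s) _ }
      map_one' := by
        ext x
        change Submodule.Quotient.mk (MonoidAlgebra.of ℤ H ((1 : C) : H) * x) =
          Submodule.Quotient.mk x
        rw [OneMemClass.coe_one, map_one, one_mul]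
      map_mul' := fun c c' => by
        ext x
        change Submodule.Quotient.mk (MonoidAlgebra.of ℤ H ((c * c' : C) : H) * x) =
          Submodule.Quotient.mk (MonoidAlgebra.of ℤ H (c : H) * (MonoidAlgebra.of ℤ H (c' : H) * x))
        rw [← mul_assoc, ← map_mul]
        rfl }
  have hρ : ∀ (c : C) x, ρ c (Submodule.Quotient.mk x) =
    Submodule.Quotient.mk (MonoidAlgebra.of ℤ H (c : H) * x) := fun _ _ => rfl
  have hCpoly : (⊤ : Subgroup C).IsPoly := (hH.mono le_top).top_of_self
  obtain ⟨𝔪, hm, hv⟩ := hCpoly.exists_maximal_notMem_smul_span ρ 𝔭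
    (Submodule.Quotient.mk 1 : V) (fun h => h1Q ((Submodule.Quotient.mk_eq_zero Q).mp h))
    (fun s hs x => by
      obtain ⟨x, rfl⟩ := Submodule.Quotient.mk_surjective _ x
      exact (Submodule.Quotient.mk_eq_zero Q).mpr (hPQ s hs x))
    (fun s hs x hx => by
      obtain ⟨x, rfl⟩ := Submodule.Quotient.mk_surjective _ x
      exact (Submodule.Quotient.mk_eq_zero Q).mpr
        (htfQ s hs x ((Submodule.Quotient.mk_eq_zero Q).mp hx)))
  let : Field (MonoidAlgebra ℤ B ⧸ 𝔪) := Ideal.Quotient.field 𝔪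
  have : @Algebra.FiniteType ℤ (MonoidAlgebra ℤ B ⧸ 𝔪) _ _ (Ring.toIntAlgebra _) :=
    .int_of_surjective (Ideal.Quotient.mk 𝔪) Ideal.Quotient.mk_surjective
  have hfin : Finite (MonoidAlgebra ℤ B ⧸ 𝔪) := Field.finite_of_finiteType_int _
  refine ⟨Nat.card (MonoidAlgebra ℤ B ⧸ 𝔪)ˣ, Nat.card_pos, fun μ hμ d hd hμd => hv ?_⟩
  set m := Nat.card (MonoidAlgebra ℤ B ⧸ 𝔪)ˣ
  have hbm : ∀ b : B, MonoidAlgebra.of ℤ B b ^ m - 1 ∈ 𝔪 := by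
    intro b
    rw [← Ideal.Quotient.eq_zero_iff_mem, map_sub, map_pow, map_one, sub_eq_zero]
    let u : (MonoidAlgebra ℤ B ⧸ 𝔪)ˣ := (((Ideal.Quotient.mk 𝔪 : _ →* _).comp
      (MonoidAlgebra.of ℤ B)).toHomUnits b)
    have h1 : u ^ m = 1 := pow_card_eq_one'
    exact congrArg Units.val h1
  set W := Submodule.span (MonoidAlgebra ℤ B) (Set.range fun c => ρ c (Submodule.Quotient.mk 1 : V))
  have hW : ∀ x : MonoidAlgebra ℤ H, (Submodule.Quotient.mk (cosetPart C 1 x) : V) ∈ W := by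
    intro x
    induction x using MonoidAlgebra.induction_linear with
    | zero => rw [map_zero]; exact W.zero_mem
    | add f g hf hg => rw [map_add]; exact W.add_mem hf hg
    | single h n =>
      rw [cosetPart_single]
      split_ifs with hh
      · rw [inv_one, mul_one] at hh
        have h1 : (Submodule.Quotient.mk (MonoidAlgebra.single h n) : V) =
            n • ρ ⟨h, hh⟩ (Submodule.Quotient.mk 1) := by
          rw [hρ, ← Submodule.Quotient.mk_smul]
          simp
        rw [h1]
        exact W.toAddSubgroup.zsmul_mem (Submodule.subset_span ⟨_, rfl⟩) n
      · exact W.zero_mem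
  have hd' : (Submodule.Quotient.mk (cosetPart C 1 d) : V) ∈ 𝔪 • W := by
    clear hμd
    induction hd using AddSubgroup.closure_induction with
    | mem z hz =>
      obtain ⟨b, x, rfl⟩ := hz
      have h1 : cosetPart C 1 ((MonoidAlgebra.of ℤ H (ι b) ^ m - 1) * x) =
          φ (MonoidAlgebra.of ℤ B b ^ m - 1) * cosetPart C 1 x := by
        rw [sub_mul, one_mul, map_sub, ← map_pow (MonoidAlgebra.of ℤ H),
          cosetPart_mul_of_left C 1 (C.pow_mem (hιC b) m), map_sub, map_pow, sub_mul, map_one,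
          one_mul, map_pow]
        simp [hφ]
      rw [h1]
      exact Submodule.smul_mem_smul (hbm b) (hW x)
    | zero => rw [map_zero]; exact Submodule.zero_mem _
    | add x y _ _ hx hy => rw [map_add]; exact Submodule.add_mem _ hx hy
    | neg x _ hx => rw [map_neg]; exact Submodule.neg_mem _ hx
  have hμQ : cosetPart C 1 μ ∈ Q :=
    cosetPart_mem ι α hα 𝔭 C (fun _ => Iff.rfl) hιC Q.toAddSubgroup hPQ
      (fun s x hx => Q.smul_mem s hx) hrQ htfQ 1 μ (hMQ μ hμ)
  have h1 : cosetPart C 1 (1 : MonoidAlgebra ℤ H) = 1 := by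
    rw [MonoidAlgebra.one_def, cosetPart_single, if_pos (by simp)]
  have h2 : (Submodule.Quotient.mk 1 : V) = Submodule.Quotient.mk (cosetPart C 1 d) := by
    rw [← h1, ← hμd, map_add, Submodule.Quotient.eq, add_sub_cancel_right]
    exact hμQ
  rw [h2]
  exact hd'

end MaximalIdeals

section NoetherianInduction

theorem exists_infinite_normal_commutative {G : Type} [Group G] [Infinite G]
    (hG : (⊤ : Subgroup G).IsPoly) : ∃ Z : Subgroup G, Z.Normal ∧ Infinite Z ∧
      ∀ x ∈ Z, ∀ y ∈ Z, x * y = y * x := by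
  classical
  have hsol : Group.IsSolvable G := by
    have := hG.isSolvable
    exact Group.isSolvable_of_surjective (f := (⊤ : Subgroup G).subtype)
      (fun x => ⟨⟨x, trivial⟩, rfl⟩)
  have hex : ∃ n, Finite (derivedSeries G n) := by
    obtain ⟨n, hn⟩ := hsol.solvable
    exact ⟨n, by rw [hn]; infer_instance⟩
  obtain ⟨n, hn, hmin⟩ : ∃ n, Finite (derivedSeries G n) ∧
      ∀ m < n, ¬ Finite (derivedSeries G m) :=
    ⟨Nat.find hex, Nat.find_spec hex, fun m hm => Nat.find_min hex hm⟩
  obtain _ | n := n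
  · exfalso
    have h1 : Finite (⊤ : Subgroup G) := hn
    exact not_finite_iff_infinite.mpr ‹_› ((Equiv.Set.univ G).finite_iff.mp h1)
  set C := derivedSeries G n with hC
  have hCn : C.Normal := inferInstance
  have hCi : Infinite C := not_finite_iff_infinite.mp (hmin n (Nat.lt_succ_self n))
  have hCfg : Group.FG C := (Group.fg_iff_subgroup_fg C).mpr (hG.mono le_top).fg
  have hcomm : Finite (commutatorSet C) := by
    have hmem : ∀ x : commutatorSet C, ((x : C) : G) ∈ derivedSeries G (n + 1) := by
      rintro ⟨x, a, b, rfl⟩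
      exact Subgroup.commutator_mem_commutator a.2 b.2
    refine Finite.of_injective
      (fun x : commutatorSet C => (⟨_, hmem x⟩ : derivedSeries G (n + 1))) ?_
    intro x y hxy
    exact Subtype.ext (Subtype.ext (Subtype.mk.inj hxy))
  have hidx : (Subgroup.center C).FiniteIndex := inferInstance
  have hZi : Infinite (Subgroup.center C) := by
    by_contra hfin
    rw [not_infinite_iff_finite] at hfin
    have : Finite C := (Subgroup.finite_iff_finite_and_finiteIndex (Subgroup.center C)).mpr ⟨hfin, hidx⟩
    exact not_finite C
  refine ⟨(Subgroup.center C).map C.subtype, inferInstance, ?_, ?_⟩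
  · exact Infinite.of_injective (fun z : Subgroup.center C =>
      (⟨_, Subgroup.mem_map_of_mem _ z.2⟩ : (Subgroup.center C).map C.subtype))
      (fun x y hxy => Subtype.ext (Subtype.ext (by simpa using hxy)))
  · rintro _ ⟨x, hx, rfl⟩ _ ⟨y, hy, rfl⟩
    exact congrArg Subtype.val ((Subgroup.mem_center_iff.mp hx y).symm)

theorem exists_normal_commutative_torsionFree {G : Type} [Group G] [Infinite G]
    (hG : (⊤ : Subgroup G).IsPoly) : ∃ B : Subgroup G, B.Normal ∧ B ≠ ⊥ ∧
      (∀ x ∈ B, ∀ y ∈ B, x * y = y * x) ∧ ∀ x ∈ B, ∀ n : ℕ, n ≠ 0 → x ^ n = 1 → x = 1 := by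
  obtain ⟨Z, hZn, hZi, hZc⟩ := exists_infinite_normal_commutative hG
  let _ : CommGroup Z := { (inferInstance : Group Z) with
    mul_comm := fun x y => Subtype.ext (hZc x x.2 y y.2) }
  have hfg : Group.FG Z := (Group.fg_iff_subgroup_fg Z).mpr (hG.mono le_top).fg
  have hTfg : (CommGroup.torsion Z).FG := by
    have h := ((hG.mono (le_top (a := Z))).top_of_self.mono (le_top (a := CommGroup.torsion Z))).fg
    exact h
  have hTf : Finite (CommGroup.torsion Z) := by
    have : Group.FG (CommGroup.torsion Z) := (Group.fg_iff_subgroup_fg _).mpr hTfg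
    exact CommGroup.finite_of_fg_isMulTorsion _ (CommMonoid.torsion.isMulTorsion (G := Z))
  set k := Nat.card (CommGroup.torsion Z)
  have hk : 0 < k := Nat.card_pos
  have hkT : ∀ z : Z, IsOfFinOrder z → z ^ k = 1 := by
    intro z hz
    have : (⟨z, hz⟩ : CommGroup.torsion Z) ^ k = 1 := pow_card_eq_one'
    exact congrArg Subtype.val this
  let B : Subgroup G :=
    { carrier := {x | ∃ z : Z, (z : G) ^ k = x}
      one_mem' := ⟨1, by simp⟩
      mul_mem' := by
        rintro _ _ ⟨z, rfl⟩ ⟨w, rfl⟩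
        exact ⟨z * w, congrArg Subtype.val (mul_pow z w k)⟩
      inv_mem' := by
        rintro _ ⟨z, rfl⟩
        exact ⟨z⁻¹, by simp⟩ }
  refine ⟨B, ⟨?_⟩, ?_, ?_, ?_⟩
  · rintro _ ⟨z, rfl⟩ g
    exact ⟨⟨g * z * g⁻¹, hZn.conj_mem z z.2 g⟩, by simp [conj_pow]⟩
  · intro hB
    have htor : IsMulTorsion Z := fun z => by
      have : (z : G) ^ k ∈ B := ⟨z, rfl⟩
      rw [hB, Subgroup.mem_bot] at this
      exact isOfFinOrder_iff_pow_eq_one.mpr ⟨k, hk, Subtype.ext this⟩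
    have : Finite Z := CommGroup.finite_of_fg_isMulTorsion _ htor
    exact not_finite Z
  · rintro _ ⟨z, rfl⟩ _ ⟨w, rfl⟩
    exact congrArg Subtype.val (mul_comm (z ^ k) (w ^ k))
  · rintro _ ⟨z, rfl⟩ n hn hz
    have : IsOfFinOrder z := isOfFinOrder_iff_pow_eq_one.mpr ⟨k * n, by positivity,
      Subtype.ext (by rw [pow_mul]; exact hz)⟩
    exact congrArg Subtype.val (hkT z this)

end NoetherianInduction

section NoetherianInduction

theorem MonoidAlgebra.mem_closure_of_mem_ker {H : Type*} [Group H] (N : Subgroup H) [N.Normal]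
    {x : MonoidAlgebra ℤ H}
    (hx : MonoidAlgebra.mapDomainRingHom ℤ (QuotientGroup.mk' N) x = 0) :
    x ∈ AddSubgroup.closure {z | ∃ n ∈ N, ∃ y : MonoidAlgebra ℤ H,
      (MonoidAlgebra.of ℤ H n - 1) * y = z} := by
  set T := AddSubgroup.closure {z | ∃ n ∈ N, ∃ y : MonoidAlgebra ℤ H,
      (MonoidAlgebra.of ℤ H n - 1) * y = z} with hT
  let σ : H ⧸ N → H := Quotient.out
  have hσ : ∀ q, QuotientGroup.mk' N (σ q) = q := fun q => Quotient.out_eq q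
  let s : MonoidAlgebra ℤ (H ⧸ N) →+ MonoidAlgebra ℤ H :=
    (MonoidAlgebra.coeffAddEquiv.symm.toAddMonoidHom.comp
      (Finsupp.mapDomain.addMonoidHom σ)).comp MonoidAlgebra.coeffAddEquiv.toAddMonoidHom
  have hs : ∀ q n, s (MonoidAlgebra.single q n) = MonoidAlgebra.single (σ q) n := by
    intro q n
    apply MonoidAlgebra.coeff_injective
    simp [s]
  have key : ∀ x, x - s (MonoidAlgebra.mapDomainRingHom ℤ (QuotientGroup.mk' N) x) ∈ T := by
    intro x
    induction x using MonoidAlgebra.induction_linear with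
    | zero => simp
    | add f g hf hg =>
      rw [map_add, map_add, add_sub_add_comm]
      exact T.add_mem hf hg
    | single h n =>
      rw [MonoidAlgebra.mapDomainRingHom_apply, MonoidAlgebra.mapDomain_single, hs]
      refine AddSubgroup.subset_closure ⟨h * (σ (QuotientGroup.mk' N h))⁻¹, ?_,
        MonoidAlgebra.single (σ (QuotientGroup.mk' N h)) n, ?_⟩
      · have h1 : h * (σ (QuotientGroup.mk' N h))⁻¹ ∈ (QuotientGroup.mk' N).ker := by
          rw [MonoidHom.mem_ker, map_mul, map_inv, hσ, mul_inv_cancel]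
        rwa [QuotientGroup.ker_mk'] at h1
      · simp [sub_mul]
  have := key x
  rwa [hx, map_zero, sub_zero] at this

variable {H : Type} [Group H] {B : Type} [CommGroup B] (ι : B →* H) (hι : Function.Injective ι)

/-- The component in `ℤB` of an element of `ℤH` along the right coset of `t`. -/
noncomputable def cosetCoeff (t : H) : MonoidAlgebra ℤ H →+ MonoidAlgebra ℤ B :=
  (MonoidAlgebra.coeffAddEquiv.symm.toAddMonoidHom.comp
    (Finsupp.comapDomain.addMonoidHom (f := fun b => ι b * t)
      (fun _ _ h => hι (mul_right_cancel h)))).comp MonoidAlgebra.coeffAddEquiv.toAddMonoidHom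

theorem coeff_cosetCoeff (t : H) (x : MonoidAlgebra ℤ H) (b : B) :
    (cosetCoeff ι hι t x).coeff b = x.coeff (ι b * t) := rfl

theorem cosetCoeff_mapDomainRingHom_mul (t : H) (s : MonoidAlgebra ℤ B) (x : MonoidAlgebra ℤ H) :
    cosetCoeff ι hι t (MonoidAlgebra.mapDomainRingHom ℤ ι s * x) = s * cosetCoeff ι hι t x := by
  induction s using MonoidAlgebra.induction_linear with
  | zero => simp
  | add f g hf hg => rw [map_add, add_mul, add_mul, map_add, hf, hg]
  | single b n =>
    apply MonoidAlgebra.coeff_injective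
    ext b'
    rw [coeff_cosetCoeff, MonoidAlgebra.mapDomainRingHom_apply, MonoidAlgebra.mapDomain_single,
      MonoidAlgebra.coeff_single_mul_apply, MonoidAlgebra.coeff_single_mul_apply, coeff_cosetCoeff]
    simp [mul_assoc]

variable (α : H →* MulAut B)

theorem cosetCoeff_of_mul (hα : ∀ h b, ι (α h b) = h * ι b * h⁻¹) (t h : H)
    (x : MonoidAlgebra ℤ H) :
    cosetCoeff ι hι t (MonoidAlgebra.of ℤ H h * x) =
      MonoidAlgebra.mapDomainRingHom ℤ (α h : B →* B) (cosetCoeff ι hι (h⁻¹ * t) x) := by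
  apply MonoidAlgebra.coeff_injective
  ext b
  obtain ⟨b', rfl⟩ := (α h).surjective b
  have h1 : ∀ y : MonoidAlgebra ℤ B, (MonoidAlgebra.mapDomainRingHom ℤ (α h : B →* B) y).coeff
      (α h b') = y.coeff b' := by
    intro y
    exact Finsupp.mapDomain_apply (α h).injective y.coeff b'
  rw [coeff_cosetCoeff, h1, coeff_cosetCoeff, hα, MonoidAlgebra.of_apply,
    MonoidAlgebra.coeff_single_mul_apply, one_mul]
  congr 1
  group

theorem IsSmallMod.bot_of_ker (hι : Function.Injective ι) [Group.FG B] [IsMulTorsionFree B]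
    (hα : ∀ h b, ι (α h b) = h * ι b * h⁻¹) (N : Subgroup H) [N.Normal]
    (hN : ∀ n ∈ N, ∃ b, ι b = n) {e : ℕ → ℕ →₀ MonoidAlgebra ℤ H} (he : IsRowIdempotent e)
    (h : IsSmallMod e
      (RingHom.ker (MonoidAlgebra.mapDomainRingHom ℤ (QuotientGroup.mk' N)))) :
    IsSmallMod e ⊥ := by
  let δ : Ideal (MonoidAlgebra ℤ B) :=
    Ideal.span {s | ∃ b, ι b ∈ N ∧ MonoidAlgebra.of ℤ B b - 1 = s}
  have hδ : δ ≠ ⊤ := by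
    intro htop
    have hle : δ ≤ RingHom.ker (augmentation B) := by
      rw [Ideal.span_le]
      rintro _ ⟨b, -, rfl⟩
      simp [augmentation_single]
    have h1 : (1 : MonoidAlgebra ℤ B) ∈ RingHom.ker (augmentation B) := hle (htop ▸ trivial)
    rw [RingHom.mem_ker, map_one] at h1
    exact one_ne_zero h1
  have hδα : ∀ h n, ∀ s ∈ δ ^ n, MonoidAlgebra.mapDomainRingHom ℤ (α h : B →* B) s ∈ δ ^ n := by
    intro h n s hs
    have h1 : δ.map (MonoidAlgebra.mapDomainRingHom ℤ (α h : B →* B)) ≤ δ := by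
      rw [Ideal.map_span, Ideal.span_le]
      rintro _ ⟨_, ⟨b, hb, rfl⟩, rfl⟩
      refine Ideal.subset_span ⟨α h b, ?_, by rw [map_sub, map_one]; simp⟩
      rw [hα]
      exact Subgroup.Normal.conj_mem inferInstance _ hb h
    have h2 := Ideal.mem_map_of_mem (MonoidAlgebra.mapDomainRingHom ℤ (α h : B →* B)) hs
    rw [Ideal.map_pow] at h2
    exact Ideal.pow_right_mono h1 n h2
  let F₀ : ℕ → AddSubgroup (MonoidAlgebra ℤ H) := fun n =>
    { carrier := {x | ∀ t, cosetCoeff ι hι t x ∈ δ ^ n}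
      add_mem' := fun hx hy t => by rw [map_add]; exact Ideal.add_mem _ (hx t) (hy t)
      zero_mem' := fun t => by rw [map_zero]; exact Ideal.zero_mem _
      neg_mem' := fun hx t => by rw [map_neg]; exact neg_mem (hx t) }
  let F : ℕ → Ideal (MonoidAlgebra ℤ H) := fun n =>
    { F₀ n with
      smul_mem' := fun r x hx => MonoidAlgebra.mul_mem_of_left (F₀ n)
        (fun h x hx t => by
          rw [cosetCoeff_of_mul ι hι α hα]
          exact hδα _ _ _ (hx _)) r x hx }
  have hF : ∀ n x, x ∈ F n ↔ ∀ t, cosetCoeff ι hι t x ∈ δ ^ n := fun _ _ => Iff.rfl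
  have := h.of_iInf he F (by
    rw [Ideal.eq_top_iff_one, hF]
    intro t
    rw [pow_zero, Ideal.one_eq_top]
    trivial) (fun n a ha b hb => by
    have ha' := MonoidAlgebra.mem_closure_of_mem_ker N ha
    clear ha
    induction ha' using AddSubgroup.closure_induction with
    | mem z hz =>
      obtain ⟨_, hm, y, rfl⟩ := hz
      obtain ⟨b', rfl⟩ := hN _ hm
      rw [mul_assoc]
      have hy := (F n).mul_mem_left y hb
      rw [hF] at hy ⊢
      intro t
      have h1 : MonoidAlgebra.of ℤ H (ι b') - 1 =
        MonoidAlgebra.mapDomainRingHom ℤ ι (MonoidAlgebra.of ℤ B b' - 1) := by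
        rw [map_sub, map_one]; simp
      rw [h1, cosetCoeff_mapDomainRingHom_mul, pow_succ']
      exact Ideal.mul_mem_mul (Ideal.subset_span ⟨b', hm, rfl⟩) (hy t)
    | zero => rw [zero_mul]; exact Ideal.zero_mem _
    | add x y hx' hy' hx hy =>
      rw [add_mul]
      exact Ideal.add_mem _ hx hy
    | neg x hx' hx =>
      rw [neg_mul]
      exact neg_mem hx)
  refine this.mono fun x hx => ?_
  have hft := MonoidAlgebra.finiteType_int (B := B)
  have hnoeth : IsNoetherianRing (MonoidAlgebra ℤ B) := by
    let _ := Ring.toIntAlgebra (MonoidAlgebra ℤ B)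
    exact Algebra.FiniteType.isNoetherianRing ℤ _
  have hinf := Ideal.iInf_pow_eq_bot_of_isDomain δ hδ
  rw [Ideal.mem_bot]
  apply MonoidAlgebra.coeff_injective
  ext t
  have h1 : cosetCoeff ι hι t x = 0 := by
    rw [← Ideal.mem_bot, ← hinf, Ideal.mem_iInf]
    exact fun n => (Ideal.mem_iInf.mp hx n) t
  have h2 := coeff_cosetCoeff ι hι t x 1
  rw [h1, map_one ι, one_mul] at h2
  simpa using h2.symm

end NoetherianInduction

section NoetherianInduction

theorem MonoidAlgebra.mapDomainRingHom_surjective {G H : Type*} [Monoid G] [Monoid H] (f : G →* H)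
    (hf : Function.Surjective f) : Function.Surjective (MonoidAlgebra.mapDomainRingHom ℤ f) := by
  intro y
  induction y using MonoidAlgebra.induction_linear with
  | zero => exact ⟨0, map_zero _⟩
  | add x y hx hy =>
    obtain ⟨x, rfl⟩ := hx
    obtain ⟨y, rfl⟩ := hy
    exact ⟨x + y, map_add _ _ _⟩
  | single h a =>
    obtain ⟨g, rfl⟩ := hf h
    exact ⟨.single g a, MonoidAlgebra.mapDomain_single⟩

/-- Nonzero row idempotents over `R` generate no proper two-sided ideal up to finitely many
columns. -/
def HasBigRowIdempotents (R : Type*) [Ring R] : Prop :=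
  ∀ e : ℕ → ℕ →₀ R, IsRowIdempotent e → ¬ IsSmallMod e ⊥ →
    ∀ M : Ideal R, M.IsTwoSided → IsSmallMod e M → M = ⊤

theorem Ideal.exists_le_maximal_isTwoSided {R : Type*} [Ring R] [IsNoetherianRing R]
    (I : Ideal R) (hI : I.IsTwoSided) (hIt : I ≠ ⊤) :
    ∃ M : Ideal R, I ≤ M ∧ M.IsTwoSided ∧ M ≠ ⊤ ∧
      ∀ N : Ideal R, N.IsTwoSided → M ≤ N → N ≠ ⊤ → N ≤ M := by
  obtain ⟨M, ⟨h1, h2, h3⟩, hmax⟩ := WellFounded.has_min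
    (wellFounded_gt : WellFounded ((· > ·) : Ideal R → Ideal R → Prop))
    {M | I ≤ M ∧ M.IsTwoSided ∧ M ≠ ⊤} ⟨I, le_rfl, hI, hIt⟩
  refine ⟨M, h1, h2, h3, fun N hN hMN hNt => ?_⟩
  by_contra h
  exact hmax N ⟨h1.trans hMN, hN, hNt⟩ (lt_of_le_not_ge hMN h)

theorem hasBigRowIdempotents_of_quotients {H : Type} [Group H] [Infinite H]
    (hH : (⊤ : Subgroup H).IsPoly)
    (ih : ∀ (N : Subgroup H) [N.Normal], N ≠ ⊥ → HasBigRowIdempotents (MonoidAlgebra ℤ (H ⧸ N))) :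
    HasBigRowIdempotents (MonoidAlgebra ℤ H) := by
  intro e he hbig I hI hsmall
  by_contra hIt
  have hnoeth : IsNoetherianRing (MonoidAlgebra ℤ H) := hH.isNoetherianRing
  obtain ⟨M, hIM, hM2, hMt, hmax⟩ := I.exists_le_maximal_isTwoSided hI hIt
  obtain ⟨B, hBn, hB, hcomm, htf⟩ := exists_normal_commutative_torsionFree hH
  let _ : CommGroup B := { (inferInstance : Group B) with
    mul_comm := fun x y => Subtype.ext (hcomm x x.2 y y.2) }
  have hfg : Group.FG B := (Group.fg_iff_subgroup_fg B).mpr (hH.mono le_top).fg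
  have hBtf : IsMulTorsionFree B := by
    rw [isMulTorsionFree_iff_not_isOfFinOrder]
    intro a ha hfin
    obtain ⟨n, hn, han⟩ := isOfFinOrder_iff_pow_eq_one.mp hfin
    exact ha (Subtype.ext (htf a a.2 n hn.ne' (congrArg Subtype.val han)))
  let α : H →* MulAut B := MulAut.conjNormal
  have hα : ∀ h (b : B), B.subtype (α h b) = h * B.subtype b * h⁻¹ := fun h b =>
    MulAut.conjNormal_apply h b
  obtain ⟨m, hm, hMm⟩ := exists_pow_sub_one_add_ne_one B.subtype α B.subtype_injective hα hH M hMt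
    hmax
  let N : Subgroup H := ((powMonoidHom m : B →* B).range).map B.subtype
  have hmemN : ∀ x, x ∈ N ↔ ∃ b : B, (b : H) ^ m = x := by
    intro x
    constructor
    · rintro ⟨_, ⟨b, rfl⟩, rfl⟩
      exact ⟨b, rfl⟩
    · rintro ⟨b, rfl⟩
      exact ⟨b ^ m, ⟨b, rfl⟩, rfl⟩
  have hNn : N.Normal := ⟨fun x hx g => by
    rw [hmemN] at hx ⊢
    obtain ⟨b, rfl⟩ := hx
    exact ⟨⟨g * b * g⁻¹, hBn.conj_mem b b.2 g⟩, by simp [conj_pow]⟩⟩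
  have hNbot : N ≠ ⊥ := by
    obtain ⟨b, hb, hb1⟩ := B.bot_or_exists_ne_one.resolve_left hB
    intro h
    have h1 : b ^ m ∈ N := (hmemN _).mpr ⟨⟨b, hb⟩, rfl⟩
    rw [h, Subgroup.mem_bot] at h1
    exact hb1 (htf b hb m hm.ne' h1)
  set φ := MonoidAlgebra.mapDomainRingHom ℤ (QuotientGroup.mk' N) with hφ
  have hφs : Function.Surjective φ :=
    MonoidAlgebra.mapDomainRingHom_surjective _ (QuotientGroup.mk'_surjective N)
  have hker : ¬ IsSmallMod e (RingHom.ker φ) := fun h => hbig <|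
    h.bot_of_ker B.subtype α B.subtype_injective hα N (fun n hn => by
      obtain ⟨b, rfl⟩ := (hmemN n).mp hn
      exact ⟨b ^ m, rfl⟩) he
  have hmemmap : ∀ y, y ∈ M.map φ ↔ ∃ x ∈ M, φ x = y := fun y =>
    Ideal.mem_map_iff_of_surjective φ hφs
  have htop := ih N hNbot (rowMap φ e) (he.map φ) (by
      rw [isSmallMod_rowMap]
      exact hker) (M.map φ)
    ⟨fun {x} y hx => by
      obtain ⟨x, hxM, rfl⟩ := (hmemmap _).mp hx
      obtain ⟨y, rfl⟩ := hφs y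
      rw [← map_mul]
      exact Ideal.mem_map_of_mem φ (M.mul_mem_right _ hxM)⟩
    (by
      rw [isSmallMod_rowMap]
      exact (hsmall.mono hIM).mono Ideal.le_comap_map)
  obtain ⟨μ, hμ, hμ1⟩ := (hmemmap 1).mp (htop ▸ Submodule.mem_top)
  have h1 : φ (1 - μ) = 0 := by rw [map_sub, map_one, hμ1, sub_self]
  refine hMm μ hμ (1 - μ) ?_ (add_sub_cancel _ _)
  refine AddSubgroup.closure_mono ?_ (MonoidAlgebra.mem_closure_of_mem_ker N h1)
  rintro _ ⟨n, hn, y, rfl⟩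
  obtain ⟨b, rfl⟩ := (hmemN n).mp hn
  exact ⟨b, y, by rw [map_pow]; rfl⟩

theorem Subgroup.IsPoly.hasBigRowIdempotents
    (hfin : ∀ (F : Type) [Group F], Finite F → Group.IsSolvable F →
      HasBigRowIdempotents (MonoidAlgebra ℤ F))
    {G : Type} [Group G] (hG : (⊤ : Subgroup G).IsPoly) :
    HasBigRowIdempotents (MonoidAlgebra ℤ G) := by
  have hwf : WellFoundedGT (Subgroup G) := by
    rw [wellFoundedGT_iff_monotone_chain_condition]
    intro a
    obtain ⟨S, hS⟩ := (hG.mono (le_top : (⨆ n, a n) ≤ ⊤)).fg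
    have hex : ∀ s ∈ S, ∃ n, s ∈ a n := fun s hs =>
      (Subgroup.mem_iSup_of_directed a.monotone.directed_le).mp
        (hS ▸ Subgroup.subset_closure hs)
    choose! n hn using hex
    refine ⟨S.sup n, fun m hm => le_antisymm (a.monotone hm) ?_⟩
    refine (le_iSup a m).trans ?_
    rw [← hS, Subgroup.closure_le]
    exact fun s hs => a.monotone (Finset.le_sup hs) (hn s hs)
  suffices h : ∀ (N : Subgroup G) (H : Type) [Group H] (f : G →* H), Function.Surjective f →
      f.ker = N → HasBigRowIdempotents (MonoidAlgebra ℤ H) from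
    h _ G (MonoidHom.id G) Function.surjective_id rfl
  intro N
  induction N using WellFoundedGT.induction with
  | _ N ih =>
  intro H _ f hf hN
  have hH : (⊤ : Subgroup H).IsPoly := by
    have h := hG.map f
    rwa [← MonoidHom.range_eq_map, MonoidHom.range_eq_top.mpr hf] at h
  obtain hfinH | hinf := finite_or_infinite H
  · have := hH.isSolvable
    exact hfin H hfinH (Group.isSolvable_of_surjective (f := (⊤ : Subgroup H).subtype)
      (fun x => ⟨⟨x, trivial⟩, rfl⟩))
  · refine hasBigRowIdempotents_of_quotients hH fun K _ hK => ?_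
    refine ih _ ?_ (H ⧸ K) ((QuotientGroup.mk' K).comp f)
      ((QuotientGroup.mk'_surjective K).comp hf) rfl
    rw [← hN]
    obtain ⟨x, hx, hx1⟩ := K.bot_or_exists_ne_one.resolve_left hK
    obtain ⟨g, rfl⟩ := hf x
    refine SetLike.lt_iff_le_and_exists.mpr ⟨fun y hy => ?_, g, ?_, hx1⟩
    · rw [MonoidHom.mem_ker] at hy ⊢
      rw [MonoidHom.comp_apply, hy, map_one]
    · exact (QuotientGroup.eq_one_iff _).mpr hx

end NoetherianInduction

section Filtration

theorem IsSmallMod.ker_of_filtration {R S : Type*} [Ring R] [Ring S] {e : ℕ → ℕ →₀ R}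
    (he : IsRowIdempotent e) (φ : R →+* S) (J : ℕ → Ideal S) (h0 : J 0 = ⊤)
    (hmul : ∀ n, ∀ a ∈ J 1, ∀ b ∈ J n, a * b ∈ J (n + 1)) (hbot : ⨅ n, J n = ⊥)
    (h : IsSmallMod e ((J 1).comap φ)) : IsSmallMod e (RingHom.ker φ) := by
  refine (h.of_iInf he (fun n => (J n).comap φ) (by rw [h0]; rfl) fun n a ha b hb => ?_).mono ?_
  · rw [Ideal.mem_comap, map_mul]
    exact hmul n _ ha _ hb
  · intro x hx
    rw [Submodule.mem_iInf] at hx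
    have h1 : φ x ∈ ⨅ n, J n := (Submodule.mem_iInf _).mpr hx
    rwa [hbot] at h1

theorem IsSmallMod.ker_of_matrix_filtration {R T ι : Type*} [Ring R] [Ring T] [Fintype ι]
    [DecidableEq ι] {e : ℕ → ℕ →₀ R} (he : IsRowIdempotent e) (φ : R →+* Matrix ι ι T)
    (J : ℕ → Ideal T) (h0 : J 0 = ⊤) (hmul : ∀ n, ∀ a ∈ J 1, ∀ b ∈ J n, a * b ∈ J (n + 1))
    (hbot : ⨅ n, J n = ⊥) (h : IsSmallMod e (((J 1).matrix ι).comap φ)) :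
    IsSmallMod e (RingHom.ker φ) := by
  refine h.ker_of_filtration he φ (fun n => (J n).matrix ι) ?_ ?_ ?_
  · rw [h0, Ideal.matrix_top]
  · intro n a ha b hb i j
    rw [Matrix.mul_apply]
    exact Ideal.sum_mem _ fun l _ => hmul n _ (ha i l) _ (hb l j)
  · refine eq_bot_iff.mpr fun M hM => ?_
    rw [Submodule.mem_iInf] at hM
    ext i j
    have h1 : M i j ∈ ⨅ n, J n := (Submodule.mem_iInf _).mpr fun n => hM n i j
    rwa [hbot] at h1

variable {A T : Type*} [CommRing A] [Ring T] [Algebra A T]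

/-- The left ideal of an `A`-algebra generated by an ideal of `A`. -/
def Ideal.smulTop (I : Ideal A) (T : Type*) [Ring T] [Algebra A T] : Ideal T :=
  { (I • ⊤ : Submodule A T) with
    smul_mem' := fun t x hx => by
      refine Submodule.smul_induction_on (p := fun x => t • x ∈ (I • ⊤ : Submodule A T)) hx
        (fun r hr s _ => ?_) fun x y hx hy => ?_
      · rw [smul_eq_mul, mul_smul_comm]
        exact Submodule.smul_mem_smul hr trivial
      · rw [smul_add]
        exact add_mem hx hy }

theorem Ideal.mem_smulTop {I : Ideal A} {x : T} : x ∈ I.smulTop T ↔ x ∈ (I • ⊤ : Submodule A T) :=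
  Iff.rfl

theorem Ideal.mul_mem_smulTop {I J : Ideal A} {x y : T} (hx : x ∈ I.smulTop T)
    (hy : y ∈ J.smulTop T) : x * y ∈ (I * J).smulTop T := by
  rw [mem_smulTop] at *
  refine Submodule.smul_induction_on (p := fun x => x * y ∈ ((I * J) • ⊤ : Submodule A T)) hx
    (fun r hr s _ => ?_) fun x z hx hz => ?_
  · rw [smul_mul_assoc, Submodule.mul_smul]
    exact Submodule.smul_mem_smul hr ((J.smulTop T).mul_mem_left s hy)
  · rw [add_mul]
    exact add_mem hx hz

theorem IsSmallMod.ker_of_smulTop [IsDomain A] [IsNoetherianRing A] [Module.Finite A T]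
    [Module.IsTorsionFree A T] {R ι : Type*} [Ring R] [Fintype ι] [DecidableEq ι]
    {e : ℕ → ℕ →₀ R} (he : IsRowIdempotent e) (φ : R →+* Matrix ι ι T) (I : Ideal A) (hI : I ≠ ⊤)
    (h : IsSmallMod e (((I.smulTop T).matrix ι).comap φ)) : IsSmallMod e (RingHom.ker φ) := by
  refine IsSmallMod.ker_of_matrix_filtration he φ (fun n => (I ^ n).smulTop T) ?_ ?_ ?_
    (by simpa using h)
  · refine eq_top_iff.mpr fun x _ => ?_
    rw [pow_zero, Ideal.one_eq_top, Ideal.mem_smulTop, Submodule.top_smul]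
    trivial
  · intro n a ha b hb
    rw [pow_succ']
    rw [pow_one] at ha
    exact Ideal.mul_mem_smulTop ha hb
  · refine eq_bot_iff.mpr fun x hx => ?_
    have h1 : x ∈ (⨅ i : ℕ, I ^ i • ⊤ : Submodule A T) := by
      rw [Submodule.mem_iInf] at hx ⊢
      exact hx
    rwa [Ideal.iInf_pow_smul_eq_bot_of_isTorsionFree I hI] at h1

end Filtration

section InducedSmall

variable {F : Type} [Group F] {A T : Type*} [CommRing A] [Ring T] [Algebra A T]

theorem inducedHom_apply (H : Subgroup F) [Fintype (F ⧸ H)] [DecidableEq (F ⧸ H)] [Fintype H]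
    (σ : H →* T) (x : MonoidAlgebra ℤ F) (s t : F ⧸ H) :
    inducedHom H σ x s t = ∑ h : H, x.coeff (s.out * h * t.out⁻¹) • σ h :=
  lift_inducedMatrix_apply H σ x s t

theorem sum_coeff_smul_of_inducedHom_eq_zero (H : Subgroup F) [Fintype (F ⧸ H)]
    [DecidableEq (F ⧸ H)] [Fintype H] (σ : H →* T) {x : MonoidAlgebra ℤ F}
    (hx : inducedHom H σ x = 0) (g g' : F) : ∑ h : H, x.coeff (g * h * g'⁻¹) • σ h = 0 := by
  obtain ⟨k, hk⟩ := QuotientGroup.mk_out_eq_mul H g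
  obtain ⟨k', hk'⟩ := QuotientGroup.mk_out_eq_mul H g'
  have h1 := inducedHom_apply H σ x (QuotientGroup.mk g) (QuotientGroup.mk g')
  rw [hx, hk, hk'] at h1
  have h2 : ∑ h : H, x.coeff (g * h * g'⁻¹) • σ h =
      σ k * (∑ h : H, x.coeff (g * k * h * (g' * k')⁻¹) • σ h) * σ k'⁻¹ := by
    rw [Finset.mul_sum, Finset.sum_mul]
    refine Fintype.sum_equiv ((Equiv.mulLeft k⁻¹).trans (Equiv.mulRight k')) _ _ fun h => ?_
    rw [mul_smul_comm, smul_mul_assoc, ← map_mul, ← map_mul]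
    congr 2
    · simp [mul_assoc]
    · simp [mul_assoc]
  rw [h2, ← h1, Matrix.zero_apply, mul_zero, zero_mul]

/-- The twist of `σ` by a linear character. -/
def MonoidHom.twist {H : Type*} [Group H] (χ : H →* Aˣ) (σ : H →* T) : H →* T where
  toFun h := (χ h : A) • σ h
  map_one' := by simp
  map_mul' x y := by simp [mul_smul, smul_comm (χ x : A)]

theorem MonoidHom.twist_apply {H : Type*} [Group H] (χ : H →* Aˣ) (σ : H →* T) (h : H) :
    χ.twist σ h = (χ h : A) • σ h := rfl

theorem geom_sum_units_eq_zero [IsDomain A] {u : Aˣ} {p : ℕ} (hu : u ^ p = 1) (hu1 : u ≠ 1) :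
    ∑ i ∈ Finset.range p, (u : A) ^ i = 0 := by
  have h := mul_geom_sum (u : A) p
  rw [← Units.val_pow_eq_pow_val, hu, Units.val_one, sub_self] at h
  exact (mul_eq_zero.mp h).resolve_left fun h0 => hu1 (Units.ext (sub_eq_zero.mp h0))

theorem Ideal.val_sub_one_mem_of_pow_eq_one (I : Ideal A) [I.IsMaximal] {p : ℕ} (hp : p.Prime)
    (hpI : (p : A) ∈ I) {u : Aˣ} (hu : u ^ p = 1) : (u : A) - 1 ∈ I := by
  have := Fact.mk hp
  have : CharP (A ⧸ I) p := by
    refine (CharP.charP_iff_prime_eq_zero hp).mpr ?_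
    rw [← map_natCast (Ideal.Quotient.mk I)]
    exact Ideal.Quotient.eq_zero_iff_mem.mpr hpI
  rw [← Ideal.Quotient.eq_zero_iff_mem]
  refine eq_zero_of_pow_eq_zero (n := p) ?_
  rw [map_sub, map_one, sub_pow_char, one_pow, ← map_pow, ← Units.val_pow_eq_pow_val, hu,
    Units.val_one, map_one, sub_self]

variable [IsDomain A] [IsNoetherianRing A] [Module.Finite A T]
  [Module.IsTorsionFree A T]

theorem IsSmallMod.twist (H : Subgroup F) [Fintype (F ⧸ H)] [DecidableEq (F ⧸ H)] [Finite F]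
    {e : ℕ → ℕ →₀ MonoidAlgebra ℤ F} (he : IsRowIdempotent e) {p : ℕ} (hp : p.Prime)
    (hpA : ¬ IsUnit (p : A)) (χ : H →* Aˣ) (hχ : ∀ h, χ h ^ p = 1) (σ : H →* T)
    (hs : IsSmallMod e (RingHom.ker (inducedHom H σ))) :
    IsSmallMod e (RingHom.ker (inducedHom H (χ.twist σ))) := by
  have := Fintype.ofFinite H
  obtain ⟨I, hI, hpI⟩ := exists_max_ideal_of_mem_nonunits hpA
  refine IsSmallMod.ker_of_smulTop he _ I hI.ne_top (hs.mono ?_)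
  intro x hx
  rw [Ideal.mem_comap, Ideal.mem_matrix]
  intro s t
  have h1 : inducedHom H (χ.twist σ) x s t = inducedHom H (χ.twist σ) x s t -
      inducedHom H σ x s t := by
    rw [RingHom.mem_ker.mp hx, Matrix.zero_apply, sub_zero]
  rw [h1, inducedHom_apply, inducedHom_apply, ← Finset.sum_sub_distrib]
  refine Ideal.sum_mem _ fun h _ => ?_
  rw [← smul_sub, MonoidHom.twist_apply]
  nth_rw 2 [← one_smul A (σ h)]
  rw [← sub_smul]
  refine zsmul_mem (?_ : _ ∈ I.smulTop T) _
  rw [Ideal.mem_smulTop]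
  exact Submodule.smul_mem_smul (I.val_sub_one_mem_of_pow_eq_one hp hpI (hχ h)) trivial

theorem IsSmallMod.restrict [CharZero A] (H N : Subgroup F) [Fintype (F ⧸ H)] [DecidableEq (F ⧸ H)]
    [Fintype (F ⧸ N)] [DecidableEq (F ⧸ N)] [Finite F] (hNH : N ≤ H)
    {e : ℕ → ℕ →₀ MonoidAlgebra ℤ F} (he : IsRowIdempotent e) {p : ℕ} (hp : p.Prime)
    (hpA : ¬ IsUnit (p : A)) (χ : H →* Aˣ) (hχ : ∀ h, χ h ^ p = 1)
    (hχN : ∀ h : H, χ h = 1 ↔ (h : F) ∈ N) (σ : H →* T)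
    (hs : IsSmallMod e (RingHom.ker (inducedHom H σ))) :
    IsSmallMod e (RingHom.ker (inducedHom N (σ.comp (Subgroup.inclusion hNH)))) := by
  classical
  have := Fintype.ofFinite H
  have := Fintype.ofFinite N
  have h1 : ∀ i : ℕ, IsSmallMod e (RingHom.ker (inducedHom H ((χ ^ i).twist σ))) := fun i =>
    hs.twist H he hp hpA (χ ^ i) (fun h => by
      rw [MonoidHom.pow_apply, ← pow_mul, mul_comm, pow_mul, hχ, one_pow]) σ
  choose K hK using h1
  refine ⟨(Finset.range p).sup K, fun i j hj => ?_⟩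
  set x := e i j
  rw [RingHom.mem_ker]
  ext s t
  rw [inducedHom_apply, Matrix.zero_apply]
  have h2 : ∀ k ∈ Finset.range p, ∑ h : H, x.coeff (s.out * h * t.out⁻¹) •
      ((χ h : A) ^ k • σ h) = 0 := fun k hk => by
    have h3 := sum_coeff_smul_of_inducedHom_eq_zero H _
      ((RingHom.mem_ker).mp (hK k i j ((Finset.le_sup hk).trans hj))) s.out t.out
    simpa [MonoidHom.twist_apply] using h3
  have h3 : (p : A) • ∑ h : N, x.coeff (s.out * h * t.out⁻¹) • σ (Subgroup.inclusion hNH h) = 0 := by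
    rw [← Finset.sum_eq_zero h2, Finset.sum_comm, Finset.smul_sum]
    have h4 : ∀ h : H, ∑ k ∈ Finset.range p, x.coeff (s.out * h * t.out⁻¹) •
        ((χ h : A) ^ k • σ h) = if (h : F) ∈ N then
          (p : A) • x.coeff (s.out * h * t.out⁻¹) • σ h else 0 := by
      intro h
      rw [← Finset.smul_sum, ← Finset.sum_smul]
      split_ifs with hh
      · rw [(hχN h).mpr hh]
        simp [smul_comm]
      · rw [geom_sum_units_eq_zero (hχ h) (fun h1 => hh ((hχN h).mp h1)), zero_smul, smul_zero]
    rw [Finset.sum_congr rfl fun h _ => h4 h, ← Finset.sum_filter]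
    refine Finset.sum_bij (fun h _ => Subgroup.inclusion hNH h) (fun h _ => ?_)
      (fun a _ b _ h => Subgroup.inclusion_injective hNH h) (fun b hb => ?_) fun h _ => rfl
    · simp
    · exact ⟨⟨b, (Finset.mem_filter.mp hb).2⟩, Finset.mem_univ _, rfl⟩
  have hp0 : (p : A) ≠ 0 := Nat.cast_ne_zero.mpr hp.ne_zero
  exact (smul_eq_zero_iff_right hp0).mp h3

end InducedSmall

section RestrictToTrivial

variable {F : Type} [Group F] {A T : Type*} [CommRing A] [Ring T] [Algebra A T]

theorem exists_character_of_prime_order {H A : Type*} [Group H] [Finite H] [Nontrivial H]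
    [Group.IsSolvable H] [CommRing A] [IsDomain A] [HasEnoughRootsOfUnity A (Nat.card H)] :
    ∃ (p : ℕ) (χ : H →* Aˣ), p.Prime ∧ (∀ h, χ h ^ p = 1) ∧ χ ≠ 1 := by
  have hlt : commutator H < ⊤ := Group.IsSolvable.commutator_lt_top_of_nontrivial H
  obtain ⟨a, -, ha⟩ := SetLike.exists_of_lt hlt
  have : NeZero (Nat.card H) := ⟨Nat.card_pos.ne'⟩
  have hexp : HasEnoughRootsOfUnity A (Monoid.exponent (Abelianization H)) :=
    HasEnoughRootsOfUnity.of_dvd A ((Group.exponent_quotient_dvd (commutator H)).trans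
      Group.exponent_dvd_nat_card)
  obtain ⟨φ, hφ⟩ := CommGroup.exists_apply_ne_one_of_hasEnoughRootsOfUnity (Abelianization H) A
    (a := Abelianization.of a) (fun h => ha ((QuotientGroup.eq_one_iff a).mp h))
  let χ : H →* Aˣ := φ.comp Abelianization.of
  have hχ : χ ≠ 1 := fun h => hφ (DFunLike.congr_fun h a)
  have hfin : IsOfFinOrder χ := isOfFinOrder_iff_pow_eq_one.mpr ⟨Nat.card H, Nat.card_pos, by
    ext h
    rw [MonoidHom.pow_apply, ← map_pow, pow_card_eq_one', map_one]
    rfl⟩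
  have hne : orderOf χ ≠ 1 := fun h => hχ (orderOf_eq_one_iff.mp h)
  have hp := Nat.minFac_prime hne
  have hord := orderOf_pow_orderOf_div hfin.orderOf_pos.ne' (Nat.minFac_dvd (orderOf χ))
  refine ⟨_, χ ^ (orderOf χ / (orderOf χ).minFac), hp, fun h => ?_, fun h => ?_⟩
  · have h1 := pow_orderOf_eq_one (χ ^ (orderOf χ / (orderOf χ).minFac))
    rw [hord] at h1
    exact DFunLike.congr_fun h1 h
  · rw [h, orderOf_one] at hord
    exact hp.one_lt.ne hord

theorem IsSmallMod.bot_of_inducedHom [IsDomain A] [IsNoetherianRing A] [Module.Finite A T]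
    [Module.IsTorsionFree A T] [CharZero A] [Nontrivial T] [Finite F] [Group.IsSolvable F]
    [HasEnoughRootsOfUnity A (Nat.card F)] (hA : ∀ p : ℕ, p.Prime → ¬ IsUnit (p : A))
    {e : ℕ → ℕ →₀ MonoidAlgebra ℤ F} (he : IsRowIdempotent e) (H : Subgroup F) [Fintype (F ⧸ H)]
    [DecidableEq (F ⧸ H)] (σ : H →* T) (hs : IsSmallMod e (RingHom.ker (inducedHom H σ))) :
    IsSmallMod e ⊥ := by
  classical
  obtain ⟨n, hn⟩ : ∃ n, Nat.card H = n := ⟨_, rfl⟩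
  have : NeZero (Nat.card F) := ⟨Nat.card_pos.ne'⟩
  induction n using Nat.strong_induction_on generalizing H with
  | _ n ih =>
  by_cases hH : H = ⊥
  · subst hH
    refine hs.mono fun x hx => ?_
    have := Fintype.ofFinite (⊥ : Subgroup F)
    ext g
    have h := sum_coeff_smul_of_inducedHom_eq_zero _ σ (RingHom.mem_ker.mp hx) g 1
    rw [Fintype.sum_unique] at h
    have h1 : (x.coeff g : A) • (1 : T) = 0 := by
      simpa [Int.cast_smul_eq_zsmul, Subsingleton.elim _ (1 : (⊥ : Subgroup F))] using h
    have h2 := (smul_eq_zero_iff_left (one_ne_zero (α := T))).mp h1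
    simpa using h2
  · have : Nontrivial H := (Subgroup.nontrivial_iff_ne_bot H).mpr hH
    have : HasEnoughRootsOfUnity A (Nat.card H) :=
      HasEnoughRootsOfUnity.of_dvd A (Subgroup.card_subgroup_dvd_card H)
    obtain ⟨p, χ, hp, hχ, hχ1⟩ := exists_character_of_prime_order (H := H) (A := A)
    have hNH : χ.ker.map H.subtype ≤ H := Subgroup.map_subtype_le _
    have := Fintype.ofFinite (F ⧸ χ.ker.map H.subtype)
    refine ih _ ?_ (χ.ker.map H.subtype) _
      (hs.restrict H _ hNH he hp (hA p hp) χ hχ (fun h => ?_) σ) rfl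
    · rw [← hn, Subgroup.card_map_of_injective H.subtype_injective]
      refine lt_of_le_of_ne (Subgroup.card_le_card_group _) fun h => hχ1 ?_
      exact MonoidHom.ker_eq_top_iff.mp (Subgroup.eq_top_of_card_eq _ h)
    · rw [← MonoidHom.mem_ker]
      simp

end RestrictToTrivial

section RepresentationKernel

variable {F : Type} [Group F]

/-- The ring homomorphism attached to a matrix representation. -/
noncomputable def representationHom {S : Type*} [Ring S] (ρ : F →* S) :
    MonoidAlgebra ℤ F →+* S :=
  MonoidAlgebra.liftNCRingHom (Int.castRingHom S) ρ fun _ _ => Int.cast_commute _ _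

theorem representationHom_apply [Fintype F] {S : Type*} [Ring S] (ρ : F →* S)
    (x : MonoidAlgebra ℤ F) : representationHom ρ x = ∑ g, x.coeff g • ρ g := by
  induction x using MonoidAlgebra.induction_linear with
  | zero => simp
  | add x y hx hy => simp [hx, hy, add_smul, Finset.sum_add_distrib]
  | single g a =>
    classical
    simp [representationHom, MonoidAlgebra.liftNCRingHom, Finsupp.single_apply, ite_smul,
      MonoidAlgebra.liftNC_single]

theorem IsSmallMod.bot_of_representation_algebra {A S : Type*} [CommRing A] [IsDomain A]
    [IsNoetherianRing A] [CharZero A] [Finite F] [Group.IsSolvable F]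
    [HasEnoughRootsOfUnity A (Nat.card F)] (hA : ∀ p : ℕ, p.Prime → ¬ IsUnit (p : A))
    [Ring S] [Nontrivial S] [Algebra A S] [Module.IsTorsionFree A S]
    {e : ℕ → ℕ →₀ MonoidAlgebra ℤ F} (he : IsRowIdempotent e) (ρ : F →* S)
    (hs : IsSmallMod e (RingHom.ker (representationHom ρ))) : IsSmallMod e ⊥ := by
  classical
  let T : Subalgebra A S := Algebra.adjoin A (Set.range ρ)
  have hT : ∀ g, ρ g ∈ T := fun g => Algebra.subset_adjoin ⟨g, rfl⟩
  let ρT : F →* T := ρ.codRestrict T hT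
  have hfin : Module.Finite A T := by
    have h1 : (Subalgebra.toSubmodule T).FG := by
      rw [Algebra.adjoin_eq_span, ← MonoidHom.coe_mrange, Submonoid.closure_eq,
        MonoidHom.coe_mrange]
      exact Submodule.fg_span (Set.finite_range ρ)
    exact Module.Finite.iff_fg.mpr h1
  have := Fintype.ofFinite F
  have := Fintype.ofFinite (⊤ : Subgroup F)
  have := Fintype.ofFinite (F ⧸ (⊤ : Subgroup F))
  refine IsSmallMod.bot_of_inducedHom (A := A) (T := T) hA he ⊤ (ρT.comp (Subgroup.subtype ⊤))
    (hs.mono fun x hx => ?_)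
  rw [RingHom.mem_ker, representationHom_apply] at hx
  rw [RingHom.mem_ker]
  ext s t
  rw [inducedHom_apply, Matrix.zero_apply]
  have h1 : ∑ h : (⊤ : Subgroup F), x.coeff (s.out * h * t.out⁻¹) • ρ h =
      ρ s.out⁻¹ * (∑ g, x.coeff g • ρ g) * ρ t.out := by
    rw [Finset.mul_sum, Finset.sum_mul]
    refine Fintype.sum_equiv (Subgroup.topEquiv.toEquiv.trans
      ((Equiv.mulLeft s.out).trans (Equiv.mulRight t.out⁻¹))) _ _ fun h => ?_
    rw [mul_smul_comm, smul_mul_assoc, ← map_mul, ← map_mul]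
    congr 2
    change (h : F) = s.out⁻¹ * (s.out * h * t.out⁻¹) * t.out
    group
  rw [hx, mul_zero, zero_mul] at h1
  rw [ZeroMemClass.coe_zero, ← h1]
  simp [ρT]

theorem IsSmallMod.bot_of_representation [Finite F] [Group.IsSolvable F] {K S : Type*} [Field K]
    [CharZero K] [IsAlgClosed K] [Ring S] [Nontrivial S] [Algebra K S]
    {e : ℕ → ℕ →₀ MonoidAlgebra ℤ F} (he : IsRowIdempotent e) (ρ : F →* S)
    (hs : IsSmallMod e (RingHom.ker (representationHom ρ))) : IsSmallMod e ⊥ := by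
  have : NeZero (Nat.card F) := ⟨Nat.card_pos.ne'⟩
  have : NeZero (Nat.card F : K) := ⟨Nat.cast_ne_zero.mpr Nat.card_pos.ne'⟩
  obtain ⟨ζ, hζ⟩ := HasEnoughRootsOfUnity.exists_primitiveRoot K (Nat.card F)
  let A := Algebra.adjoin ℤ (({ζ} : Finset K) : Set K)
  have hζA : ζ ∈ A := Algebra.subset_adjoin (by simp)
  have hIntegral : ∀ a ∈ A, IsIntegral ℤ a := fun a ha => by
    refine Algebra.adjoin_le (S := integralClosure ℤ K) ?_ ha
    intro x hx
    rw [Finset.coe_singleton, Set.mem_singleton_iff] at hx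
    exact hx ▸ hζ.isIntegral Nat.card_pos
  have : IsNoetherian ℤ A := isNoetherian_adjoin_finset _ fun x hx =>
    hIntegral x (Algebra.subset_adjoin hx)
  have : IsNoetherianRing A := isNoetherian_of_tower ℤ this
  have : HasEnoughRootsOfUnity A (Nat.card F) :=
    ⟨⟨⟨ζ, hζA⟩, IsPrimitiveRoot.of_map_of_injective (f := A.val) hζ Subtype.val_injective⟩,
      rootsOfUnity.isCyclic A _⟩
  have hA : ∀ p : ℕ, p.Prime → ¬ IsUnit (p : A) := by
    intro p hp hu
    obtain ⟨a, ha⟩ := hu.exists_right_inv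
    have h1 : (p : K) * a = 1 := by simpa using congrArg Subtype.val ha
    have hp0 : (p : K) ≠ 0 := Nat.cast_ne_zero.mpr hp.ne_zero
    have h2 : algebraMap ℚ K (1 / p) = a := by
      rw [map_div₀, map_one, map_natCast, div_eq_iff hp0, mul_comm, h1]
    have h3 : IsIntegral ℤ (1 / p : ℚ) := by
      rw [← isIntegral_algebraMap_iff (algebraMap ℚ K).injective, h2]
      exact hIntegral a a.2
    obtain ⟨m, hm⟩ := IsIntegrallyClosed.isIntegral_iff.mp h3
    rw [eq_intCast, eq_div_iff (Nat.cast_ne_zero.mpr hp.ne_zero)] at hm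
    have h4 : m * p = 1 := by exact_mod_cast hm
    have h5 := Int.isUnit_iff_natAbs_eq.mp (IsUnit.of_mul_eq_one_right m h4)
    exact hp.one_lt.ne' (by simpa using h5)
  have : Module.IsTorsionFree A S := ⟨fun a ha x y hxy => by
    have ha0 : (a : K) ≠ 0 := fun h => ha.ne_zero (Subtype.ext h)
    exact smul_right_injective S ha0 hxy⟩
  exact IsSmallMod.bot_of_representation_algebra hA he ρ hs

end RepresentationKernel

section TeichmullerLift

/-- A multiplicative section of a residue map, together with enough of Hensel's lemma
to extract roots of principal units. -/
structure TeichmullerLift (O k : Type) [CommRing O] [Field k] where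
  /-- The residue map. -/
  res : O →+* k
  /-- The multiplicative section of the residue map. -/
  lift : k →* O
  res_lift : ∀ c, res (lift c) = c
  isUnit_of_res : ∀ x, res x ≠ 0 → IsUnit x
  exists_root : ∀ N : ℕ, (N : k) ≠ 0 → ∀ u, res u = 1 → ∃ c, c ^ N = u ∧ res c = 1

variable {O k : Type} [CommRing O] [Field k]

theorem TeichmullerLift.eq_one_of_pow_eq_one (L : TeichmullerLift O k) {N : ℕ}
    (hN : (N : k) ≠ 0) {u : O} (hu : L.res u = 1) (h : u ^ N = 1) : u = 1 := by
  have h1 := mul_geom_sum u N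
  rw [h, sub_self] at h1
  have h2 : IsUnit (∑ i ∈ Finset.range N, u ^ i) := by
    apply L.isUnit_of_res
    simpa [map_sum, hu] using hN
  exact sub_eq_zero.1 (h2.mul_left_eq_zero.1 h1)

theorem TeichmullerLift.eq_lift_of_pow_eq (L : TeichmullerLift O k) {N : ℕ}
    (hN : (N : k) ≠ 0) {u : O} (hu : L.res u ≠ 0) {d : k} (h : u ^ N = L.lift d) :
    u = L.lift (L.res u) := by
  have hd : d = L.res u ^ N := by rw [← map_pow, h, L.res_lift]
  have h1 : L.lift (L.res u) * L.lift (L.res u)⁻¹ = 1 := by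
    rw [← map_mul, mul_inv_cancel₀ hu, map_one]
  have h2 : u * L.lift (L.res u)⁻¹ = 1 := by
    refine L.eq_one_of_pow_eq_one hN ?_ ?_
    · rw [map_mul, L.res_lift, mul_inv_cancel₀ hu]
    · rw [mul_pow, h, hd, map_pow L.lift, ← mul_pow, h1, one_pow]
  calc u = u * L.lift (L.res u)⁻¹ * L.lift (L.res u) := by rw [mul_assoc, mul_comm _ (L.lift _), h1, mul_one]
    _ = _ := by rw [h2, one_mul]

variable {G : Type} [Group G] {S : Type} [Ring S] [Algebra k S]

/-- The subgroup of elements acting as scalars. -/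
def MonoidHom.scalarSubgroup (k : Type) [Field k] [Algebra k S] (r : G →* S) : Subgroup G where
  carrier := {g | ∃ c : k, r g = algebraMap k S c}
  mul_mem' := by
    rintro a b ⟨c, hc⟩ ⟨d, hd⟩
    exact ⟨c * d, by rw [map_mul, hc, hd, map_mul]⟩
  one_mem' := ⟨1, by simp⟩
  inv_mem' := by
    rintro a ⟨c, hc⟩
    refine ⟨c⁻¹, ?_⟩
    have h1 : r a * r a⁻¹ = 1 := by rw [← map_mul, mul_inv_cancel, map_one]
    by_cases h0 : c = 0
    · rw [hc, h0, map_zero, zero_mul] at h1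
      exact (subsingleton_of_zero_eq_one h1).elim _ _
    · calc r a⁻¹ = algebraMap k S c⁻¹ * algebraMap k S c * r a⁻¹ := by
            rw [← map_mul, inv_mul_cancel₀ h0, map_one, one_mul]
        _ = _ := by rw [mul_assoc, ← hc, h1, mul_one]

theorem MonoidHom.scalarSubgroup_commute {r : G →* S} {g : G} (hg : g ∈ r.scalarSubgroup k)
    (s : S) : r g * s = s * r g := by
  obtain ⟨c, hc⟩ := hg
  rw [hc, Algebra.commutes]

theorem MonoidHom.map_conj_of_mem_scalarSubgroup {r : G →* S} {z : G}
    (hz : z ∈ r.scalarSubgroup k) (g : G) : r (g * z * g⁻¹) = r z := by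
  rw [map_mul, map_mul, ← MonoidHom.scalarSubgroup_commute hz, mul_assoc, ← map_mul,
    mul_inv_cancel, map_one, mul_one]

instance MonoidHom.scalarSubgroup_normal (r : G →* S) : (r.scalarSubgroup k).Normal := by
  refine ⟨fun z hz g => ?_⟩
  obtain ⟨c, hc⟩ := hz
  exact ⟨c, by rw [MonoidHom.map_conj_of_mem_scalarSubgroup ⟨c, hc⟩, hc]⟩

/-- A representation over the residue field lifts, up to multiplicity, compatibly with the
Teichmüller lift on scalars. -/
def TeichmullerLift.Lifts (L : TeichmullerLift O k) (r : G →* S) : Prop :=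
  ∃ (n : Type) (_ : Fintype n) (_ : DecidableEq n) (_ : Nonempty n) (ρ : G →* Matrix n n O)
    (ψ : S →ₐ[k] Matrix n n k), (∀ g, (ρ g).map L.res = ψ (r g)) ∧
      ∀ g c, r g = algebraMap k S c → ρ g = Matrix.scalar n (L.lift c)

theorem TeichmullerLift.lifts_of_block (L : TeichmullerLift O k) {r : G →* S} {T n : Type}
    [Fintype T] [DecidableEq T] [Nonempty T] [Fintype n] [DecidableEq n] [Nonempty n]
    (ρ : G →* Matrix T T (Matrix n n O)) (ψ : S →ₐ[k] Matrix T T (Matrix n n k))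
    (h : ∀ g s t, (ρ g s t).map L.res = ψ (r g) s t)
    (hs : ∀ g c, r g = algebraMap k S c →
      ρ g = Matrix.scalar T (Matrix.scalar n (L.lift c))) : L.Lifts r := by
  refine ⟨T × n, inferInstance, inferInstance, inferInstance,
    (Matrix.compRingEquiv T n O).toRingHom.toMonoidHom.comp ρ,
    (Matrix.compAlgEquiv T n k k).toAlgHom.comp ψ, fun g => ?_, fun g c hc => ?_⟩
  · ext ⟨s, i⟩ ⟨t, j⟩
    have := congrFun (congrFun (h g s t) i) j
    simpa using this
  · ext ⟨s, i⟩ ⟨t, j⟩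
    simp only [MonoidHom.comp_apply, hs g c hc]
    simp only [RingEquiv.toRingHom_eq_coe, RingHom.toMonoidHom_eq_coe, MonoidHom.coe_coe,
      RingHom.coe_coe, Matrix.compRingEquiv_apply, Matrix.comp_apply, Matrix.scalar_apply,
      Matrix.diagonal_apply, Prod.mk.injEq]
    by_cases h1 : s = t <;> by_cases h2 : i = j <;> simp [h1, h2]

theorem TeichmullerLift.lifts_of_scalarSubgroup_eq_top (L : TeichmullerLift O k) [Nontrivial S]
    {r : G →* S} (hr : Submodule.span k (Set.range r) = ⊤) (h : r.scalarSubgroup k = ⊤) :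
    L.Lifts r := by
  have hsurj : Function.Bijective (algebraMap k S) := by
    refine ⟨FaithfulSMul.algebraMap_injective k S, fun s => ?_⟩
    have : s ∈ Submodule.span k (Set.range r) := hr ▸ Submodule.mem_top
    induction this using Submodule.span_induction with
    | mem x hx =>
      obtain ⟨g, rfl⟩ := hx
      obtain ⟨c, hc⟩ : g ∈ r.scalarSubgroup k := h ▸ Subgroup.mem_top g
      exact ⟨c, hc.symm⟩
    | zero => exact ⟨0, map_zero _⟩
    | add x y _ _ hx hy =>
      obtain ⟨a, rfl⟩ := hx
      obtain ⟨b, rfl⟩ := hy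
      exact ⟨a + b, map_add _ _ _⟩
    | smul c x _ hx =>
      obtain ⟨a, rfl⟩ := hx
      exact ⟨c * a, by rw [map_mul, Algebra.smul_def]⟩
  let e : k ≃ₐ[k] S := AlgEquiv.ofBijective (Algebra.ofId k S) hsurj
  have he : ∀ c, e.symm (algebraMap k S c) = c := fun c => e.symm.commutes c
  refine ⟨Unit, inferInstance, inferInstance, inferInstance,
    (Matrix.scalar Unit).toMonoidHom.comp (L.lift.comp ((e.symm : S →* k).comp r)),
    (Algebra.ofId k _).comp e.symm.toAlgHom, fun g => ?_, fun g c hc => ?_⟩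
  · ext i j
    simp [Algebra.ofId_apply, L.res_lift, Matrix.algebraMap_matrix_apply]
  · simp [hc, he]

end TeichmullerLift

section Corner

variable {k S : Type} [Field k] [Ring S] [Algebra k S]

/-- In a simple ring, a two-sided condition satisfied by some nonzero element holds for one. -/
theorem IsSimpleRing.one_mem_of_mem {S : Type*} [Ring S] [IsSimpleRing S] (p : S → Prop)
    (h0 : p 0) (hadd : ∀ x y, p x → p y → p (x + y)) (hneg : ∀ x, p x → p (-x))
    (hl : ∀ x y, p y → p (x * y)) (hr : ∀ x y, p x → p (x * y)) {s : S} (hs : p s)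
    (hs0 : s ≠ 0) : p 1 := by
  let I : TwoSidedIdeal S := TwoSidedIdeal.mk' {x | p x} h0 (hadd _ _) (hneg _)
    (hl _ _) (hr _ _)
  have hI : ∀ x, x ∈ I ↔ p x := fun x => TwoSidedIdeal.mem_mk' _ _ _ _ _ _ x
  rcases eq_bot_or_eq_top I with h | h
  · exact absurd ((TwoSidedIdeal.mem_bot S).1 (h ▸ (hI s).2 hs)) hs0
  · exact (hI 1).1 (h ▸ trivial)

theorem IsSimpleRing.of_forall {S : Type*} [Ring S] [Nontrivial S]
    (h : ∀ I : TwoSidedIdeal S, ∀ s ∈ I, s ≠ 0 → (1 : S) ∈ I) : IsSimpleRing S := by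
  refine ⟨⟨fun I => ?_⟩⟩
  by_cases hI : ∃ s ∈ I, s ≠ 0
  · obtain ⟨s, hs, h0⟩ := hI
    exact Or.inr (TwoSidedIdeal.one_mem_iff I |>.1 (h I s hs h0))
  · push Not at hI
    exact Or.inl (eq_bot_iff.2 fun x hx => (TwoSidedIdeal.mem_bot S).2 (hI x hx))

theorem exists_corner [IsSimpleRing S] [Module.Finite k S] {ε : S} (hε : IsIdempotentElem ε)
    (h0 : ε ≠ 0) : ∃ (S₁ : Type) (_ : Ring S₁) (_ : Algebra k S₁) (_ : IsSimpleRing S₁)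
      (_ : Module.Finite k S₁) (κ : S →ₗ[k] S₁), Function.Surjective κ ∧ κ 1 = 1 ∧
      (∀ s t, κ s * κ t = κ (s * ε * t)) ∧ ∀ s, κ s = 0 ↔ ε * s * ε = 0 := by
  have e1 : ∀ (c : k) (x : S), ε * algebraMap k S c * ε * x = algebraMap k S c * (ε * x) :=
    fun c x => by
      rw [← Algebra.commutes, mul_assoc (algebraMap k S c), hε.eq, mul_assoc]
  let f : k →+* hε.Corner :=
    { toFun := fun c => ⟨ε * algebraMap k S c * ε, algebraMap k S c, rfl⟩
      map_zero' := Subtype.ext (by simp; rfl)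
      map_one' := Subtype.ext (by simp [hε.eq]; rfl)
      map_add' := fun a b => Subtype.ext (by simp [mul_add, add_mul]; rfl)
      map_mul' := fun a b => Subtype.ext (by
        change ε * algebraMap k S (a * b) * ε =
          ε * algebraMap k S a * ε * (ε * algebraMap k S b * ε)
        rw [e1, map_mul]
        simp only [mul_assoc, hε.mul_self_mul]
        rw [Algebra.left_comm])}
  have hf : ∀ c, (f c).1 = ε * algebraMap k S c * ε := fun c => rfl
  have hc : ∀ x : hε.Corner, ε * x.1 = x.1 ∧ x.1 * ε = x.1 :=
    fun x => (Subsemigroup.mem_corner_iff hε).1 x.2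
  let : Algebra k hε.Corner := f.toAlgebra' fun c x => Subtype.ext (by
    change ε * algebraMap k S c * ε * x.1 = x.1 * (ε * algebraMap k S c * ε)
    have e2 : ∀ y : S, ε * y = y → y * ε = y → ε * algebraMap k S c * ε * y =
        y * (ε * algebraMap k S c * ε) := fun y h1 h2 => by
      rw [e1, h1, ← Algebra.commutes, mul_assoc (algebraMap k S c), hε.eq, Algebra.left_comm, h2]
    exact e2 x.1 (hc x).1 (hc x).2)
  let κ : S →ₗ[k] hε.Corner :=
    { toFun := fun s => ⟨ε * s * ε, s, rfl⟩
      map_add' := fun s t => Subtype.ext (by simp [mul_add, add_mul]; rfl)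
      map_smul' := fun c s => Subtype.ext (by
        change ε * (c • s) * ε = ε * algebraMap k S c * ε * (ε * s * ε)
        rw [e1, Algebra.smul_def, ← mul_assoc ε, ← Algebra.commutes]
        simp only [mul_assoc, hε.mul_self_mul]) }
  have hκ : ∀ s, (κ s).1 = ε * s * ε := fun s => rfl
  have hsurj : Function.Surjective κ := by
    rintro ⟨_, s, rfl⟩
    exact ⟨s, rfl⟩
  have hz : ∀ s, κ s = 0 ↔ ε * s * ε = 0 := fun s => by
    rw [← hκ]
    exact Subtype.ext_iff
  have hm : ∀ s t, κ s * κ t = κ (s * ε * t) := fun s t => Subtype.ext (by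
    change ε * s * ε * (ε * t * ε) = ε * (s * ε * t) * ε
    simp only [mul_assoc, hε.mul_self_mul])
  have h1 : κ 1 = 1 := Subtype.ext (by rw [hκ, mul_one, hε.eq]; rfl)
  have : Nontrivial hε.Corner := ⟨κ 1, 0, fun h => h0 (by
    have := (hz 1).1 h
    rwa [mul_one, hε.eq] at this)⟩
  refine ⟨hε.Corner, inferInstance, inferInstance, IsSimpleRing.of_forall fun I s hs hs0 => ?_,
    Module.Finite.of_surjective κ hsurj, κ, hsurj, h1, hm, hz⟩
  have key := IsSimpleRing.one_mem_of_mem (fun s : S => ∀ x y, κ (x * s * y) ∈ I)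
    (fun x y => by simp)
    (fun a b ha hb x y => by rw [mul_add, add_mul, map_add]; exact I.add_mem (ha x y) (hb x y))
    (fun a ha x y => by rw [mul_neg, neg_mul, map_neg]; exact I.neg_mem (ha x y))
    (fun a b hb x y => by rw [← mul_assoc]; exact hb _ _)
    (fun a b ha x y => by rw [← mul_assoc x, mul_assoc (x * a)]; exact ha _ _)
    (s := s.1) (fun x y => by
      have : κ (x * s.1 * y) = κ x * s * κ y := Subtype.ext (by
        change ε * (x * s.1 * y) * ε = ε * x * ε * s.1 * (ε * y * ε)
        rw [mul_assoc (ε * x), (hc s).1, ← mul_assoc _ _ ε, ← mul_assoc _ ε, mul_assoc _ s.1 ε,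
          (hc s).2]
        simp only [mul_assoc])
      rw [this]
      exact I.mul_mem_right _ _ (I.mul_mem_left _ _ hs))
    (fun h => hs0 (Subtype.ext h))
  have := key 1 1
  rwa [mul_one, mul_one, h1] at this

end Corner

section Imprimitive

variable {O k : Type} [CommRing O] [Field k]
variable {G : Type} [Group G] {S : Type} [Ring S] [Algebra k S]

theorem MonoidHom.commute_of_span_eq_top {r : G →* S} (hr : Submodule.span k (Set.range r) = ⊤)
    {e : S} (he : ∀ g, r g * e = e * r g) (s : S) : s * e = e * s := by
  have : s ∈ Submodule.span k (Set.range r) := hr ▸ Submodule.mem_top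
  induction this using Submodule.span_induction with
  | mem x hx =>
    obtain ⟨g, rfl⟩ := hx
    exact he g
  | zero => simp
  | add x y _ _ hx hy => rw [add_mul, mul_add, hx, hy]
  | smul c x _ hx => rw [smul_mul_assoc, mul_smul_comm, hx]

theorem MonoidHom.map_mul_map_inv (r : G →* S) (g : G) : r g * r g⁻¹ = 1 := by
  rw [← map_mul, mul_inv_cancel, map_one]

theorem MonoidHom.map_inv_mul_map (r : G →* S) (g : G) : r g⁻¹ * r g = 1 := by
  rw [← map_mul, inv_mul_cancel, map_one]

theorem sum_conj_eq_one [IsSimpleRing S] {r : G →* S}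
    (hr : Submodule.span k (Set.range r) = ⊤) {ε : S} (hε : IsIdempotentElem ε) (h0 : ε ≠ 0)
    {H : Subgroup G} [Fintype (G ⧸ H)] (hH : ∀ g ∈ H, r g * ε = ε * r g)
    (hH' : ∀ g ∉ H, ε * r g * ε = 0) :
    ∑ t : G ⧸ H, r t.out * ε * r (t.out)⁻¹ = 1 := by
  classical
  set e := ∑ t : G ⧸ H, r t.out * ε * r (t.out)⁻¹ with he
  have hf : ∀ g h, h ∈ H → r (g * h) * ε * r (g * h)⁻¹ = r g * ε * r g⁻¹ := fun g h hh => by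
    rw [map_mul, mul_assoc (r g), hH h hh, mul_inv_rev, map_mul, ← mul_assoc,
      mul_assoc (r g), mul_assoc ε, r.map_mul_map_inv, mul_one]
  have hout : ∀ g : G, r g * ε * r g⁻¹ =
      r (g : G ⧸ H).out * ε * r ((g : G ⧸ H).out)⁻¹ := fun g => by
    obtain ⟨h, hh⟩ := QuotientGroup.mk_out_eq_mul H g
    rw [hh, hf _ _ h.2]
  have hconj : ∀ g, r g * e * r g⁻¹ = e := fun g => by
    calc r g * e * r g⁻¹ = ∑ t : G ⧸ H, r (g * t.out) * ε * r (g * t.out)⁻¹ := by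
          rw [he, Finset.mul_sum, Finset.sum_mul]
          refine Finset.sum_congr rfl fun t _ => ?_
          rw [map_mul, mul_inv_rev, map_mul]
          simp only [mul_assoc]
      _ = ∑ t : G ⧸ H, r (g • t).out * ε * r ((g • t).out)⁻¹ := by
          refine Finset.sum_congr rfl fun t _ => ?_
          rw [hout]
          have : ((g * t.out : G) : G ⧸ H) = g • t := by
            rw [← smul_eq_mul, ← MulAction.Quotient.smul_coe, QuotientGroup.out_eq']
          rw [this]
      _ = e := Fintype.sum_bijective (fun t => g • t) (MulAction.bijective g) _ _ fun t => rfl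
  have hcomm : ∀ s, s * e = e * s := MonoidHom.commute_of_span_eq_top hr fun g => by
    conv_rhs => rw [← hconj g]
    rw [mul_assoc, r.map_inv_mul_map, mul_one]
  have hp := IsSimpleRing.one_mem_of_mem (fun s : S => e * s = s) (mul_zero _)
    (fun x y hx hy => by rw [mul_add, hx, hy]) (fun x hx => by rw [mul_neg, hx])
    (fun x y hy => by rw [← mul_assoc, ← hcomm, mul_assoc, hy])
    (fun x y hx => by rw [← mul_assoc, hx]) (s := ε) (by
      rw [he, Finset.sum_mul, Finset.sum_eq_single (((1 : G) : G ⧸ H))]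
      · rw [← hout, map_one, inv_one, map_one, one_mul, mul_one, hε.eq]
      · intro t _ ht
        rw [mul_assoc, mul_assoc, ← mul_assoc ε, hH', mul_zero]
        intro h
        apply ht
        rw [← QuotientGroup.out_eq' t]
        exact (QuotientGroup.eq.2 (by simpa using h)).symm
      · simp) h0
  rwa [mul_one] at hp

theorem TeichmullerLift.lifts_of_idempotent [IsSimpleRing S] [Module.Finite k S]
    (L : TeichmullerLift O k) {r : G →* S} (hr : Submodule.span k (Set.range r) = ⊤) {ε : S}
    (hε : IsIdempotentElem ε) (h0 : ε ≠ 0) {H : Subgroup G} [H.FiniteIndex]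
    (hH : ∀ g ∈ H, r g * ε = ε * r g) (hH' : ∀ g ∉ H, ε * r g * ε = 0)
    (hzH : r.scalarSubgroup k ≤ H)
    (ih : ∀ (S₁ : Type) [Ring S₁] [Algebra k S₁] [IsSimpleRing S₁] [Module.Finite k S₁]
      (r₁ : H →* S₁), Submodule.span k (Set.range r₁) = ⊤ →
        (∀ (h : H) c, r h = algebraMap k S c → r₁ h = algebraMap k S₁ c) → L.Lifts r₁) :
    L.Lifts r := by
  classical
  have : Fintype (G ⧸ H) := Subgroup.fintypeQuotientOfFiniteIndex
  obtain ⟨S₁, _, _, _, _, κ, hsurj, hκ1, hκm, hκ0⟩ := exists_corner (k := k) hε h0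
  have hκl : ∀ s, κ (ε * s) = κ s := fun s => by
    rw [← sub_eq_zero, ← map_sub, hκ0, mul_sub, sub_mul, hε.mul_self_mul, sub_self]
  have hκr : ∀ s, κ (s * ε) = κ s := fun s => by
    rw [← sub_eq_zero, ← map_sub, hκ0, mul_sub, sub_mul, ← mul_assoc, hε.mul_mul_self, sub_self]
  let r₁ : H →* S₁ :=
    { toFun := fun h => κ (r h)
      map_one' := by rw [Subgroup.coe_one, map_one, hκ1]
      map_mul' := fun a b => by
        rw [hκm, hH a a.2, mul_assoc, hκl, ← map_mul, Subgroup.coe_mul] }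
  have hr₁ : ∀ h : H, r₁ h = κ (r h) := fun h => rfl
  have hκc : ∀ c, κ (algebraMap k S c) = algebraMap k S₁ c := fun c => by
    rw [Algebra.algebraMap_eq_smul_one, map_smul, hκ1, Algebra.algebraMap_eq_smul_one]
  have hz : ∀ g ∉ H, κ (r g) = 0 := fun g hg => (hκ0 _).2 (hH' g hg)
  have hspan : Submodule.span k (Set.range r₁) = ⊤ := by
    rw [eq_top_iff, ← LinearMap.range_eq_top.2 hsurj, LinearMap.range_eq_map, ← hr,
      Submodule.map_span, Submodule.span_le]
    rintro _ ⟨_, ⟨g, rfl⟩, rfl⟩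
    by_cases hg : g ∈ H
    · exact Submodule.subset_span ⟨⟨g, hg⟩, rfl⟩
    · rw [hz g hg]
      exact Submodule.zero_mem _
  obtain ⟨n, _, _, _, ρ, ψ, h1, h2⟩ := ih S₁ r₁ hspan fun h c hc => by rw [hr₁, hc, hκc]
  have hsum := sum_conj_eq_one hr hε h0 hH hH'
  have hone : ∀ s t : G ⧸ H, κ (r (s.out)⁻¹ * r t.out) = if s = t then 1 else 0 := fun s t => by
    split_ifs with hst
    · rw [hst, r.map_inv_mul_map, hκ1]
    · rw [← map_mul]
      refine hz _ fun h => hst ?_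
      have := QuotientGroup.eq.2 h
      rwa [QuotientGroup.out_eq', QuotientGroup.out_eq'] at this
  let Ψ : S →ₐ[k] Matrix (G ⧸ H) (G ⧸ H) (Matrix n n k) := AlgHom.ofLinearMap
    { toFun := fun x => Matrix.of fun s t => ψ (κ (r (s.out)⁻¹ * x * r t.out))
      map_add' := fun x y => by
        ext1 s t
        simp [mul_add, add_mul]
      map_smul' := fun c x => by
        ext1 s t
        simp } (by
      ext1 s t
      simp only [LinearMap.coe_mk, AddHom.coe_mk, Matrix.of_apply, mul_one, hone, Matrix.one_apply]
      split_ifs <;> simp) (fun x y => by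
      ext1 s t
      simp only [LinearMap.coe_mk, AddHom.coe_mk, Matrix.of_apply, Matrix.mul_apply]
      simp_rw [← map_mul, hκm]
      rw [← map_sum, ← map_sum]
      congr 2
      conv_lhs => rw [← mul_one x, ← hsum]
      simp only [Finset.mul_sum, Finset.sum_mul, mul_assoc])
  have hΨ : ∀ x s t, Ψ x s t = ψ (κ (r (s.out)⁻¹ * x * r t.out)) := fun x s t => rfl
  refine L.lifts_of_block (T := G ⧸ H) (n := n) (inducedMatrix H ρ) Ψ (fun g s t => ?_)
    fun g c hc => ?_
  · rw [hΨ, inducedMatrix_apply, ← map_mul, ← map_mul]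
    split_ifs with h
    · rw [h1, hr₁]
    · rw [hz _ h, map_zero]
      ext i j
      simp
  · ext1 s t
    rw [inducedMatrix_apply]
    have hconj : r ((s.out)⁻¹ * g * s.out) = algebraMap k S c := by
      have := MonoidHom.map_conj_of_mem_scalarSubgroup ⟨c, hc⟩ (s.out)⁻¹
      rw [inv_inv] at this
      rw [this, hc]
    have hmem : (s.out)⁻¹ * g * s.out ∈ H := hzH ⟨c, hconj⟩
    by_cases hst : s = t
    · subst hst
      rw [dif_pos hmem, h2 _ c (by rw [hr₁, hconj, hκc])]
      simp
    · rw [dif_neg, Matrix.scalar_apply, Matrix.diagonal_apply_ne _ hst]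
      intro h
      apply hst
      have h3 : (s.out)⁻¹ * t.out ∈ H := by
        have := H.mul_mem (H.inv_mem hmem) h
        have e : ((s.out)⁻¹ * g * s.out)⁻¹ * ((s.out)⁻¹ * g * t.out) = (s.out)⁻¹ * t.out := by
          group
        rwa [e] at this
      have := QuotientGroup.eq.2 h3
      rwa [QuotientGroup.out_eq', QuotientGroup.out_eq'] at this

end Imprimitive

section CommutativePart

variable {k : Type} [Field k]

theorem exists_idempotent_mul_eq_algebraMap_mul [IsAlgClosed k] (K : Type) [CommRing K]
    [Algebra k K] [Module.Finite k K] [IsReduced K] [Nontrivial K] :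
    ∃ ε : K, IsIdempotentElem ε ∧ ε ≠ 0 ∧ ∀ y, ∃ c, y * ε = algebraMap k K c * ε := by
  classical
  have : IsArtinianRing K := IsArtinianRing.of_finite k K
  obtain ⟨m, hm⟩ := Ideal.exists_maximal K
  let M : MaximalSpectrum K := ⟨m, hm⟩
  let f := IsArtinianRing.equivPi K
  have hf : f (f.symm (Pi.single M 1)) = Pi.single M 1 := f.apply_symm_apply _
  refine ⟨f.symm (Pi.single M 1), ?_, ?_, fun y => ?_⟩
  · apply f.injective
    rw [map_mul, hf, ← Pi.single_mul, mul_one]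
  · intro h
    have := congrArg f h
    rw [hf, map_zero] at this
    have := congrFun this M
    rw [Pi.single_eq_same, Pi.zero_apply] at this
    exact one_ne_zero this
  · let : Field (K ⧸ m) := Ideal.Quotient.field m
    obtain ⟨c, hc⟩ := (IsAlgClosed.algebraMap_bijective_of_isIntegral
      (k := k) (K := K ⧸ m)).2 (Ideal.Quotient.mk m y)
    refine ⟨c, f.injective ?_⟩
    rw [map_mul, map_mul, hf]
    funext I
    by_cases hI : I = M
    · subst hI
      rw [Pi.mul_apply, Pi.mul_apply, Pi.single_eq_same, mul_one, mul_one]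
      exact hc.symm
    · simp [Pi.single_eq_of_ne hI]

variable {G : Type} [Group G] {S : Type} [Ring S] [Algebra k S]

open scoped IsMulCommutative in
theorem exists_commRing_of_commute {s : Set S} (hs : ∀ a ∈ s, ∀ b ∈ s, a * b = b * a) :
    ∃ (K : Type) (_ : CommRing K) (_ : Algebra k K) (ι : K →ₐ[k] S),
      Function.Injective ι ∧ ∀ x, (∃ y, ι y = x) ↔ x ∈ Algebra.adjoin k s :=
  have := Algebra.isMulCommutative_adjoin k hs
  ⟨Algebra.adjoin k s, inferInstance, inferInstance,
    (Algebra.adjoin k s).val, Subtype.val_injective, fun x => by simp⟩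

theorem exists_idempotent_of_commute [IsAlgClosed k] [IsSimpleRing S] [Module.Finite k S]
    {r : G →* S} (hr : Submodule.span k (Set.range r) = ⊤) {B : Subgroup G} [B.Normal]
    (hB : ∀ a ∈ B, ∀ b ∈ B, r a * r b = r b * r a) (hs : ¬ B ≤ r.scalarSubgroup k) :
    ∃ ε : S, IsIdempotentElem ε ∧ ε ≠ 0 ∧ (∀ g, r g * ε = ε * r g ∨ ε * r g * ε = 0) ∧
      ∃ g, r g * ε ≠ ε * r g := by
  obtain ⟨K, _, _, ι, hι, hK⟩ := exists_commRing_of_commute (k := k) (s := r '' B) (by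
    rintro _ ⟨a, ha, rfl⟩ _ ⟨b, hb, rfl⟩
    exact hB a ha b hb)
  have hconj : ∀ (g : G) (x : K), ∃ y : K, ι y = r g * ι x * r g⁻¹ := fun g x => by
    rw [hK]
    have hx := (hK (ι x)).1 ⟨x, rfl⟩
    generalize ι x = z at hx ⊢
    induction hx using Algebra.adjoin_induction with
    | mem x hx =>
      obtain ⟨b, hb, rfl⟩ := hx
      rw [← map_mul, ← map_mul]
      exact Algebra.subset_adjoin ⟨_, Subgroup.Normal.conj_mem ‹_› b hb g, rfl⟩
    | algebraMap c =>
      rw [← Algebra.commutes, mul_assoc, r.map_mul_map_inv, mul_one]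
      exact Subalgebra.algebraMap_mem _ _
    | add x y _ _ hx hy =>
      rw [mul_add, add_mul]
      exact add_mem hx hy
    | mul x y _ _ hx hy =>
      have : r g * (x * y) * r g⁻¹ = r g * x * r g⁻¹ * (r g * y * r g⁻¹) := by
        rw [← mul_assoc _ (r g * y), ← mul_assoc _ (r g), mul_assoc (r g * x) (r g⁻¹),
          r.map_inv_mul_map, mul_one, mul_assoc (r g) x]
      rw [this]
      exact mul_mem hx hy
  choose φ hφ using hconj
  have hφ' : ∀ g x, r g * ι x = ι (φ g x) * r g := fun g x => by
    rw [hφ, mul_assoc, r.map_inv_mul_map, mul_one]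
  have hφm : ∀ g x y, φ g (x * y) = φ g x * φ g y := fun g x y => hι (by
    rw [hφ, map_mul, map_mul, hφ, hφ, ← mul_assoc _ (r g * ι y), ← mul_assoc _ (r g),
      mul_assoc (r g * ι x) (r g⁻¹), r.map_inv_mul_map, mul_one, mul_assoc (r g) (ι x)])
  have hφ0 : ∀ g x, φ g x = 0 ↔ x = 0 := fun g x => by
    rw [← hι.eq_iff, ← hι.eq_iff, hφ, map_zero]
    constructor
    · intro h
      calc ι x = r g⁻¹ * (r g * ι x * r g⁻¹) * r g := by
            rw [← mul_assoc, ← mul_assoc, r.map_inv_mul_map, one_mul, mul_assoc,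
              r.map_inv_mul_map, mul_one]
        _ = 0 := by rw [h, mul_zero, zero_mul]
    · intro h
      rw [h, mul_zero, zero_mul]
  have : Nontrivial K := ⟨0, 1, fun h => zero_ne_one (α := S) (by
    rw [← map_zero ι, h, map_one])⟩
  have : Module.Finite k K := Module.Finite.of_injective ι.toLinearMap hι
  have : IsArtinianRing K := IsArtinianRing.of_finite k K
  have hred : IsReduced K := by
    have hnil : IsNilpotent (nilradical K) := IsNoetherianRing.isNilpotent_nilradical K
    classical
    have hn := Nat.find_spec hnil
    obtain ⟨m, hm⟩ : ∃ m, Nat.find hnil = m + 1 := Nat.exists_eq_succ_of_ne_zero fun h => by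
      rw [h, pow_zero, Ideal.one_eq_top] at hn
      exact top_ne_bot hn
    have hmin := Nat.find_min hnil (m := m) (by omega)
    obtain ⟨y, hy, hy0⟩ := Submodule.exists_mem_ne_zero_of_ne_bot hmin
    have h1 := IsSimpleRing.one_mem_of_mem (fun s : S => ∀ x : K, x ∈ nilradical K → ι x * s = 0)
      (fun x _ => mul_zero _) (fun a b ha hb x hx => by rw [mul_add, ha x hx, hb x hx, add_zero])
      (fun a ha x hx => by rw [mul_neg, ha x hx, neg_zero])
      (fun a b hb x hx => by
        have : a ∈ Submodule.span k (Set.range r) := hr ▸ Submodule.mem_top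
        induction this using Submodule.span_induction with
        | mem a ha =>
          obtain ⟨g, rfl⟩ := ha
          obtain ⟨z, hz⟩ : ∃ z, φ g z = x := ⟨φ g⁻¹ x, hι (by
            rw [hφ, hφ, inv_inv, ← mul_assoc, ← mul_assoc, r.map_mul_map_inv, one_mul, mul_assoc,
              r.map_mul_map_inv, mul_one])⟩
          rw [← hz, ← mul_assoc, ← hφ', mul_assoc, hb z, mul_zero]
          rw [mem_nilradical] at hx ⊢
          obtain ⟨j, hj⟩ := hx
          refine ⟨j + 1, ?_⟩
          have : ∀ j, φ g (z ^ (j + 1)) = φ g z ^ (j + 1) := fun j => by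
            induction j with
            | zero => simp
            | succ j ih => rw [pow_succ, hφm, ih, ← pow_succ]
          rw [← hφ0 g, this, hz, pow_succ, hj, zero_mul]
        | zero => simp
        | add a a' _ _ ha ha' => rw [add_mul, mul_add, ha, ha', add_zero]
        | smul c a _ ha => rw [smul_mul_assoc, mul_smul_comm, ha, smul_zero])
      (fun a b ha x hx => by rw [← mul_assoc, ha x hx, zero_mul])
      (s := ι y) (fun x hx => by
        rw [← map_mul, ← map_zero ι]
        congr 1
        have : x * y ∈ nilradical K ^ (m + 1) := by
          rw [pow_succ']
          exact Ideal.mul_mem_mul hx hy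
        rw [← hm, hn] at this
        exact this)
      (fun h => hy0 (hι (by rw [h, map_zero])))
    refine ⟨fun x hx => hι ?_⟩
    rw [map_zero, ← h1 x (mem_nilradical.2 hx), mul_one]
  obtain ⟨ε, hε, h0, hc⟩ := exists_idempotent_mul_eq_algebraMap_mul (k := k) K
  have hεS : IsIdempotentElem (ι ε) := hε.map ι
  have hε0 : ι ε ≠ 0 := fun h => h0 (hι (by rw [h, map_zero]))
  refine ⟨ι ε, hεS, hε0, fun g => ?_, ?_⟩
  · have hi : ∀ (c : k) (a b : K), IsIdempotentElem b → a = algebraMap k K c * b →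
        IsIdempotentElem a → a = 0 ∨ a = b := fun c a b hb hab ha => by
      by_cases ha0 : a = 0
      · exact Or.inl ha0
      right
      have hc0 : c ≠ 0 := fun h => ha0 (by rw [hab, h, map_zero, zero_mul])
      have e1 : algebraMap k K c * a = a := by
        have : a * a = algebraMap k K c * a := by
          nth_rewrite 2 [hab]
          rw [mul_left_comm]
          congr 1
          rw [hab, mul_assoc, hb.eq]
        rw [← this, ha.eq]
      have e2 : algebraMap k K c * (a - b) = 0 := by rw [mul_sub, e1, ← hab, sub_self]
      calc a = algebraMap k K c⁻¹ * (algebraMap k K c * (a - b)) + b := by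
            rw [← mul_assoc, ← map_mul, inv_mul_cancel₀ hc0, map_one, one_mul, sub_add_cancel]
        _ = b := by rw [e2, mul_zero, zero_add]
    have hg : IsIdempotentElem (φ g ε) := by
      rw [IsIdempotentElem, ← hφm, hε.eq]
    obtain ⟨c, hc1⟩ := hc (φ g ε)
    have hprod : IsIdempotentElem (φ g ε * ε) := hg.mul hε
    obtain ⟨d, hd⟩ : ∃ d, φ g ε * ε = algebraMap k K d * φ g ε := by
      obtain ⟨d, hd⟩ := hc (φ g⁻¹ ε)
      refine ⟨d, ?_⟩
      have h1 : φ g (φ g⁻¹ ε) = ε := hι (by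
        rw [hφ, hφ, inv_inv, ← mul_assoc, ← mul_assoc, r.map_mul_map_inv, one_mul, mul_assoc,
          r.map_mul_map_inv, mul_one])
      have h2 : φ g (algebraMap k K d) = algebraMap k K d := hι (by
        rw [hφ, AlgHom.commutes, ← Algebra.commutes, mul_assoc, r.map_mul_map_inv, mul_one])
      have := congrArg (φ g) hd
      rw [hφm, h1, hφm, h2, mul_comm] at this
      exact this
    rcases hi c _ _ hε hc1 hprod with h | h
    · right
      have h3 : ι ε * r g * ι ε = ι (φ g ε * ε) * r g := by
        rw [mul_assoc, hφ', ← mul_assoc, ← map_mul, mul_comm]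
      rw [h3, h, map_zero, zero_mul]
    · left
      rcases hi d _ _ hg hd hprod with h' | h'
      · exact absurd (h.symm.trans h') h0
      · rw [hφ', ← h', h]
  · by_contra hall
    push Not at hall
    have hcomm := MonoidHom.commute_of_span_eq_top hr hall
    have h1 := IsSimpleRing.one_mem_of_mem (fun s : S => ι ε * s = s) (mul_zero _)
      (fun x y hx hy => by rw [mul_add, hx, hy]) (fun x hx => by rw [mul_neg, hx])
      (fun x y hy => by rw [← mul_assoc, ← hcomm, mul_assoc, hy])
      (fun x y hx => by rw [← mul_assoc, hx]) (s := ι ε) hεS.eq hε0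
    rw [mul_one] at h1
    have hε1 : ε = 1 := hι (by rw [h1, map_one])
    refine hs fun b hb => ?_
    obtain ⟨y, hy⟩ := (hK (r b)).2 (Algebra.subset_adjoin ⟨b, hb, rfl⟩)
    obtain ⟨c, hc⟩ := hc y
    rw [hε1, mul_one, mul_one] at hc
    exact ⟨c, by rw [← hy, hc, AlgHom.commutes]⟩

end CommutativePart

section TwistedGroupAlgebra

variable {A : Type} [Group A] {D R : Type} [CommRing D] [Ring R] [Algebra D R]

/-- A representation of a class-two extension, with prescribed central character, for which the
commutator pairing is nondegenerate. -/
structure IsTwistedRep (Z : Subgroup A) (χ : Z →* D) (u : A →* R) : Prop where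
  comm : ∀ a b, a * b * a⁻¹ * b⁻¹ ∈ Z
  map : ∀ z : Z, u z = algebraMap D R (χ z)
  nondeg : ∀ b ∉ Z, ∃ a, IsUnit (χ ⟨_, comm a b⟩ - 1)

/-- The sum over the cosets of `Z` of the conjugates of an element, twisted by an automorphism. -/
noncomputable def twistedConjSum (D : Type) [CommRing D] [Algebra D R] (Z : Subgroup A)
    [Fintype (A ⧸ Z)] (u : A →* R) (φ : MulAut A) : R →ₗ[D] R where
  toFun s := ∑ b : A ⧸ Z, u (φ b.out) * s * u (b.out)⁻¹
  map_add' x y := by simp [mul_add, add_mul, Finset.sum_add_distrib]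
  map_smul' c x := by simp [Finset.smul_sum]

variable {Z : Subgroup A} {χ : Z →* D} {u : A →* R}

theorem twistedConjSum_apply [Fintype (A ⧸ Z)] (φ : MulAut A) (s : R) :
    twistedConjSum D Z u φ s = ∑ b : A ⧸ Z, u (φ b.out) * s * u (b.out)⁻¹ := rfl

namespace IsTwistedRep

theorem commute_map (h : IsTwistedRep Z χ u) {z : A} (hz : z ∈ Z) (s : R) :
    u z * s = s * u z := by
  rw [h.map ⟨z, hz⟩, Algebra.commutes]

theorem map_conj (h : IsTwistedRep Z χ u) (a b : A) :
    u a * u b * u a⁻¹ = χ ⟨_, h.comm a b⟩ • u b := by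
  rw [Algebra.smul_def, ← h.map, ← map_mul, ← map_mul, ← map_mul]
  congr 1
  group

theorem map_mul_twistedConjSum_mul [Fintype (A ⧸ Z)] (h : IsTwistedRep Z χ u) {φ : MulAut A}
    (hφ : ∀ z ∈ Z, u (φ z) = u z) (a : A) (s : R) :
    u (φ a) * twistedConjSum D Z u φ s = twistedConjSum D Z u φ s * u a := by
  have hf : ∀ g z, z ∈ Z → u (φ (g * z)) * s * u (g * z)⁻¹ = u (φ g) * s * u g⁻¹ :=
    fun g z hz => by
    rw [map_mul, map_mul, hφ z hz, mul_inv_rev, map_mul, mul_assoc (u (φ g)), h.commute_map hz,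
      ← mul_assoc, mul_assoc (u (φ g)), mul_assoc s, u.map_mul_map_inv, mul_one]
  have hout : ∀ g : A, u (φ g) * s * u g⁻¹ =
      u (φ (g : A ⧸ Z).out) * s * u ((g : A ⧸ Z).out)⁻¹ := fun g => by
    obtain ⟨z, hz⟩ := QuotientGroup.mk_out_eq_mul Z g
    rw [hz, hf _ _ z.2]
  have hconj : u (φ a) * twistedConjSum D Z u φ s * u a⁻¹ = twistedConjSum D Z u φ s := by
    calc u (φ a) * twistedConjSum D Z u φ s * u a⁻¹
        = ∑ t : A ⧸ Z, u (φ (a * t.out)) * s * u (a * t.out)⁻¹ := by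
          rw [twistedConjSum_apply, Finset.mul_sum, Finset.sum_mul]
          refine Finset.sum_congr rfl fun t _ => ?_
          rw [map_mul, map_mul, mul_inv_rev, map_mul]
          simp only [mul_assoc]
      _ = ∑ t : A ⧸ Z, u (φ (a • t).out) * s * u ((a • t).out)⁻¹ := by
          refine Finset.sum_congr rfl fun t _ => ?_
          rw [hout]
          have : ((a * t.out : A) : A ⧸ Z) = a • t := by
            rw [← smul_eq_mul, ← MulAction.Quotient.smul_coe, QuotientGroup.out_eq']
          rw [this]
      _ = _ := Fintype.sum_bijective (fun t => a • t) (MulAction.bijective a) _ _ fun t => rfl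
  rw [← hconj, mul_assoc _ (u a⁻¹), u.map_inv_mul_map, mul_one, hconj]

theorem commute_twistedConjSum_one [Fintype (A ⧸ Z)] (h : IsTwistedRep Z χ u) (a : A) (s : R) :
    u a * twistedConjSum D Z u 1 s = twistedConjSum D Z u 1 s * u a :=
  h.map_mul_twistedConjSum_mul (φ := 1) (fun _ _ => rfl) a s

theorem twistedConjSum_one_map_of_mem [Fintype (A ⧸ Z)] (h : IsTwistedRep Z χ u) {z : A}
    (hz : z ∈ Z) : twistedConjSum D Z u 1 (u z) = (Fintype.card (A ⧸ Z) : R) * u z := by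
  rw [twistedConjSum_apply, Finset.sum_congr rfl fun b _ => by
    rw [← h.commute_map hz, mul_assoc, MulAut.one_apply, u.map_mul_map_inv, mul_one]]
  simp

theorem twistedConjSum_one_map_of_notMem [Fintype (A ⧸ Z)] (h : IsTwistedRep Z χ u) {b : A}
    (hb : b ∉ Z) : twistedConjSum D Z u 1 (u b) = 0 := by
  obtain ⟨a, ha⟩ := h.nondeg b hb
  have h1 : twistedConjSum D Z u 1 (u b) =
      (∑ c : A ⧸ Z, χ ⟨_, h.comm c.out b⟩) • u b := by
    rw [twistedConjSum_apply, Finset.sum_smul]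
    exact Finset.sum_congr rfl fun c _ => by rw [MulAut.one_apply, h.map_conj]
  have h2 := h.commute_twistedConjSum_one a (u b)
  rw [h1, smul_mul_assoc, mul_smul_comm] at h2
  have h3 : u a * u b = χ ⟨_, h.comm a b⟩ • (u b * u a) := by
    rw [← smul_mul_assoc, ← h.map_conj, mul_assoc _ (u a⁻¹), u.map_inv_mul_map, mul_one]
  rw [h3, smul_comm] at h2
  replace h2 : (χ ⟨_, h.comm a b⟩ - 1) •
      ((∑ c : A ⧸ Z, χ ⟨_, h.comm c.out b⟩) • (u b * u a)) = 0 := by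
    rw [sub_smul, one_smul, h2, sub_self]
  rw [ha.smul_eq_zero] at h2
  rw [h1, ← mul_one (u b), ← u.map_mul_map_inv a, ← mul_assoc, ← smul_mul_assoc, h2, zero_mul]

theorem twistedConjSum_one_mul_right [Fintype (A ⧸ Z)] {c : R} (hc : ∀ a, u a * c = c * u a)
    (s : R) : twistedConjSum D Z u 1 (s * c) = twistedConjSum D Z u 1 s * c := by
  rw [twistedConjSum_apply, twistedConjSum_apply, Finset.sum_mul]
  refine Finset.sum_congr rfl fun b _ => ?_
  rw [MulAut.one_apply, mul_assoc, mul_assoc, ← hc]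
  simp only [mul_assoc]

theorem sum_twistedConjSum_one_map_mul [Fintype (A ⧸ Z)] (h : IsTwistedRep Z χ u)
    {φ : MulAut A} (hφ : ∀ z, z ∈ Z → u (φ z) = u z) (hφ' : ∀ z, φ z ∈ Z → z ∈ Z)
    (hφ'' : ∀ z ∈ Z, φ z ∈ Z) (y : R) :
    ∑ b : A ⧸ Z, twistedConjSum D Z u 1 (u (φ b.out)) * y * u (b.out)⁻¹ =
      (Fintype.card (A ⧸ Z) : R) * y := by
  rw [Finset.sum_eq_single (((1 : A) : A ⧸ Z))]
  · have hz : ((1 : A) : A ⧸ Z).out ∈ Z := by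
      obtain ⟨z, hz⟩ := QuotientGroup.mk_out_eq_mul Z 1
      rw [hz, one_mul]
      exact z.2
    rw [h.twistedConjSum_one_map_of_mem (hφ'' _ hz), hφ _ hz, mul_assoc, mul_assoc,
      h.commute_map hz, mul_assoc, u.map_inv_mul_map, mul_one]
  · intro b _ hb
    rw [h.twistedConjSum_one_map_of_notMem, zero_mul, zero_mul]
    intro hmem
    apply hb
    rw [← QuotientGroup.out_eq' b]
    exact (QuotientGroup.eq.2 (by simpa using hφ' _ hmem)).symm
  · simp

theorem sum_map_mul_twistedConjSum_one [Fintype (A ⧸ Z)] (h : IsTwistedRep Z χ u) (y : R) :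
    ∑ t : A ⧸ Z, u t.out * twistedConjSum D Z u 1 (u (t.out)⁻¹ * y) =
      (Fintype.card (A ⧸ Z) : R) * y := by
  rw [← h.sum_twistedConjSum_one_map_mul (φ := 1) (fun _ _ => rfl) (fun _ hz => hz)
    (fun _ hz => hz)]
  simp_rw [twistedConjSum_apply, Finset.mul_sum, Finset.sum_mul]
  rw [Finset.sum_comm]
  simp only [MulAut.one_apply, mul_assoc]

theorem sum_map_mul_twistedConjSum [Fintype (A ⧸ Z)] (h : IsTwistedRep Z χ u)
    {φ : MulAut A} (hφ : ∀ z, z ∈ Z → u (φ z) = u z) (hφ' : ∀ z, φ z ∈ Z → z ∈ Z)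
    (hφ'' : ∀ z ∈ Z, φ z ∈ Z) :
    ∑ t : A ⧸ Z, u t.out * twistedConjSum D Z u φ (u (t.out)⁻¹) =
      (Fintype.card (A ⧸ Z) : R) := by
  rw [← mul_one (Fintype.card (A ⧸ Z) : R), ← h.sum_twistedConjSum_one_map_mul hφ hφ' hφ'']
  simp_rw [twistedConjSum_apply, Finset.mul_sum, Finset.sum_mul]
  rw [Finset.sum_comm]
  simp only [MulAut.one_apply, mul_assoc, one_mul]

theorem twistedConjSum_one_mem_of_mem_span [Fintype (A ⧸ Z)] (h : IsTwistedRep Z χ u) {x : R}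
    (hx : x ∈ Submodule.span D (Set.range u)) :
    ∃ c, twistedConjSum D Z u 1 x = algebraMap D R c := by
  induction hx using Submodule.span_induction with
  | mem x hx =>
    obtain ⟨a, rfl⟩ := hx
    by_cases ha : a ∈ Z
    · refine ⟨Fintype.card (A ⧸ Z) * χ ⟨a, ha⟩, ?_⟩
      rw [h.twistedConjSum_one_map_of_mem ha, map_mul, map_natCast, h.map ⟨a, ha⟩]
    · exact ⟨0, by rw [h.twistedConjSum_one_map_of_notMem ha, map_zero]⟩
  | zero => exact ⟨0, by simp⟩
  | add x y _ _ hx hy =>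
    obtain ⟨c, hc⟩ := hx
    obtain ⟨d, hd⟩ := hy
    exact ⟨c + d, by rw [map_add, map_add, hc, hd]⟩
  | smul c x _ hx =>
    obtain ⟨d, hd⟩ := hx
    exact ⟨c * d, by rw [map_smul, hd, map_mul, Algebra.smul_def]⟩

theorem twistedConjSum_one_of_commute [Fintype (A ⧸ Z)] {x : R}
    (hc : ∀ a, u a * x = x * u a) :
    twistedConjSum D Z u 1 x = (Fintype.card (A ⧸ Z) : D) • x := by
  rw [twistedConjSum_apply, Finset.sum_congr rfl fun b _ => by
    rw [MulAut.one_apply, hc, mul_assoc, u.map_mul_map_inv, mul_one]]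
  simp [Nat.cast_smul_eq_nsmul]

theorem eq_algebraMap_of_commute [Fintype (A ⧸ Z)] (h : IsTwistedRep Z χ u)
    (hN : IsUnit (Fintype.card (A ⧸ Z) : D)) {x : R} (hx : x ∈ Submodule.span D (Set.range u))
    (hc : ∀ a, u a * x = x * u a) : ∃ c, x = algebraMap D R c := by
  obtain ⟨c, hc1⟩ := h.twistedConjSum_one_mem_of_mem_span hx
  obtain ⟨d, hd⟩ := hN.exists_left_inv
  refine ⟨d * c, ?_⟩
  rw [map_mul, ← hc1, twistedConjSum_one_of_commute hc, ← Algebra.smul_def, smul_smul, hd, one_smul]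

theorem twistedConjSum_mem_span [Fintype (A ⧸ Z)] {φ : MulAut A} (a : A) :
    twistedConjSum D Z u φ (u a) ∈ Submodule.span D (Set.range u) := by
  rw [twistedConjSum_apply]
  refine Submodule.sum_mem _ fun b _ => Submodule.subset_span ⟨φ b.out * a * (b.out)⁻¹, ?_⟩
  rw [map_mul, map_mul]

end IsTwistedRep

end TwistedGroupAlgebra

section TwistedBlocks

variable {A : Type} [Group A] {k S : Type} [Field k] [Ring S] [Algebra k S]

/-- The averaging projection onto the centralizer of a twisted representation. -/
noncomputable def twistedProj (k : Type) [Field k] [Algebra k S] (Z : Subgroup A)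
    [Fintype (A ⧸ Z)] (u : A →* S) : S →ₗ[k] S :=
  (Fintype.card (A ⧸ Z) : k)⁻¹ • twistedConjSum k Z u 1

variable {Z : Subgroup A} [Fintype (A ⧸ Z)] {χ : Z →* k} {u : A →* S}

theorem twistedProj_apply (s : S) :
    twistedProj k Z u s = (Fintype.card (A ⧸ Z) : k)⁻¹ • twistedConjSum k Z u 1 s := rfl

namespace IsTwistedRep

theorem commute_twistedProj (h : IsTwistedRep Z χ u) (a : A) (s : S) :
    u a * twistedProj k Z u s = twistedProj k Z u s * u a := by
  rw [twistedProj_apply, mul_smul_comm, h.commute_twistedConjSum_one, smul_mul_assoc]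

theorem twistedProj_mul_right {c : S} (hc : ∀ a, u a * c = c * u a) (s : S) :
    twistedProj k Z u (s * c) = twistedProj k Z u s * c := by
  rw [twistedProj_apply, twistedConjSum_one_mul_right hc, twistedProj_apply, smul_mul_assoc]

theorem twistedProj_of_commute (hN : (Fintype.card (A ⧸ Z) : k) ≠ 0) {c : S}
    (hc : ∀ a, u a * c = c * u a) : twistedProj k Z u c = c := by
  rw [twistedProj_apply, twistedConjSum_one_of_commute hc, smul_smul, inv_mul_cancel₀ hN, one_smul]

theorem twistedProj_map_of_notMem (h : IsTwistedRep Z χ u) {b : A} (hb : b ∉ Z) :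
    twistedProj k Z u (u b) = 0 := by
  rw [twistedProj_apply, h.twistedConjSum_one_map_of_notMem hb, smul_zero]

theorem twistedProj_mem_of_mem_span (h : IsTwistedRep Z χ u) {x : S}
    (hx : x ∈ Submodule.span k (Set.range u)) :
    ∃ c, twistedProj k Z u x = algebraMap k S c := by
  obtain ⟨c, hc⟩ := h.twistedConjSum_one_mem_of_mem_span hx
  exact ⟨(Fintype.card (A ⧸ Z) : k)⁻¹ * c, by
    rw [twistedProj_apply, hc, map_mul, Algebra.smul_def]⟩

theorem sum_map_mul_twistedProj (h : IsTwistedRep Z χ u)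
    (hN : (Fintype.card (A ⧸ Z) : k) ≠ 0) (y : S) :
    ∑ t : A ⧸ Z, u t.out * twistedProj k Z u (u (t.out)⁻¹ * y) = y := by
  simp_rw [twistedProj_apply, mul_smul_comm]
  rw [← Finset.smul_sum, h.sum_map_mul_twistedConjSum_one, ← map_natCast (algebraMap k S),
    ← Algebra.smul_def, smul_smul, inv_mul_cancel₀ hN, one_smul]

theorem isSimpleRing_centralizer [IsSimpleRing S] (h : IsTwistedRep Z χ u)
    (hN : (Fintype.card (A ⧸ Z) : k) ≠ 0) :
    IsSimpleRing (Subalgebra.centralizer k (Set.range u)) := by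
  have hC : ∀ c ∈ Subalgebra.centralizer k (Set.range u), ∀ a, u a * c = c * u a :=
    fun c hc a => Subalgebra.mem_centralizer_iff k |>.1 hc _ ⟨a, rfl⟩
  have hP : ∀ s, twistedProj k Z u s ∈ Subalgebra.centralizer k (Set.range u) := fun s =>
    Subalgebra.mem_centralizer_iff k |>.2 (by
      rintro _ ⟨a, rfl⟩
      exact h.commute_twistedProj a s)
  let P : S →ₗ[k] Subalgebra.centralizer k (Set.range u) :=
    { toFun := fun s => ⟨twistedProj k Z u s, hP s⟩
      map_add' := fun x y => Subtype.ext (map_add (twistedProj k Z u) x y)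
      map_smul' := fun c x => Subtype.ext (map_smul (twistedProj k Z u) c x) }
  have hP' : ∀ s, (P s : S) = twistedProj k Z u s := fun s => rfl
  have hP1 : P 1 = 1 := Subtype.ext (by
    rw [hP', twistedProj_of_commute hN fun a => by rw [mul_one, one_mul]]
    rfl)
  refine IsSimpleRing.of_forall fun I y hy hy0 => ?_
  have key := IsSimpleRing.one_mem_of_mem (fun s : S => ∀ x x', P (x * s * x') ∈ I)
    (fun x y => by simp)
    (fun a b ha hb x y => by rw [mul_add, add_mul, map_add]; exact I.add_mem (ha x y) (hb x y))
    (fun a ha x y => by rw [mul_neg, neg_mul, map_neg]; exact I.neg_mem (ha x y))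
    (fun a b hb x y => by rw [← mul_assoc]; exact hb _ _)
    (fun a b ha x y => by rw [← mul_assoc x, mul_assoc (x * a)]; exact ha _ _)
    (s := (y : S)) (fun x x' => by
      have h1 : P (x * y * x') = ∑ t : A ⧸ Z, ∑ t' : A ⧸ Z, P (u t'.out * u t.out) *
          (P (u (t'.out)⁻¹ * x) * y * P (u (t.out)⁻¹ * x')) := Subtype.ext (by
        rw [hP']
        conv_lhs => rw [← h.sum_map_mul_twistedProj hN x, ← h.sum_map_mul_twistedProj hN x']
        simp only [Finset.mul_sum, Finset.sum_mul, map_sum, AddSubmonoidClass.coe_finsetSum]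
        refine Finset.sum_congr rfl fun t _ => Finset.sum_congr rfl fun t' _ => ?_
        rw [MulMemClass.coe_mul, MulMemClass.coe_mul, MulMemClass.coe_mul, hP', hP', hP',
          ← twistedProj_mul_right]
        · congr 1
          have e := hC _ (mul_mem (hP (u (t'.out)⁻¹ * x)) y.2) t.out
          rw [mul_assoc (u t'.out) (u t.out), ← mul_assoc (u t.out), e]
          simp only [mul_assoc]
        · exact hC _ (mul_mem (mul_mem (hP _) y.2) (hP _)))
      rw [h1]
      exact sum_mem fun t _ => sum_mem fun t' _ =>
        I.mul_mem_left _ _ (I.mul_mem_right _ _ (I.mul_mem_left _ _ hy)))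
    (fun h => hy0 (Subtype.ext h))
  have := key 1 1
  rwa [mul_one, mul_one, hP1] at this

/-- The decomposition of an algebra into matrices over the centralizer of a twisted
representation. -/
noncomputable def blockHom [DecidableEq (A ⧸ Z)] (h : IsTwistedRep Z χ u)
    (hN : (Fintype.card (A ⧸ Z) : k) ≠ 0) :
    S →ₐ[k] Matrix (A ⧸ Z) (A ⧸ Z) (Subalgebra.centralizer k (Set.range u)) :=
  have hP : ∀ s, twistedProj k Z u s ∈ Subalgebra.centralizer k (Set.range u) := fun s =>
    Subalgebra.mem_centralizer_iff k |>.2 (by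
      rintro _ ⟨a, rfl⟩
      exact h.commute_twistedProj a s)
  AlgHom.ofLinearMap
    { toFun := fun x => Matrix.of fun s t => ⟨twistedProj k Z u (u (s.out)⁻¹ * x * u t.out), hP _⟩
      map_add' := fun x y => by
        ext s t
        simp [mul_add, add_mul]
      map_smul' := fun c x => by
        ext s t
        simp }
    (by
      ext s t
      simp only [LinearMap.coe_mk, AddHom.coe_mk, Matrix.of_apply, mul_one, Matrix.one_apply]
      split_ifs with hst
      · rw [hst, u.map_inv_mul_map, twistedProj_of_commute hN fun a => by rw [mul_one, one_mul]]
        rfl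
      · rw [← map_mul, h.twistedProj_map_of_notMem]
        · rfl
        · intro hmem
          apply hst
          have := QuotientGroup.eq.2 hmem
          rwa [QuotientGroup.out_eq', QuotientGroup.out_eq'] at this)
    (fun x y => by
      ext s t
      simp only [LinearMap.coe_mk, AddHom.coe_mk, Matrix.of_apply, Matrix.mul_apply,
        AddSubmonoidClass.coe_finsetSum, MulMemClass.coe_mul]
      conv_lhs => rw [mul_assoc, mul_assoc, ← h.sum_map_mul_twistedProj hN (y * u t.out)]
      simp only [Finset.mul_sum, map_sum, mul_assoc]
      refine Finset.sum_congr rfl fun b _ => ?_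
      rw [← mul_assoc, ← mul_assoc, twistedProj_mul_right fun a => h.commute_twistedProj a _]
      simp only [mul_assoc])

theorem blockHom_apply [DecidableEq (A ⧸ Z)] (h : IsTwistedRep Z χ u)
    (hN : (Fintype.card (A ⧸ Z) : k) ≠ 0) (x : S) (s t : A ⧸ Z) :
    (h.blockHom hN x s t : S) = twistedProj k Z u (u (s.out)⁻¹ * x * u t.out) := rfl

theorem blockHom_map [DecidableEq (A ⧸ Z)] (h : IsTwistedRep Z χ u)
    (hN : (Fintype.card (A ⧸ Z) : k) ≠ 0) (a : A) (s t : A ⧸ Z) :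
    h.blockHom hN (u a) s t = algebraMap k _ (inducedMatrix Z χ a s t) := by
  apply Subtype.ext
  rw [blockHom_apply, inducedMatrix_apply, ← map_mul, ← map_mul]
  split_ifs with hmem
  · rw [twistedProj_of_commute hN fun b => (h.commute_map hmem _).symm, h.map ⟨_, hmem⟩]
    rfl
  · rw [h.twistedProj_map_of_notMem hmem, map_zero]
    rfl

end IsTwistedRep

end TwistedBlocks

section Intertwiner

theorem MonoidHom.mul_mem_span_range {A D R : Type} [Group A] [CommRing D] [Ring R] [Algebra D R]
    (u : A →* R) {x y : R} (hx : x ∈ Submodule.span D (Set.range u))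
    (hy : y ∈ Submodule.span D (Set.range u)) : x * y ∈ Submodule.span D (Set.range u) := by
  have h := Submodule.mul_mem_mul hx hy
  rw [Submodule.span_mul_span] at h
  refine Submodule.span_mono ?_ h
  rintro _ ⟨_, ⟨a, rfl⟩, _, ⟨b, rfl⟩, rfl⟩
  exact ⟨a * b, map_mul u a b⟩

theorem IsTwistedRep.exists_intertwiner {A D R : Type} [Group A] [CommRing D] [Ring R]
    [Algebra D R] {Z : Subgroup A} [Fintype (A ⧸ Z)] {χ : Z →* D} {u : A →* R}
    (h : IsTwistedRep Z χ u) {φ : MulAut A} (hφ : ∀ z, z ∈ Z → u (φ z) = u z)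
    (hφ' : ∀ z, φ z ∈ Z → z ∈ Z) (hφ'' : ∀ z ∈ Z, φ z ∈ Z) {S : Type} [Ring S]
    (f : R →+* S) (hf : (Fintype.card (A ⧸ Z) : S) * (Fintype.card (A ⧸ Z) : S) ≠ 0) :
    ∃ X ∈ Submodule.span D (Set.range u), ∃ W ∈ Submodule.span D (Set.range u),
      (∀ a, X * u a = u (φ a) * X) ∧ ∃ d : D, W * X = algebraMap D R d ∧
        f (algebraMap D R d) ≠ 0 := by
  by_contra! hcon
  apply hf
  have h1 : ∀ t t' : A ⧸ Z, f (twistedConjSum D Z u 1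
      (u (t'.out)⁻¹ * twistedConjSum D Z u φ (u (t.out)⁻¹))) = 0 := fun t t' => by
    have hX := twistedConjSum_mem_span (D := D) (Z := Z) (u := u) (φ := φ) (t.out)⁻¹
    set X := twistedConjSum D Z u φ (u (t.out)⁻¹)
    obtain ⟨d, hd⟩ := h.twistedConjSum_one_mem_of_mem_span
      (u.mul_mem_span_range (Submodule.subset_span ⟨(t'.out)⁻¹, rfl⟩) hX)
    rw [hd]
    refine hcon X hX (∑ b : A ⧸ Z, u b.out * u (t'.out)⁻¹ * u (φ (b.out)⁻¹))
      (Submodule.sum_mem _ fun b _ => u.mul_mem_span_range (u.mul_mem_span_range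
        (Submodule.subset_span ⟨_, rfl⟩) (Submodule.subset_span ⟨_, rfl⟩))
          (Submodule.subset_span ⟨_, rfl⟩))
      (fun a => (h.map_mul_twistedConjSum_mul hφ a _).symm) d ?_
    rw [← hd, twistedConjSum_apply, Finset.sum_mul]
    refine Finset.sum_congr rfl fun b _ => ?_
    rw [mul_assoc _ (u (φ _)), h.map_mul_twistedConjSum_mul hφ, MulAut.one_apply]
    simp only [mul_assoc, X]
  have h2 : ∀ t : A ⧸ Z, (Fintype.card (A ⧸ Z) : S) *
      f (twistedConjSum D Z u φ (u (t.out)⁻¹)) = 0 := fun t => by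
    rw [← map_natCast f, ← map_mul, ← h.sum_map_mul_twistedConjSum_one, map_sum]
    exact Finset.sum_eq_zero fun t' _ => by rw [map_mul, h1, mul_zero]
  have h3 : (Fintype.card (A ⧸ Z) : S) =
      ∑ t : A ⧸ Z, f (u t.out) * f (twistedConjSum D Z u φ (u (t.out)⁻¹)) := by
    rw [← map_natCast f, ← h.sum_map_mul_twistedConjSum hφ hφ' hφ'', map_sum]
    simp_rw [map_mul]
  conv_lhs => arg 2; rw [h3]
  rw [Finset.mul_sum]
  exact Finset.sum_eq_zero fun t _ => by
    rw [← mul_assoc, (Nat.cast_commute _ (f (u t.out))).eq, mul_assoc, h2, mul_zero]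

variable {A k O S : Type} [Group A] [Field k] [CommRing O] [Ring S] [Algebra k S]

/-- A twisted representation paired with its monomial lift. -/
noncomputable def TeichmullerLift.pair (L : TeichmullerLift O k) {Z : Subgroup A}
    [Fintype (A ⧸ Z)] [DecidableEq (A ⧸ Z)] (χ : Z →* k) (u : A →* S) :
    A →* S × Matrix (A ⧸ Z) (A ⧸ Z) O :=
  u.prod (inducedMatrix Z (L.lift.comp χ))

variable [Algebra O k] [Algebra O S] [IsScalarTower O k S]

theorem TeichmullerLift.isTwistedRep_pair [Nontrivial S] (L : TeichmullerLift O k)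
    (hL : ∀ x, algebraMap O k x = L.res x) {Z : Subgroup A}
    [Fintype (A ⧸ Z)] [DecidableEq (A ⧸ Z)] {χ : Z →* k} {u : A →* S}
    (h : IsTwistedRep Z χ u) : IsTwistedRep Z (L.lift.comp χ) (L.pair χ u) where
  comm := h.comm
  map z := by
    have hconj : ∀ g : A, g⁻¹ * z * g ∈ Z := fun g => by
      have := Z.mul_mem (h.comm g⁻¹ z) z.2
      simpa using this
    refine Prod.ext ?_ ?_
    · change u z = algebraMap O S (L.lift (χ z))
      rw [IsScalarTower.algebraMap_apply O k S, hL, L.res_lift, h.map]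
    · ext s t
      change inducedMatrix Z (L.lift.comp χ) z s t =
        algebraMap O (Matrix (A ⧸ Z) (A ⧸ Z) O) (L.lift (χ z)) s t
      rw [inducedMatrix_apply, Matrix.algebraMap_matrix_apply]
      by_cases hst : s = t
      · subst hst
        rw [if_pos rfl, dif_pos (hconj _)]
        change L.lift (χ _) = L.lift (χ z)
        congr 1
        apply FaithfulSMul.algebraMap_injective k S
        rw [← h.map, ← h.map]
        change u (_ * _ * _) = _
        rw [map_mul, map_mul, mul_assoc, h.commute_map z.2, ← mul_assoc, u.map_inv_mul_map, one_mul]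
      · rw [if_neg hst, dif_neg]
        intro hmem
        apply hst
        have h1 : (s.out)⁻¹ * t.out ∈ Z := by
          have h2 := Z.mul_mem hmem (Z.inv_mem (hconj t.out))
          have e : s.out⁻¹ * (z : A) * t.out * (t.out⁻¹ * z * t.out)⁻¹ = s.out⁻¹ * t.out := by group
          rwa [e] at h2
        have := QuotientGroup.eq.2 h1
        rwa [QuotientGroup.out_eq', QuotientGroup.out_eq'] at this
  nondeg b hb := by
    obtain ⟨a, ha⟩ := h.nondeg b hb
    refine ⟨a, L.isUnit_of_res _ ?_⟩
    rw [map_sub, map_one]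
    change L.res (L.lift _) - 1 ≠ 0
    rw [L.res_lift]
    exact ha.ne_zero

theorem TeichmullerLift.exists_normalized_intertwiner [Nontrivial S] [Module.Finite k S]
    (L : TeichmullerLift O k)
    (hL : ∀ x, algebraMap O k x = L.res x) {Z : Subgroup A}
    [Fintype (A ⧸ Z)] [DecidableEq (A ⧸ Z)] {χ : Z →* k} {u : A →* S}
    (h : IsTwistedRep Z χ u) (hN : (Fintype.card (A ⧸ Z) : k) ≠ 0) {φ : MulAut A}
    (hφ : ∀ z, z ∈ Z → u (φ z) = u z)
    (hφ' : ∀ z, φ z ∈ Z → z ∈ Z) (hφ'' : ∀ z ∈ Z, φ z ∈ Z) :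
    ∃ X : (S × Matrix (A ⧸ Z) (A ⧸ Z) O)ˣ,
      (X : S × _) ∈ Submodule.span O (Set.range (L.pair χ u)) ∧
      ((X⁻¹ : (S × _)ˣ) : S × Matrix (A ⧸ Z) (A ⧸ Z) O) ∈
        Submodule.span O (Set.range (L.pair χ u)) ∧
      (∀ a, (X : S × Matrix (A ⧸ Z) (A ⧸ Z) O) * L.pair χ u a = L.pair χ u (φ a) * X) ∧
      ∃ d : k, (X : S × Matrix (A ⧸ Z) (A ⧸ Z) O).2.det = L.lift d := by
  have h2 := L.isTwistedRep_pair hL h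
  have hφ2 : ∀ z, z ∈ Z → L.pair χ u (φ z) = L.pair χ u z := fun z hz => by
    rw [h2.map ⟨z, hz⟩, h2.map ⟨φ z, hφ'' z hz⟩]
    have e : χ ⟨φ z, hφ'' z hz⟩ = χ ⟨z, hz⟩ := by
      apply FaithfulSMul.algebraMap_injective k S
      rw [← h.map, ← h.map]
      exact hφ z hz
    rw [MonoidHom.comp_apply, MonoidHom.comp_apply, e]
  have hNS : (Fintype.card (A ⧸ Z) : S) * (Fintype.card (A ⧸ Z) : S) ≠ 0 := by
    rw [← map_natCast (algebraMap k S), ← map_mul]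
    exact fun h0 => mul_ne_zero hN hN
      (FaithfulSMul.algebraMap_injective k S (h0.trans (map_zero _).symm))
  obtain ⟨X, hX, W, hW, hXu, d, hWX, hd⟩ := h2.exists_intertwiner hφ2 hφ' hφ''
    (RingHom.fst S (Matrix (A ⧸ Z) (A ⧸ Z) O)) hNS
  have hd : IsUnit d := by
    apply L.isUnit_of_res
    intro h0
    apply hd
    change algebraMap O S d = 0
    rw [IsScalarTower.algebraMap_apply O k S, hL, h0, map_zero]
  obtain ⟨d', hd'⟩ := hd.exists_left_inv
  have : IsNoetherianRing S := isNoetherian_of_tower k (inferInstance : IsNoetherian k S)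
  have hWX' : d' • W * X = 1 := by
    rw [smul_mul_assoc, hWX, Algebra.smul_def, ← map_mul, hd', map_one]
  have hXW' : X * d' • W = 1 := Prod.ext
    (mul_eq_one_comm.1 (congrArg Prod.fst hWX')) (mul_eq_one_comm.1 (congrArg Prod.snd hWX'))
  have hW' : d' • W ∈ Submodule.span O (Set.range (L.pair χ u)) := Submodule.smul_mem _ _ hW
  set W' := d' • W
  have hdet : W'.2.det * X.2.det = 1 := by
    rw [← Matrix.det_mul, ← Prod.snd_mul, hWX', Prod.snd_one, Matrix.det_one]
  obtain ⟨c, hc, hc1⟩ := L.exists_root (Fintype.card (A ⧸ Z)) hN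
    (L.lift (L.res X.2.det) * W'.2.det) (by
      rw [map_mul, L.res_lift, ← map_mul, mul_comm, hdet, map_one])
  obtain ⟨c', hc'⟩ := (L.isUnit_of_res c (by rw [hc1]; exact one_ne_zero)).exists_left_inv
  refine ⟨⟨c • X, c' • W', ?_, ?_⟩, Submodule.smul_mem _ _ hX, Submodule.smul_mem _ _ hW',
    fun a => ?_, L.res X.2.det, ?_⟩
  · rw [smul_mul_smul_comm, hXW', mul_comm, hc', one_smul]
  · rw [smul_mul_smul_comm, hWX', hc', one_smul]
  · change c • X * _ = _ * c • X
    rw [smul_mul_assoc, mul_smul_comm, hXu]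
  · change (c • X.2).det = _
    rw [Matrix.det_smul, hc, mul_assoc, hdet, mul_one]

theorem TeichmullerLift.blockHom_fst_of_mem_span (L : TeichmullerLift O k)
    (hL : ∀ x, algebraMap O k x = L.res x) {Z : Subgroup A}
    [Fintype (A ⧸ Z)] [DecidableEq (A ⧸ Z)] {χ : Z →* k} {u : A →* S}
    (h : IsTwistedRep Z χ u) (hN : (Fintype.card (A ⧸ Z) : k) ≠ 0)
    {X : S × Matrix (A ⧸ Z) (A ⧸ Z) O} (hX : X ∈ Submodule.span O (Set.range (L.pair χ u)))
    (s t : A ⧸ Z) : h.blockHom hN X.1 s t = algebraMap k _ (L.res (X.2 s t)) := by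
  induction hX using Submodule.span_induction with
  | mem x hx =>
    obtain ⟨a, rfl⟩ := hx
    change h.blockHom hN (u a) s t =
      algebraMap k _ (L.res (inducedMatrix Z (L.lift.comp χ) a s t))
    rw [h.blockHom_map, inducedMatrix_apply, inducedMatrix_apply]
    split_ifs
    · rw [MonoidHom.comp_apply, L.res_lift]
    · rw [map_zero, map_zero, map_zero]
  | zero => simp
  | add x y _ _ hx hy => simp [hx, hy]
  | smul c x _ hx =>
    rw [Prod.smul_fst, ← algebraMap_smul k c x.1, map_smul, Matrix.smul_apply, hx, hL,
      Prod.smul_snd, Matrix.smul_apply, smul_eq_mul, map_mul, map_mul, Algebra.smul_def]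

theorem TeichmullerLift.fst_mem_span_of_mem_span (L : TeichmullerLift O k) {Z : Subgroup A}
    [Fintype (A ⧸ Z)] [DecidableEq (A ⧸ Z)] {χ : Z →* k} {u : A →* S}
    {X : S × Matrix (A ⧸ Z) (A ⧸ Z) O} (hX : X ∈ Submodule.span O (Set.range (L.pair χ u))) :
    X.1 ∈ Submodule.span k (Set.range u) := by
  induction hX using Submodule.span_induction with
  | mem x hx =>
    obtain ⟨a, rfl⟩ := hx
    exact Submodule.subset_span ⟨a, rfl⟩
  | zero => exact Submodule.zero_mem _
  | add x y _ _ hx hy => exact Submodule.add_mem _ hx hy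
  | smul c x _ hx =>
    rw [Prod.smul_fst, ← algebraMap_smul k c x.1]
    exact Submodule.smul_mem _ _ hx

end Intertwiner

section IntertwinerGroup

variable {A k O S : Type} [Group A] [Field k] [CommRing O] [Ring S] [Algebra k S]

namespace IsTwistedRep

theorem mem_of_scalar [Nontrivial S] {Z : Subgroup A} {χ : Z →* k} {u : A →* S}
    (h : IsTwistedRep Z χ u) {b : A} {c : k} (hb : u b = algebraMap k S c) : b ∈ Z := by
  by_contra hbZ
  obtain ⟨a, ha⟩ := h.nondeg b hbZ
  apply ha.ne_zero
  rw [sub_eq_zero]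
  apply FaithfulSMul.algebraMap_injective k S
  rw [map_one, ← h.map]
  change u (a * b * a⁻¹ * b⁻¹) = 1
  rw [map_mul, map_mul, map_mul, hb, ← Algebra.commutes, mul_assoc _ (u a), u.map_mul_map_inv,
    mul_one, ← hb, u.map_mul_map_inv]

theorem card_ne_zero [Nontrivial S] {Z : Subgroup A} [Z.Normal] [Fintype (A ⧸ Z)] {χ : Z →* k}
    {u : A →* S} (h : IsTwistedRep Z χ u) : (Fintype.card (A ⧸ Z) : k) ≠ 0 := by
  intro h0
  obtain ⟨p, hp⟩ := CharP.exists k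
  have hpN : p ∣ Fintype.card (A ⧸ Z) := (CharP.cast_eq_zero_iff k p _).1 h0
  have hp0 : p ≠ 0 := by
    rintro rfl
    exact Fintype.card_ne_zero (zero_dvd_iff.1 hpN)
  have hpp : p.Prime := (CharP.char_is_prime_or_zero k p).resolve_right hp0
  have : Fact p.Prime := ⟨hpp⟩
  obtain ⟨x, hx⟩ := exists_prime_orderOf_dvd_card p hpN
  obtain ⟨b, rfl⟩ := QuotientGroup.mk_surjective x
  have hb : b ∉ Z := fun hb => by
    rw [(QuotientGroup.eq_one_iff b).2 hb, orderOf_one] at hx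
    exact hpp.one_lt.ne hx
  have hbp : b ^ p ∈ Z := by
    rw [← QuotientGroup.eq_one_iff, QuotientGroup.mk_pow, ← hx, pow_orderOf_eq_one]
  obtain ⟨a, ha⟩ := h.nondeg b hb
  apply ha.ne_zero
  have h1 : (χ ⟨_, h.comm a b⟩) ^ p = 1 := by
    apply FaithfulSMul.algebraMap_injective k S
    have h2 : u a * u (b ^ p) * u a⁻¹ = u (b ^ p) := by
      rw [← h.commute_map hbp, mul_assoc, u.map_mul_map_inv, mul_one]
    have h3 : u a * u (b ^ p) * u a⁻¹ = (χ ⟨_, h.comm a b⟩) ^ p • u (b ^ p) := by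
      have e : a * b ^ p * a⁻¹ = (a * b * a⁻¹) ^ p := (conj_pow).symm
      rw [← map_mul, ← map_mul, e, map_pow, map_mul, map_mul, h.map_conj, smul_pow, map_pow]
    rw [h2, Algebra.smul_def] at h3
    rw [← mul_one (algebraMap k S _), ← u.map_mul_map_inv (b ^ p), ← mul_assoc, ← h3,
      u.map_mul_map_inv, map_one]
  have : ExpChar k p := ExpChar.prime hpp
  rw [← pow_eq_zero_iff hp0, sub_pow_expChar, h1, one_pow, sub_self]

end IsTwistedRep

variable [Algebra O k] [Algebra O S] [IsScalarTower O k S]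
variable {G : Type} [Group G]

/-- Pairs of a group element and a normalized operator implementing its action on a twisted
representation. -/
noncomputable def TeichmullerLift.intertwinerGroup (L : TeichmullerLift O k) {Z : Subgroup A}
    [Fintype (A ⧸ Z)] [DecidableEq (A ⧸ Z)] (χ : Z →* k) (u : A →* S) (φ : G →* MulAut A) :
    Subgroup (G × (S × Matrix (A ⧸ Z) (A ⧸ Z) O)ˣ) where
  carrier := {γ | (γ.2 : S × _) ∈ Submodule.span O (Set.range (L.pair χ u)) ∧
    ((γ.2⁻¹ : (S × _)ˣ) : S × Matrix (A ⧸ Z) (A ⧸ Z) O) ∈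
      Submodule.span O (Set.range (L.pair χ u)) ∧
    (∀ a, (γ.2 : S × Matrix (A ⧸ Z) (A ⧸ Z) O) * L.pair χ u a =
      L.pair χ u (φ γ.1 a) * γ.2) ∧
    ∃ d : k, (γ.2 : S × Matrix (A ⧸ Z) (A ⧸ Z) O).2.det = L.lift d}
  mul_mem' := by
    rintro ⟨g, X⟩ ⟨g', X'⟩ ⟨h1, h2, h3, d, h4⟩ ⟨h1', h2', h3', d', h4'⟩
    refine ⟨(L.pair χ u).mul_mem_span_range h1 h1', ?_, fun a => ?_, d * d', ?_⟩
    · rw [Prod.snd_mul, mul_inv_rev]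
      exact (L.pair χ u).mul_mem_span_range h2' h2
    · simp only [Prod.snd_mul, Units.val_mul, Prod.fst_mul, map_mul, MulAut.mul_apply] at *
      rw [mul_assoc, h3', ← mul_assoc, h3, mul_assoc]
    · simp only [Prod.snd_mul, Units.val_mul, Matrix.det_mul] at *
      rw [h4, h4', map_mul]
  one_mem' := by
    refine ⟨?_, ?_, fun a => ?_, 1, ?_⟩
    · exact Submodule.subset_span ⟨1, map_one _⟩
    · exact Submodule.subset_span ⟨1, by rw [map_one]; rfl⟩
    · simp
    · simp
  inv_mem' := by
    rintro ⟨g, X⟩ ⟨h1, h2, h3, d, h4⟩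
    refine ⟨h2, ?_, fun a => ?_, d⁻¹, ?_⟩
    · simpa using h1
    · have := h3 (φ g⁻¹ a)
      simp only [← MulAut.mul_apply, ← map_mul, mul_inv_cancel, map_one, MulAut.one_apply] at this
      change ((X⁻¹ : (S × _)ˣ) : S × Matrix (A ⧸ Z) (A ⧸ Z) O) * _ = _ * _
      rw [Units.inv_mul_eq_iff_eq_mul, ← mul_assoc]
      exact ((Units.eq_mul_inv_iff_mul_eq _).2 this.symm)
    · have h5 : (X : S × Matrix (A ⧸ Z) (A ⧸ Z) O).2.det *
          ((X⁻¹ : (S × _)ˣ) : S × Matrix (A ⧸ Z) (A ⧸ Z) O).2.det = 1 := by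
        rw [← Matrix.det_mul, ← Prod.snd_mul, Units.mul_inv, Prod.snd_one, Matrix.det_one]
      change ((X⁻¹ : (S × _)ˣ) : S × Matrix (A ⧸ Z) (A ⧸ Z) O).2.det = _
      change (X : S × Matrix (A ⧸ Z) (A ⧸ Z) O).2.det = _ at h4
      rw [h4] at h5
      have hd : d ≠ 0 := by
        rintro rfl
        have := congrArg L.res h5
        rw [map_mul, L.res_lift, zero_mul, map_one] at this
        exact zero_ne_one this
      have h6 : L.lift d⁻¹ * L.lift d = 1 := by rw [← map_mul, inv_mul_cancel₀ hd, map_one]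
      calc _ = L.lift d⁻¹ * L.lift d * _ := by rw [h6, one_mul]
        _ = _ := by rw [mul_assoc, h5, mul_one]

end IntertwinerGroup

section IntertwinerRep

variable {A k O S : Type} [Group A] [Field k] [CommRing O] [Ring S] {G : Type} [Group G]
  {L : TeichmullerLift O k} {Z : Subgroup A} {χ : Z →* k} {u : A →* S} {φ : G →* MulAut A}

theorem IsTwistedRep.map_aut_of_mem [Algebra k S] {r : G →* S} (h : IsTwistedRep Z χ u)
    (hφr : ∀ g a, r g * u a = u (φ g a) * r g) (g : G) {z : A} (hz : z ∈ Z) :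
    u (φ g z) = u z := by
  have h1 := hφr g z
  rw [← h.commute_map hz] at h1
  rw [← mul_one (u (φ g z)), ← r.map_mul_map_inv g, ← mul_assoc, ← h1, mul_assoc,
    r.map_mul_map_inv, mul_one]

variable [Fintype (A ⧸ Z)] [DecidableEq (A ⧸ Z)]

namespace TeichmullerLift

theorem fst_mul_fst_inv (X : (S × Matrix (A ⧸ Z) (A ⧸ Z) O)ˣ) :
    (X : S × Matrix (A ⧸ Z) (A ⧸ Z) O).1 *
      ((X⁻¹ : (S × _)ˣ) : S × Matrix (A ⧸ Z) (A ⧸ Z) O).1 = 1 :=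
  congrArg Prod.fst X.mul_inv

theorem fst_inv_mul_fst (X : (S × Matrix (A ⧸ Z) (A ⧸ Z) O)ˣ) :
    ((X⁻¹ : (S × _)ˣ) : S × Matrix (A ⧸ Z) (A ⧸ Z) O).1 *
      (X : S × Matrix (A ⧸ Z) (A ⧸ Z) O).1 = 1 :=
  congrArg Prod.fst X.inv_mul

variable [Algebra O S]

theorem fst_mul_map (γ : L.intertwinerGroup χ u φ) (a : A) :
    (γ.1.2 : S × Matrix (A ⧸ Z) (A ⧸ Z) O).1 * u a =
      u (φ γ.1.1 a) * (γ.1.2 : S × Matrix (A ⧸ Z) (A ⧸ Z) O).1 :=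
  congrArg Prod.fst (γ.2.2.2.1 a)

variable [Algebra k S]

theorem fst_inv_mul_mem_centralizer {r : G →* S} (hφr : ∀ g a, r g * u a = u (φ g a) * r g)
    (γ : L.intertwinerGroup χ u φ) :
    ((γ.1.2⁻¹ : (S × _)ˣ) : S × Matrix (A ⧸ Z) (A ⧸ Z) O).1 * r γ.1.1 ∈
      Subalgebra.centralizer k (Set.range u) := by
  rw [Subalgebra.mem_centralizer_iff]
  rintro _ ⟨a, rfl⟩
  have h1 := fst_mul_map (γ := γ) a
  set X := γ.1.2
  have h2 : u a * ((X⁻¹ : (S × _)ˣ) : S × Matrix (A ⧸ Z) (A ⧸ Z) O).1 =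
      ((X⁻¹ : (S × _)ˣ) : S × Matrix (A ⧸ Z) (A ⧸ Z) O).1 * u (φ γ.1.1 a) := by
    calc _ = ((X⁻¹ : (S × _)ˣ) : S × Matrix (A ⧸ Z) (A ⧸ Z) O).1 *
          ((X : S × Matrix (A ⧸ Z) (A ⧸ Z) O).1 * u a) *
          ((X⁻¹ : (S × _)ˣ) : S × Matrix (A ⧸ Z) (A ⧸ Z) O).1 := by
          rw [← mul_assoc, fst_inv_mul_fst, one_mul]
      _ = _ := by rw [h1, mul_assoc, mul_assoc, fst_mul_fst_inv, mul_one]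
  rw [← mul_assoc, h2, mul_assoc, mul_assoc, hφr]

theorem commute_of_mem_span {c x : S} (hc : c ∈ Subalgebra.centralizer k (Set.range u))
    (hx : x ∈ Submodule.span k (Set.range u)) : c * x = x * c := by
  induction hx using Submodule.span_induction with
  | mem x hx => exact ((Subalgebra.mem_centralizer_iff k).1 hc x hx).symm
  | zero => simp
  | add x y _ _ hx hy => rw [mul_add, add_mul, hx, hy]
  | smul c x _ hx => rw [mul_smul_comm, smul_mul_assoc, hx]

variable [Algebra O k] [IsScalarTower O k S]

/-- The representation of the intertwiner group on the centralizer of a twisted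
representation. -/
noncomputable def intertwinerRep (L : TeichmullerLift O k) (χ : Z →* k) {r : G →* S}
    (hφr : ∀ g a, r g * u a = u (φ g a) * r g) :
    L.intertwinerGroup χ u φ →* Subalgebra.centralizer k (Set.range u) where
  toFun γ := ⟨_, fst_inv_mul_mem_centralizer hφr γ⟩
  map_one' := Subtype.ext (by simp)
  map_mul' γ γ' := Subtype.ext (by
    have h1 := commute_of_mem_span (fst_inv_mul_mem_centralizer hφr γ)
      (L.fst_mem_span_of_mem_span γ'.2.2.1)
    simp only [Prod.snd_mul, mul_inv_rev, Units.val_mul, Prod.fst_mul, map_mul,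
      MulMemClass.coe_mul]
    rw [← mul_assoc (_ * r γ.1.1), h1]
    simp only [mul_assoc])

theorem coe_intertwinerRep {r : G →* S} (hφr : ∀ g a, r g * u a = u (φ g a) * r g)
    (γ : L.intertwinerGroup χ u φ) : (L.intertwinerRep χ hφr γ : S) =
      ((γ.1.2⁻¹ : (S × _)ˣ) : S × Matrix (A ⧸ Z) (A ⧸ Z) O).1 * r γ.1.1 := rfl

theorem map_eq_mul_intertwinerRep {r : G →* S} (hφr : ∀ g a, r g * u a = u (φ g a) * r g)
    (γ : L.intertwinerGroup χ u φ) : r γ.1.1 =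
      (γ.1.2 : S × Matrix (A ⧸ Z) (A ⧸ Z) O).1 * L.intertwinerRep χ hφr γ := by
  rw [coe_intertwinerRep, ← mul_assoc, fst_mul_fst_inv, one_mul]

theorem exists_intertwinerGroup [Nontrivial S] [Module.Finite k S]
    (hL : ∀ x, algebraMap O k x = L.res x) {r : G →* S} (h : IsTwistedRep Z χ u)
    (hN : (Fintype.card (A ⧸ Z) : k) ≠ 0) (hφr : ∀ g a, r g * u a = u (φ g a) * r g)
    (hφZ : ∀ g, ∀ z ∈ Z, φ g z ∈ Z) (g : G) :
    ∃ γ : L.intertwinerGroup χ u φ, γ.1.1 = g := by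
  obtain ⟨X, h1, h2, h3, h4⟩ := L.exists_normalized_intertwiner hL h hN (φ := φ g)
    (fun z hz => h.map_aut_of_mem hφr g hz) (fun z hz => by
      have := hφZ g⁻¹ _ hz
      rwa [← MulAut.mul_apply, ← map_mul, inv_mul_cancel, map_one] at this) (hφZ g)
  exact ⟨⟨(g, X), h1, h2, h3, h4⟩, rfl⟩

theorem span_intertwinerRep [Nontrivial S] [Module.Finite k S]
    (hL : ∀ x, algebraMap O k x = L.res x) {r : G →* S}
    (hr : Submodule.span k (Set.range r) = ⊤) (h : IsTwistedRep Z χ u)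
    (hN : (Fintype.card (A ⧸ Z) : k) ≠ 0) (hφr : ∀ g a, r g * u a = u (φ g a) * r g)
    (hφZ : ∀ g, ∀ z ∈ Z, φ g z ∈ Z) :
    Submodule.span k (Set.range (L.intertwinerRep χ hφr)) = ⊤ := by
  have hP : ∀ s, twistedProj k Z u s ∈ (Submodule.span k
      (Set.range (L.intertwinerRep χ hφr))).map
        (Subalgebra.centralizer k (Set.range u)).val.toLinearMap := fun s => by
    have hs : s ∈ Submodule.span k (Set.range r) := hr ▸ Submodule.mem_top
    induction hs using Submodule.span_induction with
    | mem s hs =>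
      obtain ⟨g, rfl⟩ := hs
      obtain ⟨γ, rfl⟩ := exists_intertwinerGroup hL h hN hφr hφZ g
      obtain ⟨c, hc⟩ := h.twistedProj_mem_of_mem_span (L.fst_mem_span_of_mem_span γ.2.1)
      rw [map_eq_mul_intertwinerRep hφr, IsTwistedRep.twistedProj_mul_right
        (fun a => (Subalgebra.mem_centralizer_iff k).1 (L.intertwinerRep χ hφr γ).2 _ ⟨a, rfl⟩),
        hc, ← Algebra.smul_def]
      exact Submodule.smul_mem _ _ ⟨_, Submodule.subset_span ⟨γ, rfl⟩, rfl⟩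
    | zero => rw [map_zero]; exact Submodule.zero_mem _
    | add x y _ _ hx hy => rw [map_add]; exact Submodule.add_mem _ hx hy
    | smul c x _ hx => rw [map_smul]; exact Submodule.smul_mem _ _ hx
  rw [eq_top_iff]
  intro c _
  obtain ⟨c', hc', h1⟩ := hP c
  rw [IsTwistedRep.twistedProj_of_commute hN fun a => (Subalgebra.mem_centralizer_iff k).1 c.2 _ ⟨a, rfl⟩] at h1
  rwa [← Subtype.ext h1]

end TeichmullerLift

end IntertwinerRep

section IntertwinerLift

theorem TeichmullerLift.isUnit_natCast {k O : Type} [Field k] [CommRing O]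
    (L : TeichmullerLift O k) {N : ℕ} (hN : (N : k) ≠ 0) : IsUnit (N : O) :=
  L.isUnit_of_res _ (by rwa [map_natCast])

variable {A k O S : Type} [Group A] [Field k] [CommRing O] [Ring S] [Algebra k S]
  [Algebra O k] [Algebra O S] [IsScalarTower O k S] {G : Type} [Group G]
  {L : TeichmullerLift O k} {Z : Subgroup A} [Fintype (A ⧸ Z)] [DecidableEq (A ⧸ Z)]
  {χ : Z →* k} {u : A →* S} {φ : G →* MulAut A}

namespace TeichmullerLift

theorem exists_eq_map_mul_algebraMap [Nontrivial S] (hL : ∀ x, algebraMap O k x = L.res x)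
    (h : IsTwistedRep Z χ u)
    (hN : (Fintype.card (A ⧸ Z) : k) ≠ 0) (γ : L.intertwinerGroup χ u φ) (a : A)
    (hγ : ∀ b, L.pair χ u (φ γ.1.1 b) = L.pair χ u (a * b * a⁻¹)) :
    ∃ c : O, (γ.1.2 : S × Matrix (A ⧸ Z) (A ⧸ Z) O) = L.pair χ u a * algebraMap O _ c := by
  have h2 := L.isTwistedRep_pair hL h
  obtain ⟨c, hc⟩ := h2.eq_algebraMap_of_commute (L.isUnit_natCast hN)
    (x := L.pair χ u a⁻¹ * γ.1.2)
    ((L.pair χ u).mul_mem_span_range (Submodule.subset_span ⟨_, rfl⟩) γ.2.1) (fun b => by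
      rw [mul_assoc (L.pair χ u a⁻¹), γ.2.2.2.1, hγ, ← mul_assoc, ← mul_assoc, ← map_mul,
        ← map_mul]
      congr 2
      group)
  exact ⟨c, by rw [← hc, ← mul_assoc, (L.pair χ u).map_mul_map_inv, one_mul]⟩

theorem res_ne_zero_of_eq [Nontrivial S] (hL : ∀ x, algebraMap O k x = L.res x)
    (γ : L.intertwinerGroup χ u φ) {a : A} {c : O}
    (hc : (γ.1.2 : S × Matrix (A ⧸ Z) (A ⧸ Z) O) = L.pair χ u a * algebraMap O _ c) :
    L.res c ≠ 0 := fun h0 => by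
  have h1 := congrArg Prod.fst hc
  change _ = u a * algebraMap O S c at h1
  rw [IsScalarTower.algebraMap_apply O k S, hL, h0, map_zero, mul_zero] at h1
  have h2 := fst_mul_fst_inv γ.1.2
  rw [h1, zero_mul] at h2
  exact zero_ne_one h2

theorem intertwinerRep_eq [Nontrivial S] (hL : ∀ x, algebraMap O k x = L.res x)
    {r : G →* S} (hφr : ∀ g a, r g * u a = u (φ g a) * r g)
    (γ : L.intertwinerGroup χ u φ) {a : A} {c : O}
    (hc : (γ.1.2 : S × Matrix (A ⧸ Z) (A ⧸ Z) O) = L.pair χ u a * algebraMap O _ c)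
    {c₀ : k} (hr : r γ.1.1 = u a * algebraMap k S c₀) :
    L.intertwinerRep χ hφr γ = algebraMap k _ ((L.res c)⁻¹ * c₀) := by
  apply Subtype.ext
  have h0 := res_ne_zero_of_eq hL γ hc
  have h1 := congrArg Prod.fst hc
  change _ = u a * algebraMap O S c at h1
  rw [IsScalarTower.algebraMap_apply O k S, hL] at h1
  have h2 := fst_inv_mul_fst γ.1.2
  rw [h1] at h2
  rw [coe_intertwinerRep, hr]
  change _ = algebraMap k S _
  calc _ = ((γ.1.2⁻¹ : (S × _)ˣ) : S × Matrix (A ⧸ Z) (A ⧸ Z) O).1 *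
        (u a * algebraMap k S (L.res c)) * algebraMap k S ((L.res c)⁻¹ * c₀) := by
        rw [mul_assoc, mul_assoc, ← map_mul, mul_inv_cancel_left₀ h0]
    _ = _ := by rw [h2, one_mul]

theorem pair_map_aut (hL : ∀ x, algebraMap O k x = L.res x) [Nontrivial S] {r : G →* S}
    (h : IsTwistedRep Z χ u) (hφr : ∀ g a, r g * u a = u (φ g a) * r g) {g : G} {a : A} {c₀ : k}
    (hr : r g = u a * algebraMap k S c₀) (b : A) :
    L.pair χ u (φ g b) = L.pair χ u (a * b * a⁻¹) := by
  have h2 := L.isTwistedRep_pair hL h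
  have h3 : u (φ g b) = u (a * b * a⁻¹) := by
    have h4 := hφr g b
    have h5 : r g = algebraMap k S c₀ * u a := by rw [hr, Algebra.commutes]
    have h6 : r g * u b = u (a * b * a⁻¹) * r g := by
      rw [h5, mul_assoc, ← map_mul, ← mul_assoc _ (algebraMap k S c₀), ← Algebra.commutes,
        mul_assoc, ← map_mul, inv_mul_cancel_right]
    rw [← mul_one (u (φ g b)), ← r.map_mul_map_inv g, ← mul_assoc, ← h4, h6, mul_assoc,
      r.map_mul_map_inv, mul_one]
  have h4 : u (φ g b * (a * b * a⁻¹)⁻¹) = algebraMap k S 1 := by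
    rw [map_mul, h3, u.map_mul_map_inv, map_one]
  have h5 := h.mem_of_scalar h4
  have h6 : L.pair χ u (φ g b * (a * b * a⁻¹)⁻¹) = 1 := by
    rw [h2.map ⟨_, h5⟩, MonoidHom.comp_apply]
    have : χ ⟨_, h5⟩ = 1 := by
      apply FaithfulSMul.algebraMap_injective k S
      rw [← h.map, h4]
    rw [this, map_one, map_one]
  rw [← mul_one (L.pair χ u (φ g b)), ← (L.pair χ u).map_inv_mul_map (a * b * a⁻¹), ← mul_assoc,
    ← map_mul, h6, one_mul]

/-- Every group element acting as an element of the twisted representation acts on the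
centralizer as a scalar. -/
theorem mem_scalarSubgroup_intertwinerRep [Nontrivial S] (hL : ∀ x, algebraMap O k x = L.res x)
    {r : G →* S} (h : IsTwistedRep Z χ u) (hN : (Fintype.card (A ⧸ Z) : k) ≠ 0)
    (hφr : ∀ g a, r g * u a = u (φ g a) * r g) (γ : L.intertwinerGroup χ u φ) {a : A}
    (hr : r γ.1.1 = u a) : γ ∈ (L.intertwinerRep χ hφr).scalarSubgroup k := by
  have hr' : r γ.1.1 = u a * algebraMap k S 1 := by rw [map_one, mul_one, hr]
  obtain ⟨c, hc⟩ := exists_eq_map_mul_algebraMap hL h hN γ a (pair_map_aut hL h hφr hr')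
  exact ⟨_, intertwinerRep_eq hL hφr γ hc hr'⟩

theorem lifts_of_lifts_intertwinerRep [Nontrivial S] [Module.Finite k S]
    (hL : ∀ x, algebraMap O k x = L.res x) {r : G →* S} (h : IsTwistedRep Z χ u)
    (hN : (Fintype.card (A ⧸ Z) : k) ≠ 0) (hφr : ∀ g a, r g * u a = u (φ g a) * r g)
    (hφZ : ∀ g, ∀ z ∈ Z, φ g z ∈ Z) (hY : L.Lifts (L.intertwinerRep χ hφr)) : L.Lifts r := by
  obtain ⟨n, _, _, _, ρ, ψ, hρ, hscal⟩ := hY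
  let σ : L.intertwinerGroup χ u φ →* Matrix (A ⧸ Z) (A ⧸ Z) (Matrix n n O) :=
    { toFun := fun γ => Matrix.of fun s t =>
        (γ.1.2 : S × Matrix (A ⧸ Z) (A ⧸ Z) O).2 s t • ρ γ
      map_one' := by
        ext s t
        by_cases hst : s = t <;> simp [hst, Matrix.one_apply]
      map_mul' := fun γ γ' => by
        ext s t : 1
        simp only [Matrix.of_apply, Matrix.mul_apply, Subgroup.coe_mul, Prod.snd_mul,
          Units.val_mul, map_mul, Finset.sum_smul, smul_mul_smul_comm] }
  have hσ : ∀ γ s t, σ γ s t = (γ.1.2 : S × Matrix (A ⧸ Z) (A ⧸ Z) O).2 s t • ρ γ :=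
    fun _ _ _ => rfl
  have hσs : ∀ γ c₀, r γ.1.1 = algebraMap k S c₀ →
      σ γ = Matrix.scalar (A ⧸ Z) (Matrix.scalar n (L.lift c₀)) := fun γ c₀ hr => by
    have hr' : r γ.1.1 = u 1 * algebraMap k S c₀ := by rw [map_one, one_mul, hr]
    obtain ⟨c, hc⟩ := exists_eq_map_mul_algebraMap hL h hN γ 1 (pair_map_aut hL h hφr hr')
    have h0 := res_ne_zero_of_eq hL γ hc
    have h1 := intertwinerRep_eq hL hφr γ hc hr'
    obtain ⟨d, hd⟩ := γ.2.2.2.2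
    rw [map_one, one_mul] at hc
    have hc2 : (γ.1.2 : S × Matrix (A ⧸ Z) (A ⧸ Z) O).2 =
        algebraMap O (Matrix (A ⧸ Z) (A ⧸ Z) O) c := congrArg Prod.snd hc
    rw [hc2, Algebra.algebraMap_eq_smul_one, Matrix.det_smul, Matrix.det_one, mul_one] at hd
    have hcl := L.eq_lift_of_pow_eq hN h0 hd
    have h3 : c * L.lift ((L.res c)⁻¹ * c₀) = L.lift c₀ := by
      conv_lhs => rw [hcl]
      rw [← map_mul, L.res_lift, mul_inv_cancel_left₀ h0]
    ext s t : 1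
    have e : ∀ M : Matrix n n O, Matrix.scalar (A ⧸ Z) M s t = if s = t then M else 0 :=
      fun M => Matrix.diagonal_apply ..
    rw [hσ, hscal γ _ h1, hc2, Matrix.algebraMap_matrix_apply, e]
    split_ifs
    · rw [← h3]
      ext i j
      simp [Matrix.diagonal_apply]
    · rw [zero_smul]
  have hex : ∀ g, ∃ γ : L.intertwinerGroup χ u φ, γ.1.1 = g :=
    exists_intertwinerGroup hL h hN hφr hφZ
  choose γ hγ using hex
  have hσeq : ∀ γ₁ γ₂ : L.intertwinerGroup χ u φ, γ₁.1.1 = γ₂.1.1 → σ γ₁ = σ γ₂ :=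
    fun γ₁ γ₂ he => by
    have h1 : σ (γ₁ * γ₂⁻¹) = 1 := by
      rw [hσs _ 1 (by
        change r (γ₁.1.1 * γ₂.1.1⁻¹) = _
        rw [he, mul_inv_cancel, map_one, map_one])]
      simp
    calc σ γ₁ = σ (γ₁ * γ₂⁻¹ * γ₂) := by rw [inv_mul_cancel_right]
      _ = σ γ₂ := by rw [map_mul, h1, one_mul]
  refine L.lifts_of_block
    { toFun := fun g => σ (γ g)
      map_one' := by rw [hσeq (γ 1) 1 (hγ 1), map_one]
      map_mul' := fun g g' => by
        rw [← map_mul]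
        refine hσeq _ _ ?_
        change _ = (γ g).1.1 * (γ g').1.1
        rw [hγ, hγ, hγ] }
    ((AlgHom.mapMatrix ψ).comp (h.blockHom hN)) (fun g s t => ?_) (fun g c hc => ?_)
  · change (σ (γ g) s t).map L.res = ψ (h.blockHom hN (r g) s t)
    have h1 : h.blockHom hN (r g) s t =
        h.blockHom hN (γ g).1.2.1.1 s t * L.intertwinerRep χ hφr (γ g) := Subtype.ext (by
      have hC := (L.intertwinerRep χ hφr (γ g)).2
      have hC' : ∀ a, u a * _ = _ * u a :=
        fun a => (Subalgebra.mem_centralizer_iff k).1 hC _ ⟨a, rfl⟩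
      have e : r g = (γ g).1.2.1.1 * L.intertwinerRep χ hφr (γ g) := by
        rw [← map_eq_mul_intertwinerRep, hγ]
      rw [MulMemClass.coe_mul, h.blockHom_apply, h.blockHom_apply,
        ← IsTwistedRep.twistedProj_mul_right hC', mul_assoc _ (u t.out), hC', e]
      simp only [mul_assoc])
    rw [h1, L.blockHom_fst_of_mem_span hL h hN (γ g).2.1, map_mul, AlgHom.commutes, ← hρ, hσ,
      ← Algebra.smul_def]
    ext i j
    simp
  · exact hσs _ _ (by rw [hγ, hc])

end TeichmullerLift

end IntertwinerLift

section ModularLift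

/-- The character by which a representation acts on its subgroup of scalars. -/
noncomputable def MonoidHom.scalarCharacter (k : Type) [Field k] {G S : Type} [Group G] [Ring S]
    [Nontrivial S] [Algebra k S] (r : G →* S) : r.scalarSubgroup k →* k where
  toFun z := z.2.choose
  map_one' := by
    apply FaithfulSMul.algebraMap_injective k S
    rw [← (1 : r.scalarSubgroup k).2.choose_spec]
    simp
  map_mul' x y := by
    apply FaithfulSMul.algebraMap_injective k S
    rw [← (x * y).2.choose_spec, map_mul, ← x.2.choose_spec, ← y.2.choose_spec]
    simp

theorem MonoidHom.map_eq_scalarCharacter {k : Type} [Field k] {G S : Type} [Group G] [Ring S]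
    [Nontrivial S] [Algebra k S] (r : G →* S) (z : r.scalarSubgroup k) :
    r z = algebraMap k S (r.scalarCharacter k z) := z.2.choose_spec

theorem Subgroup.exists_normal_commutator_mem {G : Type} [Group G] {Z : Subgroup G} [Z.Normal]
    (hZ : Z ≠ ⊤) (hn : ∃ n, derivedSeries G n ≤ Z) :
    ∃ A : Subgroup G, A.Normal ∧ Z ≤ A ∧ ¬ A ≤ Z ∧
      ∀ a ∈ A, ∀ b ∈ A, a * b * a⁻¹ * b⁻¹ ∈ Z := by
  classical
  obtain ⟨m, hm⟩ : ∃ m, Nat.find hn = m + 1 := by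
    refine Nat.exists_eq_succ_of_ne_zero fun h0 => hZ ?_
    have := Nat.find_spec hn
    rw [h0, derivedSeries_zero] at this
    exact top_le_iff.1 this
  have h1 : derivedSeries G (m + 1) ≤ Z := hm ▸ Nat.find_spec hn
  have h2 : ¬ derivedSeries G m ≤ Z := Nat.find_min hn (by omega)
  refine ⟨Z ⊔ derivedSeries G m, inferInstance, le_sup_left, fun h => h2 (le_sup_right.trans h),
    fun a ha b hb => ?_⟩
  rw [← QuotientGroup.eq_one_iff]
  have hA : ∀ a ∈ Z ⊔ derivedSeries G m, ∃ d ∈ derivedSeries G m, (a : G ⧸ Z) = d :=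
    fun a ha => by
    obtain ⟨z, hz, d, hd, rfl⟩ := Subgroup.mem_sup_of_normal_left.1 ha
    exact ⟨d, hd, by rw [QuotientGroup.mk_mul, (QuotientGroup.eq_one_iff z).2 hz, one_mul]⟩
  obtain ⟨d, hd, hda⟩ := hA a ha
  obtain ⟨e, he, heb⟩ := hA b hb
  have h3 : ((d * e * d⁻¹ * e⁻¹ : G) : G ⧸ Z) = 1 := by
    rw [QuotientGroup.eq_one_iff]
    exact h1 (Subgroup.commutator_mem_commutator hd he)
  simpa only [QuotientGroup.mk_mul, QuotientGroup.mk_inv, hda, heb] using h3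

theorem Subgroup.relIndex_lt_index {G : Type} [Group G] {Z H : Subgroup G} (hZH : Z ≤ H)
    (hZ : Z.index ≠ 0) (hH : H ≠ ⊤) : Z.relIndex H < Z.index := by
  have h1 := Subgroup.relIndex_mul_index hZH
  have h2 : H.index ≠ 1 := fun h => hH (Subgroup.index_eq_one.1 h)
  have h3 : H.index ≠ 0 := fun h => hZ (by rw [← h1, h, mul_zero])
  have h4 : Z.relIndex H ≠ 0 := fun h => hZ (by rw [← h1, h, zero_mul])
  nlinarith [Nat.pos_of_ne_zero h4, (Nat.two_le_iff _).2 ⟨h3, h2⟩]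

theorem Subgroup.index_lt_index {G : Type} [Group G] {Z A : Subgroup G} (hZA : Z ≤ A)
    (hZ : Z.index ≠ 0) (hA : ¬ A ≤ Z) : A.index < Z.index := by
  have h1 := Subgroup.relIndex_mul_index hZA
  have h2 : Z.relIndex A ≠ 1 := fun h => hA (Subgroup.relIndex_eq_one.1 h)
  have h3 : A.index ≠ 0 := fun h => hZ (by rw [← h1, h, mul_zero])
  have h4 : Z.relIndex A ≠ 0 := fun h => hZ (by rw [← h1, h, zero_mul])
  nlinarith [Nat.pos_of_ne_zero h3, (Nat.two_le_iff _).2 ⟨h4, h2⟩]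

theorem Subgroup.index_le_of_le_of_index_ne_zero {G : Type} [Group G] {H K : Subgroup G}
    (h : H ≤ K) (hH : H.index ≠ 0) : K.index ≤ H.index ∧ K.index ≠ 0 := by
  have h1 := Subgroup.index_dvd_of_le h
  exact ⟨Nat.le_of_dvd (Nat.pos_of_ne_zero hH) h1, fun h0 => hH (by
    rw [h0] at h1
    exact zero_dvd_iff.1 h1)⟩

/-- Irreducible representations of solvable groups over the residue field lift, up to
multiplicity. -/
theorem TeichmullerLift.lifts_of_index_eq {O k : Type} [CommRing O] [Field k] [IsAlgClosed k]
    (L : TeichmullerLift O k) (m : ℕ) : ∀ (G S : Type) [Group G] [Ring S] [Algebra k S]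
    [IsSimpleRing S] [Module.Finite k S] (r : G →* S), Submodule.span k (Set.range r) = ⊤ →
    (r.scalarSubgroup k).index = m → m ≠ 0 →
    (∃ n, derivedSeries G n ≤ r.scalarSubgroup k) → L.Lifts r := by
  induction m using Nat.strong_induction_on with
  | _ m ih =>
  intro G S _ _ _ _ _ r hr hm hm0 hn
  by_cases htop : r.scalarSubgroup k = ⊤
  · exact L.lifts_of_scalarSubgroup_eq_top hr htop
  set Z := r.scalarSubgroup k with hZdef
  obtain ⟨A, hAn, hZA, hAZ, hcomm⟩ := Subgroup.exists_normal_commutator_mem htop hn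
  obtain ⟨n, hn⟩ := hn
  have hZ0 : Z.index ≠ 0 := by rwa [hm]
  have hZfin : Z.FiniteIndex := ⟨hZ0⟩
  by_cases hB : ∀ b ∈ A, (∀ a ∈ A, r a * r b = r b * r a) → b ∈ Z
  · let : Algebra O k := L.res.toAlgebra
    let : Algebra O S := Algebra.compHom S L.res
    have : IsScalarTower O k S := IsScalarTower.of_algebraMap_eq fun _ => rfl
    have hL : ∀ x, algebraMap O k x = L.res x := fun _ => rfl
    let Z' := Z.subgroupOf A
    let χ : Z' →* k := (r.scalarCharacter k).comp
      ((A.subtype.comp Z'.subtype).codRestrict Z fun z => z.2)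
    let u : A →* S := r.comp A.subtype
    let φ : G →* MulAut A := MulAut.conjNormal
    have h : IsTwistedRep Z' χ u :=
      { comm := fun a b => hcomm _ a.2 _ b.2
        map := fun z => r.map_eq_scalarCharacter ⟨z, z.2⟩
        nondeg := fun b hb => by
          by_contra! hcon
          refine hb (hB b b.2 fun a ha => ?_)
          have h1 := hcon ⟨a, ha⟩
          rw [isUnit_iff_ne_zero, not_not, sub_eq_zero] at h1
          have h1' : r.scalarCharacter k ⟨_, hcomm a ha b b.2⟩ = 1 := h1
          have h2 := r.map_eq_scalarCharacter (k := k) ⟨_, hcomm a ha b b.2⟩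
          rw [h1', map_one] at h2
          have h3 : a * b = a * b * a⁻¹ * (b : G)⁻¹ * (b * a) := by group
          rw [← map_mul, h3, map_mul, h2, one_mul, map_mul] }
    have : Z'.FiniteIndex := inferInstance
    let : Fintype (A ⧸ Z') := Subgroup.fintypeQuotientOfFiniteIndex
    let : DecidableEq (A ⧸ Z') := Classical.decEq _
    have hN := h.card_ne_zero
    have hφr : ∀ g a, r g * u a = u (φ g a) * r g := fun g a => by
      change r g * r a = r (g * a * g⁻¹) * r g
      rw [← map_mul, ← map_mul, inv_mul_cancel_right]
    have hφZ : ∀ g, ∀ z ∈ Z', φ g z ∈ Z' := fun g z hz =>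
      (inferInstance : Z.Normal).conj_mem z hz g
    have := h.isSimpleRing_centralizer hN
    have : Module.Finite k (Subalgebra.centralizer k (Set.range u)) :=
      Module.Finite.of_injective (Subalgebra.centralizer k (Set.range u)).val.toLinearMap
        Subtype.val_injective
    let π : L.intertwinerGroup χ u φ →* G := (MonoidHom.fst _ _).comp (Subgroup.subtype _)
    have hπ : Function.Surjective π := TeichmullerLift.exists_intertwinerGroup hL h hN hφr hφZ
    have hA : A.comap π ≤ (L.intertwinerRep χ hφr).scalarSubgroup k := fun γ hγ =>
      TeichmullerLift.mem_scalarSubgroup_intertwinerRep hL h hN hφr γ (a := ⟨_, hγ⟩) rfl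
    have hlt := Subgroup.index_lt_index hZA hZ0 hAZ
    have hA0 : A.index ≠ 0 := (Subgroup.index_le_of_le_of_index_ne_zero hZA hZ0).2
    rw [← Subgroup.index_comap_of_surjective A hπ] at hlt hA0
    obtain ⟨h5, h6⟩ := Subgroup.index_le_of_le_of_index_ne_zero hA hA0
    refine TeichmullerLift.lifts_of_lifts_intertwinerRep hL h hN hφr hφZ
      (ih _ (by omega) _ _ _ (TeichmullerLift.span_intertwinerRep hL hr h hN hφr hφZ) rfl h6
        ⟨n, le_trans ?_ hA⟩)
    exact Subgroup.map_le_iff_le_comap.1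
      ((map_derivedSeries_le_derivedSeries π n).trans (hn.trans hZA))
  · push Not at hB
    obtain ⟨b, hbA, hb, hbZ⟩ := hB
    let B : Subgroup G :=
      { carrier := {b | b ∈ A ∧ ∀ a ∈ A, r a * r b = r b * r a}
        one_mem' := ⟨A.one_mem, fun a _ => by simp⟩
        mul_mem' := fun {x y} hx hy => ⟨A.mul_mem hx.1 hy.1, fun a ha => by
          rw [map_mul, ← mul_assoc, hx.2 a ha, mul_assoc, hy.2 a ha, mul_assoc]⟩
        inv_mem' := fun {x} hx => ⟨A.inv_mem hx.1, fun a ha => by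
          have h1 := hx.2 a ha
          calc r a * r x⁻¹ = r x⁻¹ * (r x * r a) * r x⁻¹ := by
                rw [← mul_assoc, r.map_inv_mul_map, one_mul]
            _ = r x⁻¹ * r a := by rw [← h1, mul_assoc, mul_assoc, r.map_mul_map_inv, mul_one]⟩ }
    have hBn : B.Normal := ⟨fun x hx g => ⟨hAn.conj_mem x hx.1 g, fun a ha => by
      have h1 := hx.2 (g⁻¹ * a * g) (by simpa using hAn.conj_mem a ha g⁻¹)
      rw [← map_mul, ← map_mul] at h1 ⊢
      have h2 : ∀ c, r (g * c * g⁻¹) = r g * r c * r g⁻¹ := fun c => by simp only [map_mul]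
      rw [show a * (g * x * g⁻¹) = g * (g⁻¹ * a * g * x) * g⁻¹ by group,
        show g * x * g⁻¹ * a = g * (x * (g⁻¹ * a * g)) * g⁻¹ by group, h2, h2, h1]⟩⟩
    obtain ⟨ε, hε, hε0, hεg, g₀, hg₀⟩ := exists_idempotent_of_commute hr (B := B)
      (fun a ha b hb => hb.2 a ha.1) fun h => hbZ (h ⟨hbA, hb⟩)
    let H : Subgroup G :=
      { carrier := {g | r g * ε = ε * r g}
        one_mem' := by simp
        mul_mem' := fun {x y} (hx : _ = _) (hy : _ = _) => by
          change r (x * y) * ε = ε * r (x * y)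
          rw [map_mul, mul_assoc, hy, ← mul_assoc, hx, mul_assoc]
        inv_mem' := fun {x} (hx : _ = _) => by
          change r x⁻¹ * ε = ε * r x⁻¹
          calc r x⁻¹ * ε = r x⁻¹ * (ε * r x) * r x⁻¹ := by
                rw [mul_assoc, mul_assoc, r.map_mul_map_inv, mul_one]
            _ = ε * r x⁻¹ := by rw [← hx, ← mul_assoc, r.map_inv_mul_map, one_mul] }
    have hZH : Z ≤ H := fun z hz => MonoidHom.scalarSubgroup_commute hz ε
    have hHtop : H ≠ ⊤ := fun h => hg₀ (show g₀ ∈ H from h ▸ Subgroup.mem_top g₀)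
    have hHfin : H.FiniteIndex := ⟨(Subgroup.index_le_of_le_of_index_ne_zero hZH hZ0).2⟩
    have hlt := Subgroup.relIndex_lt_index hZH hZ0 hHtop
    have hrel : Z.relIndex H ≠ 0 := fun h0 => hZ0 (by
      rw [← Subgroup.relIndex_mul_index hZH, h0, zero_mul])
    refine L.lifts_of_idempotent hr hε hε0 (H := H) (fun g hg => hg)
      (fun g hg => (hεg g).resolve_left hg) hZH fun S₁ _ _ _ _ r₁ hr₁ hsc => ?_
    have hle : Z.subgroupOf H ≤ r₁.scalarSubgroup k := fun z hz => by
      obtain ⟨c, hc⟩ := hz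
      exact ⟨c, hsc z c hc⟩
    obtain ⟨h5, h6⟩ := Subgroup.index_le_of_le_of_index_ne_zero hle hrel
    change _ ≤ Z.relIndex H at h5
    refine ih _ (by omega) _ _ _ hr₁ rfl h6 ⟨n, le_trans ?_ hle⟩
    exact Subgroup.map_le_iff_le_comap.1
      ((map_derivedSeries_le_derivedSeries H.subtype n).trans hn)

end ModularLift

theorem WittVector.constantCoeff_eq_zero_iff_mem_span {q : ℕ} [Fact q.Prime] {k : Type} [Field k] [CharP k q]
    [PerfectRing k q] (x : WittVector q k) :
    WittVector.constantCoeff x = 0 ↔ x ∈ Ideal.span {(q : WittVector q k)} := by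
  rw [← WittVector.ker_constantCoeff, RingHom.mem_ker]

/-- The Teichmüller lift into the ring of Witt vectors of an algebraically closed field. -/
noncomputable def TeichmullerLift.wittVector (q : ℕ) [Fact q.Prime] (k : Type) [Field k] [CharP k q]
    [PerfectRing k q] : TeichmullerLift (WittVector q k) k where
  res := WittVector.constantCoeff
  lift := WittVector.teichmuller q
  res_lift c := WittVector.teichmuller_coeff_zero q c
  isUnit_of_res x hx := WittVector.isUnit_of_coeff_zero_ne_zero x hx
  exists_root N hN u hu := by
    have hH : HenselianRing (WittVector q k) (Ideal.span {(q : WittVector q k)}) := inferInstance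
    have hN0 : N ≠ 0 := by rintro rfl; simp at hN
    obtain ⟨c, hc, hc'⟩ := hH.is_henselian (Polynomial.X ^ N - Polynomial.C u)
      (Polynomial.monic_X_pow_sub_C u hN0) 1 (by
        rw [← WittVector.constantCoeff_eq_zero_iff_mem_span]
        have h : Polynomial.eval 1 (Polynomial.X ^ N - Polynomial.C u) = 1 - u := by simp
        rw [h, map_sub, map_one, hu, sub_self]) (by
        apply RingHom.isUnit_map
        apply WittVector.isUnit_of_coeff_zero_ne_zero
        have h : Polynomial.eval 1 (Polynomial.derivative (Polynomial.X ^ N - Polynomial.C u)) =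
            (N : WittVector q k) := by simp [Polynomial.derivative_X_pow]
        change WittVector.constantCoeff _ ≠ 0
        rwa [h, map_natCast])
    refine ⟨c, ?_, ?_⟩
    · simpa [sub_eq_zero] using hc
    · rw [← WittVector.constantCoeff_eq_zero_iff_mem_span, map_sub, sub_eq_zero] at hc'
      simpa using hc'

theorem WittVector.charZero (q : ℕ) [Fact q.Prime] (k : Type) [Field k] [CharP k q]
    [PerfectRing k q] : CharZero (WittVector q k) := by
  have h := Fact.out (p := q.Prime)
  refine charZero_of_inj_zero fun n hn => ?_
  by_contra hn0
  obtain ⟨e, m, hm, rfl⟩ := Nat.exists_eq_pow_mul_and_not_dvd hn0 q h.ne_one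
  push_cast at hn
  have hq : (q : WittVector q k) ≠ 0 := WittVector.p_nonzero q k
  have := (mul_eq_zero.1 hn).resolve_left (pow_ne_zero _ hq)
  apply hm
  rw [← CharP.cast_eq_zero_iff k q, ← map_natCast (WittVector.constantCoeff (p := q)), this, map_zero]

theorem representationHom_comp_of {F : Type} {S : Type*} [Group F] [Ring S] (f : MonoidAlgebra ℤ F →+* S) :
    representationHom ((f : MonoidAlgebra ℤ F →* S).comp (MonoidAlgebra.of ℤ F)) = f := by
  refine MonoidAlgebra.ringHom_ext (fun a => ?_) fun g => ?_
  · exact RingHom.congr_fun (RingHom.ext_int ((representationHom _).comp MonoidAlgebra.singleOneRingHom) (f.comp MonoidAlgebra.singleOneRingHom)) a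
  · simp [representationHom, MonoidAlgebra.liftNCRingHom, MonoidAlgebra.liftNC_single]

/-- A nonzero ring which is finite over the integers has a nonzero quotient of prime characteristic. -/
theorem exists_prime_mul_ne_one (N : Type*) [Ring N] [Nontrivial N] [Module.Finite ℤ N] :
    ∃ q : ℕ, q.Prime ∧ ∀ x : N, (q : N) * x ≠ 1 := by
  obtain ⟨n, hn⟩ := CharP.exists N
  obtain rfl | hn0 := eq_or_ne n 0
  · refine ⟨2, Nat.prime_two, fun x hx => ?_⟩
    obtain ⟨r, hr, hr0⟩ := Submodule.exists_sub_one_mem_and_smul_eq_zero_of_fg_of_le_smul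
      (Ideal.span {(2 : ℤ)}) (⊤ : Submodule ℤ N) Module.Finite.fg_top (fun y _ => by
        have h : y = (2 : ℤ) • (x * y) := by
          rw [zsmul_eq_mul, ← mul_assoc, Int.cast_ofNat]
          rw [Nat.cast_ofNat] at hx
          rw [hx, one_mul]
        rw [h]
        exact Submodule.smul_mem_smul (Ideal.subset_span rfl) trivial)
    have h1 := hr0 1 trivial
    rw [zsmul_eq_mul, mul_one] at h1
    have h2 := (CharP.intCast_eq_zero_iff N 0 r).1 h1
    rw [Nat.cast_zero, zero_dvd_iff] at h2
    rw [h2, Ideal.mem_span_singleton] at hr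
    omega
  · have hn1 : n ≠ 1 := fun h => one_ne_zero (α := N) (by
      rw [← Nat.cast_one, CharP.cast_eq_zero_iff N n, h])
    obtain ⟨q, hq, m, rfl⟩ := Nat.exists_prime_and_dvd hn1
    refine ⟨q, hq, fun x hx => ?_⟩
    have h1 : (m : N) = 0 := by
      have := CharP.cast_eq_zero N (q * m)
      rw [mul_comm, Nat.cast_mul] at this
      rw [← mul_one (m : N), ← hx, ← mul_assoc, this, zero_mul]
    have h2 := Nat.le_of_dvd (Nat.pos_of_ne_zero fun h => hn0 (by rw [h, mul_zero]))
      ((CharP.cast_eq_zero_iff N (q * m) m).1 h1)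
    have h3 := hq.two_le
    have : m ≠ 0 := fun h => hn0 (by rw [h, mul_zero])
    nlinarith [Nat.pos_of_ne_zero this]

/-- A nonzero finite-dimensional algebra has a simple quotient. -/
theorem exists_simple_quotient (k T : Type) [Field k] [Ring T] [Nontrivial T] [Algebra k T]
    [Module.Finite k T] : ∃ (S : Type) (_ : Ring S) (_ : Algebra k S) (_ : IsSimpleRing S)
      (f : T →ₐ[k] S), Function.Surjective f := by
  have : IsNoetherian k T := inferInstance
  have hT : IsNoetherianRing T := isNoetherian_of_tower k this
  obtain ⟨J, -, hJ2, hJt, hmax⟩ := Ideal.exists_le_maximal_isTwoSided (⊥ : Ideal T) inferInstance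
    bot_ne_top
  have : Nontrivial (T ⧸ J) := Ideal.Quotient.nontrivial_iff.2 hJt
  refine ⟨T ⧸ J, inferInstance, inferInstance, IsSimpleRing.of_forall fun I s hs hs0 => ?_,
    Ideal.Quotient.mkₐ k J, Ideal.Quotient.mkₐ_surjective k J⟩
  by_contra h1
  obtain ⟨t, rfl⟩ := Ideal.Quotient.mk_surjective s
  let I' : Ideal T := (TwoSidedIdeal.asIdeal I).comap (Ideal.Quotient.mk J)
  have hI' : ∀ x, x ∈ I' ↔ Ideal.Quotient.mk J x ∈ I := fun x => TwoSidedIdeal.mem_asIdeal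
  apply hs0
  rw [Ideal.Quotient.eq_zero_iff_mem]
  refine hmax I' ⟨fun {a} b ha => ?_⟩ (fun x hx => ?_) (fun h => ?_) ((hI' t).2 hs)
  · rw [hI', map_mul]
    exact I.mul_mem_right _ _ ((hI' a).1 ha)
  · rw [hI', Ideal.Quotient.eq_zero_iff_mem.2 hx]
    exact I.zero_mem
  · apply h1
    have : (1 : T) ∈ I' := h ▸ Submodule.mem_top
    rwa [hI', map_one] at this

/-- A finite-dimensional algebra over a prime field maps to a simple algebra over an algebraically
closed field. -/
theorem exists_simple_of_charP (q : ℕ) [Fact q.Prime] (N : Type) [Ring N] [Nontrivial N] [CharP N q]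
    [Module.Finite ℤ N] (k : Type) [Field k] [CharP k q] :
    ∃ (S : Type) (_ : Ring S) (_ : Algebra k S) (_ : IsSimpleRing S) (_ : Module.Finite k S)
      (f : N →+* S), Submodule.span k (Set.range f) = ⊤ := by
  let : Algebra (ZMod q) N := ZMod.algebra N q
  let : Algebra (ZMod q) k := ZMod.algebra k q
  have : Module.Finite (ZMod q) N := Module.Finite.of_restrictScalars_finite ℤ (ZMod q) N
  obtain ⟨S, _, _, _, f, hf⟩ := exists_simple_quotient k (k ⊗[ZMod q] N)
  refine ⟨S, inferInstance, inferInstance, inferInstance,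
    Module.Finite.of_surjective f.toLinearMap hf,
    (f : k ⊗[ZMod q] N →+* S).comp (Algebra.TensorProduct.includeRight (A := k)).toRingHom, ?_⟩
  refine eq_top_iff.2 fun s _ => ?_
  obtain ⟨t, rfl⟩ := hf s
  induction t using TensorProduct.induction_on with
  | zero => rw [map_zero]; exact zero_mem _
  | add x y hx hy => rw [map_add]; exact add_mem (hx trivial) (hy trivial)
  | tmul c n =>
    have h : f (c ⊗ₜ n) = c • f (1 ⊗ₜ n) := by
      rw [← map_smul, TensorProduct.smul_tmul', smul_eq_mul, mul_one]
    rw [h]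
    exact Submodule.smul_mem _ _ (Submodule.subset_span ⟨n, rfl⟩)

/-- A proper two-sided ideal of an integral group ring of a finite group is annihilated by an
irreducible representation in prime characteristic. -/
theorem exists_simple_representation {F : Type} [Group F] [Finite F] (M : Ideal (MonoidAlgebra ℤ F))
    (hM : M.IsTwoSided) (hMt : M ≠ ⊤) : ∃ (q : ℕ) (_ : Fact q.Prime), ∀ (k : Type) [Field k]
      [CharP k q], ∃ (S : Type) (_ : Ring S) (_ : Algebra k S) (_ : IsSimpleRing S)
      (_ : Module.Finite k S) (r : F →* S), Submodule.span k (Set.range r) = ⊤ ∧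
        ∀ x ∈ M, representationHom r x = 0 := by
  have : Nontrivial (MonoidAlgebra ℤ F ⧸ M) := Ideal.Quotient.nontrivial_iff.2 hMt
  have hfin : Module.Finite ℤ (MonoidAlgebra ℤ F) := inferInstance
  have : Module.Finite ℤ (MonoidAlgebra ℤ F ⧸ M) :=
    Module.Finite.of_surjective (Ideal.Quotient.mk M).toAddMonoidHom.toIntLinearMap
      Ideal.Quotient.mk_surjective
  obtain ⟨q, hq, hx⟩ := exists_prime_mul_ne_one (MonoidAlgebra ℤ F ⧸ M)
  have : Fact q.Prime := ⟨hq⟩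
  refine ⟨q, this, fun k _ _ => ?_⟩
  let J : Ideal (MonoidAlgebra ℤ F ⧸ M) := Ideal.span {(q : MonoidAlgebra ℤ F ⧸ M)}
  have hJ : ∀ x, x ∈ J ↔ ∃ y, q * y = x := fun x => by
    rw [Ideal.mem_span_singleton']
    simp_rw [← (Nat.cast_commute q _).eq]
  have hJ2 : J.IsTwoSided := ⟨fun {a} b ha => by
    obtain ⟨y, rfl⟩ := (hJ a).1 ha
    exact (hJ _).2 ⟨y * b, (mul_assoc _ _ _).symm⟩⟩
  have hJt : J ≠ ⊤ := fun h => by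
    obtain ⟨y, hy⟩ := (hJ 1).1 (h ▸ Submodule.mem_top)
    exact hx y hy
  let N := (MonoidAlgebra ℤ F ⧸ M) ⧸ J
  have : Nontrivial N := Ideal.Quotient.nontrivial_iff.2 hJt
  have : CharP N q := by
    have hq0 : (q : N) = 0 := by
      rw [← map_natCast (Ideal.Quotient.mk J), Ideal.Quotient.eq_zero_iff_mem]
      exact Ideal.subset_span rfl
    obtain ⟨p, hp⟩ := CharP.exists N
    obtain rfl | rfl := (Nat.dvd_prime hq).1 ((CharP.cast_eq_zero_iff N p q).1 hq0)
    · exact absurd (Nat.cast_one.symm.trans ((CharP.cast_eq_zero_iff N 1 1).2 dvd_rfl)) one_ne_zero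
    · exact hp
  have : Module.Finite ℤ N :=
    Module.Finite.of_surjective (Ideal.Quotient.mk J).toAddMonoidHom.toIntLinearMap
      Ideal.Quotient.mk_surjective
  obtain ⟨S, _, _, _, _, f, hf⟩ := exists_simple_of_charP q N k
  let f' : MonoidAlgebra ℤ F →+* S := f.comp ((Ideal.Quotient.mk J).comp (Ideal.Quotient.mk M))
  let r : F →* S := (f' : MonoidAlgebra ℤ F →* S).comp (MonoidAlgebra.of ℤ F)
  refine ⟨S, inferInstance, inferInstance, inferInstance, inferInstance, r, ?_, fun x hx => ?_⟩
  · rw [← top_le_iff, ← hf, Submodule.span_le]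
    rintro _ ⟨n, rfl⟩
    obtain ⟨n, rfl⟩ := Ideal.Quotient.mk_surjective n
    obtain ⟨x, rfl⟩ := Ideal.Quotient.mk_surjective n
    change f' x ∈ Submodule.span k (Set.range r)
    induction x using MonoidAlgebra.induction_linear with
    | zero => rw [map_zero]; exact zero_mem _
    | add x y hx hy => rw [map_add]; exact add_mem hx hy
    | single g a =>
      have h : (MonoidAlgebra.single g a : MonoidAlgebra ℤ F) = a • MonoidAlgebra.of ℤ F g := by
        simp
      rw [h, map_zsmul]
      have hg : f' (MonoidAlgebra.of ℤ F g) ∈ Submodule.span k (Set.range r) :=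
        Submodule.subset_span ⟨g, rfl⟩
      exact zsmul_mem hg a
  · rw [representationHom_comp_of]
    change f (Ideal.Quotient.mk J (Ideal.Quotient.mk M x)) = 0
    rw [Ideal.Quotient.eq_zero_iff_mem.2 hx, map_zero, map_zero]

theorem map_representationHom {F : Type} [Group F] [Fintype F] {R S : Type*} [Ring R] [Ring S]
    (f : R →+* S) (ρ : F →* R) (x : MonoidAlgebra ℤ F) :
    f (representationHom ρ x) = ∑ g, x.coeff g • f (ρ g) := by
  simp only [representationHom_apply, map_sum, map_zsmul]

theorem hasBigRowIdempotents_of_finite (F : Type) [Group F] (hF : Finite F)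
    (hsol : Group.IsSolvable F) : HasBigRowIdempotents (MonoidAlgebra ℤ F) := by
  intro e he hbig M hM hsmall
  by_contra hMt
  obtain ⟨q, hq, hrep⟩ := exists_simple_representation M hM hMt
  let k := AlgebraicClosure (ZMod q)
  have : CharP k q := inferInstance
  obtain ⟨S, _, _, _, _, r, hr, hrM⟩ := hrep k
  let L := TeichmullerLift.wittVector q k
  have hdx : ∃ n, derivedSeries F n ≤ r.scalarSubgroup k := by
    obtain ⟨n, hn⟩ := hsol.solvable
    exact ⟨n, by rw [hn]; exact bot_le⟩
  obtain ⟨n, _, _, _, ρ, ψ, hρ, -⟩ := L.lifts_of_index_eq _ F S r hr rfl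
    Subgroup.FiniteIndex.index_ne_zero hdx
  have := Fintype.ofFinite F
  have := WittVector.charZero q k
  let A := WittVector q k
  have hI : Ideal.span {(q : A)} ≠ ⊤ := fun h => by
    have h1 : (1 : A) ∈ Ideal.span {(q : A)} := h ▸ Submodule.mem_top
    rw [← WittVector.constantCoeff_eq_zero_iff_mem_span, map_one] at h1
    exact one_ne_zero h1
  have hker := IsSmallMod.ker_of_smulTop (T := A) he (representationHom ρ) (Ideal.span {(q : A)}) hI
    (hsmall.mono fun x hx => by
      rw [Ideal.mem_comap, Ideal.mem_matrix]
      intro s t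
      have h1 : L.res.mapMatrix (representationHom ρ x) = ψ (representationHom r x) := by
        rw [map_representationHom, ← AlgHom.coe_toRingHom, map_representationHom]
        exact Finset.sum_congr rfl fun g _ => congrArg _ (hρ g)
      rw [hrM x hx, map_zero] at h1
      have h2 : WittVector.constantCoeff (representationHom ρ x s t) = 0 :=
        congrFun (congrFun h1 s) t
      rw [WittVector.constantCoeff_eq_zero_iff_mem_span] at h2
      rw [Ideal.mem_smulTop, ← mul_one (representationHom ρ x s t)]
      exact Submodule.smul_mem_smul h2 (trivial : (1 : A) ∈ ⊤))
  let K := AlgebraicClosure (FractionRing A)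
  have : CharZero (FractionRing A) := charZero_of_injective_algebraMap (IsFractionRing.injective A _)
  have : CharZero K := charZero_of_injective_algebraMap (algebraMap (FractionRing A) K).injective
  let ι : Matrix n n A →+* Matrix n n K := (algebraMap A K).mapMatrix
  refine hbig (IsSmallMod.bot_of_representation (K := K) he ((ι : Matrix n n A →* Matrix n n K).comp ρ)
    (hker.mono fun x hx => ?_))
  rw [RingHom.mem_ker] at hx ⊢
  rw [representationHom_apply]
  change ∑ g, x.coeff g • ι (ρ g) = 0
  rw [← map_representationHom, hx, map_zero]

section Assembly

theorem Subgroup.IsPoly.free_of_projective {G : Type} [Group G] (hG : (⊤ : Subgroup G).IsPoly)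
    (P : Type*) [AddCommGroup P] [Module (MonoidAlgebra ℤ G) P]
    [Module.Projective (MonoidAlgebra ℤ G) P] (hP : ¬ Module.Finite (MonoidAlgebra ℤ G) P) :
    Module.Free (MonoidAlgebra ℤ G) P := by
  have := hG.isNoetherianRing (D := ℤ)
  have hbig := hG.hasBigRowIdempotents hasBigRowIdempotents_of_finite
  exact Module.Projective.free_of_forall_countablyGenerated
    (fun Q _ _ hQ hQc hQf => Module.Projective.free_of_rowIdempotent hbig hQc hQf) hP

theorem Module.Free.exists_finite_summand (R P : Type*) [Ring R] [Nontrivial R] [AddCommGroup P]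
    [Module R P] [Module.Free R P] [Nontrivial P] :
    ∃ Q Q' : Submodule R P, IsCompl Q Q' ∧ Module.Finite R Q ∧ Q ≠ ⊥ := by
  let b := Module.Free.chooseBasis R P
  obtain ⟨i⟩ : Nonempty (Module.Free.ChooseBasisIndex R P) := b.index_nonempty
  refine ⟨Submodule.span R (b '' {i}), Submodule.span R (b '' {i}ᶜ),
    ⟨b.linearIndependent.disjoint_span_image disjoint_compl_right, ?_⟩, ?_, fun h => ?_⟩
  · rw [codisjoint_iff, ← Submodule.span_union, ← Set.image_union, Set.union_compl_self,
      Set.image_univ, b.span_eq]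
  · rw [Set.image_singleton]
    infer_instance
  · rw [Set.image_singleton, Submodule.span_singleton_eq_bot] at h
    exact b.ne_zero i h

theorem not_finite_and_not_free_of_summands (R P : Type*) [Ring R] [Nontrivial R] [AddCommGroup P]
    [Module R P] [Nontrivial P] (hP : ∀ Q : Submodule R P, (∃ Q' : Submodule R P, IsCompl Q Q') →
      Module.Finite R Q → Q = ⊥) : ¬ Module.Finite R P ∧ ¬ Module.Free R P := by
  refine ⟨fun h => ?_, fun h => ?_⟩
  · exact top_ne_bot (hP ⊤ ⟨⊥, isCompl_top_bot⟩ (Module.Finite.iff_fg.2 Module.Finite.fg_top))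
  · obtain ⟨Q, Q', h1, h2, h3⟩ := Module.Free.exists_finite_summand R P
    exact h3 (hP Q ⟨Q', h1⟩ h2)

theorem exists_moduleCat_projective_without_summands.{u} {G : Type} [Group G]
    (hG : IsPolycyclicByFinite G) (hn : ¬ IsPolycyclic G) :
    ∃ P : ModuleCat.{u} (MonoidAlgebra ℤ G),
      Nontrivial P ∧ Module.Projective (MonoidAlgebra ℤ G) P ∧
        ∀ Q : Submodule (MonoidAlgebra ℤ G) P,
          (∃ Q' : Submodule (MonoidAlgebra ℤ G) P, IsCompl Q Q') →
          Module.Finite (MonoidAlgebra ℤ G) Q → Q = ⊥ := by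
  obtain ⟨P, _, _, hP, hproj, hQ⟩ := exists_projective_without_summands hG hn
  let ε : ULift.{u} P ≃ₗ[MonoidAlgebra ℤ G] P := ULift.moduleEquiv
  refine ⟨ModuleCat.of _ (ULift.{u} P), inferInstanceAs (Nontrivial (ULift.{u} P)),
    Module.Projective.of_equiv ε.symm, ?_⟩
  rintro Q ⟨Q', hQ'⟩ hfin
  let o := Submodule.orderIsoMapComap ε
  have h1 : o Q = ⊥ := hQ (o Q) (o Q') (o.isCompl hQ')
    (Module.Finite.equiv (ε.submoduleMap Q))
  rwa [map_eq_bot_iff] at h1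

end Assembly

/-- **Theorem** (Linnell–Puninski–Smith).  For a polycyclic-by-finite group `G`
the following are equivalent: (1) `G` is not polycyclic; (2) there exists a
non-finitely generated projective `ℤG`-module that is not free; (3) there exists
a nonzero projective `ℤG`-module having no nonzero finitely generated direct
summands. -/
theorem tfae_not_polycyclic (G : Type) [Group G] (hG : IsPolycyclicByFinite G) :
    List.TFAE [
      ¬ IsPolycyclic G,
      ∃ P : ModuleCat (MonoidAlgebra ℤ G),
        Module.Projective (MonoidAlgebra ℤ G) P ∧
        ¬ Module.Finite (MonoidAlgebra ℤ G) P ∧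
        ¬ Module.Free (MonoidAlgebra ℤ G) P,
      ∃ P : ModuleCat (MonoidAlgebra ℤ G),
        Nontrivial P ∧ Module.Projective (MonoidAlgebra ℤ G) P ∧
        ∀ Q : Submodule (MonoidAlgebra ℤ G) P,
          (∃ Q' : Submodule (MonoidAlgebra ℤ G) P, IsCompl Q Q') →
          Module.Finite (MonoidAlgebra ℤ G) Q → Q = ⊥] := by
  tfae_have 1 → 2 := fun hn => by
    obtain ⟨P, _, h2, h3⟩ := exists_moduleCat_projective_without_summands hG hn
    exact ⟨P, h2, not_finite_and_not_free_of_summands _ P h3⟩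
  tfae_have 1 → 3 := exists_moduleCat_projective_without_summands hG
  tfae_have 2 → 1 := fun ⟨P, _, h2, h3⟩ hpoly =>
    h3 ((isPolycyclic_iff.1 hpoly).free_of_projective P h2)
  tfae_have 3 → 1 := fun ⟨P, _, _, h3⟩ hpoly =>
    have h := not_finite_and_not_free_of_summands _ P h3
    h.2 ((isPolycyclic_iff.1 hpoly).free_of_projective P h.1)
  tfae_finish
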